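/- Let A > 0 and ε > 0, and let n be an odd, sufficiently large integer. Set R := n^{1/5−ε}. Then for all integers k with 1 ≤ k ≤ R, with at most O(R·(log n)^{−A}) exceptional values of k, the following holds: for all but O(A(k)·(log n)^{−A}) of the admissible triplets b₁, b₂, b₃ of reduced residues mod k, there exists a representation n = p₁ + p₂ + p₃ with primes pᵢ satisfying pᵢ ≡ bᵢ (mod k) for i = 1,2,3. -/

import Mathlib

open Finset MeasureTheory

noncomputable section

/-- `e x = e^{2πix}`. -/
def e (x : ℝ) : ℂ := Complex.exp (2 * Real.pi * Complex.I * x)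

/-- The exponential sum `S_{b,k}(α) = ∑_{m ≤ n, m ≡ b (k)} Λ(m) e(αm)`. -/
def S (n k b : ℕ) (α : ℝ) : ℂ :=
  ∑ m ∈ Finset.Icc 1 n,
    if m % k = b % k then (ArithmeticFunction.vonMangoldt m : ℂ) * e (α * m) else 0

/-- `J₃(n) = ∑_{m₁+m₂+m₃=n, mᵢ ≡ bᵢ (k)} Λ(m₁)Λ(m₂)Λ(m₃)`. -/
def J3 (n k b1 b2 b3 : ℕ) : ℝ :=
  ∑ m1 ∈ Finset.Icc 1 n, ∑ m2 ∈ Finset.Icc 1 n, ∑ m3 ∈ Finset.Icc 1 n,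
    if m1 + m2 + m3 = n ∧ m1 % k = b1 % k ∧ m2 % k = b2 % k ∧ m3 % k = b3 % k then
      ArithmeticFunction.vonMangoldt m1 * ArithmeticFunction.vonMangoldt m2 *
        ArithmeticFunction.vonMangoldt m3
    else 0

/-- `R₃(n) = ∑_{p₁+p₂+p₃=n, pᵢ ≡ bᵢ (k), pᵢ prime} log p₁ log p₂ log p₃`. -/
def R3 (n k b1 b2 b3 : ℕ) : ℝ :=
  ∑ p1 ∈ Finset.Icc 1 n, ∑ p2 ∈ Finset.Icc 1 n, ∑ p3 ∈ Finset.Icc 1 n,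
    if p1.Prime ∧ p2.Prime ∧ p3.Prime ∧ p1 + p2 + p3 = n ∧
        p1 % k = b1 % k ∧ p2 % k = b2 % k ∧ p3 % k = b3 % k then
      Real.log p1 * Real.log p2 * Real.log p3
    else 0

/-- The singular series `𝔖(n,k)`. -/
def SingularSeries (n k : ℕ) : ℝ :=
  (if Odd k then 2 else 8)
    * ∏ p ∈ k.primeFactors.filter (fun p => p ≠ 2), (p : ℝ) ^ 3 / (((p : ℝ) - 1) ^ 3 + 1)
    * ∏ p ∈ n.primeFactors.filter (fun p => p ≠ 2 ∧ ¬ p ∣ k),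
        (((p : ℝ) - 1) * (((p : ℝ) - 1) ^ 2 - 1)) / (((p : ℝ) - 1) ^ 3 + 1)
    * ∏' p : Nat.Primes, if 2 < (p : ℕ) then 1 + 1 / (((p : ℕ) : ℝ) - 1) ^ 3 else 1

/-- The residue `b₃` with `b₃ ≡ n - b₁ - b₂ (mod k)`, `0 ≤ b₃ < k`. -/
def bthree (n k b1 b2 : ℕ) : ℕ := (((n : ℤ) - b1 - b2) % (k : ℤ)).toNat

/-- The reduced residues `0 ≤ b < k`, `(b,k) = 1`. -/
def redRes (k : ℕ) : Finset ℕ := (Finset.range k).filter (fun b => Nat.Coprime b k)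

/-- For fixed `b₁`, the admissible `b₂` mod `k`:
reduced residues with `(n - b₁ - b₂, k) = 1`. -/
def admFor (n k b1 : ℕ) : Finset ℕ :=
  (redRes k).filter (fun b2 => Int.gcd ((n : ℤ) - b1 - b2) k = 1)

/-- The admissible pairs `b₁, b₂` of reduced residues mod `k`. -/
def admPairs (n k : ℕ) : Finset (ℕ × ℕ) :=
  (redRes k ×ˢ redRes k).filter (fun b => Int.gcd ((n : ℤ) - b.1 - b.2) k = 1)

/-- The admissible triplets `b₁, b₂, b₃` of reduced residues mod `k`:
`n ≡ b₁ + b₂ + b₃ (mod k)`. -/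
def admTriplets (n k : ℕ) : Finset (ℕ × ℕ × ℕ) :=
  (Finset.range k ×ˢ Finset.range k ×ˢ Finset.range k).filter
    (fun b => Nat.Coprime b.1 k ∧ Nat.Coprime b.2.1 k ∧ Nat.Coprime b.2.2 k ∧
      n % k = (b.1 + b.2.1 + b.2.2) % k)

/-- The range `D < k ≤ 2D` of moduli. -/
def kRange (D : ℝ) : Finset ℕ :=
  (Finset.range (⌊2 * D⌋₊ + 1)).filter (fun k => D < (k : ℝ) ∧ (k : ℝ) ≤ 2 * D)

/-- The major arcs `𝔐`. -/
def majorArcs (n : ℕ) (D B : ℝ) : Set ℝ :=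
  ⋃ (q : ℕ) (_ : 1 ≤ q ∧ (q : ℝ) ≤ D * Real.log n ^ B) (a : ℕ)
      (_ : 0 < a ∧ a < q ∧ Nat.Coprime a q),
    Set.Ioo ((a : ℝ) / q - D * Real.log n ^ B / (q * n))
      ((a : ℝ) / q + D * Real.log n ^ B / (q * n))

/-- The minor arcs `𝔪`. -/
def minorArcs (n : ℕ) (D B : ℝ) : Set ℝ :=
  Set.Ioo (-(D * Real.log n ^ B / n)) (1 - D * Real.log n ^ B / n) \ majorArcs n D B

/-- `J₃^𝔐(n)`, the major-arc part of the integral. -/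
def J3M (n k b1 b2 b3 : ℕ) (D B : ℝ) : ℂ :=
  ∫ α in majorArcs n D B, S n k b1 α * S n k b2 α * S n k b3 α * e (-(n * α))

/-- `J₃^𝔪(n)`, the minor-arc part of the integral. -/
def J3m (n k b1 b2 b3 : ℕ) (D B : ℝ) : ℂ :=
  ∫ α in minorArcs n D B, S n k b1 α * S n k b2 α * S n k b3 α * e (-(n * α))

/-- `W₃`: the number of solutions of `p^l + q^j + r^m = n` in primes `p,q,r` and
positive exponents `l,j,m`, at least one exponent being `≥ 2`, with the prime powers in
the residue classes `b₁,b₂,b₃` mod `k`. -/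
def W3 (n k b1 b2 b3 : ℕ) : ℕ :=
  Set.ncard {x : (ℕ × ℕ) × (ℕ × ℕ) × (ℕ × ℕ) |
    x.1.1.Prime ∧ x.2.1.1.Prime ∧ x.2.2.1.Prime ∧
    1 ≤ x.1.2 ∧ 1 ≤ x.2.1.2 ∧ 1 ≤ x.2.2.2 ∧
    (2 ≤ x.1.2 ∨ 2 ≤ x.2.1.2 ∨ 2 ≤ x.2.2.2) ∧
    x.1.1 ^ x.1.2 + x.2.1.1 ^ x.2.1.2 + x.2.2.1 ^ x.2.2.2 = n ∧
    x.1.1 ^ x.1.2 % k = b1 % k ∧ x.2.1.1 ^ x.2.1.2 % k = b2 % k ∧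
    x.2.2.1 ^ x.2.2.2 % k = b3 % k}

/-- `n` has a representation `n = p₁ + p₂ + p₃` in primes with `pᵢ ≡ bᵢ (mod k)`. -/
def HasRep (n k b1 b2 b3 : ℕ) : Prop :=
  ∃ p1 p2 p3 : ℕ, p1.Prime ∧ p2.Prime ∧ p3.Prime ∧ p1 + p2 + p3 = n ∧
    p1 % k = b1 % k ∧ p2 % k = b2 % k ∧ p3 % k = b3 % k

open scoped Classical in
/-- The admissible triplets mod `k` without a representation of `n`. -/
def badTriplets (n k : ℕ) : Finset (ℕ × ℕ × ℕ) :=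
  (admTriplets n k).filter (fun b => ¬ HasRep n k b.1 b.2.1 b.2.2)

open scoped Classical in
/-- `T(k)`: the number of admissible pairs mod `k` with `R₃(n) = 0`. -/
def Tcount (n k : ℕ) : ℕ :=
  ((admPairs n k).filter (fun b => R3 n k b.1 b.2 (bthree n k b.1 b.2) = 0)).card

/-- `‖x‖`, the distance from `x` to the nearest integer. -/
def distNearestInt (x : ℝ) : ℝ := |x - round x|

namespace TernaryGoldbach

open Complex hiding log
open Real
open Filter hiding mem_sdiff prod_le_prod
open DirichletCharacter hiding Odd
open ArithmeticFunction hiding log map_zero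
open _root_.Nat hiding add_le_add card_image_le card_sigma card_univ dist_zero_right div_le_self dvd_sub
  log log_pow mul_eq_zero pow_succ'
open scoped ComplexConjugate

lemma hasDerivAt_ofReal_cpow_neg (s : ℂ) {u : ℝ} (hu : 0 < u) :
    HasDerivAt (fun x : ℝ => (x : ℂ) ^ (-s)) (-s * (u : ℂ) ^ (-s - 1)) u := by
  have := (hasDerivAt_id (u : ℂ)).cpow_const (c := -s) (Or.inl (by simpa using hu))
  simpa using this.comp_ofReal

lemma norm_cpow_neg_sub_le {a b σ : ℝ} (ha : 1 ≤ a) (hab : a ≤ b) (hσ : 0 < σ) {s : ℂ}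
    (hs : σ ≤ s.re) :
    ‖(b : ℂ) ^ (-s) - (a : ℂ) ^ (-s)‖ ≤ ‖s‖ / σ * (a ^ (-σ) - b ^ (-σ)) := by
  have hB : ∀ u : ℝ, 0 < u → HasDerivAt (fun u : ℝ => ‖s‖ / σ * (a ^ (-σ) - u ^ (-σ)))
      (‖s‖ * u ^ (-σ - 1)) u := by
    intro u hu
    have h := ((hasDerivAt_rpow_const (x := u) (p := -σ) (Or.inl hu.ne')).const_sub
      (a ^ (-σ))).const_mul (‖s‖ / σ)
    refine h.congr_deriv ?_
    field_simp
  have key := image_norm_le_of_norm_deriv_right_le_deriv_boundary' (a := a) (b := b)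
    (f := fun u : ℝ => (u : ℂ) ^ (-s) - (a : ℂ) ^ (-s))
    (f' := fun u : ℝ => -s * (u : ℂ) ^ (-s - 1))
    (B := fun u : ℝ => ‖s‖ / σ * (a ^ (-σ) - u ^ (-σ)))
    (B' := fun u : ℝ => ‖s‖ * u ^ (-σ - 1)) ?_ ?_ ?_ ?_ ?_ ?_
  · exact key ⟨hab, le_rfl⟩
  · intro u hu
    have hu0 : 0 < u := by linarith [hu.1]
    exact ((hasDerivAt_ofReal_cpow_neg s hu0).continuousAt.sub
      continuousAt_const).continuousWithinAt
  · intro u hu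
    have hu0 : 0 < u := by linarith [hu.1]
    exact ((hasDerivAt_ofReal_cpow_neg s hu0).sub_const _).hasDerivWithinAt
  · simp
  · intro u hu
    exact (hB u (by linarith [hu.1])).continuousAt.continuousWithinAt
  · intro u hu
    exact (hB u (by linarith [hu.1])).hasDerivWithinAt
  · intro u hu
    have hu1 : 1 ≤ u := by linarith [hu.1]
    have hu0 : 0 < u := by linarith [hu.1]
    rw [norm_mul, norm_neg, norm_cpow_eq_rpow_re_of_pos hu0]
    refine mul_le_mul_of_nonneg_left (rpow_le_rpow_of_exponent_le hu1 ?_) (norm_nonneg _)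
    simpa using hs

lemma tendsto_natCast_add_rpow_neg {σ : ℝ} (hσ : 0 < σ) (c : ℝ) :
    Tendsto (fun n : ℕ => ((n : ℝ) + c) ^ (-σ)) atTop (nhds 0) :=
  (tendsto_rpow_neg_atTop hσ).comp
    (tendsto_atTop_add_const_right _ _ tendsto_natCast_atTop_atTop)

lemma hasSum_rpow_neg_sub {σ : ℝ} (hσ : 0 < σ) (N : ℕ) :
    HasSum (fun n : ℕ => ((n + N : ℕ) + 1 : ℝ) ^ (-σ) - ((n + N : ℕ) + 2 : ℝ) ^ (-σ))
      ((N + 1 : ℝ) ^ (-σ)) := by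
  rw [hasSum_iff_tendsto_nat_of_nonneg]
  · have h : ∀ n : ℕ, ∑ i ∈ range n,
        (((i + N : ℕ) + 1 : ℝ) ^ (-σ) - ((i + N : ℕ) + 2 : ℝ) ^ (-σ))
        = (N + 1 : ℝ) ^ (-σ) - ((n : ℝ) + (N + 1)) ^ (-σ) := by
      intro n
      have := sum_range_sub' (fun i : ℕ => ((i : ℝ) + (N + 1)) ^ (-σ)) n
      simp only [cast_zero, zero_add] at this
      rw [← this]
      refine sum_congr rfl fun i _ => ?_
      push_cast
      congr 2 <;> ring
    simp_rw [h]
    simpa using (tendsto_natCast_add_rpow_neg hσ ((N : ℝ) + 1)).const_sub ((N + 1 : ℝ) ^ (-σ))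
  · intro i
    rw [sub_nonneg]
    apply rpow_le_rpow_of_nonpos <;> [positivity; linarith; linarith]

/-- A series of entire functions whose terms are bounded by a telescoping difference of powers
continues its sum to the right half plane, with an explicit tail. -/
lemma norm_sub_sum_le_of_telescoping {g : ℕ → ℂ → ℂ} (hg : ∀ n, Differentiable ℂ (g n))
    {B : ℝ → ℝ} (hBm : Monotone B)
    (hB : ∀ n σ s, 0 < σ → σ ≤ s.re →
      ‖g n s‖ ≤ B ‖s‖ / σ * (((n : ℝ) + 1) ^ (-σ) - ((n : ℝ) + 2) ^ (-σ)))
    {G : ℂ → ℂ} (hG : Differentiable ℂ G)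
    (hGg : ∀ s : ℂ, 1 < s.re →
      Tendsto (fun N => ∑ n ∈ range N, g n s) atTop (nhds (G s)))
    {s : ℂ} (hs : 0 < s.re) (N : ℕ) :
    ‖G s - ∑ n ∈ range N, g n s‖ ≤ B ‖s‖ / s.re * ((N : ℝ) + 1) ^ (-s.re) := by
  have hsum : ∀ z : ℂ, 0 < z.re → Summable (fun n => g n z) := by
    intro z hz
    have h0 := (hasSum_rpow_neg_sub hz 0).summable.mul_left (B ‖z‖ / z.re)
    exact Summable.of_norm_bounded h0 (fun n => by simpa using hB n z.re z hz le_rfl)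
  have hEq : G s = ∑' n, g n s := by
    set σ := s.re / 2 with hσ
    have hσ0 : 0 < σ := by positivity
    set T := ‖s‖ + 3
    set U : Set ℂ := {z | σ < z.re} ∩ Metric.ball 0 T
    have hUo : IsOpen U := (isOpen_lt continuous_const continuous_re).inter
      Metric.isOpen_ball
    have hUc : Convex ℝ U := (convex_halfSpace_re_gt σ).inter (convex_ball _ _)
    have hd : DifferentiableOn ℂ (fun z => ∑' n, g n z) U := by
      refine differentiableOn_tsum_of_summable_norm
        ((hasSum_rpow_neg_sub hσ0 0).summable.mul_left (B T / σ))
        (fun n => (hg n).differentiableOn) hUo ?_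
      intro n w hw
      refine (hB n σ w hσ0 hw.1.le).trans ?_
      have h1 : ‖w‖ ≤ T := by simpa using (Metric.mem_ball.1 hw.2).le
      simp only [add_zero]
      refine mul_le_mul_of_nonneg_right ?_ ?_
      · exact div_le_div_of_nonneg_right (hBm h1) hσ0.le
      · rw [sub_nonneg]
        apply rpow_le_rpow_of_nonpos <;> [positivity; linarith; linarith]
    have hsre : |s.re| ≤ ‖s‖ := abs_re_le_norm s
    have hsre' := (abs_le.1 hsre).2
    set z0 : ℂ := ((s.re + 2 : ℝ) : ℂ)
    have hz0U : z0 ∈ U := by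
      refine ⟨?_, ?_⟩
      · simp only [z0, Set.mem_ofPred_eq, ofReal_re]; linarith
      · rw [Metric.mem_ball, dist_zero_right, norm_real, norm_eq_abs,
          abs_of_pos (by linarith)]
        simp only [T]; linarith
    have hsU : s ∈ U := ⟨by simp only [Set.mem_ofPred_eq]; linarith, by
      rw [Metric.mem_ball, dist_zero_right]; simp only [T]; linarith⟩
    refine (hG.differentiableOn.analyticOnNhd hUo).eqOn_of_preconnected_of_eventuallyEq
      (hd.analyticOnNhd hUo) hUc.isPreconnected hz0U ?_ hsU
    have hev : ∀ᶠ z in nhds z0, 1 < z.re :=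
      (isOpen_lt continuous_const continuous_re).mem_nhds (by
        simp only [z0, Set.mem_ofPred_eq, ofReal_re]; linarith)
    filter_upwards [hev] with z hz
    exact tendsto_nhds_unique (hGg z hz) (hsum z (by linarith)).hasSum.tendsto_sum_nat
  rw [hEq, ← (hsum s hs).sum_add_tsum_nat_add N, add_sub_cancel_left]
  have h1 := (hasSum_rpow_neg_sub hs N).mul_left (B ‖s‖ / s.re)
  refine tsum_of_norm_bounded h1 fun n => ?_
  exact hB (n + N) s.re s hs le_rfl

/-- Continuation of a Dirichlet series with bounded partial sums. -/
lemma norm_sub_dirichlet_sum_le {f : ℕ → ℂ} {M : ℝ} (hM0 : 0 ≤ M)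
    (hM : ∀ n, ‖∑ m ∈ Icc 1 n, f m‖ ≤ M) {G : ℂ → ℂ} (hG : Differentiable ℂ G)
    (hGf : ∀ s : ℂ, 1 < s.re → G s = LSeries f s) {s : ℂ} (hs : 0 < s.re) (N : ℕ) :
    ‖G s - ∑ m ∈ Icc 1 N, f m * (m : ℂ) ^ (-s)‖
      ≤ M * ((N : ℝ) + 1) ^ (-s.re) * (1 + ‖s‖ / s.re) := by
  set P : ℕ → ℂ := fun n => ∑ m ∈ Icc 1 n, f m
  set g : ℕ → ℂ → ℂ := fun n s => P (n + 1) * (((n + 1 : ℕ) : ℂ) ^ (-s) - ((n + 2 : ℕ) : ℂ) ^ (-s))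
  have hsumg : ∀ (N : ℕ) (s : ℂ), ∑ n ∈ range N, g n s
      = ∑ m ∈ Icc 1 N, f m * (m : ℂ) ^ (-s) - P N * ((N + 1 : ℕ) : ℂ) ^ (-s) := by
    intro N s
    induction N with
    | zero => simp [P]
    | succ N ih =>
      rw [sum_range_succ, ih, sum_Icc_succ_top (by omega)]
      have : P (N + 1) = P N + f (N + 1) := by
        simp only [P]; rw [sum_Icc_succ_top (by omega)]
      simp only [g, this]
      ring
  have hgB : ∀ n σ s, 0 < σ → σ ≤ s.re →
      ‖g n s‖ ≤ (M * max ‖s‖ 0) / σ * (((n : ℝ) + 1) ^ (-σ) - ((n : ℝ) + 2) ^ (-σ)) := by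
    intro n σ s hσ hsσ
    have h := norm_cpow_neg_sub_le (a := (n : ℝ) + 1) (b := (n : ℝ) + 2) (by
      have : (0 : ℝ) ≤ n := by positivity
      linarith) (by linarith) hσ hsσ
    simp only [g]
    rw [norm_mul, norm_sub_rev, max_eq_left (norm_nonneg s), mul_div_assoc, mul_assoc]
    refine mul_le_mul (hM _) ?_ (norm_nonneg _) hM0
    push_cast at h ⊢
    exact h
  have hbd : ∀ n, 1 ≤ n → ‖f n‖ ≤ 2 * M := by
    intro n hn
    obtain ⟨m, rfl⟩ := Nat.exists_eq_add_of_le' hn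
    have : f (m + 1) = P (m + 1) - P m := by
      simp only [P]; rw [sum_Icc_succ_top (by omega)]; ring
    rw [this]
    refine (norm_sub_le _ _).trans ?_
    have h1 := hM (m + 1)
    have h2 := hM m
    simp only [P]; linarith
  have hlim : ∀ s : ℂ, 1 < s.re →
      Tendsto (fun N => ∑ n ∈ range N, g n s) atTop (nhds (G s)) := by
    intro s hs
    have hsm : LSeriesSummable f s :=
      LSeriesSummable_of_bounded_of_one_lt_re (m := 2 * M) (fun n hn => hbd n (by omega)) hs
    have h1 : Tendsto (fun N : ℕ => ∑ m ∈ Icc 1 N, f m * (m : ℂ) ^ (-s)) atTop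
        (nhds (G s)) := by
      have h2 := (hsm.hasSum.tendsto_sum_nat).comp (tendsto_add_atTop_nat 1)
      rw [hGf s hs]
      refine h2.congr fun N => ?_
      simp only [Function.comp]
      rw [← Ico_zero_eq_range, ← sum_Ico_consecutive _ (Nat.zero_le 1) (by omega)]
      simp only [Ico_zero_eq_range, range_one, sum_singleton, LSeries.term_zero, zero_add]
      have hI : Icc 1 N = Ico 1 (N + 1) := by ext; simp only [mem_Icc, mem_Ico]; omega
      rw [hI]
      refine sum_congr rfl fun m hm => ?_
      rw [LSeries.term_of_ne_zero (by have := (mem_Ico.1 hm).1; omega), cpow_neg,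
        div_eq_mul_inv]
    have h2 : Tendsto (fun N : ℕ => P N * ((N + 1 : ℕ) : ℂ) ^ (-s)) atTop
        (nhds 0) := by
      have h3 := (tendsto_natCast_add_rpow_neg (σ := s.re) (by linarith) 1).const_mul M
      rw [mul_zero] at h3
      refine squeeze_zero_norm (fun N => ?_) h3
      rw [norm_mul, norm_natCast_cpow_of_pos (by omega)]
      push_cast
      simp only [neg_re]
      exact mul_le_mul_of_nonneg_right (hM N) (by positivity)
    have h3 := h1.sub h2
    rw [sub_zero] at h3
    exact h3.congr fun N => (hsumg N s).symm
  have hmain := norm_sub_sum_le_of_telescoping (g := g) (B := fun x => M * max x 0) ?_ ?_ hgB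
    hG hlim hs N
  · rw [hsumg] at hmain
    have h4 : ‖P N * ((N + 1 : ℕ) : ℂ) ^ (-s)‖ ≤ M * ((N : ℝ) + 1) ^ (-s.re) := by
      rw [norm_mul, norm_natCast_cpow_of_pos (by omega)]
      push_cast
      simp only [neg_re]
      exact mul_le_mul_of_nonneg_right (hM N) (by positivity)
    rw [max_eq_left (norm_nonneg s)] at hmain
    calc _ = ‖(G s - (∑ m ∈ Icc 1 N, f m * (m : ℂ) ^ (-s) - P N * ((N + 1 : ℕ) : ℂ) ^ (-s)))
          - P N * ((N + 1 : ℕ) : ℂ) ^ (-s)‖ := by congr 1; ring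
      _ ≤ _ := norm_sub_le _ _
      _ ≤ M * ‖s‖ / s.re * ((N : ℝ) + 1) ^ (-s.re) + M * ((N : ℝ) + 1) ^ (-s.re) := by gcongr
      _ = _ := by ring
  · intro n
    refine Differentiable.const_mul (Differentiable.sub ?_ ?_) _ <;>
    · refine Differentiable.const_cpow differentiable_id.neg (Or.inl ?_)
      exact cast_ne_zero.2 (by omega)
  · intro x y hxy
    exact mul_le_mul_of_nonneg_left (max_le_max hxy le_rfl) hM0

/-- `(s - 1) ζ(s)` with the removable singularity filled in. -/
def zetaH : ℂ → ℂ := Function.update (fun s => (s - 1) * riemannZeta s) 1 1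

lemma zetaH_one : zetaH 1 = 1 := by simp [zetaH]

lemma zetaH_of_ne {s : ℂ} (hs : s ≠ 1) : zetaH s = (s - 1) * riemannZeta s := by
  simp [zetaH, hs]

lemma differentiable_zetaH : Differentiable ℂ zetaH := by
  have h := differentiable_LFunctionTrivChar₁ 1
  have : zetaH = LFunctionTrivChar₁ 1 := by
    simp [zetaH, LFunctionTrivChar₁, LFunctionTrivChar,
      LFunction_modOne_eq]
  rwa [this]

lemma zetaH_ne_zero {s : ℂ} (hs : 1 ≤ s.re) : zetaH s ≠ 0 := by
  by_cases h : s = 1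
  · rw [h, zetaH_one]; exact one_ne_zero
  · rw [zetaH_of_ne h]
    exact mul_ne_zero (sub_ne_zero.2 h) (riemannZeta_ne_zero_of_one_le_re hs)

lemma norm_zetaH_sub_le {s : ℂ} (hs : 0 < s.re) (N : ℕ) :
    ‖zetaH s - (s - 1) * ∑ m ∈ Icc 1 N, (m : ℂ) ^ (-s) - ((N + 1 : ℕ) : ℂ) ^ (1 - s)‖
      ≤ (‖s‖ + 1) * ‖s‖ / s.re * ((N : ℝ) + 1) ^ (-s.re) := by
  set g : ℕ → ℂ → ℂ := fun n s => (s - 1) * ((n + 1 : ℕ) : ℂ) ^ (-s)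
    - ((n + 1 : ℕ) : ℂ) ^ (1 - s) + ((n + 2 : ℕ) : ℂ) ^ (1 - s)
  have hsumg : ∀ (N : ℕ) (s : ℂ), ∑ n ∈ range N, g n s
      = (s - 1) * ∑ m ∈ Icc 1 N, (m : ℂ) ^ (-s) + ((N + 1 : ℕ) : ℂ) ^ (1 - s) - 1 := by
    intro N s
    induction N with
    | zero => simp
    | succ N ih =>
      rw [sum_range_succ, ih, sum_Icc_succ_top (by omega)]
      simp only [g]
      ring
  have hgB : ∀ n σ s, 0 < σ → σ ≤ s.re →
      ‖g n s‖ ≤ ((max ‖s‖ 0 + 1) * max ‖s‖ 0) / σ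
        * (((n : ℝ) + 1) ^ (-σ) - ((n : ℝ) + 2) ^ (-σ)) := by
    intro n σ s hσ hsσ
    rw [max_eq_left (norm_nonneg s)]
    have hn1 : (1 : ℝ) ≤ (n : ℝ) + 1 := by
      have : (0 : ℝ) ≤ n := by positivity
      linarith
    set D := (((n : ℝ) + 1) ^ (-σ) - ((n : ℝ) + 2) ^ (-σ))
    have h1 := norm_image_sub_le_of_norm_deriv_le_segment' (a := (n : ℝ) + 1) (b := (n : ℝ) + 2)
      (f := fun u : ℝ => (s - 1) * ((n + 1 : ℕ) : ℂ) ^ (-s) * u + (u : ℂ) ^ (-(s - 1)))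
      (f' := fun u : ℝ => (s - 1) * ((n + 1 : ℕ) : ℂ) ^ (-s)
        + -(s - 1) * (u : ℂ) ^ (-(s - 1) - 1))
      (C := (‖s‖ + 1) * (‖s‖ / σ * D)) ?_ ?_ ((n : ℝ) + 2) ⟨by linarith, le_rfl⟩
    · have h2 : g n s = ((s - 1) * ((n + 1 : ℕ) : ℂ) ^ (-s) * (((n : ℝ) + 2 : ℝ) : ℂ)
          + ((((n : ℝ) + 2 : ℝ)) : ℂ) ^ (-(s - 1)))
          - ((s - 1) * ((n + 1 : ℕ) : ℂ) ^ (-s) * (((n : ℝ) + 1 : ℝ) : ℂ)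
          + ((((n : ℝ) + 1 : ℝ)) : ℂ) ^ (-(s - 1))) := by
        simp only [g, neg_sub]
        push_cast
        ring
      rw [h2]
      refine h1.trans (le_of_eq ?_)
      ring
    · intro u hu
      have hu0 : 0 < u := by linarith [hu.1]
      have h3 : HasDerivAt (fun u : ℝ => (s - 1) * ((n + 1 : ℕ) : ℂ) ^ (-s) * (u : ℂ))
          ((s - 1) * ((n + 1 : ℕ) : ℂ) ^ (-s)) u := by
        simpa using (ofRealCLM.hasDerivAt (x := u)).const_mul
          ((s - 1) * ((n + 1 : ℕ) : ℂ) ^ (-s))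
      exact (h3.add (hasDerivAt_ofReal_cpow_neg (s - 1) hu0)).hasDerivWithinAt
    · intro u hu
      have hu0 : 0 < u := by linarith [hu.1]
      have h4 : (s - 1) * ((n + 1 : ℕ) : ℂ) ^ (-s) + -(s - 1) * (u : ℂ) ^ (-(s - 1) - 1)
          = -(s - 1) * ((u : ℂ) ^ (-s) - (((n : ℝ) + 1 : ℝ) : ℂ) ^ (-s)) := by
        have : -(s - 1) - 1 = -s := by ring
        rw [this]; push_cast; ring
      rw [h4, norm_mul, norm_neg]
      refine mul_le_mul ?_ ?_ (norm_nonneg _) (by positivity)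
      · simpa using norm_sub_le s 1
      · refine (norm_cpow_neg_sub_le hn1 hu.1 hσ hsσ).trans ?_
        refine mul_le_mul_of_nonneg_left ?_ (by positivity)
        simp only [D]
        refine sub_le_sub_left (rpow_le_rpow_of_nonpos hu0 hu.2.le (by linarith)) _
  have hlim : ∀ s : ℂ, 1 < s.re → Tendsto (fun N => ∑ n ∈ range N, g n s) atTop
      (nhds (zetaH s - 1)) := by
    intro s hs
    have hne : s ≠ 1 := by rintro rfl; simp at hs
    have h1 : Tendsto (fun N : ℕ => ∑ m ∈ Icc 1 N, (m : ℂ) ^ (-s)) atTop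
        (nhds (riemannZeta s)) := by
      rw [zeta_eq_tsum_one_div_nat_add_one_cpow hs]
      have hsm : Summable fun n : ℕ => 1 / ((n : ℂ) + 1) ^ s := by
        have := (summable_nat_add_iff 1).2 (summable_one_div_nat_cpow.2 hs)
        simpa using this
      refine hsm.hasSum.tendsto_sum_nat.congr fun N => ?_
      induction N with
      | zero => simp
      | succ N ih =>
        rw [sum_range_succ, ih, sum_Icc_succ_top (by omega), cpow_neg, one_div]
        push_cast
        rfl
    have h2 : Tendsto (fun N : ℕ => ((N + 1 : ℕ) : ℂ) ^ (1 - s)) atTop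
        (nhds 0) := by
      refine squeeze_zero_norm (fun N => ?_) (tendsto_natCast_add_rpow_neg
        (σ := s.re - 1) (by linarith) 1)
      rw [norm_natCast_cpow_of_pos (by omega)]
      simp
    have h3 := ((h1.const_mul (s - 1)).add h2).sub_const 1
    rw [add_zero, ← zetaH_of_ne hne] at h3
    exact h3.congr fun N => (hsumg N s).symm
  have hmain := norm_sub_sum_le_of_telescoping (g := g)
    (B := fun x => (max x 0 + 1) * max x 0) ?_ ?_ hgB (differentiable_zetaH.sub_const 1) hlim hs N
  · rw [hsumg, max_eq_left (norm_nonneg s)] at hmain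
    convert hmain using 2
    ring
  · intro n
    have hc : ∀ k : ℕ, k ≠ 0 → ∀ f : ℂ → ℂ, Differentiable ℂ f →
        Differentiable ℂ fun s => (k : ℂ) ^ f s := fun k hk f hf =>
      Differentiable.const_cpow hf (Or.inl (cast_ne_zero.2 hk))
    exact (((differentiable_id.sub_const 1).mul (hc _ (by omega) _ differentiable_id.neg)).sub
      (hc _ (by omega) _ (differentiable_id.const_sub 1))).add
      (hc _ (by omega) _ (differentiable_id.const_sub 1))
  · intro x y hxy
    have := max_le_max hxy (le_refl (0 : ℝ))
    have h0 : (0 : ℝ) ≤ max x 0 := le_max_right _ _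
    dsimp only
    gcongr

lemma sum_range_char_level {q : ℕ} [NeZero q] {χ : DirichletCharacter ℂ q} (hχ : χ ≠ 1) :
    ∑ m ∈ range q, χ (m : ZMod q) = 0 := by
  rw [← χ.sum_eq_zero_of_ne_one hχ]
  refine sum_nbij' (fun m => (m : ZMod q)) ZMod.val (by simp)
    (fun a _ => mem_range.2 (ZMod.val_lt a)) (fun m hm => ZMod.val_cast_of_lt (mem_range.1 hm))
    (fun a _ => ZMod.natCast_zmod_val a) (fun _ _ => rfl)

lemma norm_sum_range_char_le {q : ℕ} [NeZero q] {χ : DirichletCharacter ℂ q} (hχ : χ ≠ 1) (n : ℕ) :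
    ‖∑ m ∈ range n, χ (m : ZMod q)‖ ≤ q := by
  have hq : 0 < q := Nat.pos_of_ne_zero (NeZero.ne q)
  have h1 : ∀ a b : ℕ, ∑ m ∈ range (q * a + b), χ (m : ZMod q) = ∑ m ∈ range b, χ (m : ZMod q) := by
    intro a b
    induction a with
    | zero => simp
    | succ a ih =>
      have : q * (a + 1) + b = q + (q * a + b) := by ring
      rw [this, sum_range_add, sum_range_char_level hχ, zero_add, ← ih]
      refine sum_congr rfl fun m _ => by simp
  rw [← div_add_mod n q, h1]
  calc _ ≤ ∑ m ∈ range (n % q), ‖χ (m : ZMod q)‖ := norm_sum_le _ _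
    _ ≤ ∑ m ∈ range (n % q), (1 : ℝ) := sum_le_sum fun _ _ => χ.norm_le_one _
    _ = ((n % q : ℕ) : ℝ) := by simp
    _ ≤ q := mod_cast (mod_lt n hq).le

lemma norm_sum_Icc_char_le {q : ℕ} [NeZero q] {χ : DirichletCharacter ℂ q} (hχ : χ ≠ 1) (n : ℕ) :
    ‖∑ m ∈ Icc 1 n, χ (m : ZMod q)‖ ≤ q := by
  by_cases hq : q = 1
  · subst hq
    exact absurd (level_one χ) hχ
  have hI : range (n + 1) = insert 0 (Icc 1 n) := by ext; simp; omega
  have h := norm_sum_range_char_le hχ (n + 1)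
  have h0 : χ ((0 : ℕ) : ZMod q) = 0 := by
    rw [cast_zero]; exact χ.map_zero' hq
  rwa [hI, sum_insert (by simp), h0, zero_add] at h

lemma sum_rpow_neg_le {η σ : ℝ} (hη : 0 < η) (hσ : 1 - η ≤ σ) (N : ℕ) :
    ∑ m ∈ Icc 1 N, (m : ℝ) ^ (-σ) ≤ (N : ℝ) ^ η * (1 + log N) := by
  have h1 : ∀ m ∈ Icc 1 N, (m : ℝ) ^ (-σ) ≤ (N : ℝ) ^ η * (m : ℝ)⁻¹ := by
    intro m hm
    have hm1 := (mem_Icc.1 hm).1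
    have hmN := (mem_Icc.1 hm).2
    have hm0 : (0 : ℝ) < m := mod_cast hm1
    calc (m : ℝ) ^ (-σ) ≤ (m : ℝ) ^ (η - 1) :=
          rpow_le_rpow_of_exponent_le (mod_cast hm1) (by linarith)
      _ = (m : ℝ) ^ η * (m : ℝ)⁻¹ := by rw [rpow_sub_one hm0.ne', div_eq_mul_inv]
      _ ≤ _ := by gcongr
  refine (sum_le_sum h1).trans ?_
  rw [← mul_sum]
  refine mul_le_mul_of_nonneg_left ?_ (by positivity)
  have := harmonic_le_one_add_log N
  rw [harmonic_eq_sum_Icc] at this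
  push_cast at this
  exact this

lemma rpow_mul_one_add_log_le {η X : ℝ} (hη : 0 < η) (hX : 1 ≤ X) :
    X ^ η * (1 + log X) ≤ (1 + 1 / η) * X ^ (2 * η) := by
  have h1 : log X ≤ X ^ η / η := log_le_rpow_div (by linarith) hη
  have h2 : 1 ≤ X ^ η := one_le_rpow hX hη.le
  have h3 : X ^ (2 * η) = X ^ η * X ^ η := by
    rw [← rpow_add (by linarith)]; ring_nf
  rw [h3]
  have : 1 + log X ≤ (1 + 1 / η) * X ^ η := by
    rw [add_mul, one_div, inv_mul_eq_div]; linarith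
  calc _ ≤ X ^ η * ((1 + 1 / η) * X ^ η) := by gcongr
    _ = _ := by ring

lemma norm_dirichlet_sum_le {η X : ℝ} (hη : 0 < η) (hX : 1 ≤ X) {f : ℕ → ℂ} (hf : ∀ m, ‖f m‖ ≤ 1)
    {s : ℂ} (hs : 1 - η ≤ s.re) :
    ‖∑ m ∈ Icc 1 ⌊X⌋₊, f m * (m : ℂ) ^ (-s)‖ ≤ (1 + 1 / η) * X ^ (2 * η) := by
  have hN : 1 ≤ ⌊X⌋₊ := one_le_floor_iff _ |>.2 hX
  have hN' : (1 : ℝ) ≤ ⌊X⌋₊ := mod_cast hN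
  have hNX : (⌊X⌋₊ : ℝ) ≤ X := floor_le (by linarith)
  calc _ ≤ ∑ m ∈ Icc 1 ⌊X⌋₊, ‖f m * (m : ℂ) ^ (-s)‖ := norm_sum_le _ _
    _ ≤ ∑ m ∈ Icc 1 ⌊X⌋₊, (m : ℝ) ^ (-s.re) := by
        refine sum_le_sum fun m hm => ?_
        rw [norm_mul, norm_natCast_cpow_of_pos (mem_Icc.1 hm).1]
        simp only [neg_re]
        exact mul_le_of_le_one_left (by positivity) (hf m)
    _ ≤ (⌊X⌋₊ : ℝ) ^ η * (1 + log ⌊X⌋₊) := sum_rpow_neg_le hη hs _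
    _ ≤ X ^ η * (1 + log X) := by
        have := log_nonneg hN'
        gcongr
    _ ≤ _ := rpow_mul_one_add_log_le hη hX

lemma norm_le_three_add {s : ℂ} (h0 : 0 ≤ s.re) (h3 : s.re ≤ 3) : ‖s‖ ≤ 3 + |s.im| := by
  refine (norm_le_abs_re_add_abs_im s).trans ?_
  rw [abs_of_nonneg h0]; linarith

/-- The convexity-free bound for `L(s, χ)` slightly to the left of `Re s = 1`. -/
lemma norm_LFunction_le {η : ℝ} (hη : 0 < η) (hη2 : η ≤ 1 / 2) {q : ℕ} [NeZero q]
    {χ : DirichletCharacter ℂ q} (hχ : χ ≠ 1) {s : ℂ} (hs : 1 - η ≤ s.re) (hs3 : s.re ≤ 3) :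
    ‖χ.LFunction s‖ ≤ (6 + 1 / η) * (q * (2 + |s.im|)) ^ (2 * η) := by
  have hq1 : (1 : ℝ) ≤ q := mod_cast NeZero.one_le
  set X : ℝ := q * (2 + |s.im|) with hX
  have hX1 : 1 ≤ X := by nlinarith [abs_nonneg s.im]
  have h1 := norm_sub_dirichlet_sum_le (f := fun m => χ (m : ZMod q)) (M := q) (by positivity)
    (norm_sum_Icc_char_le hχ) (differentiable_LFunction hχ)
    (fun s hs => LFunction_eq_LSeries χ hs) (s := s) (by linarith) ⌊X⌋₊
  have h2 := norm_dirichlet_sum_le hη hX1 (f := fun m => χ (m : ZMod q))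
    (fun m => χ.norm_le_one _) hs
  have hXf : X ≤ (⌊X⌋₊ : ℝ) + 1 := (lt_floor_add_one X).le
  have h3 : (q : ℝ) * ((⌊X⌋₊ : ℝ) + 1) ^ (-s.re) * (1 + ‖s‖ / s.re) ≤ 5 * X ^ (2 * η) := by
    have hb : 1 + ‖s‖ / s.re ≤ 5 * (2 + |s.im|) := by
      have : ‖s‖ / s.re ≤ ‖s‖ / (1 / 2) := by gcongr; linarith
      have := norm_le_three_add (s := s) (by linarith) hs3
      linarith [abs_nonneg s.im]
    have hc : ((⌊X⌋₊ : ℝ) + 1) ^ (-s.re) ≤ X ^ (2 * η - 1) := by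
      calc _ ≤ X ^ (-s.re) := rpow_le_rpow_of_nonpos (by linarith) hXf (by linarith)
        _ ≤ _ := rpow_le_rpow_of_exponent_le hX1 (by linarith)
    have hd : 0 ≤ ‖s‖ / s.re := div_nonneg (norm_nonneg _) (by linarith)
    calc _ ≤ (q : ℝ) * X ^ (2 * η - 1) * (5 * (2 + |s.im|)) := by gcongr
      _ = 5 * (X ^ (2 * η - 1) * X) := by rw [hX]; ring
      _ = 5 * X ^ (2 * η) := by rw [← rpow_add_one (by linarith)]; ring_nf
  have h4 : χ.LFunction s = (χ.LFunction s - ∑ m ∈ Icc 1 ⌊X⌋₊, χ (m : ZMod q) * (m : ℂ) ^ (-s))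
    + ∑ m ∈ Icc 1 ⌊X⌋₊, χ (m : ZMod q) * (m : ℂ) ^ (-s) := by ring
  rw [h4]
  refine (norm_add_le _ _).trans ?_
  have := (add_le_add (h1.trans h3) h2)
  refine this.trans (le_of_eq ?_)
  ring

lemma norm_zetaH_le {η : ℝ} (hη : 0 < η) (hη2 : η ≤ 1 / 2) {s : ℂ} (hs : 1 - η ≤ s.re)
    (hs3 : s.re ≤ 3) :
    ‖zetaH s‖ ≤ (20 + 4 / η) * (2 + |s.im|) * (2 + |s.im|) ^ (2 * η) := by
  set X : ℝ := 2 + |s.im| with hX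
  have him := abs_nonneg s.im
  have hX1 : 1 ≤ X := by linarith
  have h1 := norm_zetaH_sub_le (s := s) (by linarith) ⌊X⌋₊
  have h2 := norm_dirichlet_sum_le hη hX1 (f := fun m => 1) (fun m => by simp) hs
  simp only [one_mul] at h2
  have hXf : X ≤ (⌊X⌋₊ : ℝ) + 1 := (lt_floor_add_one X).le
  have hXf2 : (⌊X⌋₊ : ℝ) + 1 ≤ 2 * X := by
    have := floor_le (show 0 ≤ X by linarith)
    linarith
  have hXp : X ^ (2 * η) = X ^ (2 * η - 1) * X := by
    rw [← rpow_add_one (by linarith)]; ring_nf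
  have hXp1 : 1 ≤ X ^ (2 * η) := one_le_rpow hX1 (by linarith)
  have hns : ‖s‖ ≤ 2 * X := by
    have := norm_le_three_add (s := s) (by linarith) hs3
    linarith
  have hns1 : ‖s - 1‖ ≤ 3 * X := by
    have := norm_sub_le s 1
    rw [norm_one] at this; linarith
  have hA : ‖(s - 1) * ∑ m ∈ Icc 1 ⌊X⌋₊, (m : ℂ) ^ (-s)‖
      ≤ (3 * X) * ((1 + 1 / η) * X ^ (2 * η)) := by
    rw [norm_mul]
    gcongr
  have hB : ‖((⌊X⌋₊ + 1 : ℕ) : ℂ) ^ (1 - s)‖ ≤ 2 * X * X ^ (2 * η) := by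
    rw [norm_natCast_cpow_of_pos (by omega)]
    push_cast
    simp only [sub_re, one_re]
    calc ((⌊X⌋₊ : ℝ) + 1) ^ (1 - s.re) ≤ ((⌊X⌋₊ : ℝ) + 1) ^ (1 : ℝ) :=
          rpow_le_rpow_of_exponent_le (by linarith) (by linarith)
      _ = (⌊X⌋₊ : ℝ) + 1 := rpow_one _
      _ ≤ 2 * X * 1 := by linarith
      _ ≤ _ := by gcongr
  have hC : (‖s‖ + 1) * ‖s‖ / s.re * ((⌊X⌋₊ : ℝ) + 1) ^ (-s.re) ≤ 12 * X * X ^ (2 * η) := by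
    have hc : ((⌊X⌋₊ : ℝ) + 1) ^ (-s.re) ≤ X ^ (2 * η - 1) := by
      calc _ ≤ X ^ (-s.re) := rpow_le_rpow_of_nonpos (by linarith) hXf (by linarith)
        _ ≤ _ := rpow_le_rpow_of_exponent_le hX1 (by linarith)
    have hd : (‖s‖ + 1) * ‖s‖ / s.re ≤ (3 * X) * (2 * X) / (1 / 2) := by
      gcongr
      · linarith
      · linarith
    calc _ ≤ (3 * X) * (2 * X) / (1 / 2) * X ^ (2 * η - 1) := by gcongr
      _ = _ := by rw [hXp]; ring
  have hD : zetaH s = (zetaH s - (s - 1) * ∑ m ∈ Icc 1 ⌊X⌋₊, (m : ℂ) ^ (-s)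
      - ((⌊X⌋₊ + 1 : ℕ) : ℂ) ^ (1 - s)) + (s - 1) * ∑ m ∈ Icc 1 ⌊X⌋₊, (m : ℂ) ^ (-s)
      + ((⌊X⌋₊ + 1 : ℕ) : ℂ) ^ (1 - s) := by ring
  rw [hD]
  refine (norm_add₃_le).trans ?_
  have h0 : 0 ≤ X * X ^ (2 * η) := by positivity
  have he : 0 ≤ 1 / η * (X * X ^ (2 * η)) := by positivity
  have hf : (20 + 4 / η) * X * X ^ (2 * η) = 20 * (X * X ^ (2 * η)) + 4 * (1 / η * (X * X ^ (2 * η))) := by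
    ring
  have hg : (3 * X) * ((1 + 1 / η) * X ^ (2 * η))
    = 3 * (X * X ^ (2 * η)) + 3 * (1 / η * (X * X ^ (2 * η))) := by ring
  rw [hf]
  linarith [h1.trans hC]

lemma norm_deriv_LFunction_le {η : ℝ} (hη : 0 < η) (hη4 : η ≤ 1 / 4) {q : ℕ} [NeZero q]
    {χ : DirichletCharacter ℂ q} (hχ : χ ≠ 1) {s : ℂ} (hs : 1 - η ≤ s.re) (hs3 : s.re ≤ 5 / 2) :
    ‖deriv χ.LFunction s‖ ≤ 4 / η ^ 2 * (q * (2 + |s.im|)) ^ (4 * η) := by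
  have hq1 : (1 : ℝ) ≤ q := mod_cast NeZero.one_le
  set X : ℝ := q * (2 + |s.im|) with hX
  have hX1 : 1 ≤ X := by nlinarith [abs_nonneg s.im]
  have h := norm_deriv_le_of_forall_mem_sphere_norm_le (f := χ.LFunction) (c := s)
    (R := η) (C := (6 + 1 / (2 * η)) * (2 * X ^ (4 * η))) hη
    (differentiable_LFunction hχ).diffContOnCl ?_
  · refine h.trans ?_
    rw [div_le_iff₀ hη]
    have : 4 / η ^ 2 * X ^ (4 * η) * η = (4 / η) * X ^ (4 * η) := by field_simp
    rw [this, ← mul_assoc]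
    gcongr
    have : (6 + 1 / (2 * η)) * 2 = (12 * η + 1) / η := by field_simp; ring
    rw [this]
    gcongr
    linarith
  · intro z hz
    have hz' : ‖z - s‖ = η := by simpa [dist_eq_norm] using hz
    have h1 := abs_re_le_norm (z - s)
    have h2 := abs_im_le_norm (z - s)
    rw [hz', sub_re, abs_le] at h1
    rw [hz', sub_im] at h2
    have h3 : |z.im| ≤ |s.im| + η := by
      have := abs_add_le (z.im - s.im) s.im
      rw [sub_add_cancel] at this; linarith
    refine (norm_LFunction_le (η := 2 * η) (by linarith) (by linarith) hχ (by linarith)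
      (by linarith)).trans ?_
    have h4 : (q : ℝ) * (2 + |z.im|) ≤ 2 * X := by
      rw [hX]; nlinarith [abs_nonneg s.im]
    have h5 : ((q : ℝ) * (2 + |z.im|)) ^ (2 * (2 * η)) ≤ 2 * X ^ (4 * η) := by
      calc _ ≤ (2 * X) ^ (2 * (2 * η)) := by gcongr
        _ = 2 ^ (4 * η) * X ^ (4 * η) := by
            rw [mul_rpow (by norm_num) (by linarith)]; ring_nf
        _ ≤ 2 ^ (1 : ℝ) * X ^ (4 * η) := by
            gcongr
            · norm_num
            · linarith
        _ = _ := by rw [rpow_one]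
    gcongr

/-- From a `3-4-1` type bound to the right of the line `Re s = 1` and a derivative bound, a lower
bound up to the line. -/
lemma lower_bound_of_deriv {f : ℂ → ℂ} {y c C Y : ℝ} (hc : 0 < c) (hc1 : c ≤ 1) (hC : 1 ≤ C)
    (hY : 1 ≤ Y) (hf : ∀ x ∈ Set.Icc (0 : ℝ) 1, DifferentiableAt ℂ f (1 + x + I * y))
    (h1 : ∀ x ∈ Set.Ioc (0 : ℝ) 1, c ^ 4 * x ^ 3 / Y ^ 4 ≤ ‖f (1 + x + I * y)‖ ^ 4)
    (h2 : ∀ x ∈ Set.Icc (0 : ℝ) 1, ‖deriv f (1 + x + I * y)‖ ≤ C * Y)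
    {x : ℝ} (hx : x ∈ Set.Icc (0 : ℝ) 1) :
    c * (c / (2 * C)) ^ 3 / 2 / Y ^ 7 ≤ ‖f (1 + x + I * y)‖ := by
  set δ := c / (2 * C) with hδ
  have hδ0 : 0 < δ := by positivity
  have hδ1 : δ ≤ 1 := by rw [hδ, div_le_one (by linarith)]; linarith
  set x0 := δ ^ 4 / Y ^ 8 with hx0
  have hx00 : 0 < x0 := by positivity
  have hx01 : x0 ≤ 1 := by
    rw [hx0, div_le_one (by positivity)]
    exact (pow_le_one₀ hδ0.le hδ1).trans (one_le_pow₀ hY)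
  have hlow : ∀ x : ℝ, x0 ≤ x → x ≤ 1 → c * δ ^ 3 / Y ^ 7 ≤ ‖f (1 + x + I * y)‖ := by
    intro x hx hx1
    refine le_of_pow_le_pow_left₀ (n := 4) (by norm_num) (norm_nonneg _)
      (le_trans ?_ (h1 x ⟨by linarith, hx1⟩))
    calc (c * δ ^ 3 / Y ^ 7) ^ 4 = c ^ 4 * x0 ^ 3 / Y ^ 4 := by
          rw [hx0]; field_simp
      _ ≤ _ := by gcongr
  by_cases hxx : x0 ≤ x
  · refine le_trans ?_ (hlow x hxx hx.2)
    rw [div_div, mul_comm (2 : ℝ), ← div_div]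
    have : 0 ≤ c * δ ^ 3 / Y ^ 7 := by positivity
    linarith
  · push Not at hxx
    have hdist : ‖f (1 + x0 + I * y) - f (1 + x + I * y)‖ ≤ C * Y * x0 := by
      have h3 := Convex.norm_image_sub_le_of_norm_hasDerivWithin_le (s := Set.Icc (0 : ℝ) 1)
        (f := fun x : ℝ => f (1 + x + I * y))
        (f' := fun x : ℝ => deriv f (1 + x + I * y)) (C := C * Y) ?_ h2
        (convex_Icc 0 1) hx ⟨hx00.le, hx01⟩
      · refine h3.trans ?_
        gcongr
        rw [norm_eq_abs, abs_le]; constructor <;> linarith [hx.1]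
      · intro x hx
        have h4 := (hf x hx).hasDerivAt
        have h5 : HasDerivAt (fun z : ℂ => 1 + z + I * y) 1 (x : ℂ) := by
          simpa using ((hasDerivAt_id (x : ℂ)).const_add 1).add_const (I * y)
        have h6 := (h4.comp (x : ℂ) h5).comp_ofReal
        rw [mul_one] at h6
        exact h6.hasDerivWithinAt
    have h7 := hlow x0 le_rfl hx01
    have h8 : C * Y * x0 = c * δ ^ 3 / 2 / Y ^ 7 := by
      have hδc : c = 2 * C * δ := by rw [hδ]; field_simp
      rw [hx0, hδc]; field_simp
    have h9 : c * δ ^ 3 / Y ^ 7 = 2 * (c * δ ^ 3 / 2 / Y ^ 7) := by ring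
    have h10 := norm_sub_norm_le (f (1 + x0 + I * y)) (f (1 + x + I * y))
    linarith

lemma exists_two_pow_card_primeFactors_le {η : ℝ} (hη : 0 < η) :
    ∃ C : ℝ, 1 ≤ C ∧ ∀ q : ℕ, 1 ≤ q → (2 : ℝ) ^ q.primeFactors.card ≤ C * (q : ℝ) ^ η := by
  set P : ℕ := ⌈(2 : ℝ) ^ (1 / η)⌉₊
  refine ⟨2 ^ P, one_le_pow₀ (by norm_num), fun q hq => ?_⟩
  have h1 : (2 : ℝ) ^ q.primeFactors.card = ∏ p ∈ q.primeFactors, (2 : ℝ) := by simp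
  have h2 : ∀ p ∈ q.primeFactors, (2 : ℝ) ≤ (if p < P then 2 else 1) * (p : ℝ) ^ η := by
    intro p hp
    have hp1 : (1 : ℝ) ≤ p := mod_cast (prime_of_mem_primeFactors hp).one_lt.le
    split_ifs with h
    · have := one_le_rpow hp1 hη.le
      linarith
    · have h3 : (2 : ℝ) ^ (1 / η) ≤ p := (le_ceil _).trans (mod_cast not_lt.1 h)
      rw [one_mul]
      calc (2 : ℝ) = ((2 : ℝ) ^ (1 / η)) ^ η := by
            rw [← rpow_mul (by norm_num), one_div_mul_cancel hη.ne', rpow_one]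
        _ ≤ _ := by gcongr
  rw [h1]
  refine (prod_le_prod (fun _ _ => by norm_num) h2).trans ?_
  rw [prod_mul_distrib, finsetProd_rpow _ _ (fun i _ => by positivity)]
  gcongr
  · rw [prod_ite, prod_const, prod_const_one, mul_one]
    refine pow_le_pow_right₀ (by norm_num) ?_
    calc _ ≤ (range P).card := card_le_card (fun p hp => mem_range.2 (mem_filter.1 hp).2)
      _ = P := card_range P
  · rw [← cast_prod]
    exact_mod_cast le_of_dvd hq (prod_primeFactors_dvd q)

lemma norm_riemannZeta_le {η : ℝ} (hη : 0 < η) (hη2 : η ≤ 1 / 2) {x : ℝ} (hx : 0 < x) (hx1 : x ≤ 1)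
    (y : ℝ) :
    ‖riemannZeta (1 + x + I * y)‖
      ≤ (20 + 4 / η) * (2 + |y|) * (2 + |y|) ^ (2 * η) / ‖(x + I * y : ℂ)‖ := by
  have hne : (1 + x + I * y : ℂ) ≠ 1 := by
    intro h
    have := congrArg re h
    simp at this
    exact hx.ne' this
  have h := norm_zetaH_le hη hη2 (s := 1 + x + I * y) (by simp; linarith)
    (by simp; linarith)
  rw [zetaH_of_ne hne, norm_mul] at h
  have h2 : (1 + x + I * y : ℂ) - 1 = x + I * y := by ring
  have h3 : (1 + x + I * y : ℂ).im = y := by simp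
  rw [h2, h3] at h
  rw [le_div_iff₀ (norm_pos_iff.2 ?_)]
  · linarith
  · rw [← h2]; exact sub_ne_zero.2 hne

lemma norm_one_sub_prime_cpow_le {p : ℕ} (hp : p.Prime) {s : ℂ} (hs : 0 ≤ s.re) :
    ‖(1 - (p : ℂ) ^ (-s))‖ ≤ 2 := by
  refine (norm_sub_le _ _).trans ?_
  rw [norm_natCast_cpow_of_pos hp.pos, norm_one]
  have : (p : ℝ) ^ (-s).re ≤ 1 :=
    rpow_le_one_of_one_le_of_nonpos (mod_cast hp.one_lt.le) (by simpa using hs)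
  linarith

lemma norm_LFunctionTrivChar_le {q : ℕ} [NeZero q] {x : ℝ} (hx : 0 < x) (y : ℝ) :
    ‖LFunctionTrivChar q (1 + x + I * y)‖
      ≤ 2 ^ q.primeFactors.card * ‖riemannZeta (1 + x + I * y)‖ := by
  have hne : (1 + x + I * y : ℂ) ≠ 1 := by
    intro h
    have := congrArg re h
    simp at this
    exact hx.ne' this
  rw [LFunctionTrivChar_eq_mul_riemannZeta hne, norm_mul, norm_prod]
  refine mul_le_mul_of_nonneg_right ?_ (norm_nonneg _)
  rw [← prod_const]
  refine prod_le_prod (fun _ _ => norm_nonneg _) fun p hp => ?_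
  exact norm_one_sub_prime_cpow_le (prime_of_mem_primeFactors hp) (by simp; linarith)

lemma norm_LFunctionTrivChar_real_le {q : ℕ} [NeZero q] {x : ℝ} (hx : 0 < x) (hx1 : x ≤ 1) :
    ‖LFunctionTrivChar q (1 + x)‖ ≤ 112 / x := by
  have hne : (1 + x : ℂ) ≠ 1 := by simpa using hx.ne'
  rw [LFunctionTrivChar_eq_mul_riemannZeta hne, norm_mul, norm_prod]
  have h1 : ∏ p ∈ q.primeFactors, ‖(1 - (p : ℂ) ^ (-(1 + x : ℂ)))‖ ≤ 1 := by
    refine prod_le_one (fun _ _ => norm_nonneg _) fun p hp => ?_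
    have hp := (prime_of_mem_primeFactors hp)
    have h2 : (1 - (p : ℂ) ^ (-(1 + x : ℂ))) = ((1 - (p : ℝ) ^ (-(1 + x)) : ℝ) : ℂ) := by
      push_cast
      rw [ofReal_cpow (by positivity)]
      push_cast; rfl
    have h3 : (p : ℝ) ^ (-(1 + x)) ≤ 1 :=
      rpow_le_one_of_one_le_of_nonpos (mod_cast hp.one_lt.le) (by linarith)
    have h4 : 0 ≤ (p : ℝ) ^ (-(1 + x)) := by positivity
    rw [h2, norm_real, norm_eq_abs, abs_le]
    constructor <;> linarith
  have h2 := norm_riemannZeta_le (η := 1 / 2) (by norm_num) le_rfl hx hx1 0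
  simp only [ofReal_zero, mul_zero, add_zero, abs_zero, norm_real,
    norm_eq_abs, abs_of_pos hx] at h2
  norm_num at h2
  calc _ ≤ 1 * ‖riemannZeta (1 + x)‖ := by gcongr
    _ ≤ _ := by rw [one_mul]; exact h2

lemma two_mul_I_cast (y : ℝ) : 2 * I * (y : ℂ) = I * ((2 * y : ℝ) : ℂ) := by
  push_cast; ring

/-- Lower bound from the `3-4-1` inequality when the square of the character is nontrivial. -/
lemma norm_LFunction_pow_four_ge_of_sq_ne_one {η : ℝ} (hη : 0 < η) (hη2 : η ≤ 1 / 4) :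
    ∃ c : ℝ, 0 < c ∧ c ≤ 1 ∧ ∀ (q : ℕ) [NeZero q] (χ : DirichletCharacter ℂ q), χ ^ 2 ≠ 1 →
      ∀ x y : ℝ, 0 < x → x ≤ 1 →
      c * x ^ 3 / (q * (2 + |y|)) ^ (4 * η) ≤ ‖χ.LFunction (1 + x + I * y)‖ ^ 4 := by
  set K : ℝ := 112 ^ 3 * (2 * (6 + 1 / η)) with hK
  have hK0 : 1 ≤ K := by
    have : 0 ≤ 1 / η := by positivity
    rw [hK]; linarith
  refine ⟨1 / K, by positivity, by rw [div_le_one (by linarith)]; linarith, ?_⟩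
  intro q _ χ hχ x y hx hx1
  have hq1 : (1 : ℝ) ≤ q := mod_cast NeZero.one_le
  set X : ℝ := q * (2 + |y|) with hX
  have hX1 : 1 ≤ X := by nlinarith [abs_nonneg y]
  have h := norm_LFunction_product_ge_one χ hx y
  rw [two_mul_I_cast, norm_mul, norm_mul, norm_pow, norm_pow] at h
  have h1 := norm_LFunctionTrivChar_real_le (q := q) hx hx1
  have h2 : ‖(χ ^ 2).LFunction (1 + x + I * (2 * y : ℝ))‖
      ≤ 2 * (6 + 1 / η) * X ^ (4 * η) := by
    refine (norm_LFunction_le hη (by linarith) hχ (by simp; linarith) (by simp; linarith)).trans ?_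
    have h3 : (1 + x + I * (2 * y : ℝ) : ℂ).im = 2 * y := by simp
    rw [h3, abs_mul, abs_two]
    have h4 : (q : ℝ) * (2 + 2 * |y|) ≤ 2 * X := by rw [hX]; nlinarith [abs_nonneg y]
    calc (6 + 1 / η) * ((q : ℝ) * (2 + 2 * |y|)) ^ (2 * η) ≤ (6 + 1 / η) * (2 * X) ^ (2 * η) := by
          gcongr
      _ = (6 + 1 / η) * (2 ^ (2 * η) * X ^ (2 * η)) := by
          rw [mul_rpow (by norm_num) (by linarith)]
      _ ≤ (6 + 1 / η) * (2 ^ (1 : ℝ) * X ^ (4 * η)) := by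
          gcongr
          · norm_num
          · linarith
          · norm_num
      _ = _ := by rw [rpow_one]; ring
  have h5 : 1 ≤ (112 / x) ^ 3 * ‖χ.LFunction (1 + x + I * y)‖ ^ 4
      * (2 * (6 + 1 / η) * X ^ (4 * η)) := by
    refine h.le.trans ?_
    gcongr
  have hXp : 0 < X ^ (4 * η) := by positivity
  rw [div_le_iff₀ hXp, one_div, inv_mul_le_iff₀ (by linarith)]
  rw [div_pow, div_mul_eq_mul_div, div_mul_eq_mul_div, le_div_iff₀ (by positivity)] at h5
  rw [hK]; linarith

/-- Lower bound from the `3-4-1` inequality for quadratic (possibly principal) characters. -/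
lemma norm_LFunction_pow_four_ge_of_sq_eq_one {η : ℝ} (hη : 0 < η) (hη2 : η ≤ 1 / 4) :
    ∃ c : ℝ, 0 < c ∧ c ≤ 1 ∧ ∀ (q : ℕ) [NeZero q] (χ : DirichletCharacter ℂ q), χ ^ 2 = 1 →
      ∀ x y : ℝ, 0 < x → x ≤ 1 →
      c * x ^ 3 / (q * (2 + |y|)) ^ (4 * η) * (‖(x + I * (2 * y : ℝ) : ℂ)‖ / (2 + |y|))
        ≤ ‖χ.LFunction (1 + x + I * y)‖ ^ 4 := by
  obtain ⟨D, hD1, hD⟩ := exists_two_pow_card_primeFactors_le hη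
  set K : ℝ := 112 ^ 3 * (D * (4 * (20 + 4 / η))) with hK
  have hK0 : 1 ≤ K := by
    have : 0 ≤ 4 / η := by positivity
    rw [hK]; nlinarith
  refine ⟨1 / K, by positivity, by rw [div_le_one (by linarith)]; linarith, ?_⟩
  intro q _ χ hχ x y hx hx1
  have hq1 : (1 : ℝ) ≤ q := mod_cast NeZero.one_le
  set X : ℝ := q * (2 + |y|) with hX
  set w : ℝ := ‖(x + I * (2 * y : ℝ) : ℂ)‖ with hw
  have hy0 := abs_nonneg y
  have hw0 : 0 < w := by
    rw [hw, norm_pos_iff]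
    intro h
    have := congrArg re h
    simp at this
    exact hx.ne' this
  have hX1 : 1 ≤ X := by nlinarith [abs_nonneg y]
  have h := norm_LFunction_product_ge_one χ hx y
  rw [two_mul_I_cast, norm_mul, norm_mul, norm_pow, norm_pow, hχ] at h
  have h1 := norm_LFunctionTrivChar_real_le (q := q) hx hx1
  have h2 : ‖(1 : DirichletCharacter ℂ q).LFunction (1 + x + I * (2 * y : ℝ))‖
      ≤ D * (4 * (20 + 4 / η)) * X ^ (4 * η) * (2 + |y|) / w := by
    refine (norm_LFunctionTrivChar_le (q := q) hx (2 * y)).trans ?_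
    have h3 := norm_riemannZeta_le hη (by linarith) hx hx1 (2 * y)
    rw [← hw, abs_mul, abs_two] at h3
    have h4 : (2 + 2 * |y|) ≤ 2 * (2 + |y|) := by linarith
    have h5 : (2 + 2 * |y|) ^ (2 * η) ≤ 2 * (2 + |y|) ^ (2 * η) := by
      calc (2 + 2 * |y|) ^ (2 * η) ≤ (2 * (2 + |y|)) ^ (2 * η) := by gcongr
        _ = 2 ^ (2 * η) * (2 + |y|) ^ (2 * η) := by
            rw [mul_rpow (by norm_num) (by linarith)]
        _ ≤ 2 ^ (1 : ℝ) * (2 + |y|) ^ (2 * η) := by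
            gcongr
            · norm_num
            · linarith
        _ = _ := by rw [rpow_one]
    have h6 : (q : ℝ) ^ η * (2 + |y|) ^ (2 * η) ≤ X ^ (4 * η) := by
      rw [hX, mul_rpow (by linarith) (by linarith)]
      gcongr
      · linarith
      · linarith
      · linarith
    calc _ ≤ (D * (q : ℝ) ^ η) * ((20 + 4 / η) * (2 * (2 + |y|)) * (2 * (2 + |y|) ^ (2 * η)) / w) := by
          refine mul_le_mul (hD q (Nat.pos_of_ne_zero (NeZero.ne q))) (h3.trans ?_) (norm_nonneg _)
            (by positivity)
          gcongr
      _ = D * (4 * (20 + 4 / η)) * ((q : ℝ) ^ η * (2 + |y|) ^ (2 * η)) * (2 + |y|) / w := by ring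
      _ ≤ _ := by gcongr
  have h5 : 1 ≤ (112 / x) ^ 3 * ‖χ.LFunction (1 + x + I * y)‖ ^ 4
      * (D * (4 * (20 + 4 / η)) * X ^ (4 * η) * (2 + |y|) / w) := by
    refine h.le.trans ?_
    gcongr
  have hXp : 0 < X ^ (4 * η) := by positivity
  have h6 : (112 / x) ^ 3 * ‖χ.LFunction (1 + x + I * y)‖ ^ 4
      * (D * (4 * (20 + 4 / η)) * X ^ (4 * η) * (2 + |y|) / w)
      = ‖χ.LFunction (1 + x + I * y)‖ ^ 4 * (K * X ^ (4 * η) * (2 + |y|) / (x ^ 3 * w)) := by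
    rw [hK]; field_simp
  rw [h6] at h5
  have h7 : 1 / K * x ^ 3 / X ^ (4 * η) * (w / (2 + |y|))
      = 1 / (K * X ^ (4 * η) * (2 + |y|) / (x ^ 3 * w)) := by
    field_simp
  rw [h7, div_le_iff₀ (by positivity)]
  exact h5

lemma differentiable_dslope {f : ℂ → ℂ} (hf : Differentiable ℂ f) (c : ℂ) :
    Differentiable ℂ (dslope f c) :=
  differentiableOn_univ.1 ((differentiableOn_dslope univ_mem).2 hf.differentiableOn)

/-- Estermann's device: if the Taylor coefficients at `3/2` of `G s / (s - 1)` alternate in sign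
and this function is nonpositive at some `β < 1`, then `G 1` cannot be too small. -/
lemma estermann {G : ℂ → ℂ} (hG : Differentiable ℂ G) {B b β : ℝ}
    (hB : ∀ s ∈ Metric.closedBall (3 / 2 : ℂ) 1, ‖G s‖ ≤ B)
    (hpos : ∀ m : ℕ, 0 ≤ ((-1) ^ m * iteratedDeriv m (fun s => G s / (s - 1)) (3 / 2)).re)
    (hb : b ≤ (G (3 / 2) / (3 / 2 - 1)).re) (hβ : 3 / 4 ≤ β) (hβ1 : β < 1)
    (hneg : (G β / (β - 1)).re ≤ 0) {M : ℕ} (hM : 1 ≤ M) :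
    b ≤ (G 1).re * (1 + 2 * (1 - β)) ^ M / (1 - β) + 16 * B * (3 / 4) ^ M := by
  set H : ℂ → ℂ := dslope G 1 with hH
  have hHd : Differentiable ℂ H := differentiable_dslope hG 1
  have hHG : ∀ s : ℂ, s ≠ 1 → H s = (G s - G 1) / (s - 1) := by
    intro s hs
    rw [hH, dslope_of_ne _ hs, slope_def_field]
  have hB0 : 0 ≤ B := (norm_nonneg _).trans (hB (3 / 2) (by simp))
  have h1B : ‖G 1‖ ≤ B := hB 1 (by
    rw [Metric.mem_closedBall, dist_eq_norm]; norm_num)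
  have hHB : ∀ s ∈ Metric.sphere (3 / 2 : ℂ) 1, ‖H s‖ ≤ 4 * B := by
    intro s hs
    have hs' : ‖s - 3 / 2‖ = 1 := by simpa [dist_eq_norm] using hs
    have h12 : 1 / 2 ≤ ‖s - 1‖ := by
      have := norm_sub_le (s - 1) (1 / 2)
      rw [show s - 1 - 1 / 2 = s - 3 / 2 by ring, hs'] at this
      norm_num at this ⊢; linarith
    have hne : s ≠ 1 := by
      rintro rfl; simp at h12; norm_num at h12
    rw [hHG s hne, norm_div, div_le_iff₀ (by linarith)]
    calc ‖G s - G 1‖ ≤ ‖G s‖ + ‖G 1‖ := norm_sub_le _ _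
      _ ≤ B + B := add_le_add (hB s (Metric.sphere_subset_closedBall hs)) h1B
      _ ≤ _ := by nlinarith
  set h : ℕ → ℂ := fun m => (-1) ^ m * ((m.factorial : ℂ)⁻¹ * iteratedDeriv m H (3 / 2)) with hh
  have hhB : ∀ m, ‖h m‖ ≤ 4 * B := by
    intro m
    have := norm_iteratedDeriv_le_of_forall_mem_sphere_norm_le m one_pos
      (hHd.diffContOnCl (s := Metric.ball (3 / 2 : ℂ) 1)) hHB
    have hf : (0 : ℝ) < m.factorial := mod_cast m.factorial_pos
    simp only [hh, norm_mul, norm_pow, norm_neg, norm_one, one_pow, one_mul, norm_inv,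
      Complex.norm_natCast]
    rw [inv_mul_le_iff₀ hf]
    simpa using this
  set x : ℝ := 3 / 2 - β with hx
  have hsum : HasSum (fun m => h m * (x : ℂ) ^ m) (H β) := by
    have := hasSum_taylorSeries_of_entire hHd (3 / 2) (β : ℂ)
    have heq : (fun m : ℕ => (m.factorial : ℂ)⁻¹ • ((β : ℂ) - 3 / 2) ^ m • iteratedDeriv m H (3 / 2))
        = fun m => h m * (x : ℂ) ^ m := by
      funext m
      simp only [hh, smul_eq_mul, hx]
      push_cast
      rw [show ((β : ℂ) - 3 / 2) = (-1) * (3 / 2 - β) by ring, mul_pow]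
      ring
    rw [heq] at this
    exact this
  have hre : HasSum (fun m => (h m).re * x ^ m) (H β).re := by
    have := hasSum_re hsum
    have heq : (fun m => (h m * (x : ℂ) ^ m).re) = fun m => (h m).re * x ^ m := by
      funext m
      rw [← ofReal_pow, re_mul_ofReal]
    rw [heq] at this
    exact this
  -- derivatives of `G/(s-1)`
  have hcoef : ∀ m : ℕ, 0 ≤ (h m).re + 2 * (G 1).re * 2 ^ m := by
    intro m
    have hev : (fun s => G s / (s - 1)) =ᶠ[nhds (3 / 2 : ℂ)]
        fun s => G 1 * (s - 1)⁻¹ + H s := by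
      have : ∀ᶠ s in nhds (3 / 2 : ℂ), s ≠ 1 := isOpen_ne.mem_nhds (by norm_num)
      filter_upwards [this] with s hs
      rw [hHG s hs]
      field_simp [sub_ne_zero.2 hs]
      ring
    have hp := hpos m
    have hcd : ContDiffAt ℂ m (fun s : ℂ => (s - 1)⁻¹) (3 / 2) :=
      (contDiffAt_id.sub contDiffAt_const).inv (by norm_num)
    rw [hev.iteratedDeriv_eq, iteratedDeriv_fun_add (contDiffAt_const.mul hcd)
      (hHd.contDiff.contDiffAt), iteratedDeriv_const_mul _ hcd] at hp
    have hinv : iteratedDeriv m (fun s : ℂ => (s - 1)⁻¹) (3 / 2)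
        = (-1) ^ m * m.factorial * 2 ^ (m + 1) := by
      have := iter_deriv_inv_linear_sub m (1 : ℂ) 1
      simp only [one_mul, one_pow, mul_one] at this
      rw [iteratedDeriv_eq_iterate, this]
      simp only
      rw [show (3 / 2 : ℂ) - 1 = (2 : ℂ)⁻¹ by norm_num, inv_zpow', show (-(-1 - (m : ℤ))) = ((m + 1 : ℕ) : ℤ) by push_cast; ring, zpow_natCast]
    have hid : (-1) ^ m * (G 1 * iteratedDeriv m (fun s : ℂ => (s - 1)⁻¹) (3 / 2)
        + iteratedDeriv m H (3 / 2)) = ((m.factorial : ℝ) : ℂ) * (h m + G 1 * ((2 * 2 ^ m : ℝ) : ℂ)) := by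
      have hf : (m.factorial : ℂ) ≠ 0 := mod_cast m.factorial_ne_zero
      rw [hinv]
      simp only [hh]
      have h1 : ((-1 : ℂ)) ^ m * (-1) ^ m = 1 := by rw [← mul_pow]; simp
      push_cast
      field_simp
      linear_combination (G 1 * m.factorial * 2 ^ (m + 1)) * h1
    rw [hid, re_ofReal_mul, add_re, re_mul_ofReal] at hp
    have := (mul_nonneg_iff_of_pos_left (mod_cast m.factorial_pos)).1 hp
    linarith
  have hh0 : b ≤ (h 0).re + 2 * (G 1).re := by
    have : G (3 / 2) / (3 / 2 - 1) = h 0 + 2 * G 1 := by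
      simp only [hh]
      rw [iteratedDeriv_zero, hHG _ (by norm_num)]
      simp; ring
    rw [this] at hb
    simpa using hb
  have hx1 : 1 / 2 < x := by linarith
  have hx2 : x ≤ 3 / 4 := by linarith
  have htail : |(H β).re - ∑ m ∈ range M, (h m).re * x ^ m| ≤ 16 * B * (3 / 4) ^ M := by
    have hg : ∀ m, ‖(h m).re * x ^ m‖ ≤ 4 * B * x ^ m := by
      intro m
      rw [norm_mul, norm_pow, norm_eq_abs, norm_eq_abs, abs_of_pos (by linarith : 0 < x)]
      exact mul_le_mul_of_nonneg_right ((abs_re_le_norm _).trans (hhB m)) (by positivity)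
    have := norm_sub_le_of_geometric_bound_of_hasSum (by linarith : x < 1) hg hre M
    rw [norm_eq_abs, abs_sub_comm] at this
    refine this.trans ?_
    rw [div_le_iff₀ (by linarith)]
    have h3 : x ^ M ≤ (3 / 4) ^ M := pow_le_pow_left₀ (by linarith) hx2 M
    have h4 : 0 < (3 / 4 : ℝ) ^ M := by positivity
    nlinarith [mul_le_mul_of_nonneg_left h3 hB0, mul_nonneg hB0 h4.le]
  have hpart : b - (G 1).re * ((2 * x) ^ M - 1) / (1 - β) ≤ ∑ m ∈ range M, (h m).re * x ^ m := by
    have hgeo : ∑ m ∈ range M, (2 * x) ^ m = ((2 * x) ^ M - 1) / (2 * (1 - β)) := by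
      rw [geom_sum_eq (by linarith)]
      congr 1; rw [hx]; ring
    have h1 : b ≤ ∑ m ∈ range M, ((h m).re + 2 * (G 1).re * 2 ^ m) * x ^ m := by
      refine hh0.trans ?_
      have := single_le_sum (f := fun m => ((h m).re + 2 * (G 1).re * 2 ^ m) * x ^ m)
        (s := range M) (fun m _ => mul_nonneg (hcoef m) (pow_nonneg (by linarith) m))
        (mem_range.2 hM)
      simpa using this
    have h2 : ∑ m ∈ range M, ((h m).re + 2 * (G 1).re * 2 ^ m) * x ^ m
        = ∑ m ∈ range M, (h m).re * x ^ m + 2 * (G 1).re * ∑ m ∈ range M, (2 * x) ^ m := by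
      rw [mul_sum, ← sum_add_distrib]
      refine sum_congr rfl fun m _ => ?_
      rw [mul_pow]; ring
    rw [h2, hgeo] at h1
    have : 2 * (G 1).re * (((2 * x) ^ M - 1) / (2 * (1 - β)))
        = (G 1).re * ((2 * x) ^ M - 1) / (1 - β) := by
      have : (1 - β) ≠ 0 := by linarith
      field_simp
    linarith
  have hFβ : (G β / (β - 1)).re = (H β).re - (G 1).re / (1 - β) := by
    have hne : (β : ℂ) ≠ 1 := by
      intro h; exact hβ1.ne (mod_cast h)
    have : G β / (β - 1) = H β - G 1 / ((1 - β : ℝ) : ℂ) := by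
      rw [hHG _ hne]
      push_cast
      have h1 : (β : ℂ) - 1 ≠ 0 := sub_ne_zero.2 hne
      have h2 : 1 - (β : ℂ) ≠ 0 := sub_ne_zero.2 hne.symm
      field_simp
      ring
    rw [this, sub_re, div_ofReal_re]
  have h2x : 2 * x = 1 + 2 * (1 - β) := by rw [hx]; ring
  rw [hFβ] at hneg
  rw [h2x] at hpart
  have := (abs_le.1 htail).1
  have he : (G 1).re * ((1 + 2 * (1 - β)) ^ M - 1) / (1 - β)
      = (G 1).re * (1 + 2 * (1 - β)) ^ M / (1 - β) - (G 1).re / (1 - β) := by ring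
  linarith

open scoped ComplexOrder

lemma iteratedDeriv_alternating_of_deriv_eq {F P : ℂ → ℂ} {x : ℝ} (hx : 1 < x)
    (hF : DifferentiableOn ℂ F {s | 1 < s.re}) (hP : DifferentiableOn ℂ P {s | 1 < s.re})
    (hd : ∀ s : ℂ, 1 < s.re → deriv F s = -(P s * F s))
    (hPpos : ∀ m : ℕ, 0 ≤ (-1) ^ m * iteratedDeriv m P x) (hF0 : 0 ≤ F x) (m : ℕ) :
    0 ≤ (-1) ^ m * iteratedDeriv m F x := by
  have hopen : IsOpen {s : ℂ | 1 < s.re} := isOpen_lt continuous_const continuous_re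
  have hmem : (x : ℂ) ∈ {s : ℂ | 1 < s.re} := by simpa using hx
  have cF : ∀ n : ℕ, ContDiffAt ℂ n F x := fun n =>
    (hF.contDiffOn hopen).contDiffAt (hopen.mem_nhds hmem)
  have cP : ∀ n : ℕ, ContDiffAt ℂ n P x := fun n =>
    (hP.contDiffOn hopen).contDiffAt (hopen.mem_nhds hmem)
  induction m using Nat.strong_induction_on with
  | _ m ih =>
    rcases m with _ | m
    · simpa using hF0
    · have hev : deriv F =ᶠ[nhds (x : ℂ)] fun s => -(P s * F s) := by
        filter_upwards [hopen.mem_nhds hmem] with s hs using hd s hs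
      rw [iteratedDeriv_succ', hev.iteratedDeriv_eq, iteratedDeriv_fun_neg,
        iteratedDeriv_fun_mul (cP m) (cF m), mul_neg, pow_succ, mul_neg_one, neg_mul, neg_neg, mul_sum]
      refine sum_nonneg fun i hi => ?_
      have hi' : i ≤ m := Nat.lt_succ_iff.1 (mem_range.1 hi)
      have h1 := hPpos i
      have h2 := ih (m - i) (by omega)
      have h3 : ((-1 : ℂ)) ^ m = (-1) ^ i * (-1) ^ (m - i) := by rw [← pow_add]; congr 1; omega
      have h4 : (-1 : ℂ) ^ m * ((m.choose i : ℂ) * iteratedDeriv i P x * iteratedDeriv (m - i) F x)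
        = (m.choose i : ℂ) * (((-1) ^ i * iteratedDeriv i P x)
          * ((-1) ^ (m - i) * iteratedDeriv (m - i) F x)) := by
        rw [h3]; ring
      rw [h4]
      exact mul_nonneg (mod_cast Nat.zero_le _) (mul_nonneg h1 h2)

lemma abscissaOfAbsConv_lt_of_summable {a : ℕ → ℂ} (ha : ∀ s : ℂ, 1 < s.re → LSeriesSummable a s)
    {x : ℝ} (hx : 1 < x) : LSeries.abscissaOfAbsConv a < x := by
  refine lt_of_le_of_lt (b := ((1 : ℝ) : EReal)) ?_ (mod_cast hx)
  exact LSeries.abscissaOfAbsConv_le_of_forall_lt_LSeriesSummable fun y hy => ha _ (by simpa using hy)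

lemma riemannZeta_pos {x : ℝ} (hx : 1 < x) : 0 < riemannZeta x := by
  rw [← LSeries_one_eq_riemannZeta (by simpa using hx)]
  refine LSeries.positive (fun n => ?_) (by simp) ?_
  · simp
  · rw [LSeries.abscissaOfAbsConv_one]; exact_mod_cast hx

lemma LFunction_pos {q : ℕ} [NeZero q] {χ : DirichletCharacter ℂ q} (hχ : χ ^ 2 = 1) {x : ℝ}
    (hx : 1 < x) : 0 < χ.LFunction x := by
  have hx' : 1 < (x : ℂ).re := by simpa using hx
  have h1 : 0 < LSeries χ.zetaMul x :=
    LSeries.positive (fun n => zetaMul_nonneg hχ n)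
      (by rw [χ.isMultiplicative_zetaMul.map_one]; exact zero_lt_one)
      (abscissaOfAbsConv_lt_of_summable (fun s hs => χ.LSeriesSummable_zetaMul hs) hx)
  have h2 : LSeries χ.zetaMul x = riemannZeta x * χ.LFunction x := by
    rw [zetaMul, ← ArithmeticFunction.coe_mul, LSeries_convolution']
    · rw [LFunction_eq_LSeries _ hx', ← LSeries_zeta_eq_riemannZeta hx']
      congr 1
      exact (LSeries_congr (fun {n} h => χ.apply_eq_toArithmeticFunction_apply h) _).symm
    · exact LSeriesSummable_zeta_iff.mpr hx'
    · exact (LSeriesSummable_congr _ fun h => (χ.apply_eq_toArithmeticFunction_apply h).symm).mpr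
        (ZMod.LSeriesSummable_of_one_lt_re χ hx')
  rw [h2] at h1
  have hz := riemannZeta_pos hx
  rw [pos_iff] at hz h1 ⊢
  rw [mul_re, mul_im, ← hz.2] at h1
  obtain ⟨h3, h4⟩ := h1
  have h5 : (χ.LFunction x).im = 0 := by
    have : (riemannZeta x).re * (χ.LFunction x).im = 0 := by linarith
    exact (mul_eq_zero.1 this).resolve_left hz.1.ne'
  refine ⟨?_, h5.symm⟩
  rw [zero_mul, sub_zero] at h3
  exact pos_of_mul_pos_right h3 hz.1.le |> fun h => h

lemma char_apply_real {q : ℕ} {χ : DirichletCharacter ℂ q} (hχ : χ ^ 2 = 1) (n : ℕ) :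
    0 ≤ 1 + χ n := by
  rcases MulChar.isQuadratic_iff_sq_eq_one.mpr hχ n with h | h | h <;> rw [h] <;> norm_num

/-- Sign alternation for `ζ L(χ₁) L(χ₂) L(χ₁χ₂)`. -/
lemma iteratedDeriv_product_alternating {q : ℕ} [NeZero q] {χ ψ : DirichletCharacter ℂ q}
    (hχ : χ ^ 2 = 1) (hψ : ψ ^ 2 = 1) {x : ℝ} (hx : 1 < x) (m : ℕ) :
    0 ≤ (-1) ^ m * iteratedDeriv m (fun s => riemannZeta s * χ.LFunction s * ψ.LFunction s
      * (χ * ψ).LFunction s) x := by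
  have hopen : IsOpen {s : ℂ | 1 < s.re} := isOpen_lt continuous_const continuous_re
  set a : ℕ → ℂ := (fun n => (Λ n : ℂ)) +
    ((fun n : ℕ => χ n) * fun n => (Λ n : ℂ)) +
    ((fun n : ℕ => ψ n) * fun n => (Λ n : ℂ)) +
    ((fun n : ℕ => (χ * ψ) n) * fun n => (Λ n : ℂ)) with ha
  have ha0 : 0 ≤ a := by
    intro n
    have : a n = (Λ n : ℂ) * ((1 + χ n) * (1 + ψ n)) := by
      simp only [ha, Pi.add_apply, Pi.mul_apply, MulChar.mul_apply]; ring
    rw [this]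
    exact mul_nonneg (zero_le_real.2 vonMangoldt_nonneg)
      (mul_nonneg (char_apply_real hχ n) (char_apply_real hψ n))
  have s1 := fun s (hs : 1 < s.re) => LSeriesSummable_vonMangoldt (s := s) hs
  have s2 := fun s (hs : 1 < s.re) => χ.LSeriesSummable_twist_vonMangoldt (s := s) hs
  have s3 := fun s (hs : 1 < s.re) => ψ.LSeriesSummable_twist_vonMangoldt (s := s) hs
  have s4 := fun s (hs : 1 < s.re) => (χ * ψ).LSeriesSummable_twist_vonMangoldt (s := s) hs
  have hsum : ∀ s : ℂ, 1 < s.re → LSeriesSummable a s := fun s hs =>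
    (((s1 s hs).add (s2 s hs)).add (s3 s hs)).add (s4 s hs)
  have hne1 : ∀ s : ℂ, 1 < s.re → s ≠ 1 := by rintro s hs rfl; simp at hs
  have hLne : ∀ (θ : DirichletCharacter ℂ q) (s : ℂ), 1 < s.re → θ.LFunction s ≠ 0 := fun θ s hs =>
    LFunction_ne_zero_of_one_le_re θ (.inr (hne1 s hs)) hs.le
  have hLd : ∀ (θ : DirichletCharacter ℂ q) (s : ℂ), 1 < s.re → DifferentiableAt ℂ θ.LFunction s :=
    fun θ s hs => θ.differentiableAt_LFunction s (.inl (hne1 s hs))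
  have hζne : ∀ s : ℂ, 1 < s.re → riemannZeta s ≠ 0 := fun s hs => riemannZeta_ne_zero_of_one_lt_re hs
  have hζd : ∀ s : ℂ, 1 < s.re → DifferentiableAt ℂ riemannZeta s := fun s hs =>
    differentiableAt_riemannZeta (hne1 s hs)
  have hlog : ∀ (θ : DirichletCharacter ℂ q) (s : ℂ), 1 < s.re →
      LSeries ((fun n : ℕ => θ n) * fun n => (Λ n : ℂ)) s
        = - logDeriv θ.LFunction s := by
    intro θ s hs
    rw [θ.LSeries_twist_vonMangoldt_eq hs, logDeriv_apply, θ.deriv_LFunction_eq_deriv_LSeries hs,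
      θ.LFunction_eq_LSeries hs, neg_div]
  have hd : ∀ s : ℂ, 1 < s.re → deriv (fun s => riemannZeta s * χ.LFunction s * ψ.LFunction s
      * (χ * ψ).LFunction s) s = -(LSeries a s * (riemannZeta s * χ.LFunction s * ψ.LFunction s
      * (χ * ψ).LFunction s)) := by
    intro s hs
    have e1 : LSeries a s = -logDeriv (fun s => riemannZeta s * χ.LFunction s * ψ.LFunction s
      * (χ * ψ).LFunction s) s := by
      rw [ha, LSeries_add (((s1 s hs).add (s2 s hs)).add (s3 s hs)) (s4 s hs),
        LSeries_add ((s1 s hs).add (s2 s hs)) (s3 s hs), LSeries_add (s1 s hs) (s2 s hs),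
        hlog _ s hs, hlog _ s hs, hlog _ s hs,
        LSeries_vonMangoldt_eq_deriv_riemannZeta_div hs,
        logDeriv_mul (f := fun s => riemannZeta s * χ.LFunction s * ψ.LFunction s)
          (g := (χ * ψ).LFunction) s (mul_ne_zero (mul_ne_zero (hζne s hs) (hLne _ s hs)) (hLne _ s hs))
          (hLne _ s hs) (((hζd s hs).mul (hLd _ s hs)).mul (hLd _ s hs)) (hLd _ s hs),
        logDeriv_mul (f := fun s => riemannZeta s * χ.LFunction s) (g := ψ.LFunction) s
          (mul_ne_zero (hζne s hs) (hLne _ s hs))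
          (hLne _ s hs) ((hζd s hs).mul (hLd _ s hs)) (hLd _ s hs),
        logDeriv_mul s (hζne s hs) (hLne _ s hs) (hζd s hs) (hLd _ s hs)]
      simp only [logDeriv_apply]
      ring
    rw [e1, logDeriv_apply, neg_mul, neg_neg, div_mul_cancel₀]
    refine mul_ne_zero (mul_ne_zero (mul_ne_zero ?_ ?_) ?_) ?_
    exacts [hζne s hs, hLne _ s hs, hLne _ s hs, hLne _ s hs]
  have hχψ : (χ * ψ) ^ 2 = 1 := by rw [mul_pow, hχ, hψ, one_mul]
  refine iteratedDeriv_alternating_of_deriv_eq hx ?_ ?_ hd ?_ ?_ m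
  · exact fun s hs => ((((hζd s hs).mul (hLd _ s hs)).mul (hLd _ s hs)).mul
      (hLd _ s hs)).differentiableWithinAt
  · intro s hs
    refine (LSeries_differentiableOn a s ?_).differentiableAt ?_ |>.differentiableWithinAt
    · exact abscissaOfAbsConv_lt_of_summable hsum hs
    · exact (isOpen_re_gt_EReal _).mem_nhds (abscissaOfAbsConv_lt_of_summable hsum hs)
  · exact LSeries.iteratedDeriv_alternating ha0 (abscissaOfAbsConv_lt_of_summable hsum hx)
  · exact mul_nonneg (mul_nonneg (mul_nonneg (riemannZeta_pos hx).le (LFunction_pos hχ hx).le)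
      (LFunction_pos hψ hx).le) (LFunction_pos hχψ hx).le

open scoped ComplexOrder

lemma im_eq_zero_of_iteratedDeriv {G : ℂ → ℂ} (hG : Differentiable ℂ G) {c : ℝ}
    (h : ∀ m : ℕ, (iteratedDeriv m G c).im = 0) (x : ℝ) : (G x).im = 0 := by
  have h1 := hasSum_im (hasSum_taylorSeries_of_entire hG c x)
  have h2 : (fun m : ℕ => ((m.factorial : ℂ)⁻¹ • ((x : ℂ) - c) ^ m • iteratedDeriv m G c).im)
      = fun _ => 0 := by
    funext m
    have : (m.factorial : ℂ)⁻¹ • ((x : ℂ) - c) ^ m • iteratedDeriv m G c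
      = (((m.factorial : ℝ)⁻¹ * (x - c) ^ m : ℝ) : ℂ) * iteratedDeriv m G c := by
      push_cast; simp only [smul_eq_mul]; ring
    rw [this, im_ofReal_mul, h m, mul_zero]
  rw [h2] at h1
  exact h1.unique hasSum_zero

lemma im_iteratedDeriv_sub_one (m : ℕ) (x : ℝ) :
    (iteratedDeriv m (fun s : ℂ => s - 1) x).im = 0 := by
  rcases m with _ | _ | m
  · simp
  · simp
  · rw [iteratedDeriv_succ', show deriv (fun s : ℂ => s - 1) = fun _ => 1 by
      funext s; simp, iteratedDeriv_const]
    simp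

lemma im_eq_zero_of_alternating {G : ℂ → ℂ} (hG : Differentiable ℂ G)
    (h : ∀ m : ℕ, 0 ≤ (-1) ^ m * iteratedDeriv m (fun s => G s / (s - 1)) (3 / 2 : ℝ)) (x : ℝ) :
    (G x).im = 0 := by
  refine im_eq_zero_of_iteratedDeriv hG (c := 3 / 2) (fun m => ?_) x
  have hF : ∀ m : ℕ, (iteratedDeriv m (fun s => G s / (s - 1)) (3 / 2 : ℝ)).im = 0 := by
    intro m
    have h1 := (nonneg_iff.1 (h m)).2
    rcases neg_one_pow_eq_or ℂ m with h2 | h2 <;> rw [h2] at h1 <;> simpa using h1.symm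
  have hne : ∀ᶠ s in nhds ((3 / 2 : ℝ) : ℂ), s ≠ 1 := isOpen_ne.mem_nhds (by norm_num)
  have hev : G =ᶠ[nhds ((3 / 2 : ℝ) : ℂ)] fun s => (s - 1) * (G s / (s - 1)) := by
    filter_upwards [hne] with s hs
    rw [mul_div_cancel₀ _ (sub_ne_zero.2 hs)]
  have c1 : ContDiffAt ℂ m (fun s : ℂ => s - 1) ((3 / 2 : ℝ) : ℂ) := contDiffAt_id.sub contDiffAt_const
  have c2 : ContDiffAt ℂ m (fun s : ℂ => G s / (s - 1)) ((3 / 2 : ℝ) : ℂ) :=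
    hG.contDiff.contDiffAt.div c1 (by norm_num)
  rw [hev.iteratedDeriv_eq, iteratedDeriv_fun_mul c1 c2, im_sum]
  refine sum_eq_zero fun i _ => ?_
  rw [mul_assoc, ← ofReal_natCast, im_ofReal_mul, mul_im, hF,
    im_iteratedDeriv_sub_one]
  simp

lemma one_add_le_rpow {δ : ℝ} (hδ : 0 ≤ δ) : 1 + 2 * δ ≤ (4 / 3 : ℝ) ^ (8 * δ) := by
  have h1 : 1 / 4 ≤ log (4 / 3) := by
    have := one_sub_inv_le_log_of_pos (x := 4 / 3) (by norm_num)
    norm_num at this ⊢; linarith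
  rw [rpow_def_of_pos (by norm_num)]
  have := add_one_le_exp (log (4 / 3) * (8 * δ))
  nlinarith

lemma norm_LFunction_real_ge {q : ℕ} [NeZero q] {χ : DirichletCharacter ℂ q} (hχ : χ ^ 2 = 1) :
    1 / 224 ≤ ‖χ.LFunction (3 / 2 : ℝ)‖ := by
  have h := norm_LFunction_product_ge_one χ (x := 1 / 2) (by norm_num) 0
  have h1 := norm_LFunctionTrivChar_real_le (q := q) (x := 1 / 2) (by norm_num) (by norm_num)
  have e1 : (1 : ℂ) + ((1 / 2 : ℝ) : ℂ) + I * ((0 : ℝ) : ℂ) = ((3 / 2 : ℝ) : ℂ) := by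
    push_cast; ring
  have e2 : (1 : ℂ) + ((1 / 2 : ℝ) : ℂ) + 2 * I * ((0 : ℝ) : ℂ) = 1 + ((1 / 2 : ℝ) : ℂ) := by
    push_cast; ring
  rw [hχ, e1, e2, norm_mul, norm_mul, norm_pow, norm_pow] at h
  have h2 : ‖(1 : DirichletCharacter ℂ q).LFunction (1 + ((1 / 2 : ℝ) : ℂ))‖ ≤ 224 := by
    refine h1.trans (by norm_num)
  have h3 : ‖LFunctionTrivChar q (1 + ((1 / 2 : ℝ) : ℂ))‖ ≤ 224 :=
    h1.trans (by norm_num)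
  have h4 : 1 ≤ 224 ^ 3 * ‖χ.LFunction (3 / 2 : ℝ)‖ ^ 4 * 224 := by
    refine h.le.trans ?_
    gcongr
  by_contra! hlt
  have h5 : ‖χ.LFunction (3 / 2 : ℝ)‖ ^ 4 < (1 / 224) ^ 4 :=
    pow_lt_pow_left₀ hlt (norm_nonneg _) (by norm_num)
  norm_num at h5 h4
  linarith

/-- The product `(s - 1) ζ(s) L(s, χ) L(s, ψ) L(s, χψ)`. -/
def siegelProduct {q : ℕ} [NeZero q] (χ ψ : DirichletCharacter ℂ q) (s : ℂ) : ℂ :=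
  zetaH s * χ.LFunction s * ψ.LFunction s * (χ * ψ).LFunction s

lemma siegel_core {β : ℝ} (hβ : 3 / 4 ≤ β) (hβ1 : β < 1) :
    ∃ c : ℝ, 0 < c ∧ ∀ (q : ℕ) [NeZero q] (χ ψ : DirichletCharacter ℂ q), χ ^ 2 = 1 → ψ ^ 2 = 1 →
      χ ≠ 1 → ψ ≠ 1 → χ * ψ ≠ 1 →
      (χ.LFunction β = 0 ∨ ∀ x : ℝ, β ≤ x → x < 1 → siegelProduct χ ψ x ≠ 0) →
      c * (q : ℝ) ^ (-(24 * (1 - β)))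
        ≤ ‖χ.LFunction 1‖ * ‖ψ.LFunction 1‖ * ‖(χ * ψ).LFunction 1‖ := by
  set b : ℝ := 2 * ‖zetaH (3 / 2 : ℝ)‖ * (1 / 224) ^ 3 with hb
  have hb0 : 0 < b := by
    have : 0 < ‖zetaH (3 / 2 : ℝ)‖ := norm_pos_iff.2 (zetaH_ne_zero (by norm_num))
    positivity
  set D : ℝ := 32 * (252 * 24 ^ 3) / b + 1 with hD
  have hD1 : 1 ≤ D := by rw [hD]; linarith [show 0 ≤ 32 * (252 * 24 ^ 3) / b by positivity]
  set δ : ℝ := 1 - β with hδ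
  have hδ0 : 0 < δ := by linarith
  refine ⟨b / 2 * δ / (4 / 3 * D) ^ (8 * δ), by positivity, ?_⟩
  intro q _ χ ψ hχ hψ hχ1 hψ1 hχψ1 hcase
  have hq1 : (1 : ℝ) ≤ q := mod_cast NeZero.one_le
  set G := siegelProduct χ ψ with hG
  have hGd : Differentiable ℂ G := by
    intro s
    exact ((((differentiable_zetaH s).mul (χ.differentiableAt_LFunction s (.inr hχ1))).mul
      (ψ.differentiableAt_LFunction s (.inr hψ1))).mul
      ((χ * ψ).differentiableAt_LFunction s (.inr hχψ1)))
  have hGζ : (fun s => G s / (s - 1)) =ᶠ[nhds ((3 / 2 : ℝ) : ℂ)]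
      fun s => riemannZeta s * χ.LFunction s * ψ.LFunction s * (χ * ψ).LFunction s := by
    have hne : ∀ᶠ s in nhds ((3 / 2 : ℝ) : ℂ), s ≠ 1 := isOpen_ne.mem_nhds (by norm_num)
    filter_upwards [hne] with s hs
    rw [hG, siegelProduct, zetaH_of_ne hs]
    field_simp [sub_ne_zero.2 hs]
  have hpos : ∀ m : ℕ, 0 ≤ (-1) ^ m * iteratedDeriv m (fun s => G s / (s - 1)) (3 / 2 : ℝ) := by
    intro m
    rw [hGζ.iteratedDeriv_eq]
    exact iteratedDeriv_product_alternating hχ hψ (by norm_num) m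
  have hF0 : 0 ≤ G (3 / 2 : ℝ) / ((3 / 2 : ℝ) - 1) := by simpa using hpos 0
  have hreal := im_eq_zero_of_alternating hGd hpos
  have hbF : b ≤ (G (3 / 2 : ℝ) / ((3 / 2 : ℝ) - 1)).re := by
    have h1 := eq_coe_norm_of_nonneg hF0
    rw [h1, ofReal_re]
    rw [hG, siegelProduct, norm_div, norm_mul, norm_mul, norm_mul]
    have h2 : ‖((3 / 2 : ℝ) : ℂ) - 1‖ = 1 / 2 := by
      rw [← ofReal_one, ← ofReal_sub, norm_real]; norm_num
    rw [h2, hb]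
    have a1 := norm_LFunction_real_ge hχ
    have a2 := norm_LFunction_real_ge hψ
    have a3 := norm_LFunction_real_ge (χ := χ * ψ) (by rw [mul_pow, hχ, hψ, one_mul])
    calc 2 * ‖zetaH (3 / 2 : ℝ)‖ * (1 / 224) ^ 3
        = ‖zetaH (3 / 2 : ℝ)‖ * (1 / 224) * (1 / 224) * (1 / 224) / (1 / 2) := by ring
      _ ≤ _ := by gcongr
  set B : ℝ := 252 * 24 ^ 3 * (q : ℝ) ^ 3 with hB
  have hGB : ∀ s ∈ Metric.closedBall (3 / 2 : ℂ) 1, ‖G s‖ ≤ B := by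
    intro s hs
    rw [Metric.mem_closedBall, dist_eq_norm] at hs
    have hre := abs_le.1 ((abs_re_le_norm _).trans hs)
    have him := (abs_im_le_norm _).trans hs
    simp at hre him
    norm_num at hre
    have hL : ∀ θ : DirichletCharacter ℂ q, θ ≠ 1 → ‖θ.LFunction s‖ ≤ 24 * q := by
      intro θ hφ
      refine (norm_LFunction_le (η := 1 / 2) (by norm_num) le_rfl hφ (by linarith)
        (by linarith)).trans ?_
      norm_num
      nlinarith
    have hz : ‖zetaH s‖ ≤ 252 := by
      refine (norm_zetaH_le (η := 1 / 2) (by norm_num) le_rfl (by linarith) (by linarith)).trans ?_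
      norm_num
      nlinarith [abs_nonneg s.im]
    rw [hG, siegelProduct, norm_mul, norm_mul, norm_mul]
    calc _ ≤ 252 * (24 * q) * (24 * q) * (24 * (q : ℝ)) := by
          gcongr
          exacts [hL _ hχ1, hL _ hψ1, hL _ hχψ1]
      _ = B := by rw [hB]; ring
  have hGβ : (G β / (β - 1)).re ≤ 0 := by
    rcases hcase with h0 | hno
    · rw [hG, siegelProduct, h0]; simp
    · have hnz : ∀ x ∈ Set.Icc β (3 / 2), (G x).re ≠ 0 := by
        intro x hx h0
        have h1 : G x = 0 := ext h0 (hreal x)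
        rcases lt_or_ge x 1 with hx1 | hx1
        · exact hno x hx.1 hx1 h1
        · rw [hG, siegelProduct] at h1
          have hx1' : 1 ≤ (x : ℂ).re := by simpa using hx1
          refine absurd h1 (mul_ne_zero (mul_ne_zero (mul_ne_zero (zetaH_ne_zero hx1') ?_) ?_) ?_)
          exacts [χ.LFunction_ne_zero_of_one_le_re (.inl hχ1) hx1',
            ψ.LFunction_ne_zero_of_one_le_re (.inl hψ1) hx1',
            (χ * ψ).LFunction_ne_zero_of_one_le_re (.inl hχψ1) hx1']
      have hcont : ContinuousOn (fun x : ℝ => (G x).re) (Set.Icc β (3 / 2)) :=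
        (continuous_re.comp (hGd.continuous.comp continuous_ofReal)).continuousOn
      have h32 : 0 < (G (3 / 2 : ℝ)).re := by
        have : (G (3 / 2 : ℝ) / ((3 / 2 : ℝ) - 1)).re = (G (3 / 2 : ℝ)).re / (1 / 2) := by
          rw [show ((3 / 2 : ℝ) : ℂ) - 1 = ((1 / 2 : ℝ) : ℂ) by push_cast; ring, div_ofReal_re]
        rw [this] at hbF
        linarith
      have hpos' : 0 ≤ (G β).re := by
        by_contra! hlt
        obtain ⟨x, hx, hx0⟩ := intermediate_value_Icc (by linarith) hcont ⟨hlt.le, h32.le⟩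
        exact hnz x hx hx0
      rw [show (β : ℂ) - 1 = ((β - 1 : ℝ) : ℂ) by push_cast; ring, div_ofReal_re]
      exact div_nonpos_of_nonneg_of_nonpos hpos' (by linarith)
  set X : ℝ := D * (q : ℝ) ^ 3 with hX
  have hX1 : 1 ≤ X := one_le_mul_of_one_le_of_one_le hD1 (one_le_pow₀ hq1)
  obtain ⟨n, hn1, hn2⟩ := exists_nat_pow_near hX1 (show (1 : ℝ) < 4 / 3 by norm_num)
  have hmain := estermann hGd hGB (b := b) (β := β) (M := n + 1)
    (fun m => by simpa using (nonneg_iff.1 (hpos m)).1) (by simpa using hbF) hβ hβ1 hGβ (by omega)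
  have h34 : 16 * B * (3 / 4) ^ (n + 1) ≤ b / 2 := by
    have h1 : (3 / 4 : ℝ) ^ (n + 1) = ((4 / 3) ^ (n + 1))⁻¹ := by rw [← inv_pow]; norm_num
    rw [h1, ← div_eq_mul_inv, div_le_iff₀ (by positivity)]
    have h2 : 16 * B ≤ b / 2 * X := by
      have : b * D = 32 * (252 * 24 ^ 3) + b := by rw [hD]; field_simp
      have h3 : b / 2 * X = (b * D) * (q : ℝ) ^ 3 / 2 := by rw [hX]; ring
      rw [h3, this, hB]
      have : 0 ≤ b * (q : ℝ) ^ 3 := by positivity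
      linarith
    exact h2.trans (mul_le_mul_of_nonneg_left hn2.le (by linarith))
  have hpow : (1 + 2 * δ) ^ (n + 1) ≤ (4 / 3 * D) ^ (8 * δ) * (q : ℝ) ^ (24 * δ) := by
    calc (1 + 2 * δ) ^ (n + 1) ≤ ((4 / 3 : ℝ) ^ (8 * δ)) ^ (n + 1) :=
          pow_le_pow_left₀ (by linarith) (one_add_le_rpow hδ0.le) _
      _ = ((4 / 3 : ℝ) ^ (n + 1)) ^ (8 * δ) := by
          rw [← rpow_natCast, ← rpow_natCast, ← rpow_mul (by norm_num),
            ← rpow_mul (by norm_num), mul_comm]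
      _ ≤ (4 / 3 * D * (q : ℝ) ^ 3) ^ (8 * δ) := by
          gcongr
          rw [pow_succ]; linarith
      _ = _ := by
          rw [mul_rpow (by positivity) (by positivity), ← rpow_natCast,
            ← rpow_mul (by linarith)]
          congr 2; push_cast; ring
  have hG1 : G 1 = χ.LFunction 1 * ψ.LFunction 1 * (χ * ψ).LFunction 1 := by
    rw [hG, siegelProduct, zetaH_one, one_mul]
  rw [← norm_mul, ← norm_mul, ← hG1]
  refine le_trans ?_ (re_le_norm _)
  have h5 : b / 2 * δ ≤ (G 1).re * (1 + 2 * δ) ^ (n + 1) := by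
    have : b / 2 ≤ (G 1).re * (1 + 2 * δ) ^ (n + 1) / δ := by linarith
    rwa [le_div_iff₀ hδ0] at this
  have h6 : 0 < (G 1).re := by
    have : 0 < (1 + 2 * δ) ^ (n + 1) := by positivity
    by_contra! h
    nlinarith [mul_pos hb0 hδ0]
  have h7 : b / 2 * δ ≤ (G 1).re * ((4 / 3 * D) ^ (8 * δ) * (q : ℝ) ^ (24 * δ)) :=
    h5.trans (mul_le_mul_of_nonneg_left hpow h6.le)
  rw [rpow_neg (by linarith), ← div_eq_mul_inv, div_div, div_le_iff₀ (by positivity)]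
  exact h7

lemma norm_LFunction_changeLevel_le {M N : ℕ} [NeZero M] [NeZero N] (hMN : M ∣ N)
    {χ : DirichletCharacter ℂ M} (hχ : χ ≠ 1) {s : ℂ} (hs : 0 ≤ s.re) :
    ‖(changeLevel hMN χ).LFunction s‖ ≤ 2 ^ N.primeFactors.card * ‖χ.LFunction s‖ := by
  rw [LFunction_changeLevel hMN χ (.inl hχ), norm_mul, norm_prod, mul_comm]
  gcongr
  rw [← prod_const]
  refine prod_le_prod (fun _ _ => norm_nonneg _) fun p hp => ?_
  have hpp := prime_of_mem_primeFactors hp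
  calc _ ≤ ‖(1 : ℂ)‖ + ‖χ p * (p : ℂ) ^ (-s)‖ := norm_sub_le _ _
    _ ≤ 1 + 1 * 1 := by
      rw [norm_mul, norm_one]
      gcongr
      · exact χ.norm_le_one _
      · rw [norm_natCast_cpow_of_pos hpp.pos, neg_re]
        exact rpow_le_one_of_one_le_of_nonpos (mod_cast hpp.one_le) (by linarith)
    _ = 2 := by norm_num

lemma norm_LFunction_le_changeLevel {M N : ℕ} [NeZero M] [NeZero N] (hMN : M ∣ N)
    {χ : DirichletCharacter ℂ M} (hχ : χ ≠ 1) :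
    ‖χ.LFunction 1‖ ≤ 2 ^ N.primeFactors.card * ‖(changeLevel hMN χ).LFunction 1‖ := by
  rw [LFunction_changeLevel hMN χ (.inl hχ), norm_mul, norm_prod]
  have h : (1 / 2 : ℝ) ^ N.primeFactors.card
      ≤ ∏ p ∈ N.primeFactors, ‖1 - χ p * (p : ℂ) ^ (-1 : ℂ)‖ := by
    rw [← prod_const]
    refine prod_le_prod (fun _ _ => by norm_num) fun p hp => ?_
    have hpp := prime_of_mem_primeFactors hp
    have h1 : ‖χ p * (p : ℂ) ^ (-1 : ℂ)‖ ≤ 1 / 2 := by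
      rw [norm_mul, norm_natCast_cpow_of_pos hpp.pos]
      have h2 : (2 : ℝ) ≤ p := mod_cast hpp.two_le
      have h3 : (p : ℝ) ^ (-1 : ℂ).re ≤ 1 / 2 := by
        simp [rpow_neg_one]
        exact inv_anti₀ (by norm_num) h2
      calc _ ≤ 1 * ((p : ℝ) ^ (-1 : ℂ).re) := by gcongr; exact χ.norm_le_one _
        _ ≤ _ := by rwa [one_mul]
    have h4 := norm_sub_norm_le (1 : ℂ) (χ p * (p : ℂ) ^ (-1 : ℂ))
    rw [norm_one] at h4
    linarith
  calc ‖χ.LFunction 1‖ = 2 ^ N.primeFactors.card * (‖χ.LFunction 1‖ * (1 / 2) ^ N.primeFactors.card) := by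
        rw [mul_left_comm, ← mul_pow]; norm_num
    _ ≤ _ := by gcongr

lemma siegel_of_base {q₁ : ℕ} [NeZero q₁] {χ : DirichletCharacter ℂ q₁} (hχ : χ ^ 2 = 1)
    (hχ1 : χ ≠ 1) {δ : ℝ} (hδ : 0 < δ) (hδ4 : δ ≤ 1 / 4)
    (hcase : χ.LFunction (1 - δ : ℝ) = 0 ∨ ((∀ x : ℝ, 1 - δ ≤ x → x < 1 → zetaH x ≠ 0) ∧
      ∀ (q : ℕ) [NeZero q] (θ : DirichletCharacter ℂ q), θ ^ 2 = 1 → θ ≠ 1 → ∀ x : ℝ,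
        1 - δ ≤ x → x < 1 → θ.LFunction x ≠ 0)) :
    ∃ c : ℝ, 0 < c ∧ ∀ (q : ℕ) [NeZero q] (ψ : DirichletCharacter ℂ q), ψ ^ 2 = 1 → ψ ≠ 1 →
      c * (q : ℝ) ^ (-(29 * δ)) ≤ ‖ψ.LFunction 1‖ := by
  obtain ⟨c₀, hc₀, hcore⟩ := siegel_core (β := 1 - δ) (by linarith) (by linarith)
  obtain ⟨C, hC1, hC⟩ := exists_two_pow_card_primeFactors_le hδ
  have hq1 : (1 : ℝ) ≤ q₁ := mod_cast NeZero.one_le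
  set K : ℝ := (6 + 1 / δ) * 2 ^ (2 * δ) with hK
  have hK0 : 0 < K := by positivity
  have hL0 : 0 < ‖χ.LFunction 1‖ := norm_pos_iff.2 (LFunction_apply_one_ne_zero hχ1)
  refine ⟨min (c₀ * (q₁ : ℝ) ^ (-(29 * δ)) / (K ^ 2 * C)) (‖χ.LFunction 1‖ / (C ^ 2 * (q₁ : ℝ) ^ (2 * δ))),
    lt_min (by positivity) (by positivity), ?_⟩
  intro q _ ψ hψ hψ1
  have hq : (1 : ℝ) ≤ q := mod_cast NeZero.one_le
  have d1 : q₁ ∣ q₁ * q := dvd_mul_right _ _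
  have d2 : q ∣ q₁ * q := dvd_mul_left _ _
  set χ' := changeLevel d1 χ with hχ'
  set ψ' := changeLevel d2 ψ with hψ'
  set Q : ℝ := ((q₁ * q : ℕ) : ℝ) with hQ
  have hQe : Q = q₁ * q := by rw [hQ]; push_cast; ring
  have hQ1 : 1 ≤ Q := by rw [hQe]; exact one_le_mul_of_one_le_of_one_le hq1 hq
  have s1 : χ' ^ 2 = 1 := by rw [hχ', ← map_pow, hχ, map_one]
  have s2 : ψ' ^ 2 = 1 := by rw [hψ', ← map_pow, hψ, map_one]
  have n1 : χ' ≠ 1 := by rwa [hχ', Ne, changeLevel_eq_one_iff]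
  have n2 : ψ' ≠ 1 := by rwa [hψ', Ne, changeLevel_eq_one_iff]
  have hω := hC (q₁ * q) (Nat.pos_of_ne_zero (NeZero.ne _))
  rw [← hQ] at hω
  have u2 := norm_LFunction_changeLevel_le d2 hψ1 (s := 1) (by simp)
  rw [← hψ'] at u2
  by_cases h12 : χ' * ψ' = 1
  · have he : ψ' = χ' := by
      calc ψ' = χ' ^ 2 * ψ' := by rw [s1, one_mul]
        _ = χ' * (χ' * ψ') := by rw [pow_two, mul_assoc]
        _ = χ' := by rw [h12, mul_one]
    have u1 := norm_LFunction_le_changeLevel d1 hχ1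
    rw [← hχ', ← he] at u1
    have h3 : ‖χ.LFunction 1‖ ≤ (C * Q ^ δ) * ((C * Q ^ δ) * ‖ψ.LFunction 1‖) :=
      u1.trans (mul_le_mul hω (u2.trans (by gcongr)) (norm_nonneg _) (by positivity))
    have h4 : (C * Q ^ δ) * ((C * Q ^ δ) * ‖ψ.LFunction 1‖)
        = C ^ 2 * (q₁ : ℝ) ^ (2 * δ) * ((q : ℝ) ^ (2 * δ) * ‖ψ.LFunction 1‖) := by
      rw [hQe, mul_rpow (by linarith) (by linarith), two_mul, rpow_add (by linarith),
        rpow_add (by linarith)]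
      ring
    rw [h4] at h3
    calc _ ≤ ‖χ.LFunction 1‖ / (C ^ 2 * (q₁ : ℝ) ^ (2 * δ)) * (q : ℝ) ^ (-(2 * δ)) := by
          gcongr
          · exact min_le_right _ _
          · norm_num
      _ ≤ _ := by
          rw [rpow_neg (by linarith), ← div_eq_mul_inv, div_div, div_le_iff₀ (by positivity)]
          linarith
  · have hcase' : χ'.LFunction (1 - δ : ℝ) = 0 ∨
        ∀ x : ℝ, 1 - δ ≤ x → x < 1 → siegelProduct χ' ψ' x ≠ 0 := by
      rcases hcase with h | ⟨hz, hL⟩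
      · left
        rw [hχ', LFunction_changeLevel d1 χ (.inl hχ1), h, zero_mul]
      · right
        intro x hx hx1
        refine mul_ne_zero (mul_ne_zero (mul_ne_zero (hz x hx hx1) (hL _ χ' s1 n1 x hx hx1))
          (hL _ ψ' s2 n2 x hx hx1)) (hL _ (χ' * ψ') ?_ h12 x hx hx1)
        rw [mul_pow, s1, s2, one_mul]
    have h := hcore (q₁ * q) χ' ψ' s1 s2 n1 n2 h12 hcase'
    rw [← hQ, show 1 - (1 - δ) = δ by ring] at h
    have hup : ∀ θ : DirichletCharacter ℂ (q₁ * q), θ ≠ 1 → ‖θ.LFunction 1‖ ≤ K * Q ^ (2 * δ) := by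
      intro θ hφ
      refine (norm_LFunction_le hδ (by linarith) hφ (by simp; linarith) (by simp)).trans ?_
      rw [← hQ]
      simp only [one_im, abs_zero, add_zero]
      rw [mul_rpow (by linarith) (by norm_num), hK]
      exact le_of_eq (by ring)
    have h5 : c₀ * Q ^ (-(24 * δ)) ≤ K * Q ^ (2 * δ) * (C * Q ^ δ * ‖ψ.LFunction 1‖) * (K * Q ^ (2 * δ)) := by
      refine h.trans ?_
      gcongr
      · exact hup _ n1
      · exact u2.trans (by gcongr)
      · exact hup _ h12
    have h6 : K * Q ^ (2 * δ) * (C * Q ^ δ * ‖ψ.LFunction 1‖) * (K * Q ^ (2 * δ))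
        = K ^ 2 * C * Q ^ (5 * δ) * ‖ψ.LFunction 1‖ := by
      have : Q ^ (5 * δ) = Q ^ (2 * δ) * Q ^ δ * Q ^ (2 * δ) := by
        rw [← rpow_add (by linarith), ← rpow_add (by linarith)]; congr 1; ring
      rw [this]; ring
    rw [h6] at h5
    have h7 : c₀ * Q ^ (-(29 * δ)) ≤ K ^ 2 * C * ‖ψ.LFunction 1‖ := by
      have e1 : Q ^ (-(24 * δ)) = Q ^ (-(29 * δ)) * Q ^ (5 * δ) := by
        rw [← rpow_add (by linarith)]; congr 1; ring
      rw [e1] at h5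
      have hp : 0 < Q ^ (5 * δ) := by positivity
      refine le_of_mul_le_mul_right ?_ hp
      linarith
    calc _ ≤ c₀ * (q₁ : ℝ) ^ (-(29 * δ)) / (K ^ 2 * C) * (q : ℝ) ^ (-(29 * δ)) := by
          gcongr
          exact min_le_left _ _
      _ = c₀ * Q ^ (-(29 * δ)) / (K ^ 2 * C) := by
          rw [hQe, mul_rpow (by linarith) (by linarith)]; ring
      _ ≤ _ := by
          rw [div_le_iff₀ (by positivity)]; linarith

/-- **Siegel's theorem**. -/
theorem siegel {η : ℝ} (hη : 0 < η) :
    ∃ c : ℝ, 0 < c ∧ ∀ (q : ℕ) [NeZero q] (ψ : DirichletCharacter ℂ q), ψ ^ 2 = 1 → ψ ≠ 1 →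
      c * (q : ℝ) ^ (-η) ≤ ‖ψ.LFunction 1‖ := by
  obtain ⟨r, hr, hz⟩ : ∃ r > 0, ∀ x : ℝ, |x - 1| < r → zetaH x ≠ 0 := by
    have hc : ContinuousAt (fun x : ℝ => zetaH x) 1 :=
      (differentiable_zetaH.continuous.comp continuous_ofReal).continuousAt
    have h1 : zetaH ((1 : ℝ) : ℂ) ≠ 0 := by simp [zetaH_one]
    have := hc.eventually_ne h1
    rw [Metric.eventually_nhds_iff] at this
    obtain ⟨r, hr, h⟩ := this
    exact ⟨r, hr, fun x hx => h (by rwa [Real.dist_eq])⟩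
  set δ₀ : ℝ := min (min (η / 29) (1 / 4)) (r / 2) with hδ₀
  have hδ₀0 : 0 < δ₀ := lt_min (lt_min (by linarith) (by norm_num)) (by linarith)
  have hb1 : δ₀ ≤ η / 29 := (min_le_left _ _).trans (min_le_left _ _)
  have hb2 : δ₀ ≤ 1 / 4 := (min_le_left _ _).trans (min_le_right _ _)
  have hb3 : δ₀ ≤ r / 2 := min_le_right _ _
  have hfin : ∀ δ : ℝ, δ ≤ δ₀ → (∃ c : ℝ, 0 < c ∧ ∀ (q : ℕ) [NeZero q] (ψ : DirichletCharacter ℂ q),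
      ψ ^ 2 = 1 → ψ ≠ 1 → c * (q : ℝ) ^ (-(29 * δ)) ≤ ‖ψ.LFunction 1‖) →
      ∃ c : ℝ, 0 < c ∧ ∀ (q : ℕ) [NeZero q] (ψ : DirichletCharacter ℂ q), ψ ^ 2 = 1 → ψ ≠ 1 →
      c * (q : ℝ) ^ (-η) ≤ ‖ψ.LFunction 1‖ := by
    rintro δ hδ ⟨c, hc, h⟩
    refine ⟨c, hc, fun q _ ψ h1 h2 => le_trans ?_ (h q ψ h1 h2)⟩
    gcongr
    · exact_mod_cast Nat.pos_of_ne_zero (NeZero.ne q)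
    · linarith
  by_cases hzero : ∃ (q : ℕ) (_ : NeZero q) (χ : DirichletCharacter ℂ q) (x : ℝ), χ ^ 2 = 1 ∧ χ ≠ 1 ∧
      1 - δ₀ ≤ x ∧ x < 1 ∧ χ.LFunction x = 0
  · obtain ⟨q, _, χ, x, h1, h2, h3, h4, h5⟩ := hzero
    refine hfin (1 - x) (by linarith) (siegel_of_base h1 h2 (by linarith) (by linarith) (.inl ?_))
    rwa [sub_sub_cancel]
  · by_cases hex : ∃ (q : ℕ) (_ : NeZero q) (χ : DirichletCharacter ℂ q), χ ^ 2 = 1 ∧ χ ≠ 1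
    · obtain ⟨q, _, χ, h1, h2⟩ := hex
      refine hfin δ₀ le_rfl (siegel_of_base h1 h2 hδ₀0 hb2 (.inr ⟨?_, ?_⟩))
      · intro x hx hx1
        refine hz x ?_
        rw [abs_lt]; constructor <;> linarith
      · intro q' _ θ h3 h4 x hx hx1 h5
        exact hzero ⟨q', inferInstance, θ, x, h3, h4, hx, hx1, h5⟩
    · exact ⟨1, one_pos, fun q _ ψ h1 h2 => absurd ⟨q, inferInstance, ψ, h1, h2⟩ hex⟩

lemma norm_LFunction_ge_of_sq_ne_one {η : ℝ} (hη : 0 < η) (hη4 : η ≤ 1 / 4) :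
    ∃ c : ℝ, 0 < c ∧ ∀ (q : ℕ) [NeZero q] (χ : DirichletCharacter ℂ q), χ ^ 2 ≠ 1 →
      ∀ x y : ℝ, 0 ≤ x → x ≤ 1 →
      c * (q * (2 + |y|)) ^ (-(63 * η)) ≤ ‖χ.LFunction (1 + x + I * y)‖ := by
  obtain ⟨c, hc, hc1, h⟩ := norm_LFunction_pow_four_ge_of_sq_ne_one hη hη4
  have hη2 : 1 ≤ 4 / η ^ 2 := by
    rw [le_div_iff₀ (by positivity)]; nlinarith
  refine ⟨c * (c / (2 * (4 / η ^ 2))) ^ 3 / 2, by positivity, ?_⟩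
  intro q _ χ hχ x y hx hx1
  have hχ1 : χ ≠ 1 := by rintro rfl; simp at hχ
  have hq1 : (1 : ℝ) ≤ q := mod_cast NeZero.one_le
  set X : ℝ := q * (2 + |y|) with hX
  have hX1 : 1 ≤ X := by nlinarith [abs_nonneg y]
  set Y : ℝ := X ^ (9 * η) with hY
  have hY1 : 1 ≤ Y := one_le_rpow hX1 (by linarith)
  have h4Y : X ^ (4 * η) ≤ Y := rpow_le_rpow_of_exponent_le hX1 (by linarith)
  have hY7 : Y ^ 7 = X ^ (63 * η) := by
    rw [hY, ← rpow_natCast, ← rpow_mul (by linarith)]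
    congr 1; push_cast; ring
  have := lower_bound_of_deriv (f := χ.LFunction) (y := y) hc hc1 hη2 hY1 ?_ ?_ ?_ (x := x) ⟨hx, hx1⟩
  · refine le_trans (le_of_eq ?_) this
    rw [rpow_neg (by linarith), hY7, ← div_eq_mul_inv]
  · intro x _
    exact χ.differentiableAt_LFunction _ (.inr hχ1)
  · intro x hx
    refine le_trans ?_ (h q χ hχ x y hx.1 hx.2)
    have e1 : c ^ 4 ≤ c := pow_le_of_le_one hc.le hc1 (by norm_num)
    have e2 : X ^ (4 * η) ≤ Y ^ 4 := h4Y.trans (le_self_pow₀ hY1 (by norm_num))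
    have hx0 : 0 ≤ x := hx.1.le
    have hp : 0 < X ^ (4 * η) := by positivity
    gcongr
  · intro x hx
    have h1 := norm_deriv_LFunction_le hη hη4 hχ1 (s := 1 + x + I * y) (by simp; linarith [hx.1])
      (by simp; linarith [hx.2])
    refine h1.trans ?_
    have : (1 + x + I * y : ℂ).im = y := by simp
    rw [this, ← hX]
    gcongr

lemma norm_LFunction_ge_of_sq_eq_one {η : ℝ} (hη : 0 < η) (hη4 : η ≤ 1 / 4) :
    ∃ c : ℝ, 0 < c ∧ ∀ (q : ℕ) [NeZero q] (χ : DirichletCharacter ℂ q), χ ^ 2 = 1 → χ ≠ 1 →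
      ∀ x y : ℝ, 0 ≤ x → x ≤ 1 →
      c * (q * (2 + |y|)) ^ (-(63 * η)) ≤ ‖χ.LFunction (1 + x + I * y)‖ := by
  obtain ⟨c, hc, hc1, h⟩ := norm_LFunction_pow_four_ge_of_sq_eq_one hη hη4
  obtain ⟨cS, hcS, hS⟩ := siegel hη
  have hη2 : 1 ≤ 4 / η ^ 2 := by
    rw [le_div_iff₀ (by positivity)]; nlinarith
  set t₀ : ℝ := min 1 (cS * η ^ 2 / 16) with ht₀
  have ht0 : 0 < t₀ := lt_min one_pos (by positivity)
  have ht1 : t₀ ≤ 1 := min_le_left _ _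
  have htS : t₀ ≤ cS * η ^ 2 / 16 := min_le_right _ _
  set c' : ℝ := c * t₀ / 3 with hc'
  have hc'0 : 0 < c' := by positivity
  have hc'1 : c' ≤ 1 := by rw [hc']; nlinarith
  refine ⟨min (c' * (c' / (2 * (4 / η ^ 2))) ^ 3 / 2) (min c' (cS / 2)), by positivity, ?_⟩
  intro q _ χ hχ hχ1 x y hx hx1
  have hq1 : (1 : ℝ) ≤ q := mod_cast NeZero.one_le
  have hy0 := abs_nonneg y
  set X : ℝ := q * (2 + |y|) with hX
  have hX1 : 1 ≤ X := by nlinarith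
  have hXq : (q : ℝ) ≤ X := by nlinarith
  set T : ℝ := t₀ * X ^ (-(5 * η)) with hT
  have hX5 : X ^ (-(5 * η)) ≤ 1 := rpow_le_one_of_one_le_of_nonpos hX1 (by linarith)
  have hX50 : 0 < X ^ (-(5 * η)) := by positivity
  have hT1 : T ≤ 1 := by rw [hT]; nlinarith
  have hT0 : 0 < T := by positivity
  have hder : ∀ x y' : ℝ, 0 ≤ x → x ≤ 1 → |y'| ≤ |y| →
      ‖deriv χ.LFunction (1 + x + I * y')‖ ≤ 4 / η ^ 2 * X ^ (4 * η) := by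
    intro x y' hx hx1 hy'
    have h1 := norm_deriv_LFunction_le hη hη4 hχ1 (s := 1 + x + I * y') (by simp; linarith)
      (by simp; linarith)
    refine h1.trans ?_
    have : (1 + x + I * y' : ℂ).im = y' := by simp
    rw [this, hX]
    gcongr
  rcases le_or_gt T |y| with hy | hy
  · set Y : ℝ := X ^ (9 * η) with hY
    have hY1 : 1 ≤ Y := one_le_rpow hX1 (by linarith)
    have h4Y : X ^ (4 * η) ≤ Y := rpow_le_rpow_of_exponent_le hX1 (by linarith)
    have hY7 : Y ^ 7 = X ^ (63 * η) := by
      rw [hY, ← rpow_natCast, ← rpow_mul (by linarith)]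
      congr 1; push_cast; ring
    have := lower_bound_of_deriv (f := χ.LFunction) (y := y) hc'0 hc'1 hη2 hY1 ?_ ?_ ?_ (x := x) ⟨hx, hx1⟩
    · refine le_trans ?_ this
      rw [rpow_neg (by linarith), hY7, ← div_eq_mul_inv]
      gcongr
      exact min_le_left _ _
    · intro x _
      exact χ.differentiableAt_LFunction _ (.inr hχ1)
    · intro x hx
      refine le_trans ?_ (h q χ hχ x y hx.1 hx.2)
      have hx0 : 0 ≤ x := hx.1.le
      have hw : T / 3 ≤ ‖(x + I * (2 * y : ℝ) : ℂ)‖ / (2 + |y|) := by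
        rw [le_div_iff₀ (by linarith)]
        have h1 := abs_im_le_norm (x + I * (2 * y : ℝ) : ℂ)
        have h2 : (x + I * (2 * y : ℝ) : ℂ).im = 2 * y := by simp
        rw [h2, abs_mul, abs_two] at h1
        nlinarith
      have e1 : c' ^ 4 ≤ c' := pow_le_of_le_one hc'0.le hc'1 (by norm_num)
      have e2 : Y ≤ Y ^ 4 := le_self_pow₀ hY1 (by norm_num)
      calc c' ^ 4 * x ^ 3 / Y ^ 4 ≤ c' * x ^ 3 / Y := by gcongr
        _ = c * x ^ 3 / X ^ (4 * η) * (T / 3) := by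
            have : X ^ (-(5 * η)) = X ^ (4 * η) / Y := by
              rw [hY, ← rpow_sub (by linarith)]; congr 1; ring
            have hp : 0 < X ^ (4 * η) := by positivity
            rw [hT, this, hc']
            field_simp
        _ ≤ _ := by gcongr
    · intro x hx
      refine (hder x y hx.1 hx.2 le_rfl).trans ?_
      gcongr
  · rcases le_or_gt T x with hxT | hxT
    · have hx0 : 0 < x := hT0.trans_le hxT
      have h1 := h q χ hχ x y hx0 hx1
      have hw : x / 3 ≤ ‖(x + I * (2 * y : ℝ) : ℂ)‖ / (2 + |y|) := by
        rw [le_div_iff₀ (by linarith)]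
        have h1 := abs_re_le_norm (x + I * (2 * y : ℝ) : ℂ)
        have h2 : (x + I * (2 * y : ℝ) : ℂ).re = x := by simp
        rw [h2, abs_of_pos hx0] at h1
        nlinarith
      have h2 : (c' * X ^ (-(63 * η))) ^ 4 ≤ ‖χ.LFunction (1 + x + I * y)‖ ^ 4 := by
        refine le_trans ?_ h1
        calc (c' * X ^ (-(63 * η))) ^ 4 ≤ (c' * X ^ (-(6 * η))) ^ 4 := by
              gcongr
              norm_num
          _ = c' ^ 4 * X ^ (-(24 * η)) := by
              rw [mul_pow, ← rpow_natCast (X ^ _), ← rpow_mul (by linarith)]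
              congr 2; push_cast; ring
          _ = (c / 3) ^ 4 * T ^ 4 * X ^ (-(4 * η)) := by
              rw [hc', hT, mul_pow t₀, ← rpow_natCast (X ^ _), ← rpow_mul (by linarith)]
              rw [mul_assoc _ _ (X ^ (-(4 * η))), mul_assoc _ _ (X ^ (-(4 * η))),
                ← rpow_add (by linarith)]
              rw [show -(5 * η) * ((4 : ℕ) : ℝ) + -(4 * η) = -(24 * η) by push_cast; ring]
              ring
          _ ≤ (c / 3) * x ^ 4 * X ^ (-(4 * η)) := by
              gcongr
              exact pow_le_of_le_one (by positivity) (by linarith) (by norm_num)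
          _ = c * x ^ 3 / X ^ (4 * η) * (x / 3) := by
              rw [rpow_neg (by linarith)]; ring
          _ ≤ _ := by gcongr
      have h3 := le_of_pow_le_pow_left₀ (by norm_num) (norm_nonneg _) h2
      refine le_trans ?_ h3
      gcongr
      exact (min_le_right _ _).trans (min_le_left _ _)
    · have hdist : ‖χ.LFunction (1 + x + I * y) - χ.LFunction 1‖
          ≤ 4 / η ^ 2 * X ^ (4 * η) * ‖(1 + x + I * y : ℂ) - 1‖ := by
        set S : Set ℂ := {s | 1 ≤ s.re ∧ s.re ≤ 2 ∧ -|y| ≤ s.im ∧ s.im ≤ |y|} with hSd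
        have hconv : Convex ℝ S := by
          have := ((convex_halfSpace_re_ge 1).inter (convex_halfSpace_re_le 2)).inter
            ((convex_halfSpace_im_ge (-|y|)).inter (convex_halfSpace_im_le |y|))
          convert this using 1
          ext s
          simp only [hSd, Set.mem_inter_iff, Set.mem_ofPred_eq]
          tauto
        refine hconv.norm_image_sub_le_of_norm_deriv_le (f := χ.LFunction)
          (fun s _ => χ.differentiableAt_LFunction s (.inr hχ1)) (fun s hs => ?_) ?_ ?_
        · have hs' : s = 1 + ((s.re - 1 : ℝ) : ℂ) + I * (s.im : ℝ) := by
            apply Complex.ext <;> simp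
          rw [hs']
          exact hder _ _ (by linarith [hs.1]) (by linarith [hs.2.1]) (abs_le.2 hs.2.2)
        · simp [hSd]
        · simp only [hSd, Set.mem_ofPred_eq]
          simp
          exact ⟨hx, by linarith, neg_abs_le y, le_abs_self y⟩
      have hn : ‖(1 + x + I * y : ℂ) - 1‖ ≤ 2 * T := by
        rw [show (1 + x + I * y : ℂ) - 1 = x + I * y by ring]
        refine (norm_add_le _ _).trans ?_
        rw [norm_mul, norm_I, one_mul, norm_real, norm_real,
          norm_eq_abs, norm_eq_abs, abs_of_nonneg hx]
        linarith
      have h1 : cS * X ^ (-η) ≤ ‖χ.LFunction 1‖ := by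
        refine le_trans ?_ (hS q χ hχ hχ1)
        gcongr ?_ * ?_
        exact rpow_le_rpow_of_nonpos (by linarith) hXq (by linarith)
      have h2 : 4 / η ^ 2 * X ^ (4 * η) * ‖(1 + x + I * y : ℂ) - 1‖ ≤ cS / 2 * X ^ (-η) := by
        calc _ ≤ 4 / η ^ 2 * X ^ (4 * η) * (2 * T) := by gcongr
          _ = 8 / η ^ 2 * t₀ * (X ^ (4 * η) * X ^ (-(5 * η))) := by rw [hT]; ring
          _ = 8 / η ^ 2 * t₀ * X ^ (-η) := by
              rw [← rpow_add (by linarith)]; congr 2; ring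
          _ ≤ 8 / η ^ 2 * (cS * η ^ 2 / 16) * X ^ (-η) := by gcongr
          _ = _ := by field_simp; ring
      have h3 := norm_sub_norm_le (χ.LFunction 1) (χ.LFunction (1 + x + I * y))
      rw [norm_sub_rev] at h3
      have h4 : cS / 2 * X ^ (-η) ≤ ‖χ.LFunction (1 + x + I * y)‖ := by linarith
      refine le_trans ?_ h4
      gcongr
      · exact (min_le_right _ _).trans (min_le_right _ _)
      · linarith

/-- Uniform lower bound for `L(s, χ)` in `1 ≤ Re s ≤ 2`. -/
lemma norm_LFunction_ge {η : ℝ} (hη : 0 < η) :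
    ∃ c : ℝ, 0 < c ∧ c ≤ 1 ∧ ∀ (q : ℕ) [NeZero q] (χ : DirichletCharacter ℂ q), χ ≠ 1 →
      ∀ s : ℂ, 1 ≤ s.re → s.re ≤ 2 → c * (q * (2 + |s.im|)) ^ (-η) ≤ ‖χ.LFunction s‖ := by
  set ε : ℝ := min (η / 63) (1 / 4) with hε
  have hε0 : 0 < ε := lt_min (by linarith) (by norm_num)
  have hε1 : ε ≤ η / 63 := min_le_left _ _
  obtain ⟨c₁, hc₁, h₁⟩ := norm_LFunction_ge_of_sq_ne_one hε0 (min_le_right _ _)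
  obtain ⟨c₂, hc₂, h₂⟩ := norm_LFunction_ge_of_sq_eq_one hε0 (min_le_right _ _)
  refine ⟨min 1 (min c₁ c₂), by positivity, min_le_left _ _, ?_⟩
  intro q _ χ hχ s hs hs2
  have hq1 : (1 : ℝ) ≤ q := mod_cast NeZero.one_le
  have hX1 : (1 : ℝ) ≤ q * (2 + |s.im|) := by nlinarith [abs_nonneg s.im]
  have hs' : s = 1 + ((s.re - 1 : ℝ) : ℂ) + I * (s.im : ℝ) := by
    apply Complex.ext <;> simp
  have hexp : (q * (2 + |s.im|)) ^ (-η) ≤ (q * (2 + |s.im|)) ^ (-(63 * ε)) :=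
    rpow_le_rpow_of_exponent_le hX1 (by linarith)
  by_cases hsq : χ ^ 2 = 1
  · have := h₂ q χ hsq hχ (s.re - 1) s.im (by linarith) (by linarith)
    rw [← hs'] at this
    refine le_trans ?_ this
    gcongr
    exact (min_le_right _ _).trans (min_le_right _ _)
  · have := h₁ q χ hsq (s.re - 1) s.im (by linarith) (by linarith)
    rw [← hs'] at this
    refine le_trans ?_ this
    gcongr
    exact (min_le_right _ _).trans (min_le_left _ _)

/-- Cauchy bounds for the derivatives of `f' / f` at `s`, from an upper bound of `f` near `s`
and a lower bound at `s`. -/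
lemma norm_iteratedDeriv_logDeriv_le {f : ℂ → ℂ} (hf : Differentiable ℂ f) {s : ℂ} {a M m : ℝ}
    (ha : 0 < a) (hm : 0 < m) (hM : ∀ z, ‖z - s‖ ≤ a → ‖f z‖ ≤ M) (hms : m ≤ ‖f s‖) (k : ℕ) :
    ‖iteratedDeriv k (logDeriv f) s‖ ≤ k.factorial * (4 * M / (a * m)) ^ (k + 1) := by
  have hmM : m ≤ M := hms.trans (hM s (by simpa using ha.le))
  have hM0 : 0 < M := hm.trans_le hmM
  set r := a * m / (4 * M) with hr
  have hr0 : 0 < r := by positivity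
  have hra : r ≤ a / 4 := by
    rw [hr, div_le_div_iff₀ (by positivity) (by norm_num)]; nlinarith
  have hder : ∀ z, ‖z - s‖ ≤ a / 2 → ‖deriv f z‖ ≤ 2 * M / a := by
    intro z hz
    have h := norm_deriv_le_of_forall_mem_sphere_norm_le (f := f) (c := z)
      (R := a / 2) (C := M) (by linarith) hf.diffContOnCl (fun w hw => hM w ?_)
    · refine h.trans (le_of_eq ?_); field_simp
    · have hw' : ‖w - z‖ = a / 2 := by simpa [dist_eq_norm] using hw
      have := norm_add_le (w - z) (z - s)
      rw [sub_add_sub_cancel] at this; linarith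
  have hlow : ∀ z, ‖z - s‖ ≤ r → m / 2 ≤ ‖f z‖ := by
    intro z hz
    have h := (convex_closedBall s (a / 2)).norm_image_sub_le_of_norm_deriv_le (f := f)
      (C := 2 * M / a) (x := s) (y := z) (fun w _ => hf w)
      (fun w hw => hder w (by simpa [dist_eq_norm] using hw)) (by simp; linarith)
      (by simp [dist_eq_norm]; linarith)
    have h2 : 2 * M / a * ‖z - s‖ ≤ m / 2 := by
      calc _ ≤ 2 * M / a * r := by gcongr
        _ = m / 2 := by grind
    have h3 := norm_sub_norm_le (f s) (f z)
    rw [norm_sub_rev] at h3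
    linarith
  have hlog : ∀ z, ‖z - s‖ ≤ r → ‖logDeriv f z‖ ≤ 1 / r := by
    intro z hz
    rw [logDeriv_apply, norm_div]
    calc _ ≤ (2 * M / a) / (m / 2) := by
          bound
      _ = _ := by grind
  have hcl : closure (Metric.ball s r) = Metric.closedBall s r := closure_ball s hr0.ne'
  have hdiff : DiffContOnCl ℂ (logDeriv f) (Metric.ball s r) := by
    apply DifferentiableOn.diffContOnCl
    rw [hcl]
    intro z hz
    have hz' : ‖z - s‖ ≤ r := by simpa [dist_eq_norm] using hz
    have hne : f z ≠ 0 := norm_pos_iff.1 (by linarith [hlow z hz'])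
    exact ((hf.deriv z).div (hf z) hne).differentiableWithinAt
  have h := norm_iteratedDeriv_le_of_forall_mem_sphere_norm_le k hr0 hdiff
    (C := 1 / r) (fun z hz => hlog z (by
      have : ‖z - s‖ = r := by simpa [dist_eq_norm] using hz
      exact this.le))
  refine h.trans (le_of_eq ?_)
  have : 4 * M / (a * m) = 1 / r := by rw [hr]; field_simp
  rw [this, one_div, inv_pow, pow_succ]; field_simp

lemma im_abs_le_add {z s : ℂ} {a : ℝ} (h : ‖z - s‖ ≤ a) : |z.im| ≤ |s.im| + a := by
  have h2 := abs_im_le_norm (z - s)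
  rw [sub_im] at h2
  grind

lemma re_mem_of_norm_sub_le {z s : ℂ} {a : ℝ} (h : ‖z - s‖ ≤ a) :
    s.re - a ≤ z.re ∧ z.re ≤ s.re + a := by
  have h1 := abs_re_le_norm (z - s)
  rw [sub_re, abs_le] at h1
  constructor <;> linarith

lemma two_mul_rpow_le {x t : ℝ} (hx : 0 ≤ x) (ht : t ≤ 1) : (2 * x) ^ t ≤ 2 * x ^ t := by
  rw [mul_rpow zero_le_two hx]
  gcongr
  exact rpow_le_self_of_one_le one_le_two ht

lemma norm_iteratedDeriv_logDeriv_LFunction_le (k : ℕ) :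
    ∃ C : ℝ, 0 < C ∧ ∀ (q : ℕ) [NeZero q] (χ : DirichletCharacter ℂ q), χ ≠ 1 →
      ∀ s : ℂ, 1 ≤ s.re → s.re ≤ 2 →
      ‖iteratedDeriv k (logDeriv χ.LFunction) s‖ ≤ C * (q * (2 + |s.im|)) ^ (1 / 2 : ℝ) := by
  set b : ℝ := 1 / (6 * (k + 1)) with hb
  have hb0 : 0 < b := by positivity
  have hb1 : b ≤ 1 / 6 := by
    rw [hb]; apply one_div_le_one_div_of_le (by norm_num)
    have : (0 : ℝ) ≤ k := by positivity
    linarith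
  obtain ⟨c, hc, hc1, h⟩ := norm_LFunction_ge hb0
  refine ⟨k.factorial * (4 * ((6 + 1 / b) * 2) / (b * c)) ^ (k + 1), by positivity, ?_⟩
  intro q _ χ hχ s hs hs2
  have hq1 : (1 : ℝ) ≤ q := mod_cast NeZero.one_le
  set X : ℝ := q * (2 + |s.im|) with hX
  have him := abs_nonneg s.im
  have hX1 : 1 ≤ X := by nlinarith
  have hX0 : 0 < X := by linarith
  have key := norm_iteratedDeriv_logDeriv_le (differentiable_LFunction hχ)
    (s := s) (a := b) (M := (6 + 1 / b) * (2 * X ^ (2 * b))) (m := c * X ^ (-b)) hb0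
    (by positivity) ?_ (h q χ hχ s hs hs2) k
  · refine key.trans (le_of_eq ?_)
    have : 4 * ((6 + 1 / b) * (2 * X ^ (2 * b))) / (b * (c * X ^ (-b)))
        = 4 * ((6 + 1 / b) * 2) / (b * c) * X ^ (3 * b) := by
      rw [show 3 * b = 2 * b + b by ring, rpow_add hX0, rpow_neg hX0.le]
      have : X ^ b ≠ 0 := by positivity
      field_simp
    rw [this, mul_pow, ← rpow_natCast (X ^ _), ← rpow_mul hX0.le, ← mul_assoc]
    grind
  · intro z hz
    have h1 := re_mem_of_norm_sub_le hz
    have h3 := im_abs_le_add hz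
    refine (norm_LFunction_le hb0 (by linarith) hχ (by linarith) (by linarith)).trans ?_
    gcongr
    refine (rpow_le_rpow (by positivity) ?_ (by linarith)).trans
      (two_mul_rpow_le hX0.le (by linarith))
    rw [hX]; nlinarith

lemma norm_zetaH_le_of_near {η : ℝ} (hη : 0 < η) (hη2 : η ≤ 1 / 2) {s z : ℂ} (hs : 1 ≤ s.re)
    (hs3 : s.re ≤ 2) (hz : ‖z - s‖ ≤ η) :
    ‖zetaH z‖ ≤ (20 + 4 / η) * 4 * (2 + |s.im|) ^ (1 + 2 * η) := by
  have h1 := re_mem_of_norm_sub_le hz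
  have h3 := im_abs_le_add hz
  have him := abs_nonneg s.im
  refine (norm_zetaH_le hη hη2 (by linarith) (by linarith)).trans ?_
  have h0 : 0 < 2 + |s.im| := by linarith
  rw [rpow_add h0, rpow_one, mul_assoc, mul_assoc]
  have h4 : (2 + |z.im|) ≤ 2 * (2 + |s.im|) := by linarith
  have h5 : (2 + |z.im|) ^ (2 * η) ≤ 2 * (2 + |s.im|) ^ (2 * η) :=
    (rpow_le_rpow (by positivity) h4 (by linarith)).trans (two_mul_rpow_le h0.le (by linarith))
  have : 0 ≤ 4 / η := by positivity
  refine mul_le_mul_of_nonneg_left ?_ (by positivity)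
  calc (2 + |z.im|) * (2 + |z.im|) ^ (2 * η) ≤ (2 * (2 + |s.im|)) * (2 * (2 + |s.im|) ^ (2 * η)) := by
        gcongr
    _ = _ := by ring

/-- Lower bound for `(s - 1) ζ(s)` in `1 ≤ Re s ≤ 2`. -/
lemma norm_zetaH_ge {η : ℝ} (hη : 0 < η) :
    ∃ c : ℝ, 0 < c ∧ c ≤ 1 ∧
      ∀ s : ℂ, 1 ≤ s.re → s.re ≤ 2 → c * (2 + |s.im|) ^ (1 - η) ≤ ‖zetaH s‖ := by
  set ε : ℝ := min (η / 21) (1 / 4) with hε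
  have hε0 : 0 < ε := lt_min (by linarith) (by norm_num)
  have hε1 : ε ≤ η / 21 := min_le_left _ _
  have hε4 : ε ≤ 1 / 4 := min_le_right _ _
  obtain ⟨c, hc, hc1, h⟩ := norm_LFunction_pow_four_ge_of_sq_eq_one hε0 hε4
  set c' := c / 9 with hc'
  have hc'0 : 0 < c' := by positivity
  set C : ℝ := (20 + 4 / ε) * 4 / ε with hC
  have hC1 : 1 ≤ C := by
    rw [hC, le_div_iff₀ hε0]
    have : 0 ≤ 4 / ε := by positivity
    linarith
  -- bounded heights
  obtain ⟨c₀, hc₀, h₀⟩ : ∃ c₀ : ℝ, 0 < c₀ ∧ ∀ s : ℂ, 1 ≤ s.re → s.re ≤ 2 → |s.im| ≤ 1 →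
      c₀ ≤ ‖zetaH s‖ := by
    have hK : IsCompact (Set.Icc (1 : ℝ) 2 ×ℂ Set.Icc (-1 : ℝ) 1) := isCompact_Icc.reProdIm isCompact_Icc
    obtain ⟨z, hz, hmin⟩ := hK.exists_isMinOn ⟨1, by simp [mem_reProdIm]⟩
      differentiable_zetaH.continuous.norm.continuousOn
    refine ⟨‖zetaH z‖, norm_pos_iff.2 (zetaH_ne_zero hz.1.1), fun s h1 h2 h3 => hmin ?_⟩
    exact ⟨⟨h1, h2⟩, abs_le.1 h3⟩
  refine ⟨min 1 (min (c' * (c' / (2 * C)) ^ 3 / 2) (c₀ / 3)), by positivity, min_le_left _ _, ?_⟩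
  intro s hs hs2
  set X : ℝ := 2 + |s.im| with hX
  have hX1 : 1 ≤ X := by rw [hX]; linarith [abs_nonneg s.im]
  have hX0 : 0 < X := by linarith
  rcases le_or_gt |s.im| 1 with him | him
  · refine le_trans ?_ (h₀ s hs hs2 him)
    have : X ^ (1 - η) ≤ 3 := by
      calc X ^ (1 - η) ≤ X ^ (1 : ℝ) := rpow_le_rpow_of_exponent_le hX1 (by linarith)
        _ ≤ 3 := by rw [rpow_one]; linarith
    calc _ ≤ c₀ / 3 * 3 := by
          gcongr
          exact (min_le_right _ _).trans (min_le_right _ _)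
      _ = _ := by ring
  · set y := s.im with hy
    set Y : ℝ := X ^ (3 * ε) with hY
    have hY1 : 1 ≤ Y := one_le_rpow hX1 (by linarith)
    have h2Y : X ^ (2 * ε) ≤ Y := rpow_le_rpow_of_exponent_le hX1 (by linarith)
    have hY7 : Y ^ 7 = X ^ (21 * ε) := by
      rw [hY, ← rpow_natCast, ← rpow_mul hX0.le]
      congr 1; push_cast; ring
    have hXn : ‖((X : ℝ) : ℂ)‖ = X := by rw [norm_real, norm_eq_abs, abs_of_pos hX0]
    have hs' : s = 1 + ((s.re - 1 : ℝ) : ℂ) + I * (y : ℝ) := by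
      apply Complex.ext <;> simp [hy]
    have := lower_bound_of_deriv (f := fun z => zetaH z / (X : ℂ)) (y := y) hc'0
      (by rw [hc']; linarith) hC1 hY1 ?_ ?_ ?_ (x := s.re - 1) ⟨by linarith, by linarith⟩
    · rw [← hs', hY7, norm_div, hXn, le_div_iff₀ hX0] at this
      refine le_trans ?_ this
      calc _ ≤ c' * (c' / (2 * C)) ^ 3 / 2 * X ^ (1 - 21 * ε) := by
            gcongr
            · exact (min_le_right _ _).trans (min_le_left _ _)
            · linarith
        _ = _ := by rw [rpow_sub hX0, rpow_one]; ring
    · intro x _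
      exact (differentiable_zetaH _).div_const _
    · intro x hx
      have hx0 := hx.1
      have hne : (1 + x + I * y : ℂ) ≠ 1 := by
        intro h
        have := congrArg re h
        simp at this
        exact hx0.ne' this
      have h1 := h 1 1 (by simp) x y hx.1 hx.2
      rw [LFunction_modOne_eq, cast_one, one_mul, ← hX] at h1
      rw [zetaH_of_ne hne, show (1 + x + I * y : ℂ) - 1 = x + I * y by ring,
        norm_div, norm_mul, hXn]
      have h2 : X / 3 ≤ ‖(x + I * y : ℂ)‖ := by
        have h1 := abs_im_le_norm (x + I * y : ℂ)
        have h2 : (x + I * y : ℂ).im = y := by simp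
        rw [h2] at h1
        linarith
      have h3 : 1 / 3 ≤ ‖(x + I * (2 * y : ℝ) : ℂ)‖ / X := by
        rw [le_div_iff₀ hX0]
        have h1 := abs_im_le_norm (x + I * (2 * y : ℝ) : ℂ)
        have h2 : (x + I * (2 * y : ℝ) : ℂ).im = 2 * y := by simp
        rw [h2, abs_mul, abs_two] at h1
        linarith
      have e2 : X ^ (4 * ε) ≤ Y ^ 4 := by
        rw [hY, ← rpow_natCast, ← rpow_mul hX0.le]
        apply rpow_le_rpow_of_exponent_le hX1; push_cast; linarith
      calc c' ^ 4 * x ^ 3 / Y ^ 4 = (1 / 3) ^ 4 * ((c / 3) ^ 4 * x ^ 3 / Y ^ 4) := by rw [hc']; ring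
        _ ≤ (1 / 3) ^ 4 * ((c / 3) ^ 4 * x ^ 3 / X ^ (4 * ε)) := by gcongr
        _ ≤ (1 / 3) ^ 4 * ((c / 3) * x ^ 3 / X ^ (4 * ε)) := by
            gcongr
            exact pow_le_of_le_one (by positivity) (by linarith) (by norm_num)
        _ = (1 / 3) ^ 4 * (c * x ^ 3 / X ^ (4 * ε) * (1 / 3)) := by ring
        _ ≤ (1 / 3) ^ 4 * ‖riemannZeta (1 + x + I * y)‖ ^ 4 := by
            gcongr
            exact le_trans (by gcongr) h1
        _ = (X / 3 * ‖riemannZeta (1 + x + I * y)‖ / X) ^ 4 := by field_simp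
        _ ≤ _ := by gcongr
    · intro x hx
      have hd : deriv (fun z => zetaH z / (X : ℂ)) (1 + x + I * y)
          = deriv zetaH (1 + x + I * y) / X := deriv_div_const _
      rw [hd, norm_div, hXn, div_le_iff₀ hX0]
      have h := norm_deriv_le_of_forall_mem_sphere_norm_le (f := zetaH)
        (c := 1 + x + I * y) (R := ε) (C := (20 + 4 / ε) * 4 * X ^ (1 + 2 * ε)) hε0
        differentiable_zetaH.diffContOnCl (fun z hz => ?_)
      · refine h.trans ?_
        rw [rpow_add hX0, rpow_one, hC]
        calc _ = (20 + 4 / ε) * 4 / ε * X ^ (2 * ε) * X := by ring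
          _ ≤ _ := by gcongr
      · have hz' : ‖z - (1 + x + I * y)‖ ≤ ε := by
          have : ‖z - (1 + x + I * y)‖ = ε := by simpa [dist_eq_norm] using hz
          exact this.le
        have := norm_zetaH_le_of_near hε0 (by linarith) (s := 1 + x + I * y)
          (by simp; exact hx.1) (by simp; linarith [hx.2]) hz'
        simpa [hX] using this

lemma norm_iteratedDeriv_logDeriv_zetaH_le (k : ℕ) :
    ∃ C : ℝ, 0 < C ∧ ∀ s : ℂ, 1 ≤ s.re → s.re ≤ 2 →
      ‖iteratedDeriv k (logDeriv zetaH) s‖ ≤ C * (2 + |s.im|) ^ (1 / 2 : ℝ) := by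
  set b : ℝ := 1 / (6 * (k + 1)) with hb
  have hb0 : 0 < b := by positivity
  have hb1 : b ≤ 1 / 6 := by
    rw [hb]; apply one_div_le_one_div_of_le (by norm_num)
    have : (0 : ℝ) ≤ k := by positivity
    linarith
  obtain ⟨c, hc, hc1, h⟩ := norm_zetaH_ge hb0
  refine ⟨k.factorial * (4 * ((20 + 4 / b) * 4) / (b * c)) ^ (k + 1), by positivity, ?_⟩
  intro s hs hs2
  set X : ℝ := 2 + |s.im| with hX
  have hX1 : 1 ≤ X := by rw [hX]; linarith [abs_nonneg s.im]
  have hX0 : 0 < X := by linarith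
  have key := norm_iteratedDeriv_logDeriv_le differentiable_zetaH
    (s := s) (a := b) (M := (20 + 4 / b) * 4 * X ^ (1 + 2 * b)) (m := c * X ^ (1 - b)) hb0
    (by positivity) (fun z hz => norm_zetaH_le_of_near hb0 (by linarith) hs hs2 hz) (h s hs hs2) k
  refine key.trans (le_of_eq ?_)
  have : 4 * ((20 + 4 / b) * 4 * X ^ (1 + 2 * b)) / (b * (c * X ^ (1 - b)))
      = 4 * ((20 + 4 / b) * 4) / (b * c) * X ^ (3 * b) := by
    rw [show 1 + 2 * b = (1 - b) + 3 * b by ring, rpow_add hX0 (1 - b)]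
    have : X ^ (1 - b) ≠ 0 := by positivity
    field_simp
  rw [this, mul_pow, ← rpow_natCast (X ^ _), ← rpow_mul hX0.le, ← mul_assoc]
  congr 2
  rw [hb]; push_cast; field_simp; norm_num

lemma norm_iteratedDeriv_dslope_zetaH_le (k : ℕ) :
    ∃ C : ℝ, 0 < C ∧ ∀ s : ℂ, 1 ≤ s.re → s.re ≤ 2 →
      ‖iteratedDeriv k (dslope zetaH 1) s‖ ≤ C * (2 + |s.im|) ^ (1 / 2 : ℝ) := by
  have hd := differentiable_dslope differentiable_zetaH 1
  obtain ⟨C₀, hC₀⟩ := (isCompact_closedBall (1 : ℂ) 1).exists_bound_of_continuousOn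
    hd.continuous.continuousOn
  have hbd : ∀ s : ℂ, 1 ≤ s.re → s.re ≤ 2 → ∀ z : ℂ, ‖z - s‖ ≤ 1 / 4 →
      ‖dslope zetaH 1 z‖ ≤ (max C₀ 0 + 1000) * (2 + |s.im|) ^ (1 / 2 : ℝ) := by
    intro s hs hs2 z hz
    have hX1 : 1 ≤ (2 + |s.im|) ^ (1 / 2 : ℝ) :=
      one_le_rpow (by linarith [abs_nonneg s.im]) (by norm_num)
    have h0 : 0 ≤ max C₀ 0 := le_max_right _ _
    rcases le_or_gt ‖z - 1‖ 1 with h1 | h1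
    · calc ‖dslope zetaH 1 z‖ ≤ C₀ := hC₀ z (by simpa [dist_eq_norm] using h1)
        _ ≤ (max C₀ 0 + 1000) * 1 := by linarith [le_max_left C₀ 0]
        _ ≤ _ := by gcongr
    · have hz1 : z ≠ 1 := by rintro rfl; norm_num at h1
      rw [dslope_of_ne _ hz1, slope_def_field, norm_div, zetaH_one, div_le_iff₀ (by linarith)]
      have h2 := norm_zetaH_le_of_near (η := 1 / 4) (by norm_num) (by norm_num) hs hs2 hz
      have h3 : 2 + |s.im| ≤ 4 * ‖z - 1‖ := by
        have h1' := abs_im_le_norm (z - 1)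
        have h2' := im_abs_le_add (z := s) (s := z) (a := 1 / 4) (by rw [norm_sub_rev]; exact hz)
        rw [sub_im, one_im, sub_zero] at h1'
        linarith
      rw [rpow_add (by linarith [abs_nonneg s.im]), rpow_one] at h2
      norm_num at h2 hX1 ⊢
      set W := (2 + |s.im|) ^ (1 / 2 : ℝ)
      have h4 : ‖zetaH z - 1‖ ≤ ‖zetaH z‖ + 1 := by
        refine (norm_sub_le _ _).trans ?_; simp
      have h5 : (2 + |s.im|) * W ≤ 4 * ‖z - 1‖ * W := by gcongr
      have h6 : 0 ≤ max C₀ 0 * W * ‖z - 1‖ := by positivity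
      nlinarith
  refine ⟨k.factorial * ((max C₀ 0 + 1000)) / (1 / 4) ^ k, by positivity, ?_⟩
  intro s hs hs2
  have h := norm_iteratedDeriv_le_of_forall_mem_sphere_norm_le k (R := 1 / 4)
    (c := s) (by norm_num) hd.diffContOnCl
    (C := (max C₀ 0 + 1000) * (2 + |s.im|) ^ (1 / 2 : ℝ)) (fun z hz => hbd s hs hs2 z (by
      have : ‖z - s‖ = 1 / 4 := by simpa [dist_eq_norm] using hz
      exact this.le))
  refine h.trans (le_of_eq (by ring))

lemma one_add_sq_le_norm_kernel {σ : ℝ} (hσ : 1 ≤ σ) (t : ℝ) :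
    1 + t ^ 2 ≤ ‖((σ + t * I : ℂ) * (σ + t * I + 1))‖ := by
  have h1 : 1 + t ^ 2 ≤ ‖(σ + t * I : ℂ)‖ ^ 2 := by
    rw [Complex.sq_norm, normSq_add_mul_I]; nlinarith
  have h2 : ‖(σ + t * I : ℂ)‖ ^ 2 ≤ ‖(σ + t * I + 1 : ℂ)‖ ^ 2 := by
    rw [show (σ + t * I + 1 : ℂ) = ((σ + 1 : ℝ) : ℂ) + t * I by push_cast; ring]
    rw [Complex.sq_norm, normSq_add_mul_I, Complex.sq_norm, normSq_add_mul_I]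
    nlinarith
  have h3 := (pow_le_pow_iff_left₀ (norm_nonneg _) (norm_nonneg _) two_ne_zero).1 h2
  rw [norm_mul]
  calc _ ≤ _ := h1
    _ = ‖(σ + t * I : ℂ)‖ * ‖(σ + t * I : ℂ)‖ := sq _
    _ ≤ _ := by gcongr

lemma kernel_ne_zero {σ : ℝ} (hσ : 1 ≤ σ) (t : ℝ) :
    ((σ + t * I : ℂ) * (σ + t * I + 1)) ≠ 0 := by
  have h := one_add_sq_le_norm_kernel hσ t
  exact norm_pos_iff.1 (lt_of_lt_of_le (by positivity) h)

lemma continuous_kernel {σ : ℝ} (hσ : 1 ≤ σ) :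
    Continuous fun t : ℝ => 1 / ((σ + t * I : ℂ) * (σ + t * I + 1)) :=
  continuous_const.div (by fun_prop) (kernel_ne_zero hσ)

lemma norm_kernel_le {σ : ℝ} (hσ : 1 ≤ σ) (t : ℝ) :
    ‖1 / ((σ + t * I : ℂ) * (σ + t * I + 1))‖ ≤ 1 / (1 + t ^ 2) := by
  rw [norm_div, norm_one]
  exact one_div_le_one_div_of_le (by positivity) (one_add_sq_le_norm_kernel hσ t)

lemma integrable_kernel {σ : ℝ} (hσ : 1 ≤ σ) :
    Integrable fun t : ℝ => 1 / ((σ + t * I : ℂ) * (σ + t * I + 1)) := by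
  refine integrable_inv_one_add_sq.mono' (continuous_kernel hσ).aestronglyMeasurable
    (Eventually.of_forall fun t => ?_)
  simpa using norm_kernel_le hσ t

lemma integrable_sqrt_weight :
    Integrable fun t : ℝ => (2 + |t|) ^ (1 / 2 : ℝ) / (1 + t ^ 2) := by
  have h := (integrable_rpow_neg_one_add_norm_sq (E := ℝ) (μ := volume) (r := 3 / 2)
    (by norm_num)).const_mul 3
  refine h.mono' ?_ (Eventually.of_forall fun t => ?_)
  · refine Continuous.aestronglyMeasurable ?_
    refine Continuous.div ?_ (by fun_prop) (fun t => by positivity)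
    exact Continuous.rpow_const (by fun_prop) (fun t => .inr (by norm_num))
  · have h0 : 0 < 1 + t ^ 2 := by positivity
    rw [norm_eq_abs, abs_of_nonneg (by positivity), norm_eq_abs, sq_abs,
      div_le_iff₀ h0, mul_assoc, ← rpow_add_one h0.ne']
    have h1 : (2 + |t|) ≤ 9 * (1 + t ^ 2) ^ (1 / 2 : ℝ) := by
      rw [← sqrt_eq_rpow]
      have := sqrt_le_sqrt (show t ^ 2 ≤ 1 + t ^ 2 by linarith)
      rw [sqrt_sq_eq_abs] at this
      have h2 := sqrt_le_sqrt (show 1 ≤ 1 + t ^ 2 by nlinarith)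
      rw [Real.sqrt_one] at h2
      linarith
    calc (2 + |t|) ^ (1 / 2 : ℝ) ≤ (9 * (1 + t ^ 2) ^ (1 / 2 : ℝ)) ^ (1 / 2 : ℝ) := by gcongr
      _ = 9 ^ (1 / 2 : ℝ) * (1 + t ^ 2) ^ (1 / 4 : ℝ) := by
          rw [mul_rpow (by norm_num) (by positivity), ← rpow_mul h0.le]; norm_num
      _ = _ := by
          linarith

lemma integral_cpow_kernel {σ : ℝ} (hσ : 1 ≤ σ) {u : ℝ} (hu : 0 < u) :
    ∫ t : ℝ, (u : ℂ) ^ (-(σ + t * I)) *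
      (1 / ((σ + t * I : ℂ) * (σ + t * I + 1)))
      = 2 * π * (max (1 - u) 0 : ℝ) := by
  set f : ℝ → ℂ := fun t => Set.indicator (Set.Ioc 0 1) (fun _ => 1 : ℝ → ℂ) t -
    Set.indicator (Set.Ioc 0 1) (fun t => (t : ℂ) ^ (1 : ℂ) : ℝ → ℂ) t with hf
  have hm : ∀ s : ℂ, 0 < s.re → HasMellin f s (1 / (s * (s + 1))) := by
    intro s hs
    have h1 := hasMellin_one_Ioc hs
    have h2 := hasMellin_cpow_Ioc 1 (s := s) (by simp; linarith)
    have h3 := hasMellin_sub h1.1 h2.1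
    rw [h1.2, h2.2] at h3
    refine ⟨h3.1, h3.2.trans ?_⟩
    have hs0 : s ≠ 0 := by rintro rfl; simp at hs
    have hs1 : s + 1 ≠ 0 := by
      intro h
      have := congrArg re h
      simp at this; linarith
    field_simp; ring
  have hfe : ∀ t : ℝ, 0 < t → f t = (max (1 - t) 0 : ℝ) := by
    intro t ht
    rcases le_or_gt t 1 with h | h
    · have : t ∈ Set.Ioc (0 : ℝ) 1 := ⟨ht, h⟩
      simp only [hf, Set.indicator_of_mem this, cpow_one]
      rw [max_eq_left (by linarith)]; push_cast; ring
    · have : t ∉ Set.Ioc (0 : ℝ) 1 := fun hh => absurd hh.2 (by linarith)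
      simp only [hf, Set.indicator_of_notMem this]
      rw [max_eq_right (by linarith)]; simp
  have hre : ∀ t : ℝ, (σ + t * I : ℂ).re = σ := by intro t; simp
  have hme : ∀ t : ℝ, mellin f (σ + t * I)
      = 1 / ((σ + t * I : ℂ) * (σ + t * I + 1)) := by
    intro t
    exact (hm _ (by rw [hre]; linarith)).2
  have hc : ContinuousAt f u := by
    have : ContinuousAt (fun t : ℝ => ((max (1 - t) 0 : ℝ) : ℂ)) u := by fun_prop
    refine this.congr ?_
    filter_upwards [lt_mem_nhds hu] with t ht
    exact (hfe t ht).symm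
  have h := mellinInv_mellin_eq σ f hu (hm σ (by simp; linarith)).1 ?_ hc
  · rw [hfe u hu, mellinInv] at h
    simp_rw [hme] at h
    simp only [smul_eq_mul] at h
    have h2 : 2 * (π : ℂ) * ((1 / (2 * π) : ℝ) : ℂ) = 1 := by
      have : (π : ℂ) ≠ 0 := mod_cast pi_ne_zero
      push_cast; field_simp
    rw [← h, real_smul, ← mul_assoc, h2, one_mul]
  · refine (integrable_kernel hσ).congr (Eventually.of_forall fun t => ?_)
    exact (hme t).symm

/-- A Cesàro-weighted partial sum is controlled by the size of the Dirichlet series on a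
vertical line. -/
lemma norm_cesaro_sum_le : ∃ K : ℝ, 0 < K ∧ ∀ (b : ℕ → ℂ) (σ x W : ℝ), 1 ≤ σ → 0 < x →
    LSeriesSummable b σ →
    (∀ t : ℝ, ‖LSeries b (σ + t * I)‖ ≤ W * (2 + |t|) ^ (1 / 2 : ℝ)) →
    ‖∑ m ∈ Icc 1 ⌊x⌋₊, b m * ((1 - m / x : ℝ) : ℂ)‖ ≤ K * W * x ^ σ := by
  set K₀ : ℝ := ∫ t : ℝ, (2 + |t|) ^ (1 / 2 : ℝ) / (1 + t ^ 2) with hK₀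
  have hK₀0 : 0 ≤ K₀ := integral_nonneg fun t => by positivity
  refine ⟨K₀ + 1, by linarith, ?_⟩
  intro b σ x W hσ hx hb hW
  have hW0 : 0 ≤ W := by
    have := (norm_nonneg _).trans (hW 0)
    by_contra! h
    have h2 : (0 : ℝ) < (2 + |(0 : ℝ)|) ^ (1 / 2 : ℝ) := by positivity
    nlinarith
  set k : ℝ → ℂ := fun t => 1 / ((σ + t * I : ℂ) * (σ + t * I + 1)) with hk
  set F : ℕ → ℝ → ℂ := fun m t => (x : ℂ) ^ (σ + t * I) * k t *
    LSeries.term b (σ + t * I) m with hF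
  have hxc : (x : ℂ) ≠ 0 := mod_cast hx.ne'
  have hFeq : ∀ m : ℕ, m ≠ 0 → ∀ t, F m t =
      b m * ((((m : ℝ) / x : ℝ) : ℂ) ^ (-(σ + t * I : ℂ)) * k t) := by
    intro m hm t
    have hm0 : (0 : ℝ) < m := mod_cast Nat.pos_of_ne_zero hm
    simp only [hF, LSeries.term_of_ne_zero hm]
    rw [div_eq_mul_inv (m : ℝ), ofReal_mul, mul_cpow_ofReal_nonneg hm0.le
      (by positivity), cpow_neg, ofReal_inv, inv_cpow, cpow_neg,
      inv_inv]
    · push_cast; ring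
    · rw [arg_ofReal_of_nonneg hx.le]; exact pi_pos.ne
  have hxn : ∀ t : ℝ, ‖(x : ℂ) ^ (σ + t * I)‖ = x ^ σ := by
    intro t; rw [norm_cpow_eq_rpow_re_of_pos hx]; simp
  have hnorm : ∀ m t, ‖F m t‖ = x ^ σ * ‖k t‖ * ‖LSeries.term b σ m‖ := by
    intro m t
    simp only [hF, norm_mul, hxn]
    rw [LSeries.norm_term_eq, LSeries.norm_term_eq]; simp
  have hkint : Integrable k := integrable_kernel hσ
  have hFint : ∀ m, Integrable (F m) := by
    intro m
    have hcont : Continuous (F m) := by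
      rcases eq_or_ne m 0 with rfl | hm
      · simp only [hF, LSeries.term_zero, mul_zero]; exact continuous_const
      · have hm0 : (m : ℂ) ≠ 0 := mod_cast hm
        simp only [hF, LSeries.term_of_ne_zero hm]
        refine ((Continuous.const_cpow (by fun_prop) (.inl hxc)).mul (continuous_kernel hσ)).mul ?_
        refine continuous_const.div (Continuous.const_cpow (by fun_prop) (.inl hm0)) (fun t => ?_)
        simp [hm]
    refine (hkint.norm.const_mul (x ^ σ * ‖LSeries.term b σ m‖)).mono'
      hcont.aestronglyMeasurable (Eventually.of_forall fun t => ?_)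
    rw [hnorm]; exact le_of_eq (by ring)
  have hsum : Summable fun m => ∫ t, ‖F m t‖ := by
    simp_rw [hnorm, mul_assoc]
    simp_rw [integral_const_mul, integral_mul_const]
    exact ((summable_norm_iff.2 hb).mul_left _).mul_left _
  have hS := hasSum_integral_of_summable_integral_norm hFint hsum
  have hterm : ∀ m, (∫ t, F m t) = if m ∈ Icc 1 ⌊x⌋₊ then
      2 * π * (b m * ((1 - m / x : ℝ) : ℂ)) else 0 := by
    intro m
    rcases eq_or_ne m 0 with rfl | hm
    · simp [hF]
    · simp_rw [hFeq m hm]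
      have hm0 : (0 : ℝ) < m := mod_cast Nat.pos_of_ne_zero hm
      rw [integral_const_mul, integral_cpow_kernel hσ (by positivity)]
      split_ifs with h
      · have : (m : ℝ) ≤ x := (le_floor_iff hx.le).1 (mem_Icc.1 h).2
        rw [max_eq_left]
        · ring
        · rw [sub_nonneg, div_le_one hx]; exact this
      · have : x < m := by
          by_contra! h'
          exact h (mem_Icc.2 ⟨Nat.pos_of_ne_zero hm, le_floor h'⟩)
        rw [max_eq_right]
        · simp
        · rw [sub_nonpos, one_le_div hx]; exact this.le
  simp_rw [hterm] at hS
  have hS2 := hS.unique (hasSum_sum_of_ne_finset_zero (s := Icc 1 ⌊x⌋₊)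
    (fun m hm => by rw [if_neg hm]))
  rw [sum_congr rfl (fun m hm => if_pos hm), ← mul_sum] at hS2
  have hbound : ‖∫ t, ∑' m, F m t‖ ≤ ∫ t : ℝ, x ^ σ * W * ((2 + |t|) ^ (1 / 2 : ℝ) / (1 + t ^ 2)) := by
    refine norm_integral_le_of_norm_le (integrable_sqrt_weight.const_mul _)
      (Eventually.of_forall fun t => ?_)
    simp only [hF]
    rw [tsum_mul_left, norm_mul, norm_mul, hxn]
    calc x ^ σ * ‖k t‖ * ‖LSeries b (σ + t * I)‖
        ≤ x ^ σ * (1 / (1 + t ^ 2)) * (W * (2 + |t|) ^ (1 / 2 : ℝ)) := by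
          gcongr
          · exact norm_kernel_le hσ t
          · exact hW t
      _ = _ := by ring
  rw [hS2, integral_const_mul, norm_mul] at hbound
  have h2pi : (1 : ℝ) ≤ ‖(2 * π : ℂ)‖ := by
    rw [show (2 * π : ℂ) = ((2 * π : ℝ) : ℂ) by push_cast; ring, norm_real,
      norm_eq_abs, abs_of_pos two_pi_pos]
    linarith [pi_gt_three]
  have hxs : 0 < x ^ σ := by positivity
  calc _ = 1 * ‖∑ m ∈ Icc 1 ⌊x⌋₊, b m * ((1 - m / x : ℝ) : ℂ)‖ := (one_mul _).symm
    _ ≤ ‖(2 * π : ℂ)‖ * ‖∑ m ∈ Icc 1 ⌊x⌋₊, b m * ((1 - m / x : ℝ) : ℂ)‖ := by gcongr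
    _ ≤ x ^ σ * W * K₀ := hbound
    _ ≤ (K₀ + 1) * W * x ^ σ := by
        have : 0 ≤ W * x ^ σ := by positivity
        nlinarith

/-- Abel's inequality for monotone weights. -/
lemma norm_sum_Ioc_mul_le {w : ℕ → ℝ} {b : ℕ → ℂ} {T : ℝ} {M N : ℕ} (hMN : M < N)
    (hw0 : ∀ m, M < m → m ≤ N → 0 ≤ w m)
    (hw : ∀ m, M < m → m < N → w (m + 1) ≤ w m)
    (hB : ∀ n, M ≤ n → n ≤ N → ‖∑ m ∈ Icc 1 n, b m‖ ≤ T) :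
    ‖∑ m ∈ Ioc M N, (w m : ℂ) * b m‖ ≤ 2 * T * w (M + 1) := by
  have hT : 0 ≤ T := (norm_nonneg _).trans (hB M le_rfl hMN.le)
  have key : ∀ n, M < n → n ≤ N →
      ‖∑ m ∈ Ioc M n, (w m : ℂ) * b m - w n * ∑ m ∈ Icc 1 n, b m‖ ≤ T * (2 * w (M + 1) - w n) := by
    intro n hn
    induction n, hn using le_induction with
    | base =>
      intro h
      rw [succ_eq_add_one, Ioc_succ_singleton, sum_singleton,
        ← succ_eq_add_one, sum_Icc_succ_top (by omega), mul_add, sub_add_cancel_right,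
        norm_neg, norm_mul, norm_real, norm_eq_abs, abs_of_nonneg (hw0 _ (by omega) h)]
      have := hB M le_rfl hMN.le
      have h0 := hw0 (M + 1) (by omega) h
      nlinarith
    | succ n hn ih =>
      intro h
      have ih := ih (by omega)
      have h1 := hw n (by omega) (by omega)
      rw [sum_Ioc_succ_top (by omega), sum_Icc_succ_top (by omega)]
      have e1 : ∑ m ∈ Ioc M n, (w m : ℂ) * b m + w (n + 1) * b (n + 1)
          - w (n + 1) * (∑ m ∈ Icc 1 n, b m + b (n + 1))
          = (∑ m ∈ Ioc M n, (w m : ℂ) * b m - w n * ∑ m ∈ Icc 1 n, b m)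
            + ((w n - w (n + 1) : ℝ) : ℂ) * ∑ m ∈ Icc 1 n, b m := by push_cast; ring
      rw [e1]
      refine (norm_add_le _ _).trans ?_
      rw [norm_mul, norm_real, norm_eq_abs, abs_of_nonneg (by linarith)]
      have h2 := hB n (by omega) (by omega)
      nlinarith
  have h := key N hMN le_rfl
  have h1 := norm_add_le (∑ m ∈ Ioc M N, (w m : ℂ) * b m - w N * ∑ m ∈ Icc 1 N, b m)
    (w N * ∑ m ∈ Icc 1 N, b m)
  rw [sub_add_cancel, norm_mul, norm_real, norm_eq_abs,
    abs_of_nonneg (hw0 N hMN le_rfl)] at h1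
  have h3 := mul_le_mul_of_nonneg_left (hB N hMN.le le_rfl) (hw0 N hMN le_rfl)
  nlinarith

lemma exists_log_pow_le (j : ℕ) {δ : ℝ} (hδ : 0 < δ) :
    ∃ C : ℝ, 1 ≤ C ∧ ∀ x : ℝ, 1 ≤ x → log x ^ j ≤ C * x ^ δ := by
  set ε := δ / (j + 1) with hε
  have hε0 : 0 < ε := by positivity
  refine ⟨max 1 ((1 / ε) ^ j), le_max_left _ _, fun x hx => ?_⟩
  have h := log_le_rpow_div (by linarith : 0 ≤ x) hε0
  have hx0 : 0 < x := by linarith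
  calc log x ^ j ≤ (x ^ ε / ε) ^ j := by
        bound
    _ = (1 / ε) ^ j * x ^ (ε * j) := by
        rw [rpow_mul_natCast hx0.le, ← mul_pow]; congr 1; ring
    _ ≤ max 1 ((1 / ε) ^ j) * x ^ δ := by
        gcongr
        · exact le_max_right _ _
        · rw [hε, div_mul_eq_mul_div, div_le_iff₀ (by positivity)]; nlinarith

lemma one_le_log_of_three_le {N : ℕ} (hN : 3 ≤ N) : 1 ≤ log N := by
  rw [le_log_iff_exp_le (by positivity)]
  have : (3 : ℝ) ≤ N := mod_cast hN
  linarith [exp_one_lt_d9]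

lemma norm_sum_mul_sub_le : ∃ K : ℝ, 1 ≤ K ∧ ∀ (b : ℕ → ℂ) (W : ℝ),
    (∀ σ : ℝ, 1 < σ → LSeriesSummable b σ) →
    (∀ σ t : ℝ, 1 < σ → σ ≤ 2 →
      ‖LSeries b (σ + t * I)‖ ≤ W * (2 + |t|) ^ (1 / 2 : ℝ)) →
    ∀ N : ℕ, 3 ≤ N → ‖∑ m ∈ Icc 1 N, b m * ((N : ℂ) - m)‖ ≤ K * W * N ^ 2 := by
  obtain ⟨K, hK, h⟩ := norm_cesaro_sum_le
  refine ⟨max 1 (3 * K), le_max_left _ _, ?_⟩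
  intro b W hb hW N hN
  have hL := one_le_log_of_three_le hN
  set L := log N with hLd
  have hN0 : (0 : ℝ) < N := by positivity
  have hσ : 1 < 1 + 1 / L := by have : 0 < 1 / L := by positivity
                                linarith
  have hσ2 : 1 + 1 / L ≤ 2 := by
    have : 1 / L ≤ 1 := by rw [div_le_one (by linarith)]; exact hL
    linarith
  have h1 := h b (1 + 1 / L) N W hσ.le hN0 (by simpa using hb _ hσ) (fun t => hW _ t hσ hσ2)
  have hW0 : 0 ≤ W := by
    have := (norm_nonneg _).trans (hW 2 0 (by norm_num) le_rfl)
    by_contra! h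
    have h2 : (0 : ℝ) < (2 + |(0 : ℝ)|) ^ (1 / 2 : ℝ) := by positivity
    nlinarith
  rw [floor_natCast] at h1
  have e1 : ∑ m ∈ Icc 1 N, b m * ((N : ℂ) - m)
      = (N : ℂ) * ∑ m ∈ Icc 1 N, b m * ((1 - (m : ℝ) / N : ℝ) : ℂ) := by
    rw [mul_sum]
    refine sum_congr rfl fun m _ => ?_
    have : (N : ℂ) ≠ 0 := mod_cast hN0.ne'
    push_cast; field_simp
  have e2 : (N : ℝ) ^ (1 + 1 / L) ≤ 3 * N := by
    rw [rpow_add hN0, rpow_one, rpow_def_of_pos hN0, ← hLd,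
      mul_one_div_cancel (by linarith)]
    nlinarith [exp_one_lt_d9]
  rw [e1, norm_mul, Complex.norm_natCast]
  calc _ ≤ (N : ℝ) * (K * W * (3 * N)) := by
        gcongr
        exact h1.trans (by gcongr)
    _ = 3 * K * W * N ^ 2 := by ring
    _ ≤ _ := by
        bound

lemma norm_sum_le_of_LSeries (j : ℕ) : ∃ C : ℝ, 1 ≤ C ∧ ∀ (a : ℕ → ℂ) (W : ℝ), 1 ≤ W →
    (∀ m, 1 ≤ m → ‖a m‖ ≤ 1 + log m) →
    (∀ σ : ℝ, 1 < σ → LSeriesSummable (fun m => (log m : ℂ) ^ (2 * j) * a m) σ) →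
    (∀ σ t : ℝ, 1 < σ → σ ≤ 2 →
      ‖LSeries (fun m => (log m : ℂ) ^ (2 * j) * a m) (σ + t * I)‖
        ≤ W * (2 + |t|) ^ (1 / 2 : ℝ)) →
    ∀ N : ℕ, 3 ≤ N →
      ‖∑ m ∈ Icc 1 N, (log m : ℂ) ^ (2 * j) * a m‖ ≤ C * W * N * log N ^ (j + 1) := by
  obtain ⟨K, hK1, hK⟩ := norm_sum_mul_sub_le
  obtain ⟨C₀, hC₀1, hC₀⟩ := exists_log_pow_le j one_pos
  refine ⟨5 * K + 3 * 2 ^ (2 * j) * (1 + C₀), ?_, ?_⟩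
  · have : 0 ≤ 3 * 2 ^ (2 * j) * (1 + C₀) := by positivity
    linarith
  intro a W hW1 ha hs hW N hN
  set b : ℕ → ℂ := fun m => (log m : ℂ) ^ (2 * j) * a m with hb
  set L := log N with hLd
  have hL : 1 ≤ L := one_le_log_of_three_le hN
  have hN0 : (0 : ℝ) < N := by positivity
  have hN1 : (1 : ℝ) ≤ N := mod_cast (by omega : 1 ≤ N)
  have hLj : 1 ≤ L ^ j := one_le_pow₀ hL
  set H : ℕ := ⌈(N : ℝ) / L ^ j⌉₊ with hH
  have hH1 : (N : ℝ) / L ^ j ≤ H := le_ceil _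
  have hH0 : (0 : ℝ) < H := lt_of_lt_of_le (by positivity) hH1
  have hHN : H ≤ N := ceil_le.2 (div_le_self hN0.le hLj)
  have hHNr : (H : ℝ) ≤ N := mod_cast hHN
  have hH2 : (H : ℝ) ≤ (1 + C₀) * (N / L ^ j) := by
    have h1 := (ceil_lt_add_one (by positivity : 0 ≤ (N : ℝ) / L ^ j)).le
    have h2 := hC₀ N hN1
    rw [rpow_one] at h2
    have h3 : 1 ≤ C₀ * (N / L ^ j) := by
      rw [← mul_div_assoc, le_div_iff₀ (by positivity), one_mul]; exact h2
    linarith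
  have hD1 := hK b W hs hW N hN
  have hD2 := hK b W hs hW (N + H) (by omega)
  have hbm : ∀ m ∈ Ioc N (N + H), ‖b m * (((N + H : ℕ) : ℂ) - m)‖
      ≤ (2 * L) ^ (2 * j) * (3 * L) * H := by
    intro m hm
    rw [mem_Ioc] at hm
    have hm1 : (1 : ℝ) ≤ m := mod_cast (by omega : 1 ≤ m)
    have hmN : (m : ℝ) ≤ (N : ℝ) ^ 2 := by
      have h1 : (m : ℝ) ≤ N + H := mod_cast hm.2
      have h3 : (3 : ℝ) ≤ N := mod_cast hN
      nlinarith
    have hlm : log m ≤ 2 * L := by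
      have := log_le_log (by linarith) hmN
      rwa [log_pow, cast_two] at this
    have hlm0 := log_nonneg hm1
    rw [norm_mul, hb]
    simp only [norm_mul, norm_pow, norm_real, norm_eq_abs, abs_of_nonneg hlm0]
    gcongr
    · grind
    · rw [← cast_sub hm.2, Complex.norm_natCast]
      exact_mod_cast (by omega : N + H - m ≤ H)
  have hsplit : ∑ m ∈ Icc 1 (N + H), b m * (((N + H : ℕ) : ℂ) - m)
      = ∑ m ∈ Icc 1 N, b m * (((N + H : ℕ) : ℂ) - m)
        + ∑ m ∈ Ioc N (N + H), b m * (((N + H : ℕ) : ℂ) - m) := by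
    have : ∀ n, Icc 1 n = Ioc 0 n := fun n => by ext; simp; omega
    rw [this, this, sum_Ioc_consecutive _ (by omega) (by omega)]
  have hid : (H : ℂ) * ∑ m ∈ Icc 1 N, b m
      = ∑ m ∈ Icc 1 (N + H), b m * (((N + H : ℕ) : ℂ) - m) - ∑ m ∈ Icc 1 N, b m * ((N : ℂ) - m)
        - ∑ m ∈ Ioc N (N + H), b m * (((N + H : ℕ) : ℂ) - m) := by
    rw [hsplit, add_sub_right_comm, add_sub_cancel_right, ← sum_sub_distrib, mul_sum]
    refine sum_congr rfl fun m _ => ?_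
    push_cast; ring
  have herr : ‖∑ m ∈ Ioc N (N + H), b m * (((N + H : ℕ) : ℂ) - m)‖
      ≤ H * ((2 * L) ^ (2 * j) * (3 * L) * H) := by
    refine (norm_sum_le_of_le _ hbm).trans ?_
    rw [sum_const, card_Ioc, nsmul_eq_mul]; simp
  have hNH : ((N + H : ℕ) : ℝ) ^ 2 ≤ 4 * N ^ 2 := by
    push_cast; nlinarith
  have hmain : (H : ℝ) * ‖∑ m ∈ Icc 1 N, b m‖
      ≤ 5 * K * W * N ^ 2 + H * ((2 * L) ^ (2 * j) * (3 * L) * H) := by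
    have h := congrArg norm hid
    rw [norm_mul, Complex.norm_natCast] at h
    rw [h]
    refine (norm_sub_le _ _).trans ?_
    have h2 := norm_sub_le (∑ m ∈ Icc 1 (N + H), b m * (((N + H : ℕ) : ℂ) - m))
      (∑ m ∈ Icc 1 N, b m * ((N : ℂ) - m))
    have h3 : K * W * ((N + H : ℕ) : ℝ) ^ 2 ≤ K * W * (4 * N ^ 2) := by gcongr
    linarith
  have hN2 : (N : ℝ) ^ 2 ≤ H * (N * L ^ j) := by
    calc (N : ℝ) ^ 2 = N / L ^ j * (N * L ^ j) := by field_simp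
      _ ≤ _ := by gcongr
  refine le_of_mul_le_mul_left ?_ hH0
  calc _ ≤ _ := hmain
    _ ≤ 5 * K * W * (H * (N * L ^ j)) + H * ((2 * L) ^ (2 * j) * (3 * L) *
          ((1 + C₀) * (N / L ^ j))) := by gcongr
    _ = H * (5 * K * W * N * L ^ j + 3 * 2 ^ (2 * j) * (1 + C₀) * N * L ^ (j + 1)) := by
        have h2 : L ^ (2 * j) = L ^ j * L ^ j := by rw [two_mul, pow_add]
        rw [mul_pow, h2, pow_succ L j]
        field_simp
    _ ≤ H * (5 * K * W * N * L ^ (j + 1) + 3 * 2 ^ (2 * j) * (1 + C₀) * N * L ^ (j + 1) * W) := by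
        bound
    _ = _ := by ring

lemma norm_sum_le_div_log_pow (k : ℕ) : ∃ C : ℝ, 1 ≤ C ∧ ∀ (a : ℕ → ℂ) (W : ℝ), 1 ≤ W →
    (∀ m, 1 ≤ m → ‖a m‖ ≤ 1 + log m) →
    (∀ σ : ℝ, 1 < σ → LSeriesSummable (fun m => (log m : ℂ) ^ (2 * (k + 1)) * a m) σ) →
    (∀ σ t : ℝ, 1 < σ → σ ≤ 2 →
      ‖LSeries (fun m => (log m : ℂ) ^ (2 * (k + 1)) * a m) (σ + t * I)‖
        ≤ W * (2 + |t|) ^ (1 / 2 : ℝ)) →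
    ∀ N : ℕ, 3 ≤ N → ‖∑ m ∈ Icc 1 N, a m‖ ≤ C * W * N / log N ^ k := by
  obtain ⟨C₁, hC₁1, hC₁⟩ := norm_sum_le_of_LSeries (k + 1)
  obtain ⟨C₂, hC₂1, hC₂⟩ := exists_log_pow_le (k + 1) (δ := 1 / 2) (by norm_num)
  refine ⟨2 * (C₁ + 2) * 2 ^ (2 * (k + 1)) + 2 * C₂, by
    have : 0 ≤ 2 * (C₁ + 2) * 2 ^ (2 * (k + 1)) := by positivity
    linarith, ?_⟩
  intro a W hW1 ha hs hW N hN
  set b : ℕ → ℂ := fun m => (log m : ℂ) ^ (2 * (k + 1)) * a m with hb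
  set L := log N with hLd
  have hL : 1 ≤ L := one_le_log_of_three_le hN
  have hN0 : (0 : ℝ) < N := by positivity
  have hN1 : (1 : ℝ) ≤ N := mod_cast (by omega : 1 ≤ N)
  set M : ℕ := ⌊(N : ℝ) ^ (1 / 2 : ℝ)⌋₊ with hM
  have hM1 : 1 ≤ M := le_floor (by simpa using one_le_rpow hN1 (by norm_num))
  have hMN : M < N := by
    have h1 : (N : ℝ) ^ (1 / 2 : ℝ) < N := by
      calc (N : ℝ) ^ (1 / 2 : ℝ) < (N : ℝ) ^ (1 : ℝ) :=
            rpow_lt_rpow_of_exponent_lt (mod_cast (by omega : 1 < N)) (by norm_num)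
        _ = N := rpow_one _
    exact (floor_lt (by positivity)).2 h1
  have hB : ∀ n, M ≤ n → n ≤ N → ‖∑ m ∈ Icc 1 n, b m‖ ≤ (C₁ + 2) * W * N * L ^ (k + 2) := by
    intro n hn hnN
    have hnN' : (n : ℝ) ≤ N := mod_cast hnN
    rcases le_or_gt 3 n with h3 | h3
    · refine (hC₁ a W hW1 ha hs hW n h3).trans ?_
      bound
    · have hone : 1 ≤ L ^ (k + 2) := one_le_pow₀ hL
      have htriv : ‖∑ m ∈ Icc 1 n, b m‖ ≤ ∑ m ∈ Icc 1 n, (2 : ℝ) := by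
        refine norm_sum_le_of_le _ fun m hm => ?_
        rw [mem_Icc] at hm
        have hm1 : (1 : ℝ) ≤ m := mod_cast hm.1
        have hm2 : (m : ℝ) ≤ 2 := mod_cast (by omega : m ≤ 2)
        have h0 := log_nonneg hm1
        have h1 : log m ≤ 1 := (log_le_sub_one_of_pos (by linarith)).trans (by linarith)
        simp only [hb, norm_mul, norm_pow, norm_real, norm_eq_abs, abs_of_nonneg h0]
        calc _ ≤ 1 * (1 + log m) := by
              bound
          _ ≤ 2 := by linarith
      rw [sum_const, card_Icc, nsmul_eq_mul, Nat.add_sub_cancel] at htriv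
      refine htriv.trans ?_
      calc (n : ℝ) * 2 ≤ N * 2 := by gcongr
        _ ≤ N * ((C₁ + 2) * W * L ^ (k + 2)) := by
            gcongr
            nlinarith [mul_le_mul hW1 hone zero_le_one (by linarith)]
        _ = _ := by ring
  have hlogM : ∀ m : ℕ, M < m → L / 2 ≤ log m := by
    intro m hm
    have h1 : (N : ℝ) ^ (1 / 2 : ℝ) ≤ m := (lt_of_floor_lt hm).le
    have h2 := log_le_log (by positivity) h1
    rw [log_rpow hN0] at h2
    linarith
  have habel := norm_sum_Ioc_mul_le (w := fun m => (log m ^ (2 * (k + 1)))⁻¹) (b := b)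
    hMN (fun m hm _ => by
      have := hlogM m hm
      have : 0 ≤ log m := by linarith
      positivity) (fun m hm _ => by
      have h1 := hlogM m hm
      have h0 : 0 < log m := by linarith
      have hm0 : (0 : ℝ) < m := mod_cast (by omega : 0 < m)
      gcongr
      exact_mod_cast le_succ m) hB
  have e1 : ∑ m ∈ Ioc M N, (((log m ^ (2 * (k + 1)))⁻¹ : ℝ) : ℂ) * b m = ∑ m ∈ Ioc M N, a m := by
    refine sum_congr rfl fun m hm => ?_
    have h1 := hlogM m (mem_Ioc.1 hm).1
    have h0 : (log m : ℂ) ≠ 0 := by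
      have : 0 < log m := by linarith
      exact_mod_cast this.ne'
    simp only [hb]
    rw [ofReal_inv, ofReal_pow, inv_mul_cancel_left₀ (pow_ne_zero _ h0)]
  rw [e1] at habel
  have hw : (log (M + 1 : ℕ) ^ (2 * (k + 1)))⁻¹ ≤ 2 ^ (2 * (k + 1)) / L ^ (2 * (k + 1)) := by
    rw [← div_pow, ← inv_div L, inv_pow]
    have := hlogM (M + 1) (by omega)
    gcongr
  have hsmall : ‖∑ m ∈ Icc 1 M, a m‖ ≤ 2 * C₂ * W * N / L ^ k := by
    have h1 : ‖∑ m ∈ Icc 1 M, a m‖ ≤ ∑ m ∈ Icc 1 M, 2 * L := by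
      refine norm_sum_le_of_le _ fun m hm => ?_
      rw [mem_Icc] at hm
      have hm1 : (1 : ℝ) ≤ m := mod_cast hm.1
      have : log m ≤ L := log_le_log (by linarith) (mod_cast (by omega : m ≤ N))
      linarith [ha m hm.1]
    rw [sum_const, card_Icc, nsmul_eq_mul, Nat.add_sub_cancel] at h1
    refine h1.trans ?_
    rw [le_div_iff₀ (by positivity)]
    have h2 := hC₂ N hN1
    have h3 : (M : ℝ) ≤ (N : ℝ) ^ (1 / 2 : ℝ) := floor_le (by positivity)
    calc (M : ℝ) * (2 * L) * L ^ k = 2 * M * L ^ (k + 1) := by ring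
      _ ≤ 2 * (N : ℝ) ^ (1 / 2 : ℝ) * (C₂ * (N : ℝ) ^ (1 / 2 : ℝ)) := by gcongr
      _ = 2 * C₂ * 1 * ((N : ℝ) ^ (1 / 2 : ℝ) * (N : ℝ) ^ (1 / 2 : ℝ)) := by ring
      _ ≤ 2 * C₂ * W * ((N : ℝ) ^ (1 / 2 : ℝ) * (N : ℝ) ^ (1 / 2 : ℝ)) := by gcongr
      _ = _ := by rw [← rpow_add hN0]; norm_num
  have hsplit : ∑ m ∈ Icc 1 N, a m = ∑ m ∈ Icc 1 M, a m + ∑ m ∈ Ioc M N, a m := by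
    have : ∀ n, Icc 1 n = Ioc 0 n := fun n => by ext; simp; omega
    rw [this, this, sum_Ioc_consecutive _ (by omega) (by omega)]
  rw [hsplit]
  refine (norm_add_le _ _).trans ?_
  calc _ ≤ 2 * C₂ * W * N / L ^ k + 2 * ((C₁ + 2) * W * N * L ^ (k + 2)) *
        (2 ^ (2 * (k + 1)) / L ^ (2 * (k + 1))) := by
        refine add_le_add hsmall (habel.trans ?_)
        gcongr
    _ = _ := by
        rw [show 2 * (k + 1) = (k + 2) + k by ring, pow_add L]
        field_simp; ring

lemma norm_sum_le_of_iteratedDeriv (k : ℕ) : ∃ C : ℝ, 1 ≤ C ∧ ∀ (a : ℕ → ℂ) (W : ℝ) (F : ℂ → ℂ),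
    1 ≤ W → (∀ m, 1 ≤ m → ‖a m‖ ≤ 1 + log m) →
    (∀ σ : ℝ, 1 < σ → LSeriesSummable a σ) → (∀ s : ℂ, 1 < s.re → LSeries a s = F s) →
    (∀ s : ℂ, 1 < s.re → s.re ≤ 2 →
      ‖iteratedDeriv (2 * (k + 1)) F s‖ ≤ W * (2 + |s.im|) ^ (1 / 2 : ℝ)) →
    ∀ N : ℕ, 3 ≤ N → ‖∑ m ∈ Icc 1 N, a m‖ ≤ C * W * N / log N ^ k := by
  obtain ⟨C, hC1, hC⟩ := norm_sum_le_div_log_pow k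
  refine ⟨C, hC1, ?_⟩
  intro a W F hW1 ha hs hF hW N hN
  have hmul : ∀ j : ℕ, LSeries.logMul^[j] a = fun m : ℕ => (log m : ℂ) ^ j * a m := by
    intro j
    induction j with
    | zero => funext m; simp
    | succ j ih =>
      rw [Function.iterate_succ_apply', ih]
      funext m
      simp only [LSeries.logMul, natCast_log]
      ring
  have habs : LSeries.abscissaOfAbsConv a ≤ 1 := by
    have := LSeries.abscissaOfAbsConv_le_of_forall_lt_LSeriesSummable (f := a) (x := 1) hs
    simpa using this
  have hlt : ∀ s : ℂ, 1 < s.re → LSeries.abscissaOfAbsConv a < s.re := fun s h =>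
    habs.trans_lt (mod_cast h)
  refine hC a W hW1 ha ?_ ?_ N hN
  · intro σ hσ
    rw [← hmul]
    apply LSeriesSummable_of_abscissaOfAbsConv_lt_re
    rw [LSeries.absicssaOfAbsConv_logPowMul]
    bound
  · intro σ t hσ hσ2
    have hre : 1 < ((σ : ℂ) + t * I).re := by simpa using hσ
    have h1 := LSeries_iteratedDeriv (f := a) (2 * (k + 1)) (hlt _ hre)
    have h2 : LSeries a =ᶠ[nhds ((σ : ℂ) + t * I)] F := by
      filter_upwards [(isOpen_lt continuous_const continuous_re).mem_nhds hre] with z hz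
      exact hF z hz
    rw [h2.iteratedDeriv_eq, hmul] at h1
    have h3 := hW _ hre (by simpa using hσ2)
    rw [h1, norm_mul, norm_pow, norm_neg, norm_one, one_pow, one_mul] at h3
    simpa using h3

/-- Siegel–Walfisz for non-principal characters. -/
lemma norm_sum_char_vonMangoldt_le (k : ℕ) : ∃ C : ℝ, 1 ≤ C ∧
    ∀ (q : ℕ) [NeZero q] (χ : DirichletCharacter ℂ q), χ ≠ 1 → ∀ N : ℕ, 3 ≤ N →
      ‖∑ m ∈ Icc 1 N, χ m * (Λ m : ℂ)‖
        ≤ C * (q : ℝ) ^ (1 / 2 : ℝ) * N / log N ^ k := by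
  obtain ⟨C₁, hC₁1, hC₁⟩ := norm_sum_le_of_iteratedDeriv k
  obtain ⟨C₂, hC₂0, hC₂⟩ := norm_iteratedDeriv_logDeriv_LFunction_le (2 * (k + 1))
  refine ⟨C₁ * max 1 C₂, one_le_mul_of_one_le_of_one_le hC₁1 (le_max_left _ _), ?_⟩
  intro q _ χ hχ N hN
  have hq1 : (1 : ℝ) ≤ q := mod_cast NeZero.one_le
  have h := hC₁ (fun m => χ m * (Λ m : ℂ)) (max 1 C₂ * (q : ℝ) ^ (1 / 2 : ℝ))
    (fun s => -logDeriv χ.LFunction s)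
    (one_le_mul_of_one_le_of_one_le (le_max_left _ _) (one_le_rpow hq1 (by norm_num)))
    ?_ ?_ ?_ ?_ N hN
  · rwa [← mul_assoc] at h
  · intro m hm
    rw [norm_mul, norm_real, norm_eq_abs, abs_of_nonneg vonMangoldt_nonneg]
    have h1 := χ.norm_le_one m
    have h2 : Λ m ≤ log m := vonMangoldt_le_log
    have h3 : 0 ≤ Λ m := vonMangoldt_nonneg
    nlinarith
  · intro σ hσ
    exact χ.LSeriesSummable_twist_vonMangoldt (by simpa using hσ)
  · intro s hs
    have h1 := χ.LSeries_twist_vonMangoldt_eq hs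
    have h2 : LSeries (fun m => χ m * (Λ m : ℂ)) s = _ := h1
    rw [h2, logDeriv_apply, χ.deriv_LFunction_eq_deriv_LSeries hs, χ.LFunction_eq_LSeries hs,
      neg_div]
  · intro s hs1 hs2
    have h1 := hC₂ q χ hχ s hs1.le hs2
    rw [iteratedDeriv_fun_neg, norm_neg]
    refine h1.trans ?_
    rw [mul_rpow (by positivity) (by positivity), ← mul_assoc]
    bound

/-- The prime number theorem with a logarithmic saving. -/
lemma abs_sum_vonMangoldt_sub_le (k : ℕ) : ∃ C : ℝ, 1 ≤ C ∧ ∀ N : ℕ, 3 ≤ N →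
      |∑ m ∈ Icc 1 N, Λ m - N| ≤ C * N / log N ^ k := by
  obtain ⟨C₁, hC₁1, hC₁⟩ := norm_sum_le_of_iteratedDeriv k
  obtain ⟨C₂, hC₂0, hC₂⟩ := norm_iteratedDeriv_logDeriv_zetaH_le (2 * (k + 1))
  obtain ⟨C₃, hC₃0, hC₃⟩ := norm_iteratedDeriv_dslope_zetaH_le (2 * (k + 1))
  refine ⟨C₁ * max 1 (C₂ + C₃), one_le_mul_of_one_le_of_one_le hC₁1 (le_max_left _ _), ?_⟩
  intro N hN
  have h := hC₁ (fun m => (Λ m : ℂ) - 1) (max 1 (C₂ + C₃))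
    (fun s => -logDeriv zetaH s - dslope zetaH 1 s) (le_max_left _ _)
    ?_ ?_ ?_ ?_ N hN
  · rw [sum_sub_distrib] at h
    simp only [sum_const, card_Icc, Nat.add_sub_cancel, nsmul_eq_mul, mul_one] at h
    rw [← norm_eq_abs, ← norm_real]
    push_cast
    exact h
  · intro m hm
    have h2 : Λ m ≤ log m := vonMangoldt_le_log
    have h3 : 0 ≤ Λ m := vonMangoldt_nonneg
    refine (norm_sub_le _ _).trans ?_
    rw [norm_real, norm_eq_abs, abs_of_nonneg h3, norm_one]
    linarith
  · intro σ hσ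
    have h1 := LSeriesSummable_vonMangoldt (s := (σ : ℂ)) (by simpa using hσ)
    have h2 := (LSeriesSummable_one_iff (s := (σ : ℂ))).2 (by simpa using hσ)
    exact h1.sub h2
  · intro s hs
    have hs1 : s ≠ 1 := by rintro rfl; simp at hs
    have hs0 : s - 1 ≠ 0 := sub_ne_zero.2 hs1
    have hζ : riemannZeta s ≠ 0 := riemannZeta_ne_zero_of_one_le_re hs.le
    have h1 := LSeriesSummable_vonMangoldt hs
    have h2 := (LSeriesSummable_one_iff (s := s)).2 hs
    have h3 : LSeries (fun m => (Λ m : ℂ) - 1) s = _ := LSeries_sub h1 h2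
    rw [h3, LSeries_vonMangoldt_eq_deriv_riemannZeta_div hs,
      show LSeries (fun _ => 1) s = riemannZeta s from LSeries_one_eq_riemannZeta hs,
      dslope_of_ne _ hs1, slope_def_field, zetaH_one, logDeriv_apply]
    have h4 : zetaH =ᶠ[nhds s] fun z => (z - 1) * riemannZeta z := by
      filter_upwards [isOpen_ne.mem_nhds hs1] with z hz
      exact zetaH_of_ne hz
    have h5 : deriv zetaH s = riemannZeta s + (s - 1) * deriv riemannZeta s := by
      rw [h4.deriv_eq, deriv_fun_mul (by fun_prop) (differentiableAt_riemannZeta hs1)]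
      simp
    rw [h5, zetaH_of_ne hs1]
    field_simp
    ring
  · intro s hs1 hs2
    have hz : AnalyticAt ℂ zetaH s := differentiable_zetaH.analyticAt s
    have hd : ContDiffAt ℂ (2 * (k + 1) : ℕ) (fun s => logDeriv zetaH s) s := by
      have : AnalyticAt ℂ (fun s => logDeriv zetaH s) s :=
        hz.deriv.div hz (zetaH_ne_zero hs1.le)
      exact this.contDiffAt
    have hds := differentiable_dslope differentiable_zetaH 1
    have hd2 : ContDiffAt ℂ (2 * (k + 1) : ℕ) (fun s => dslope zetaH 1 s) s :=
      (hds.analyticAt s).contDiffAt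
    rw [iteratedDeriv_fun_sub hd.neg hd2, iteratedDeriv_fun_neg]
    refine (norm_sub_le _ _).trans ?_
    rw [norm_neg]
    refine (add_le_add (hC₂ s hs1.le hs2) (hC₃ s hs1.le hs2)).trans ?_
    rw [← add_mul]
    bound

lemma e_add (x y : ℝ) : e (x + y) = e x * e y := by
  simp only [e, ← Complex.exp_add]; congr 1; push_cast; ring

lemma e_zero : e 0 = 1 := by simp [e]

lemma norm_e (x : ℝ) : ‖e x‖ = 1 := by
  rw [e, show (2 * π * I * x : ℂ) = ((2 * π * x : ℝ) : ℂ) * I by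
    push_cast; ring, norm_exp_ofReal_mul_I]

lemma e_intCast (z : ℤ) : e z = 1 := by
  rw [e, show (2 * π * I * ((z : ℝ) : ℂ) : ℂ) = z * (2 * π * I) by
    push_cast; ring, exp_int_mul_two_pi_mul_I]

lemma e_add_intCast (x : ℝ) (z : ℤ) : e (x + z) = e x := by rw [e_add, e_intCast, mul_one]

lemma conj_e (x : ℝ) : conj (e x) = e (-x) := by
  rw [e, e, ← exp_conj]; congr 1
  simp only [map_mul, conj_ofReal, conj_I, map_ofNat]
  push_cast; ring

/-- `x` is at distance at least `δ` from every integer. -/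
def Far (δ x : ℝ) : Prop := ∀ z : ℤ, δ ≤ |x - z|

lemma Far.mono {δ δ' x : ℝ} (h : Far δ x) (hδ : δ' ≤ δ) : Far δ' x := fun z => hδ.trans (h z)

lemma Far.add {δ x y η : ℝ} (h : Far δ x) (hy : |y| ≤ η) : Far (δ - η) (x + y) := fun z => by
  grind [h z]

/-- A fraction that is not an integer is far from the integers. -/
lemma far_div {a : ℤ} {r : ℕ} (hr : 0 < r) (h : ¬ (r : ℤ) ∣ a) : Far (1 / r) ((a : ℝ) / r) := by
  intro z
  have hr0 : (0 : ℝ) < r := mod_cast hr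
  have h1 : (a : ℝ) / r - z = ((a - r * z : ℤ) : ℝ) / r := by push_cast; field_simp
  rw [h1, abs_div, abs_of_pos hr0]
  have h2 : a - r * z ≠ 0 := fun h0 => h ⟨z, by linarith⟩
  have h3 : (1 : ℝ) ≤ |((a - r * z : ℤ) : ℝ)| := mod_cast Int.one_le_abs h2
  gcongr

lemma norm_one_sub_e_ge {δ x : ℝ} (h : Far δ x) : 4 * δ ≤ ‖1 - e x‖ := by
  set y : ℝ := x - round x with hy
  have h1 : δ ≤ |y| := h (round x)
  have h2 : |y| ≤ 1 / 2 := abs_sub_round x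
  have h3 : e x = e y := by
    rw [hy, sub_eq_add_neg, ← Int.cast_neg, e_add_intCast]
  have h4 : ‖1 - e y‖ = 2 * |Real.sin (π * y)| := by
    have h5 : e y = Complex.exp (I * ((2 * π * y : ℝ) : ℂ)) := by
      rw [e]; congr 1; push_cast; ring
    rw [norm_sub_rev, h5, norm_exp_I_mul_ofReal_sub_one, norm_eq_abs, abs_mul,
      abs_two]
    congr 3; ring
  have h6 : 2 * |y| ≤ |Real.sin (π * y)| := by
    have h7 : |π * y| ≤ π / 2 := by
      rw [abs_mul, abs_of_pos pi_pos]; nlinarith [pi_pos]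
    have := mul_abs_le_abs_sin h7
    rw [abs_mul, abs_of_pos pi_pos] at this
    calc 2 * |y| = 2 / π * (π * |y|) := by field_simp
      _ ≤ _ := this
  rw [h3, h4]
  linarith

/-- A sum of a function which is multiplied by `ω` under translation by `K`. -/
lemma norm_sum_range_le_of_quasiperiodic {g : ℕ → ℂ} {x δ B : ℝ} {K : ℕ} (hδ : 0 < δ)
    (hx : Far δ x) (hg : ∀ m, g (m + K) = e x * g m)
    (hB : ∀ T, ∑ m ∈ range K, ‖g (T + m)‖ ≤ B) (T : ℕ) :
    ‖∑ m ∈ range T, g m‖ ≤ B / δ := by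
  have h1 := norm_one_sub_e_ge hx
  have h2 : (1 - e x) * ∑ m ∈ range T, g m
      = ∑ m ∈ range K, g m - ∑ m ∈ range K, g (T + m) := by
    have h3 : ∑ m ∈ range (T + K), g m = ∑ m ∈ range T, g m + ∑ m ∈ range K, g (T + m) :=
      sum_range_add _ _ _
    have h4 : ∑ m ∈ range (K + T), g m = ∑ m ∈ range K, g m + ∑ m ∈ range T, g (K + m) :=
      sum_range_add _ _ _
    have h5 : ∑ m ∈ range T, g (K + m) = e x * ∑ m ∈ range T, g m := by
      rw [mul_sum]; exact sum_congr rfl fun m _ => by rw [add_comm, hg]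
    rw [add_comm K T, h3, h5] at h4
    linear_combination h4
  have h6 : ‖(1 - e x) * ∑ m ∈ range T, g m‖ ≤ 2 * B := by
    rw [h2]
    refine (norm_sub_le _ _).trans ?_
    have := hB 0
    simp only [zero_add] at this
    linarith [(norm_sum_le (range K) g), norm_sum_le (range K) (fun m => g (T + m)), hB T]
  rw [norm_mul] at h6
  rw [le_div_iff₀ hδ]
  nlinarith [norm_nonneg (∑ m ∈ range T, g m)]

structure UnitPeriodic (κ : ℕ) (f : ℕ → ℂ) : Prop where
  add m : f (m + κ) = f m
  norm_le m : ‖f m‖ ≤ 1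

lemma UnitPeriodic.add_mul {κ : ℕ} {f : ℕ → ℂ} (h : UnitPeriodic κ f) (m k : ℕ) :
    f (m + k * κ) = f m := by
  induction k with
  | zero => simp
  | succ k ih => grind [h.add (m + k * κ)]

lemma norm_sum_range_periodic_mul_e_le {f : ℕ → ℂ} {x δ : ℝ} {K : ℕ} (hδ : 0 < δ)
    (hx : Far δ (x * K)) (hf : UnitPeriodic K f) (T : ℕ) :
    ‖∑ m ∈ range T, f m * e (x * m)‖ ≤ K / δ := by
  refine norm_sum_range_le_of_quasiperiodic (g := fun m => f m * e (x * m)) (K := K) hδ hx ?_ ?_ T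
  · intro m
    simp only [hf.add]
    push_cast
    rw [mul_add, e_add]; ring
  · intro T
    calc _ ≤ ∑ m ∈ range K, (1 : ℝ) := sum_le_sum fun m _ => by
          rw [norm_mul, norm_e, mul_one]; exact hf.norm_le _
      _ = _ := by simp

lemma norm_sum_Icc_periodic_mul_e_le {f : ℕ → ℂ} {x δ : ℝ} {K : ℕ} (hδ : 0 < δ)
    (hx : Far δ (x * K)) (hf : UnitPeriodic K f) (T : ℕ) :
    ‖∑ m ∈ Icc 1 T, f m * e (x * m)‖ ≤ K / δ := by
  have h := norm_sum_range_periodic_mul_e_le (f := fun m => f (m + 1)) hδ hx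
    ⟨fun m => by rw [add_right_comm, hf.add], fun m => hf.norm_le _⟩ T
  have h1 : ∑ m ∈ Icc 1 T, f m * e (x * m) = e x * ∑ m ∈ range T, f (m + 1) * e (x * m) := by
    rw [show Icc 1 T = Ico 1 (T + 1) by ext; simp, sum_Ico_eq_sum_range, mul_sum]
    refine sum_congr (by simp) fun m _ => ?_
    rw [add_comm 1 m]
    push_cast
    rw [mul_add, e_add, mul_one]; ring
  rw [h1, norm_mul, norm_e, one_mul]
  exact h

/-- Summing over all factorisations of the integers up to `N`. -/
lemma sum_Icc_sum_divisorsAntidiagonal {M : Type*} [AddCommMonoid M] (F : ℕ → ℕ → M) (N : ℕ) :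
    ∑ m ∈ Icc 1 N, ∑ x ∈ m.divisorsAntidiagonal, F x.1 x.2
      = ∑ u ∈ Icc 1 N, ∑ v ∈ Icc 1 (N / u), F u v := by
  rw [sum_sigma', sum_sigma']
  refine sum_nbij' (fun x => ⟨x.2.1, x.2.2⟩) (fun x => ⟨x.1 * x.2, (x.1, x.2)⟩) ?_ ?_ ?_ ?_ ?_
  · rintro ⟨m, u, v⟩ h
    simp only [mem_sigma, mem_Icc, mem_divisorsAntidiagonal] at h ⊢
    obtain ⟨⟨h1, h2⟩, h3, h4⟩ := h
    have hu : 0 < u := Nat.pos_of_ne_zero (by grind)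
    have hv : 0 < v := Nat.pos_of_ne_zero (by grind)
    refine ⟨⟨hu, ?_⟩, hv, ?_⟩
    · nlinarith
    · rw [Nat.le_div_iff_mul_le hu]; nlinarith
  · rintro ⟨u, v⟩ h
    simp only [mem_sigma, mem_Icc, mem_divisorsAntidiagonal] at h ⊢
    obtain ⟨⟨h1, h2⟩, h3, h4⟩ := h
    rw [Nat.le_div_iff_mul_le (by omega)] at h4
    have : 0 < u * v := Nat.mul_pos h1 h3
    grind
  · rintro ⟨m, u, v⟩ h
    simp only [mem_sigma, mem_Icc, mem_divisorsAntidiagonal] at h ⊢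
    simp [h.2.1]
  · simp
  simp

lemma sum_Icc_mul_apply (f g : ArithmeticFunction ℝ) (χ : ℕ → ℝ) (N : ℕ) :
    ∑ m ∈ Icc 1 N, (f * g) m * χ m
      = ∑ u ∈ Icc 1 N, ∑ v ∈ Icc 1 (N / u), f u * g v * χ (u * v) := by
  rw [← sum_Icc_sum_divisorsAntidiagonal (fun u v => f u * g v * χ (u * v))]
  refine sum_congr rfl fun m _ => ?_
  rw [ArithmeticFunction.mul_apply, sum_mul]
  exact sum_congr rfl fun x hx => by rw [(mem_divisorsAntidiagonal.1 hx).1]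

lemma sum_Icc_mul_apply_complex (f g : ArithmeticFunction ℝ) (χ : ℕ → ℂ) (N : ℕ) :
    ∑ m ∈ Icc 1 N, ((f * g) m : ℂ) * χ m
      = ∑ u ∈ Icc 1 N, ∑ v ∈ Icc 1 (N / u), (f u : ℂ) * g v * χ (u * v) := by
  rw [← sum_Icc_sum_divisorsAntidiagonal (fun u v => (f u : ℂ) * g v * χ (u * v))]
  refine sum_congr rfl fun m _ => ?_
  rw [ArithmeticFunction.mul_apply, ofReal_sum, sum_mul]
  exact sum_congr rfl fun x hx => by
    rw [(mem_divisorsAntidiagonal.1 hx).1]; push_cast; rfl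

lemma sum_Icc_inv_le (N : ℕ) : ∑ u ∈ Icc 1 N, (1 / u : ℝ) ≤ 1 + log N := by
  have h := harmonic_le_one_add_log N
  rw [harmonic_eq_sum_Icc] at h
  push_cast at h
  simpa using h

lemma card_divisors_eq (m : ℕ) :
    (m.divisors.card : ℝ) = ((zeta : ArithmeticFunction ℝ) *
      (zeta : ArithmeticFunction ℝ)) m := by
  rw [coe_zeta_mul_apply, card_eq_sum_ones, cast_sum]
  refine sum_congr rfl fun d hd => ?_
  have : d ≠ 0 := (pos_of_mem_divisors hd).ne'
  simp [natCoe_apply, zeta_apply, this]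

lemma card_divisors_mul_le (m n : ℕ) :
    ((m * n).divisors.card : ℝ) ≤ m.divisors.card * n.divisors.card := by
  rw [divisors_mul]
  exact_mod_cast card_mul_le

lemma sum_card_divisors_mul (χ : ℕ → ℝ) (N : ℕ) :
    ∑ m ∈ Icc 1 N, (m.divisors.card : ℝ) * χ m
      = ∑ u ∈ Icc 1 N, ∑ v ∈ Icc 1 (N / u), χ (u * v) := by
  simp only [card_divisors_eq]
  rw [sum_Icc_mul_apply]
  refine sum_congr rfl fun u hu => sum_congr rfl fun v hv => ?_
  have hu0 : u ≠ 0 := one_le_iff_ne_zero.1 (mem_Icc.1 hu).1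
  have hv0 : v ≠ 0 := one_le_iff_ne_zero.1 (mem_Icc.1 hv).1
  simp [natCoe_apply, zeta_apply, hu0, hv0]

lemma sum_card_divisors_le (N : ℕ) :
    ∑ m ∈ Icc 1 N, (m.divisors.card : ℝ) ≤ N * (1 + log N) := by
  have h := sum_card_divisors_mul (fun _ => 1) N
  simp only [mul_one] at h
  rw [h]
  calc _ ≤ ∑ u ∈ Icc 1 N, (N : ℝ) * (1 / u) := sum_le_sum fun u _ => by
        simp only [sum_const, card_Icc, Nat.add_sub_cancel, nsmul_eq_mul, mul_one]
        rw [mul_one_div]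
        exact cast_div_le
    _ ≤ _ := by rw [← mul_sum]; gcongr; exact sum_Icc_inv_le N

lemma sum_card_divisors_sq_le (N : ℕ) :
    ∑ m ∈ Icc 1 N, (m.divisors.card : ℝ) ^ 2 ≤ N * (1 + log N) ^ 3 := by
  have hlog : 0 ≤ 1 + log N := by linarith [log_natCast_nonneg N]
  simp only [sq]
  rw [sum_card_divisors_mul (fun m => (m.divisors.card : ℝ))]
  have h1 : ∑ m ∈ Icc 1 N, (m.divisors.card : ℝ) * (1 / m) ≤ (1 + log N) ^ 2 := by
    rw [sum_card_divisors_mul (fun m => (1 / m : ℝ)), sq]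
    calc _ ≤ ∑ u ∈ Icc 1 N, (1 / u : ℝ) * (1 + log N) := sum_le_sum fun u hu => by
          rw [mem_Icc] at hu
          have : ∀ v : ℕ, (1 / ((u * v : ℕ) : ℝ)) = 1 / u * (1 / v) := fun v => by
            push_cast; field_simp
          simp only [this]
          rw [← mul_sum]
          gcongr
          refine (sum_le_sum_of_subset_of_nonneg
            (Icc_subset_Icc_right (Nat.div_le_self N u)) fun _ _ _ => by positivity).trans
            (sum_Icc_inv_le N)
      _ ≤ _ := by rw [← sum_mul]; gcongr; exact sum_Icc_inv_le N
  calc _ ≤ ∑ u ∈ Icc 1 N, (u.divisors.card : ℝ) * (N * (1 / u) * (1 + log N)) := by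
        refine sum_le_sum fun u hu => ?_
        rw [mem_Icc] at hu
        calc _ ≤ ∑ v ∈ Icc 1 (N / u), (u.divisors.card : ℝ) * v.divisors.card :=
              sum_le_sum fun v _ => card_divisors_mul_le u v
          _ ≤ _ := by
              rw [← mul_sum]
              gcongr
              refine (sum_card_divisors_le _).trans ?_
              have h2 : ((N / u : ℕ) : ℝ) ≤ N * (1 / u) := by
                rw [mul_one_div]; exact cast_div_le
              rcases Nat.eq_zero_or_pos (N / u) with h0 | h0
              · rw [h0]; simp; positivity
              · have h3 : log ((N / u : ℕ) : ℝ) ≤ log N :=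
                  log_le_log (mod_cast h0) (mod_cast Nat.div_le_self N u)
                gcongr
    _ = N * (1 + log N) * ∑ m ∈ Icc 1 N, (m.divisors.card : ℝ) * (1 / m) := by
        rw [mul_sum]; grind
    _ ≤ N * (1 + log N) * (1 + log N) ^ 2 := by gcongr
    _ = _ := by ring

/-- The part of an arithmetic function supported on `[1, U]`. -/
def lowPart (U : ℕ) (f : ArithmeticFunction ℝ) : ArithmeticFunction ℝ :=
  ⟨fun m => if m ≤ U then f m else 0, by simp⟩

/-- The part of an arithmetic function supported on `(U, ∞)`. -/
def highPart (U : ℕ) (f : ArithmeticFunction ℝ) : ArithmeticFunction ℝ :=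
  ⟨fun m => if m ≤ U then 0 else f m, by simp⟩

lemma lowPart_apply (U : ℕ) (f : ArithmeticFunction ℝ) (m : ℕ) :
    lowPart U f m = if m ≤ U then f m else 0 := rfl

lemma highPart_apply (U : ℕ) (f : ArithmeticFunction ℝ) (m : ℕ) :
    highPart U f m = if m ≤ U then 0 else f m := rfl

lemma lowPart_add_highPart (U : ℕ) (f : ArithmeticFunction ℝ) :
    lowPart U f + highPart U f = f := by
  ext m
  simp only [ArithmeticFunction.add_apply, lowPart_apply, highPart_apply]
  split_ifs <;> simp

/-- The Möbius function with real values. -/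
def moebiusR : ArithmeticFunction ℝ :=
  ((moebius : ArithmeticFunction ℤ) : ArithmeticFunction ℝ)

/-- The constant function `1` as a real arithmetic function. -/
def zetaR : ArithmeticFunction ℝ := (zeta : ArithmeticFunction ℝ)

lemma moebiusR_mul_zetaR : moebiusR * zetaR = 1 := coe_moebius_mul_coe_zeta

lemma abs_moebiusR_le (m : ℕ) : |moebiusR m| ≤ 1 := by
  have h := abs_moebius_le_one (n := m)
  rw [moebiusR, intCoe_apply]
  exact_mod_cast h

lemma zetaR_apply {m : ℕ} (hm : m ≠ 0) : zetaR m = 1 := by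
  simp [zetaR, natCoe_apply, zeta_apply, hm]

/-- Vaughan's identity. -/
theorem vonMangoldt_eq_vaughan (U : ℕ) :
    Λ
        + lowPart U moebiusR * lowPart U Λ * zetaR
      = lowPart U Λ + lowPart U moebiusR * ArithmeticFunction.log
      + highPart U moebiusR * zetaR * highPart U Λ := by
  have h1 := lowPart_add_highPart U Λ
  have h2 := lowPart_add_highPart U moebiusR
  have h3 : (Λ : ArithmeticFunction ℝ) * zetaR
      = ArithmeticFunction.log := vonMangoldt_mul_zeta
  have h4 := moebiusR_mul_zetaR
  grind

/-- The coefficients `∑_{d ∣ u, d > U} μ(d)`. -/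
def vaughanBeta (U : ℕ) : ArithmeticFunction ℝ := highPart U moebiusR * zetaR

lemma vaughanBeta_eq (U u : ℕ) : vaughanBeta U u = ∑ d ∈ u.divisors, highPart U moebiusR d := by
  rw [vaughanBeta, zetaR, coe_mul_zeta_apply]

lemma vaughanBeta_eq_zero {U u : ℕ} (h : u ≤ U) : vaughanBeta U u = 0 := by
  rw [vaughanBeta_eq]
  refine sum_eq_zero fun d hd => ?_
  rw [highPart_apply, if_pos ((divisor_le hd).trans h)]

lemma abs_vaughanBeta_le (U u : ℕ) : |vaughanBeta U u| ≤ u.divisors.card := by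
  rw [vaughanBeta_eq]
  refine (abs_sum_le_sum_abs _ _).trans ?_
  rw [card_eq_sum_ones]
  push_cast
  refine sum_le_sum fun d _ => ?_
  rw [highPart_apply]
  split_ifs
  · simp
  · exact abs_moebiusR_le d

lemma lowPart_mul_lowPart_eq_zero {U w : ℕ} (h : U ^ 2 < w) :
    (lowPart U moebiusR * lowPart U Λ) w = 0 := by
  rw [ArithmeticFunction.mul_apply]
  refine sum_eq_zero fun x hx => ?_
  rw [mem_divisorsAntidiagonal] at hx
  rw [lowPart_apply, lowPart_apply]
  by_cases h1 : x.1 ≤ U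
  · by_cases h2 : x.2 ≤ U
    · nlinarith
    · simp [h2]
  · simp [h1]

lemma abs_lowPart_mul_lowPart_le (U w : ℕ) :
    |(lowPart U moebiusR * lowPart U Λ) w| ≤ log w := by
  rw [ArithmeticFunction.mul_apply, ← log_apply,
    ← zeta_mul_vonMangoldt, ArithmeticFunction.mul_apply]
  refine (abs_sum_le_sum_abs _ _).trans (sum_le_sum fun x hx => ?_)
  have h0 : x.1 ≠ 0 := left_ne_zero_of_mul (((mem_divisorsAntidiagonal.1 hx).1).symm ▸
    (mem_divisorsAntidiagonal.1 hx).2)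
  have h1 : ((zeta : ArithmeticFunction ℝ)) x.1 = 1 := zetaR_apply h0
  rw [abs_mul, h1]
  have hΛ := vonMangoldt_nonneg (n := x.2)
  refine mul_le_mul ?_ ?_ (abs_nonneg _) zero_le_one
  · rw [lowPart_apply]; split_ifs
    · exact abs_moebiusR_le _
    · simp
  · rw [lowPart_apply]; grind

lemma norm_sum_log_mul_le {g : ℕ → ℂ} {B : ℝ} (T : ℕ)
    (hB : ∀ t ≤ T, ‖∑ m ∈ Icc 1 t, g m‖ ≤ B) :
    ‖∑ m ∈ Icc 1 T, (log m : ℂ) * g m‖ ≤ 3 * B * log T := by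
  rcases Nat.eq_zero_or_pos T with rfl | hT
  · simp
  have h1 := norm_sum_Ioc_mul_le (w := fun m => log T - log m) (b := g) (T := B) hT
    (fun m hm hmT => by
      have : log m ≤ log T := log_le_log (mod_cast hm)
        (mod_cast hmT)
      simpa using this)
    (fun m hm hmT => by
      bound)
    (fun t _ ht => hB t ht)
  have hI : Ioc 0 T = Icc 1 T := by ext; simp; omega
  have h2 : ∑ m ∈ Icc 1 T, (log m : ℂ) * g m = (log T : ℂ) * ∑ m ∈ Icc 1 T, g m
      - ∑ m ∈ Ioc 0 T, ((log T - log m : ℝ) : ℂ) * g m := by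
    rw [hI, mul_sum, ← sum_sub_distrib]
    exact sum_congr rfl fun m _ => by push_cast; ring
  have hlog := log_natCast_nonneg T
  rw [h2]
  refine (norm_sub_le _ _).trans ?_
  have h3 : ‖(log T : ℂ) * ∑ m ∈ Icc 1 T, g m‖ ≤ log T * B := by
    rw [norm_mul, norm_real, norm_of_nonneg hlog]
    exact mul_le_mul_of_nonneg_left (hB T le_rfl) hlog
  simp only [zero_add, cast_one, Real.log_one, sub_zero] at h1
  linarith

lemma norm_sum_Icc_le_of_support {f : ℕ → ℂ} {N W : ℕ} {X : ℝ} (hX : 0 ≤ X)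
    (h0 : ∀ u, W < u → f u = 0) (h : ∀ u, 1 ≤ u → u ≤ N → u ≤ W → ‖f u‖ ≤ X) :
    ‖∑ u ∈ Icc 1 N, f u‖ ≤ W * X := by
  have h1 : ∑ u ∈ Icc 1 N, f u = ∑ u ∈ (Icc 1 N).filter (· ≤ W), f u := by
    rw [sum_filter]
    refine sum_congr rfl fun u _ => ?_
    split_ifs with hu
    · rfl
    · exact h0 u (by omega)
  rw [h1]
  have h2 : ((Icc 1 N).filter (· ≤ W)).card ≤ W := by
    refine (card_le_card (t := Icc 1 W) fun u hu => ?_).trans (by simp)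
    simp only [mem_filter, mem_Icc] at hu ⊢
    omega
  have h3 := norm_sum_le_of_le ((Icc 1 N).filter (· ≤ W)) (f := f) (n := fun _ => X) fun u hu => by
    grind
  refine h3.trans ?_
  rw [sum_const, nsmul_eq_mul]
  gcongr

/-- Vaughan's decomposition of a von Mangoldt sum into type I and type II sums. -/
lemma norm_sum_vonMangoldt_mul_le {χ : ℕ → ℂ} (hχ : ∀ m, ‖χ m‖ ≤ 1) (N : ℕ) {U : ℕ} (hU : 1 ≤ U) {B : ℝ}
    (hB : ∀ d, 1 ≤ d → d ≤ U ^ 2 → ∀ T, ‖∑ v ∈ Icc 1 T, χ (d * v)‖ ≤ B) :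
    ‖∑ m ∈ Icc 1 N, (Λ m : ℂ) * χ m‖
      ≤ U ^ 2 + 4 * U ^ 2 * B * log N
        + ‖∑ u ∈ Icc 1 N, ∑ v ∈ Icc 1 (N / u), (vaughanBeta U u : ℂ)
            * (highPart U Λ v : ℂ) * χ (u * v)‖ := by
  have hlogN := log_natCast_nonneg N
  have hB0 : 0 ≤ B := (norm_nonneg _).trans (hB 1 le_rfl (one_le_pow _ _ hU) 0)
  have key : ∀ m, (Λ m : ℂ) * χ m
      = (lowPart U Λ m : ℂ) * χ m
      + ((lowPart U moebiusR * ArithmeticFunction.log) m : ℂ) * χ m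
      - ((lowPart U moebiusR * lowPart U Λ * zetaR) m : ℂ) * χ m
      + ((vaughanBeta U * highPart U Λ) m : ℂ) * χ m := by
    intro m
    have h := congrArg (fun f : ArithmeticFunction ℝ => (f m : ℂ)) (vonMangoldt_eq_vaughan U)
    simp only [ArithmeticFunction.add_apply] at h
    push_cast at h
    rw [vaughanBeta]
    linear_combination χ m * h
  rw [sum_congr rfl fun m _ => key m, sum_add_distrib, sum_sub_distrib, sum_add_distrib,
    sum_Icc_mul_apply_complex, sum_Icc_mul_apply_complex, sum_Icc_mul_apply_complex]
  have h1 : ‖∑ m ∈ Icc 1 N, (lowPart U Λ m : ℂ) * χ m‖ ≤ U ^ 2 := by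
    have := norm_sum_Icc_le_of_support (N := N) (W := U) (X := U)
      (f := fun m => (lowPart U Λ m : ℂ) * χ m) (cast_nonneg _)
      (fun m hm => by simp [lowPart_apply, not_le.2 hm])
      (fun m hm1 _ hm => by
        rw [norm_mul, lowPart_apply, if_pos hm, norm_real,
          norm_of_nonneg vonMangoldt_nonneg]
        have h1 := vonMangoldt_le_log (n := m)
        have h2 : log m ≤ m := log_le_self (cast_nonneg _)
        have h3 : (m : ℝ) ≤ U := mod_cast hm
        have h4 := mul_le_of_le_one_right vonMangoldt_nonneg (hχ m) (a := Λ m)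
        linarith)
    simpa [sq] using this
  have h2 : ‖∑ u ∈ Icc 1 N, ∑ v ∈ Icc 1 (N / u), (lowPart U moebiusR u : ℂ)
      * (ArithmeticFunction.log v : ℂ) * χ (u * v)‖ ≤ 3 * U ^ 2 * B * log N := by
    have := norm_sum_Icc_le_of_support (N := N) (W := U) (X := 3 * B * log N)
      (f := fun u => ∑ v ∈ Icc 1 (N / u), (lowPart U moebiusR u : ℂ)
      * (ArithmeticFunction.log v : ℂ) * χ (u * v)) (by positivity)
      (fun m hm => by simp [lowPart_apply, not_le.2 hm])
      (fun u hu1 huN hu => by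
        have h1 : ∑ v ∈ Icc 1 (N / u), (lowPart U moebiusR u : ℂ)
            * (ArithmeticFunction.log v : ℂ) * χ (u * v)
            = (lowPart U moebiusR u : ℂ) * ∑ v ∈ Icc 1 (N / u), (log v : ℂ) * χ (u * v) := by
          rw [mul_sum]
          exact sum_congr rfl fun v _ => by rw [log_apply]; ring
        rw [h1, norm_mul, lowPart_apply, if_pos hu, norm_real]
        have h2 := norm_sum_log_mul_le (N / u)
          (fun t _ => hB u hu1 (hu.trans (Nat.le_self_pow two_ne_zero U)) t)
        have h3 : log (N / u : ℕ) ≤ log N := by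
          rcases Nat.eq_zero_or_pos (N / u) with h | h
          · rw [h]; simpa using hlogN
          · exact log_le_log (mod_cast h) (mod_cast Nat.div_le_self N u)
        have h4 : 3 * B * log (N / u : ℕ) ≤ 3 * B * log N :=
          mul_le_mul_of_nonneg_left h3 (by positivity)
        exact (mul_le_of_le_one_left (norm_nonneg _) (abs_moebiusR_le u)).trans (h2.trans h4))
    refine this.trans ?_
    have h5 : (U : ℝ) ≤ U ^ 2 := mod_cast Nat.le_self_pow two_ne_zero U
    have h6 := mul_le_mul_of_nonneg_right h5 (by positivity : 0 ≤ 3 * B * log N)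
    linarith
  have h3 : ‖∑ u ∈ Icc 1 N, ∑ v ∈ Icc 1 (N / u),
      ((lowPart U moebiusR * lowPart U Λ) u : ℂ)
      * (zetaR v : ℂ) * χ (u * v)‖ ≤ U ^ 2 * B * log N := by
    have := norm_sum_Icc_le_of_support (N := N) (W := U ^ 2) (X := log N * B)
      (f := fun u => ∑ v ∈ Icc 1 (N / u),
      ((lowPart U moebiusR * lowPart U Λ) u : ℂ)
      * (zetaR v : ℂ) * χ (u * v)) (by positivity)
      (fun m hm => by simp [lowPart_mul_lowPart_eq_zero hm])
      (fun u hu1 huN hu => by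
        have h1 : ∑ v ∈ Icc 1 (N / u),
            ((lowPart U moebiusR * lowPart U Λ) u : ℂ)
            * (zetaR v : ℂ) * χ (u * v)
            = ((lowPart U moebiusR * lowPart U Λ) u : ℂ)
              * ∑ v ∈ Icc 1 (N / u), χ (u * v) := by
          rw [mul_sum]
          refine sum_congr rfl fun v hv => ?_
          rw [zetaR_apply (one_le_iff_ne_zero.1 (mem_Icc.1 hv).1)]
          push_cast; ring
        rw [h1, norm_mul, norm_real]
        have h3 : log u ≤ log N :=
          log_le_log (mod_cast hu1) (mod_cast huN)
        exact mul_le_mul ((abs_lowPart_mul_lowPart_le U u).trans h3) (hB u hu1 hu _)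
          (norm_nonneg _) hlogN)
    push_cast at this
    linarith
  refine (norm_add_le _ _).trans (add_le_add ?_ le_rfl)
  refine (norm_sub_le _ _).trans ?_
  have := norm_add_le (∑ m ∈ Icc 1 N, (lowPart U Λ m : ℂ) * χ m)
    (∑ u ∈ Icc 1 N, ∑ v ∈ Icc 1 (N / u), (lowPart U moebiusR u : ℂ)
      * (ArithmeticFunction.log v : ℂ) * χ (u * v))
  linarith

/-- The Cauchy–Schwarz bound for a bilinear form by the row sums of its Gram matrix. -/
lemma norm_bilinear_sq_le {ι κ : Type*} (I : Finset ι) (J : Finset κ) (c : ι → κ → ℂ)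
    (x : ι → ℂ) (y : κ → ℂ) {W : ℝ}
    (hW : ∀ u ∈ I, ∑ u' ∈ I, ‖∑ v ∈ J, c u v * conj (c u' v)‖ ≤ W) :
    ‖∑ u ∈ I, ∑ v ∈ J, x u * y v * c u v‖ ^ 2
      ≤ (∑ v ∈ J, ‖y v‖ ^ 2) * ((∑ u ∈ I, ‖x u‖ ^ 2) * W) := by
  set K : ι → ι → ℝ := fun u u' => ‖∑ v ∈ J, c u v * conj (c u' v)‖ with hK
  have hsymm : ∀ u u', K u u' = K u' u := by
    intro u u'
    simp only [hK]
    rw [← RCLike.norm_conj, map_sum]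
    congr 1
    exact sum_congr rfl fun v _ => by rw [map_mul, RCLike.conj_conj, mul_comm]
  set T : κ → ℂ := fun v => ∑ u ∈ I, x u * c u v with hT
  have h1 : ∑ u ∈ I, ∑ v ∈ J, x u * y v * c u v = ∑ v ∈ J, y v * T v := by
    rw [sum_comm]
    refine sum_congr rfl fun v _ => ?_
    rw [hT, mul_sum]
    exact sum_congr rfl fun u _ => by ring
  have h2 : ‖∑ v ∈ J, y v * T v‖ ^ 2 ≤ (∑ v ∈ J, ‖y v‖ ^ 2) * ∑ v ∈ J, ‖T v‖ ^ 2 := by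
    refine le_trans ?_ (sum_mul_sq_le_sq_mul_sq J (fun v => ‖y v‖) (fun v => ‖T v‖))
    refine pow_le_pow_left₀ (norm_nonneg _) ((norm_sum_le _ _).trans_eq ?_) 2
    exact sum_congr rfl fun v _ => norm_mul _ _
  have h3 : ((∑ v ∈ J, ‖T v‖ ^ 2 : ℝ) : ℂ) = ∑ u ∈ I, ∑ u' ∈ I, x u * conj (x u')
      * ∑ v ∈ J, c u v * conj (c u' v) := by
    push_cast
    have : ∀ v ∈ J, ((‖T v‖ : ℂ) ^ 2) = ∑ u ∈ I, ∑ u' ∈ I, x u * conj (x u')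
        * (c u v * conj (c u' v)) := by
      intro v _
      rw [← mul_conj', hT]
      simp only [map_sum, map_mul]
      rw [sum_mul_sum]
      exact sum_congr rfl fun u _ => sum_congr rfl fun u' _ => by ring
    rw [sum_congr rfl this, sum_comm]
    refine sum_congr rfl fun u _ => ?_
    rw [sum_comm]
    exact sum_congr rfl fun u' _ => by rw [mul_sum]
  have h4 : ∑ v ∈ J, ‖T v‖ ^ 2 ≤ ∑ u ∈ I, ∑ u' ∈ I, ‖x u‖ * ‖x u'‖ * K u u' := by
    have h0 : ∑ v ∈ J, ‖T v‖ ^ 2 = ‖((∑ v ∈ J, ‖T v‖ ^ 2 : ℝ) : ℂ)‖ := by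
      rw [norm_real, norm_of_nonneg (sum_nonneg fun _ _ => sq_nonneg _)]
    rw [h0, h3]
    refine (norm_sum_le _ _).trans (sum_le_sum fun u _ => (norm_sum_le _ _).trans
      (sum_le_sum fun u' _ => ?_))
    rw [norm_mul, norm_mul, RCLike.norm_conj]
  have h5 : ∑ u ∈ I, ∑ u' ∈ I, ‖x u‖ * ‖x u'‖ * K u u'
      ≤ ∑ u ∈ I, ∑ u' ∈ I, (‖x u‖ ^ 2 * K u u' / 2 + ‖x u'‖ ^ 2 * K u' u / 2) := by
    refine sum_le_sum fun u _ => sum_le_sum fun u' _ => ?_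
    rw [hsymm u' u]
    nlinarith [mul_nonneg (sq_nonneg (‖x u‖ - ‖x u'‖)) (norm_nonneg _ : 0 ≤ K u u')]
  have h6 : ∑ u ∈ I, ∑ u' ∈ I, (‖x u‖ ^ 2 * K u u' / 2 + ‖x u'‖ ^ 2 * K u' u / 2)
      = ∑ u ∈ I, ‖x u‖ ^ 2 * ∑ u' ∈ I, K u u' := by
    simp only [sum_add_distrib]
    rw [sum_comm (f := fun u u' => ‖x u'‖ ^ 2 * K u' u / 2), ← sum_add_distrib]
    refine sum_congr rfl fun u _ => ?_
    rw [← sum_add_distrib, mul_sum]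
    exact sum_congr rfl fun u' _ => by ring
  have h7 : ∑ u ∈ I, ‖x u‖ ^ 2 * ∑ u' ∈ I, K u u' ≤ (∑ u ∈ I, ‖x u‖ ^ 2) * W := by
    rw [sum_mul]
    exact sum_le_sum fun u hu => mul_le_mul_of_nonneg_left (hW u hu) (sq_nonneg _)
  rw [h1]
  exact h2.trans (mul_le_mul_of_nonneg_left (by linarith) (sum_nonneg fun _ _ => sq_nonneg _))

/-- The number of integers of an interval of length `M` in a residue class mod `r`. -/
lemma card_filter_Ioc_zmod_le {r : ℕ} [NeZero r] (P M : ℕ) (t : ZMod r) :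
    (((Ioc P (P + M)).filter (fun u : ℕ => (u : ZMod r) = t)).card : ℝ) ≤ M / r + 1 := by
  have hr : 0 < r := pos_of_neZero r
  have h : ((Ioc P (P + M)).filter (fun u : ℕ => (u : ZMod r) = t)).card
      ≤ (range (M / r + 1)).card := by
    refine card_le_card_of_injOn (fun u => (u - P - 1) / r) ?_ ?_
    · intro u hu
      simp only [coe_filter, mem_Ioc, Set.mem_ofPred_eq] at hu
      simp only [coe_range, Set.mem_Iio]
      exact lt_succ_of_le (Nat.div_le_div_right (by omega))
    · intro u hu u' hu' h
      simp only [coe_filter, mem_Ioc, Set.mem_ofPred_eq] at hu hu' h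
      have h1 : (u : ZMod r) = u' := hu.2.trans hu'.2.symm
      rw [ZMod.natCast_eq_natCast_iff] at h1
      have h2 : u - P - 1 ≡ u' - P - 1 [MOD r] := by
        have h3 : u - P - 1 + (P + 1) ≡ u' - P - 1 + (P + 1) [MOD r] := by
          rwa [show u - P - 1 + (P + 1) = u by omega, show u' - P - 1 + (P + 1) = u' by omega]
        exact Nat.ModEq.add_right_cancel' _ h3
      have h4 := div_add_mod (u - P - 1) r
      have h5 := div_add_mod (u' - P - 1) r
      rw [h, h2] at h4
      omega
  rw [card_range] at h
  calc _ ≤ ((M / r + 1 : ℕ) : ℝ) := mod_cast h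
    _ ≤ _ := by push_cast; linarith [@cast_div_le ℝ _ _ _ M r]

/-- The weight dominating `1 / ‖t / r‖` (up to constants), equal to `X` at `0`. -/
def invDist (r : ℕ) (X Y : ℝ) (t : ZMod r) : ℝ :=
  if t = 0 then X else Y * (1 / (t.val : ℝ) + 1 / ((r : ℝ) - t.val))

lemma invDist_nonneg {r : ℕ} [NeZero r] {X Y : ℝ} (hX : 0 ≤ X) (hY : 0 ≤ Y) (t : ZMod r) :
    0 ≤ invDist r X Y t := by
  rw [invDist]
  split_ifs
  · exact hX
  · have : (t.val : ℝ) < r := mod_cast t.val_lt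
    positivity

lemma sum_invDist_le {r : ℕ} [NeZero r] {X Y : ℝ} (hY : 0 ≤ Y) :
    ∑ t : ZMod r, invDist r X Y t ≤ X + 2 * Y * (1 + log r) := by
  obtain ⟨r, rfl⟩ : ∃ s, r = s + 1 := ⟨r - 1, by have := pos_of_neZero r; omega⟩
  have h0 : ∑ t : ZMod (r + 1), invDist (r + 1) X Y t
      = ∑ j ∈ range (r + 1), if j = 0 then X else
        Y * (1 / (j : ℝ) + 1 / (((r + 1 : ℕ) : ℝ) - j)) := by
    rw [← Fin.sum_univ_eq_sum_range (fun j => if j = 0 then X else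
        Y * (1 / (j : ℝ) + 1 / (((r + 1 : ℕ) : ℝ) - j)))]
    refine sum_congr rfl fun t _ => ?_
    change invDist (r + 1) X Y t = if ZMod.val (n := r + 1) t = 0 then X else
      Y * (1 / (ZMod.val (n := r + 1) t : ℝ) + 1 / (((r + 1 : ℕ) : ℝ) - ZMod.val (n := r + 1) t))
    rw [invDist]
    by_cases h : t = (0 : ZMod (r + 1))
    · simp
    · simp
  rw [h0, sum_range_succ']
  simp only [Nat.add_eq_zero_iff, one_ne_zero, and_false, if_false, if_true]
  rw [← mul_sum, sum_add_distrib]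
  have h1 : ∑ j ∈ range r, (1 / ((j + 1 : ℕ) : ℝ)) ≤ 1 + log r := by
    have := sum_Icc_inv_le r
    rwa [show Icc 1 r = Ico 1 (r + 1) by ext; simp, sum_Ico_eq_sum_range,
      show r + 1 - 1 = r by omega, sum_congr rfl fun j _ => by rw [add_comm 1 j]] at this
  have h2 : ∑ j ∈ range r, (1 / (((r + 1 : ℕ) : ℝ) - (j + 1 : ℕ))) ≤ 1 + log r := by
    rw [← sum_range_reflect]
    refine le_trans (le_of_eq (sum_congr rfl fun j hj => ?_)) h1
    have : r - 1 - j + 1 = r - j := by have := mem_range.1 hj; omega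
    rw [this, cast_sub (mem_range.1 hj).le]
    congr 1
    push_cast; ring
  have h3 : log r ≤ log ((r + 1 : ℕ) : ℝ) := by
    rcases Nat.eq_zero_or_pos r with rfl | h
    · simp
    · bound
  nlinarith

lemma sum_Ioc_invDist_le {r : ℕ} [NeZero r] {X Y : ℝ} (hX : 0 ≤ X) (hY : 0 ≤ Y) {a : ZMod r}
    (ha : IsUnit a) (c : ZMod r) (P M : ℕ) :
    ∑ u ∈ Ioc P (P + M), invDist r X Y ((c - u) * a)
      ≤ (M / r + 1) * (X + 2 * Y * (1 + log r)) := by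
  have h1 : ∑ u ∈ Ioc P (P + M), invDist r X Y ((c - u) * a)
      = ∑ t : ZMod r, ∑ u ∈ (Ioc P (P + M)).filter (fun u : ℕ => (u : ZMod r) = t),
        invDist r X Y ((c - u) * a) := (sum_fiberwise _ _ _).symm
  rw [h1]
  have h2 : ∀ t : ZMod r, ∑ u ∈ (Ioc P (P + M)).filter (fun u : ℕ => (u : ZMod r) = t),
        invDist r X Y ((c - u) * a) ≤ (M / r + 1) * invDist r X Y ((c - t) * a) := by
    intro t
    rw [sum_congr rfl fun u hu => by rw [(mem_filter.1 hu).2], sum_const, nsmul_eq_mul]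
    exact mul_le_mul_of_nonneg_right (card_filter_Ioc_zmod_le P M t) (invDist_nonneg hX hY _)
  refine (sum_le_sum fun t _ => h2 t).trans ?_
  rw [← mul_sum]
  have h3 : ∑ t : ZMod r, invDist r X Y ((c - t) * a) = ∑ t : ZMod r, invDist r X Y t := by
    refine Fintype.sum_bijective (fun t => (c - t) * a) ?_ _ _ fun _ => rfl
    rw [← Finite.injective_iff_bijective]
    intro t t' h
    have := ha.mul_right_cancel h
    simpa using this
  rw [h3]
  exact mul_le_mul_of_nonneg_left (sum_invDist_le hY) (by positivity)

lemma val_mem_of_ne_zero {r : ℕ} [NeZero r] {x : ZMod r} (hx : x ≠ 0) :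
    (1 : ℝ) ≤ x.val ∧ (x.val : ℝ) + 1 ≤ r :=
  ⟨mod_cast one_le_iff_ne_zero.2 (by rwa [Ne, ZMod.val_eq_zero]), mod_cast ZMod.val_lt x⟩

lemma far_mul_of_near {r : ℕ} [NeZero r] {a h : ℤ} {θ H : ℝ}
    (hθ : |θ - a / r| ≤ 1 / (4 * r * H)) (hH : 0 < H) (hh : |(h : ℝ)| ≤ H)
    (ht : ((h * a : ℤ) : ZMod r) ≠ 0) :
    Far (min (((h * a : ℤ) : ZMod r).val : ℝ) (r - ((h * a : ℤ) : ZMod r).val) / (2 * r))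
      (θ * h) := by
  have hr : 0 < r := pos_of_neZero r
  have hr0 : (0 : ℝ) < r := mod_cast hr
  set j : ℕ := ((h * a : ℤ) : ZMod r).val with hj
  have ⟨hj1', hjr'⟩ := val_mem_of_ne_zero ht
  obtain ⟨q, hq⟩ : ∃ q : ℤ, h * a = r * q + j := by
    have : ((h * a - j : ℤ) : ZMod r) = 0 := by
      rw [Int.cast_sub, Int.cast_natCast, hj, ZMod.natCast_zmod_val, sub_self]
    rw [ZMod.intCast_zmod_eq_zero_iff_dvd] at this
    obtain ⟨q, hq⟩ := this
    grind
  have h1 : Far (min (j : ℝ) (r - j) / r) ((h * a : ℤ) / r) := by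
    intro z
    have h2 : (((h * a : ℤ) : ℝ) / r - z) = ((r * (q - z) + j : ℤ) : ℝ) / r := by
      rw [hq]; push_cast; field_simp; ring
    rw [h2, abs_div, abs_of_pos hr0]
    refine div_le_div_of_nonneg_right ?_ hr0.le
    rcases le_or_gt 0 (q - z) with hz | hz
    · have h3 : (0 : ℝ) ≤ ((q - z : ℤ) : ℝ) := mod_cast hz
      refine (min_le_left _ _).trans (le_trans ?_ (le_abs_self _))
      push_cast at h3 ⊢
      nlinarith
    · have h3 : ((q - z : ℤ) : ℝ) ≤ -1 := mod_cast Int.le_sub_one_of_lt hz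
      refine (min_le_right _ _).trans (le_trans ?_ (neg_le_abs _))
      push_cast at h3 ⊢
      nlinarith
  have h4 : |(θ - a / r) * h| ≤ 1 / (4 * r) := by
    rw [abs_mul]
    calc _ ≤ 1 / (4 * r * H) * H := mul_le_mul hθ hh (abs_nonneg _) (by positivity)
      _ = _ := by field_simp
  have h5 := h1.add h4
  have h6 : ((h * a : ℤ) : ℝ) / r + (θ - a / r) * h = θ * h := by push_cast; ring
  rw [h6] at h5
  refine h5.mono ?_
  have h7 : 1 ≤ min (j : ℝ) (r - j) := le_min hj1' (by linarith)
  rw [div_sub_div _ _ hr0.ne' (by positivity), div_le_div_iff₀ (by positivity) (by positivity)]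
  nlinarith [mul_pos (mul_pos hr0 hr0) hr0, mul_pos hr0 hr0]

lemma norm_sum_periodic_le_invDist {r κ : ℕ} [NeZero r] {a h : ℤ} {θ H x X : ℝ}
    (hθ : |θ - a / r| ≤ 1 / (4 * r * H)) (hH : 0 < H) (hh : |(h : ℝ)| ≤ H)
    (hx : x * κ = θ * h) {f : ℕ → ℂ} (hf : UnitPeriodic κ f)
    {T : ℕ} (hT : (T : ℝ) ≤ X) :
    ‖∑ v ∈ Icc 1 T, f v * e (x * v)‖ ≤ invDist r X (2 * r * κ) ((h : ZMod r) * (a : ZMod r)) := by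
  rw [invDist]
  split_ifs with h0
  · refine (norm_sum_le_of_le (n := fun _ => (1 : ℝ)) _ fun v _ => ?_).trans ?_
    · rw [norm_mul, norm_e, mul_one]; exact hf.norm_le v
    · simpa using hT
  · have hcast : ((h * a : ℤ) : ZMod r) = (h : ZMod r) * (a : ZMod r) := by push_cast; rfl
    have hfar := far_mul_of_near hθ hH hh (by rwa [hcast])
    rw [hcast] at hfar
    set j : ℕ := ((h : ZMod r) * (a : ZMod r)).val with hj
    have hr0 : (0 : ℝ) < r := mod_cast pos_of_neZero r
    have ⟨hj1, hjr⟩ := val_mem_of_ne_zero h0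
    have hm : 0 < min (j : ℝ) (r - j) := lt_min (by linarith) (by linarith)
    have h1 := norm_sum_Icc_periodic_mul_e_le (δ := min (j : ℝ) (r - j) / (2 * r)) (by positivity)
      (by rwa [hx]) hf T
    refine h1.trans ?_
    have h2 : (κ : ℝ) / (min (j : ℝ) (r - j) / (2 * r))
        = 2 * r * κ * (1 / min (j : ℝ) (r - j)) := by
      field_simp
    rw [h2]
    refine mul_le_mul_of_nonneg_left ?_ (by positivity)
    have h3 : 0 ≤ 1 / (j : ℝ) := by positivity
    have h4 : 0 ≤ 1 / ((r : ℝ) - j) := one_div_nonneg.2 (by linarith)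
    grind

/-- Type I sums at a point close to a reduced fraction with large denominator. -/
lemma norm_sum_typeI_le {r κ d : ℕ} [NeZero r] {a : ℤ} {α H : ℝ}
    (ha : IsUnit (a : ZMod r)) (hα : |α * κ - a / r| ≤ 1 / (4 * r * H)) (hH : 0 < H)
    (hd1 : 1 ≤ d) (hdr : d < r) (hdH : (d : ℝ) ≤ H) {ε : ℕ → ℂ} (hε : UnitPeriodic κ ε) (T : ℕ) :
    ‖∑ v ∈ Icc 1 T, ε (d * v) * e (α * (d * v : ℕ))‖ ≤ 4 * r * κ := by
  have h := norm_sum_periodic_le_invDist (h := d) (x := α * d) (κ := κ) (X := T) (T := T) hα hH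
    (by simpa using hdH) (by push_cast; ring) (f := fun v => ε (d * v))
    ⟨fun m => by rw [mul_add, hε.add_mul], fun m => hε.norm_le _⟩ le_rfl
  have h0 : ((d : ℤ) : ZMod r) * (a : ZMod r) ≠ 0 := by
    intro h0
    have h1 : (d : ZMod r) = 0 := by
      have := ha.mul_left_eq_zero.1 h0
      exact_mod_cast this
    rw [ZMod.natCast_eq_zero_iff] at h1
    exact absurd (le_of_dvd hd1 h1) (by omega)
  rw [invDist, if_neg h0] at h
  set j : ℕ := (((d : ℤ) : ZMod r) * (a : ZMod r)).val with hj
  have hr0 : (0 : ℝ) < r := mod_cast pos_of_neZero r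
  have ⟨hj1, hjr⟩ := val_mem_of_ne_zero h0
  have h3 : 1 / (j : ℝ) ≤ 1 := by rw [div_le_one (by linarith)]; exact hj1
  have h4 : 1 / ((r : ℝ) - j) ≤ 1 := by rw [div_le_one (by linarith)]; linarith
  have h5 : ∑ v ∈ Icc 1 T, ε (d * v) * e (α * (d * v : ℕ))
      = ∑ v ∈ Icc 1 T, ε (d * v) * e (α * d * v) :=
    sum_congr rfl fun v _ => by grind
  rw [h5]
  refine h.trans ?_
  have := mul_le_mul_of_nonneg_left (add_le_add h3 h4) (by positivity : (0 : ℝ) ≤ 2 * r * κ)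
  linarith

/-- One dyadic block of a type II sum. -/
lemma norm_sum_dyadic_sq_le {r κ P N : ℕ} [NeZero r] {a : ℤ} {α H : ℝ}
    (ha : IsUnit (a : ZMod r)) (hα : |α * κ - a / r| ≤ 1 / (4 * r * H)) (hH : 0 < H)
    (hP : 1 ≤ P) (hPH : (P : ℝ) ≤ H) {ε : ℕ → ℂ} (hε : UnitPeriodic κ ε) (x y : ℕ → ℂ) :
    ‖∑ u ∈ Ioc P (P + P), ∑ v ∈ Icc 1 (N / u), x u * y v * (ε (u * v) * e (α * (u * v : ℕ)))‖ ^ 2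
      ≤ (∑ v ∈ Icc 1 (N / P), ‖y v‖ ^ 2) * ((∑ u ∈ Ioc P (P + P), ‖x u‖ ^ 2) *
        ((P / r + 1) * (N / P + 4 * r * κ * (1 + log r)))) := by
  set c : ℕ → ℕ → ℂ := fun u v => if v ≤ N / u then ε (u * v) * e (α * (u * v : ℕ)) else 0 with hc
  have h1 : ∀ u ∈ Ioc P (P + P),
      ∑ v ∈ Icc 1 (N / u), x u * y v * (ε (u * v) * e (α * (u * v : ℕ)))
      = ∑ v ∈ Icc 1 (N / P), x u * y v * c u v := by
    intro u hu
    have hu' := (mem_Ioc.1 hu).1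
    have h2 : Icc 1 (N / u) = (Icc 1 (N / P)).filter (· ≤ N / u) := by
      ext v
      have := div_le_div_left hu'.le hP (a := N)
      simp only [mem_filter, mem_Icc]
      omega
    rw [h2, sum_filter]
    refine sum_congr rfl fun v _ => ?_
    simp only [hc]
    split_ifs <;> simp
  rw [sum_congr rfl h1]
  refine norm_bilinear_sq_le _ _ c x y fun u hu => ?_
  have hu' := mem_Ioc.1 hu
  have h2 : ∀ u' ∈ Ioc P (P + P), ‖∑ v ∈ Icc 1 (N / P), c u v * conj (c u' v)‖
      ≤ invDist r (N / P) (2 * r * κ) (((u : ZMod r) - u') * a) := by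
    intro u' hv'
    have hu2 := mem_Ioc.1 hv'
    have h3 : ∑ v ∈ Icc 1 (N / P), c u v * conj (c u' v)
        = ∑ v ∈ Icc 1 (min (N / u) (N / u')), (ε (u * v) * conj (ε (u' * v)))
          * e (α * ((u : ℝ) - u') * v) := by
      have h4 : Icc 1 (min (N / u) (N / u'))
          = (Icc 1 (N / P)).filter (fun v => v ≤ N / u ∧ v ≤ N / u') := by
        ext v
        have := div_le_div_left hu'.1.le hP (a := N)
        simp only [mem_filter, mem_Icc]
        omega
      rw [h4, sum_filter]
      refine sum_congr rfl fun v _ => ?_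
      simp only [hc]
      by_cases h5 : v ≤ N / u <;> by_cases h6 : v ≤ N / u' <;> simp only [h5, h6, if_true,
        if_false, and_self, and_true, and_false, map_zero, mul_zero, zero_mul]
      rw [map_mul, conj_e, mul_mul_mul_comm, ← e_add]
      congr 2
      push_cast; ring
    rw [h3]
    have h7 := norm_sum_periodic_le_invDist (h := (u : ℤ) - u') (x := α * ((u : ℝ) - u')) (κ := κ)
      (X := N / P) (T := min (N / u) (N / u')) hα hH ?_ (by push_cast; ring)
      (f := fun v => ε (u * v) * conj (ε (u' * v)))
      ⟨fun m => by simp only [mul_add, hε.add_mul], fun m => by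
        rw [norm_mul, RCLike.norm_conj]
        exact mul_le_one₀ (hε.norm_le _) (norm_nonneg _) (hε.norm_le _)⟩ ?_
    · push_cast at h7
      exact h7
    · refine le_trans ?_ hPH
      push_cast
      have e1 : (P : ℝ) < u := mod_cast hu'.1
      have e2 : (P : ℝ) < u' := mod_cast hu2.1
      have e3 : (u : ℝ) ≤ P + P := mod_cast hu'.2
      have e4 : (u' : ℝ) ≤ P + P := mod_cast hu2.2
      grind
    · calc ((min (N / u) (N / u') : ℕ) : ℝ) ≤ ((N / P : ℕ) : ℝ) := mod_cast (min_le_left _ _).trans (div_le_div_left hu'.1.le hP)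
        _ ≤ _ := cast_div_le
  refine (sum_le_sum h2).trans ?_
  refine (sum_Ioc_invDist_le (by positivity) (by positivity) ha u P P).trans_eq ?_
  ring

lemma sum_Ioc_dyadic {M : Type*} [AddCommMonoid M] (g : ℕ → M) (U K : ℕ) :
    ∑ u ∈ Ioc U (U * 2 ^ K), g u
      = ∑ i ∈ range K, ∑ u ∈ Ioc (U * 2 ^ i) (U * 2 ^ i + U * 2 ^ i), g u := by
  induction K with
  | zero => simp
  | succ K ih =>
    rw [sum_range_succ, ← ih, sum_Ioc_consecutive]
    · congr 2; ring
    · bound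
    · omega

/-- Type II sums in which one variable runs over a short range. -/
lemma norm_sum_typeII_short_le {r κ U s N K : ℕ} [NeZero r] {a : ℤ} {α L : ℝ}
    (ha : IsUnit (a : ZMod r)) (hα : |α * κ - a / r| ≤ 1 / (4 * r * s)) (hs : 1 ≤ s)
    (hU : 1 ≤ U) (hK : s ≤ 2 ^ K) {ε : ℕ → ℂ} (hε : UnitPeriodic κ ε) {x y : ℕ → ℂ} (hx0 : ∀ u ≤ U, x u = 0) (hxs : ∀ u, s < u → x u = 0)
    (hx : ∀ T ≤ 2 * s, ∑ u ∈ Icc 1 T, ‖x u‖ ^ 2 ≤ T * L)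
    (hy : ∀ T ≤ N, ∑ u ∈ Icc 1 T, ‖y u‖ ^ 2 ≤ T * L) :
    ‖∑ u ∈ Icc 1 N, ∑ v ∈ Icc 1 (N / u), x u * y v * (ε (u * v) * e (α * (u * v : ℕ)))‖
      ≤ K * √(2 * N * L ^ 2 *
        (N / r + N / U + 4 * κ * (s + r) * (1 + log r))) := by
  set g : ℕ → ℂ := fun u =>
    ∑ v ∈ Icc 1 (N / u), x u * y v * (ε (u * v) * e (α * (u * v : ℕ))) with hg
  have hr0 : (0 : ℝ) < r := mod_cast pos_of_neZero r
  have hs0 : (0 : ℝ) < s := mod_cast hs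
  have hU0 : (0 : ℝ) < U := mod_cast hU
  have hlogr := log_natCast_nonneg r
  have hL : 0 ≤ L := by
    have h1 := hx 1 (by omega)
    have h2 : 0 ≤ ∑ u ∈ Icc 1 1, ‖x u‖ ^ 2 := sum_nonneg fun _ _ => sq_nonneg _
    simpa using h2.trans h1
  have h1 : ∑ u ∈ Icc 1 N, g u = ∑ u ∈ Ioc U (U * 2 ^ K), g u := by
    refine sum_congr_of_eq_on_inter (fun u hu hu' => ?_) (fun u hu hu' => ?_) fun u _ _ => rfl
    · have : u ≤ U ∨ s < u := by
        by_contra! h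
        exact hu' (mem_Ioc.2 ⟨h.1, h.2.trans (hK.trans (Nat.le_mul_of_pos_left _ hU))⟩)
      have : x u = 0 := this.elim (hx0 u) (hxs u)
      simp [hg, this]
    · have h2 : N < u := by
        by_contra! h
        exact hu' (mem_Icc.2 ⟨by grind, h⟩)
      simp [hg, div_eq_of_lt h2]
  rw [h1, sum_Ioc_dyadic]
  refine (norm_sum_le_of_le _ (n := fun _ => √(2 * N * L ^ 2 *
        (N / r + N / U + 4 * κ * (s + r) * (1 + log r)))) fun i _ => ?_).trans ?_
  · set P := U * 2 ^ i with hPdef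
    have hUP : U ≤ P := Nat.le_mul_of_pos_right _ (by positivity)
    rcases lt_or_ge P s with hPs | hPs
    · refine le_sqrt_of_sq_le ?_
      have hP0 : (0 : ℝ) < P := mod_cast hU.trans hUP
      have hPs' : (P : ℝ) ≤ s := mod_cast hPs.le
      have hUP' : (U : ℝ) ≤ P := mod_cast hUP
      refine (norm_sum_dyadic_sq_le (N := N) ha hα hs0 (hU.trans hUP) hPs' hε x y).trans ?_
      have h2 : ∑ v ∈ Icc 1 (N / P), ‖y v‖ ^ 2 ≤ N / P * L :=
        (hy _ (Nat.div_le_self _ _)).trans (mul_le_mul_of_nonneg_right cast_div_le hL)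
      have h3 : ∑ u ∈ Ioc P (P + P), ‖x u‖ ^ 2 ≤ 2 * P * L := by
        refine (sum_le_sum_of_subset_of_nonneg (t := Icc 1 (2 * P)) (fun u hu => ?_)
          fun _ _ _ => sq_nonneg _).trans ((hx (2 * P) (by omega)).trans_eq (by push_cast; ring))
        simp only [mem_Ioc, mem_Icc] at hu ⊢
        omega
      have hW : 0 ≤ ((P : ℝ) / r + 1) * (N / P + 4 * r * κ * (1 + log r)) := by positivity
      calc _ ≤ (N / P * L) * ((2 * P * L) *
            (((P : ℝ) / r + 1) * (N / P + 4 * r * κ * (1 + log r)))) :=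
          mul_le_mul h2 (mul_le_mul_of_nonneg_right h3 hW)
            (mul_nonneg (sum_nonneg fun _ _ => sq_nonneg _) hW) (by positivity)
        _ = 2 * N * L ^ 2 * (N / r + N / P + 4 * κ * (P + r) * (1 + log r)) := by
          field_simp
        _ ≤ _ := by
          gcongr
    · have : ∑ u ∈ Ioc P (P + P), g u = 0 := by
        refine sum_eq_zero fun u hu => ?_
        simp [hg, hxs u (hPs.trans_lt (mem_Ioc.1 hu).1)]
      rw [this, norm_zero]
      exact sqrt_nonneg _
  simp

lemma sum_Icc_div_swap {M : Type*} [AddCommMonoid M] (F : ℕ → ℕ → M) (N : ℕ) :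
    ∑ u ∈ Icc 1 N, ∑ v ∈ Icc 1 (N / u), F u v = ∑ v ∈ Icc 1 N, ∑ u ∈ Icc 1 (N / v), F u v := by
  rw [← sum_Icc_sum_divisorsAntidiagonal, ← sum_Icc_sum_divisorsAntidiagonal (fun v u => F u v)]
  refine sum_congr rfl fun m _ => ?_
  exact sum_nbij' Prod.swap Prod.swap (fun x hx => swap_mem_divisorsAntidiagonal.2 hx)
    (fun x hx => swap_mem_divisorsAntidiagonal.2 hx) (fun _ _ => rfl) (fun _ _ => rfl)
    fun _ _ => rfl

/-- Bound for twisted von Mangoldt sums on the minor arcs. -/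
theorem norm_sum_vonMangoldt_minor_le {r κ U N : ℕ} [NeZero r] {a : ℤ} {α : ℝ}
    (hN : 3 ≤ N) (ha : IsUnit (a : ZMod r)) (hα : |α * κ - a / r| ≤ 1 / (4 * r * N.sqrt))
    (hU : 1 ≤ U) (hUr : U ^ 2 < r) (hUN : U ^ 2 ≤ N.sqrt) (hrN : r ≤ N)
    {ε : ℕ → ℂ} (hε : UnitPeriodic κ ε) :
    ‖∑ m ∈ Icc 1 N, (Λ m : ℂ) * (ε m * e (α * m))‖
      ≤ U ^ 2 + 16 * U ^ 2 * r * κ * log N + 200 * log N ^ 5 *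
        √(N * (N / r + N / U + κ * (N.sqrt + r))) := by
  set s := N.sqrt with hs
  have hs1 : 1 ≤ s := (one_le_pow _ _ hU).trans hUN
  have hs0 : (0 : ℝ) < s := mod_cast hs1
  have hsN : s ≤ N := sqrt_le_self N
  have hl := one_le_log_of_three_le hN
  have h1 := norm_sum_vonMangoldt_mul_le (χ := fun m => ε m * e (α * m)) (fun m => by
      rw [norm_mul, norm_e, mul_one]; exact hε.norm_le m) N hU (B := 4 * r * κ) fun d hd1 hd T =>
    norm_sum_typeI_le ha hα hs0 hd1 (hd.trans_lt hUr) (mod_cast hd.trans hUN) hε T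
  have hr0 : (0 : ℝ) < r := mod_cast pos_of_neZero r
  have hU0 : (0 : ℝ) < U := mod_cast hU
  have h2s : 2 * s ≤ N := by
    rcases Nat.lt_or_ge s 2 with h | h
    · omega
    · exact (Nat.mul_le_mul_right s h).trans (sqrt_le N)
  set l := log N with hl_def
  set L := (1 + l) ^ 3 with hL
  set K := Nat.log 2 N + 1 with hK
  have hKs : s ≤ 2 ^ K := hsN.trans (lt_pow_succ_log_self one_lt_two N).le
  have hKl : (K : ℝ) ≤ 3 * l := by
    have e1 : (Nat.log 2 N : ℝ) ≤ l / log 2 := natLog_le_logb N 2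
    have e2 := log_two_gt_d9
    have e3 : l / log 2 ≤ 2 * l := by
      rw [div_le_iff₀ (by linarith)]; nlinarith
    rw [hK]; push_cast; linarith
  have hlogT : ∀ T : ℕ, 1 ≤ T → T ≤ N → log T ≤ l := fun T h1 h2 =>
    log_le_log (mod_cast h1) (mod_cast h2)
  have hβ : ∀ T ≤ N, ∑ u ∈ Icc 1 T, ‖(vaughanBeta U u : ℂ)‖ ^ 2 ≤ T * L := by
    intro T hT
    rcases Nat.eq_zero_or_pos T with rfl | hT0
    · simp
    refine (sum_le_sum fun u _ => ?_).trans ((sum_card_divisors_sq_le T).trans ?_)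
    · rw [norm_real, norm_eq_abs]
      exact pow_le_pow_left₀ (abs_nonneg _) (abs_vaughanBeta_le U u) 2
    · exact mul_le_mul_of_nonneg_left (pow_le_pow_left₀
        (by positivity) (by grind) 3)
        (cast_nonneg _)
  have hγ : ∀ T ≤ N,
      ∑ u ∈ Icc 1 T, ‖(highPart U Λ u : ℂ)‖ ^ 2 ≤ T * L := by
    intro T hT
    refine (sum_le_sum (g := fun _ => L) fun u hu => ?_).trans (by simp)
    have hu' := mem_Icc.1 hu
    have e1 := hlogT u hu'.1 (hu'.2.trans hT)
    have e2 : ‖(highPart U Λ u : ℂ)‖ ≤ l := by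
      rw [norm_real, norm_eq_abs, highPart_apply]
      split_ifs
      · simp; linarith
      · rw [abs_of_nonneg vonMangoldt_nonneg]
        exact vonMangoldt_le_log.trans e1
    have e3 := pow_le_pow_left₀ (norm_nonneg _) e2 2
    rw [hL]
    nlinarith [pow_pos (by linarith : 0 < l) 3, pow_pos (by linarith : 0 < l) 2]
  set S := √(2 * N * L ^ 2 *
        (N / r + N / U + 4 * κ * (s + r) * (1 + log r))) with hS
  have hII : ‖∑ u ∈ Icc 1 N, ∑ v ∈ Icc 1 (N / u), (vaughanBeta U u : ℂ)
      * (highPart U Λ v : ℂ)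
      * (ε (u * v) * e (α * (u * v : ℕ)))‖ ≤ K * S + K * S := by
    have hsplit : ∑ u ∈ Icc 1 N, ∑ v ∈ Icc 1 (N / u), (vaughanBeta U u : ℂ)
        * (highPart U Λ v : ℂ)
        * (ε (u * v) * e (α * (u * v : ℕ)))
        = ∑ u ∈ Icc 1 N, ∑ v ∈ Icc 1 (N / u), (if u ≤ s then (vaughanBeta U u : ℂ) else 0)
          * (highPart U Λ v : ℂ)
          * (ε (u * v) * e (α * (u * v : ℕ)))
        + ∑ v ∈ Icc 1 N, ∑ u ∈ Icc 1 (N / v),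
          (if v ≤ s then (highPart U Λ v : ℂ) else 0)
          * (if u ≤ s then 0 else (vaughanBeta U u : ℂ))
          * (ε (v * u) * e (α * (v * u : ℕ))) := by
      rw [← sum_Icc_div_swap (fun u v =>
          (if v ≤ s then (highPart U Λ v : ℂ) else 0)
          * (if u ≤ s then 0 else (vaughanBeta U u : ℂ))
          * (ε (v * u) * e (α * (v * u : ℕ)))), ← sum_add_distrib]
      refine sum_congr rfl fun u hu => ?_
      rw [← sum_add_distrib]
      refine sum_congr rfl fun v hv => ?_
      by_cases hus : u ≤ s
      · simp [hus]
      · have hvs : v ≤ s := by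
          by_contra! h
          have e1 := (Nat.le_div_iff_mul_le (mem_Icc.1 hu).1).1 (mem_Icc.1 hv).2
          have e2 := lt_succ_sqrt N
          have e3 := Nat.mul_le_mul (succ_le_of_lt h) (succ_le_of_lt (not_le.1 hus))
          simp only [succ_eq_add_one] at e2 e3
          rw [← hs] at e2
          omega
        grind
    rw [hsplit]
    refine (norm_add_le _ _).trans (add_le_add ?_ ?_)
    · refine norm_sum_typeII_short_le ha hα hs1 hU hKs hε ?_ ?_ ?_ hγ
      · intro u hu; simp [vaughanBeta_eq_zero hu]
      · grind
      · refine fun T hT => (sum_le_sum fun u _ => ?_).trans (hβ T (hT.trans h2s))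
        bound
    · refine norm_sum_typeII_short_le ha hα hs1 hU hKs hε ?_ ?_ ?_ ?_
      · intro u hu; simp [highPart_apply, hu]
      · grind
      · refine fun T hT => (sum_le_sum fun u _ => ?_).trans (hγ T (hT.trans h2s))
        bound
      · refine fun T hT => (sum_le_sum fun u _ => ?_).trans (hβ T hT)
        bound
  have hSle : S ≤ 32 * l ^ 4 * √(N * (N / r + N / U + κ * (s + r))) := by
    set Y : ℝ := N * (N / r + N / U + κ * (s + r)) with hY
    have hY0 : 0 ≤ Y := by positivity
    rw [hS, ← sqrt_sq (by positivity : 0 ≤ 32 * l ^ 4), ← sqrt_mul (by positivity)]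
    refine sqrt_le_sqrt ?_
    have e1 : log r ≤ l := hlogT r (pos_of_neZero r) hrN
    have e2 : L ≤ 8 * l ^ 3 := by
      calc L ≤ (2 * l) ^ 3 := pow_le_pow_left₀ (by linarith) (by linarith) 3
        _ = _ := by ring
    have e3 : L ^ 2 ≤ 64 * l ^ 6 := by
      calc L ^ 2 ≤ (8 * l ^ 3) ^ 2 := pow_le_pow_left₀ (by positivity) e2 2
        _ = _ := by ring
    have e4 : (N : ℝ) / r + N / U + 4 * κ * (s + r) * (1 + log r)
        ≤ 8 * l * (N / r + N / U + κ * (s + r)) := by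
      have f1 : 4 * κ * ((s : ℝ) + r) * (1 + log r) ≤ 4 * κ * ((s : ℝ) + r) * (2 * l) :=
        mul_le_mul_of_nonneg_left (by linarith) (by positivity)
      have f2 : 0 ≤ (N : ℝ) / r + N / U := by positivity
      nlinarith
    have hlogr := log_natCast_nonneg r
    calc _ ≤ 2 * N * (64 * l ^ 6) * (8 * l * (N / r + N / U + κ * (s + r))) := by
          gcongr
      _ = 1024 * l ^ 7 * Y := by rw [hY]; ring
      _ ≤ 1024 * l ^ 8 * Y := by
          refine mul_le_mul_of_nonneg_right ?_ hY0
          exact mul_le_mul_of_nonneg_left (pow_le_pow_right₀ hl (by norm_num)) (by norm_num)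
      _ = _ := by ring
  have hS0 : 0 ≤ S := sqrt_nonneg _
  nlinarith

lemma mem_redRes {q a : ℕ} : a ∈ redRes q ↔ a < q ∧ Coprime a q := by
  simp [redRes]

lemma card_redRes (q : ℕ) : (redRes q).card = q.totient := by
  rw [redRes, totient_eq_card_coprime]
  congr 1
  grind

/-- Regrouping the fractions `j / K` according to their reduced denominators. -/
lemma sum_range_div {M : Type*} [AddCommMonoid M] (F : ℝ → M) {K : ℕ} (hK : 0 < K) :
    ∑ j ∈ range K, F ((j : ℝ) / K) = ∑ q ∈ K.divisors, ∑ a ∈ redRes q, F ((a : ℝ) / q) := by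
  rw [sum_sigma']
  refine sum_nbij' (fun j => ⟨K / j.gcd K, j / j.gcd K⟩) (fun x => x.2 * (K / x.1))
    ?_ ?_ ?_ ?_ ?_
  · intro j hj
    have hg : 0 < j.gcd K := gcd_pos_of_pos_right _ hK
    simp only [mem_sigma, mem_divisors, mem_redRes]
    refine ⟨⟨div_dvd_of_dvd (Nat.gcd_dvd_right _ _), hK.ne'⟩, ?_, ?_⟩
    · exact div_lt_div_of_lt_of_dvd (Nat.gcd_dvd_right _ _) (mem_range.1 hj)
    · exact coprime_div_gcd_div_gcd hg
  · rintro ⟨q, a⟩ hx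
    simp only [mem_sigma, mem_divisors, mem_redRes] at hx
    obtain ⟨⟨⟨d, rfl⟩, -⟩, ha, -⟩ := hx
    have hq : 0 < q := by omega
    have hd : 0 < d := Nat.pos_of_mul_pos_left hK
    simp only [mem_range]
    rw [Nat.mul_div_cancel_left _ hq]
    gcongr
  · intro j hj
    have hg : 0 < j.gcd K := gcd_pos_of_pos_right _ hK
    simp only
    rw [Nat.div_div_self (Nat.gcd_dvd_right _ _) hK.ne', Nat.div_mul_cancel (Nat.gcd_dvd_left _ _)]
  · rintro ⟨q, a⟩ hx
    simp only [mem_sigma, mem_divisors, mem_redRes] at hx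
    obtain ⟨⟨⟨d, rfl⟩, -⟩, ha, hc⟩ := hx
    have hq : 0 < q := by omega
    have hd : 0 < d := Nat.pos_of_mul_pos_left hK
    simp only
    rw [Nat.mul_div_cancel_left _ hq, Nat.gcd_mul_right, hc.gcd_eq_one, one_mul,
      Nat.mul_div_cancel _ hd, Nat.mul_div_cancel _ hd]
  · intro j hj
    have hg : 0 < j.gcd K := gcd_pos_of_pos_right _ hK
    have hg' : ((j.gcd K : ℕ) : ℝ) ≠ 0 := by positivity
    congr 1
    simp only
    rw [cast_div (Nat.gcd_dvd_left _ _) hg', cast_div (Nat.gcd_dvd_right _ _) hg']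
    grind

lemma e_natCast_mul (j : ℕ) (x : ℝ) : e (j * x) = e x ^ j := by
  rw [e, e, ← Complex.exp_nat_mul]
  congr 1
  push_cast
  ring

/-- Orthogonality of additive characters. -/
lemma sum_range_e (K : ℕ) (hK : 0 < K) (z : ℤ) :
    ∑ j ∈ range K, e ((j : ℝ) / K * z) = if (K : ℤ) ∣ z then (K : ℂ) else 0 := by
  have hK' : (K : ℝ) ≠ 0 := by positivity
  have h1 : ∀ j : ℕ, e ((j : ℝ) / K * z) = e ((z : ℝ) / K) ^ j := by
    intro j
    rw [← e_natCast_mul]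
    congr 1
    ring
  simp_rw [h1]
  split_ifs with h
  · obtain ⟨w, rfl⟩ := h
    have : e (((K * w : ℤ) : ℝ) / K) = 1 := by
      push_cast
      rw [mul_div_cancel_left₀ _ hK', e_intCast]
    simp_rw [this]
    simp
  · have hf := norm_one_sub_e_ge (far_div hK h)
    have hne : e ((z : ℝ) / K) ≠ 1 := by
      intro h1
      rw [h1] at hf
      have : (0 : ℝ) < 4 * (1 / K) := by positivity
      simp at hf
      linarith [show (0:ℝ) < 4 * (K:ℝ)⁻¹ by positivity]
    rw [geom_sum_eq hne, ← e_natCast_mul, mul_div_cancel₀ _ hK', e_intCast]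
    simp

/-- Ramanujan's sum. -/
def ramanujanSum (q m : ℕ) : ℂ := ∑ a ∈ redRes q, e ((a : ℝ) / q * m)

lemma norm_ramanujanSum_le (q m : ℕ) : ‖ramanujanSum q m‖ ≤ q.totient := by
  rw [← card_redRes]
  refine (norm_sum_le _ _).trans ?_
  simp [norm_e]

/-- The arithmetic function `d ↦ d 1_{d ∣ m}`. -/
def dvdWeight (m : ℕ) : ArithmeticFunction ℂ := ⟨fun d => if d ∣ m then (d : ℂ) else 0, by simp⟩

lemma dvdWeight_apply (m d : ℕ) : dvdWeight m d = if d ∣ m then (d : ℂ) else 0 := rfl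

lemma isMultiplicative_dvdWeight (m : ℕ) : (dvdWeight m).IsMultiplicative := by
  refine ⟨by simp [dvdWeight_apply], fun {a b} hab => ?_⟩
  simp only [dvdWeight_apply]
  by_cases ha : a ∣ m <;> by_cases hb : b ∣ m
  · simp [ha, hb, hab.mul_dvd_of_dvd_of_dvd ha hb]
  · have : ¬ a * b ∣ m := fun h => hb ((dvd_mul_left b a).trans h)
    simp [hb, this]
  · have : ¬ a * b ∣ m := fun h => ha ((dvd_mul_right a b).trans h)
    simp [ha, this]
  · have : ¬ a * b ∣ m := fun h => hb ((dvd_mul_left b a).trans h)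
    simp [hb, this]

/-- Ramanujan's sum as an arithmetic function of the modulus. -/
def ramanujanFun (m : ℕ) : ArithmeticFunction ℂ :=
  ((moebius : ArithmeticFunction ℤ) : ArithmeticFunction ℂ) * dvdWeight m

lemma isMultiplicative_ramanujanFun (m : ℕ) : (ramanujanFun m).IsMultiplicative :=
  isMultiplicative_moebius.intCast.mul (isMultiplicative_dvdWeight m)

lemma ramanujanFun_apply (m q : ℕ) (hq : 0 < q) : ramanujanFun m q = ramanujanSum q m := by
  have h := (sum_eq_iff_sum_mul_moebius_eq (R := ℂ)
    (f := fun q => ramanujanSum q m) (g := fun q => dvdWeight m q)).1 (fun K hK => by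
      have h1 := sum_range_div (fun x => e (x * m)) hK
      have h2 := sum_range_e K hK m
      simp only [Int.cast_natCast] at h2
      rw [h2] at h1
      simp only [ramanujanSum]
      rw [← h1, dvdWeight_apply]
      simp [Int.natCast_dvd_natCast]) q hq
  bound

lemma ramanujanFun_prime {m p : ℕ} (hp : p.Prime) :
    ramanujanFun m p = if p ∣ m then (p : ℂ) - 1 else -1 := by
  rw [ramanujanFun, ArithmeticFunction.mul_apply,
    sum_divisorsAntidiagonal (f := fun a b => (((moebius :
      ArithmeticFunction ℤ) : ArithmeticFunction ℂ) a) * dvdWeight m b), hp.sum_divisors]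
  simp only [intCoe_apply, moebius_apply_one, dvdWeight_apply,
    moebius_apply_prime hp]
  by_cases h : p ∣ m
  · simp [h, Nat.div_self hp.pos]
    ring
  · simp [h, Nat.div_self hp.pos]

lemma ramanujanSum_of_coprime {q m : ℕ} (hq : 0 < q) (h : Coprime m q) :
    ramanujanSum q m = moebius q := by
  rw [← ramanujanFun_apply m q hq, ramanujanFun, ArithmeticFunction.mul_apply]
  rw [sum_eq_single (q, 1)]
  · simp [dvdWeight_apply]
  · rintro ⟨a, b⟩ hab hne
    rw [mem_divisorsAntidiagonal] at hab
    simp only [dvdWeight_apply]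
    rw [if_neg, mul_zero]
    intro hb
    have : b ∣ 1 := by
      rw [← h.gcd_eq_one]
      exact Nat.dvd_gcd hb (hab.1 ▸ dvd_mul_left b a)
    have hb1 : b = 1 := dvd_one.1 this
    grind
  · intro h
    simp [hq.ne'] at h

/-- The normalised indicator of coprimality to `K`, as an Euler product. -/
def coprimeWeight (K m : ℕ) : ℂ :=
  ∏ p ∈ K.primeFactors, if p ∣ m then 0 else (p : ℂ) / ((p : ℂ) - 1)

/-- The arithmetic function `1 / φ`. -/
def invTotient : ArithmeticFunction ℂ := ⟨fun q => ((q.totient : ℂ))⁻¹, by simp⟩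

lemma invTotient_apply (q : ℕ) : invTotient q = ((q.totient : ℂ))⁻¹ := rfl

lemma isMultiplicative_invTotient : invTotient.IsMultiplicative :=
  ⟨by simp [invTotient_apply], fun {a b} hab => by simp [invTotient_apply, totient_mul hab, mul_comm]⟩

/-- Ramanujan's expansion of the indicator of coprimality. -/
lemma coprimeWeight_eq {K m : ℕ} (hK : 0 < K) :
    coprimeWeight K m = ∑ q ∈ K.divisors,
      (moebius q : ℂ) / q.totient * ramanujanSum q m := by
  set P := ∏ p ∈ K.primeFactors, p with hP
  have hPs : Squarefree P := squarefree_prod_of_pairwise_isCoprime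
      (fun p hp q hq hpq => by
        simp only [Function.onFun]
        rw [← coprime_iff_isRelPrime]
        exact (coprime_primes (prime_of_mem_primeFactors hp)
          (prime_of_mem_primeFactors hq)).2 hpq)
      (fun p hp => (prime_of_mem_primeFactors hp).squarefree)
  have hPK : P ∣ K := prod_primeFactors_dvd K
  have hPf : P.primeFactors = K.primeFactors := primeFactors_prod_primeFactors K
  have hmul := isMultiplicative_invTotient.pmul (isMultiplicative_ramanujanFun m)
  have h1 := IsMultiplicative.prodPrimeFactors_one_sub_of_squarefree
    _ hmul hPs
  have h2 : coprimeWeight K m = ∏ p ∈ P.primeFactors, (1 - (pmul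
      invTotient (ramanujanFun m)) p) := by
    rw [coprimeWeight, hPf]
    refine prod_congr rfl fun p hp => ?_
    have hpp := prime_of_mem_primeFactors hp
    rw [pmul_apply, ramanujanFun_prime hpp]
    rw [invTotient_apply, totient_prime hpp]
    rw [cast_sub hpp.one_lt.le, cast_one]
    have : (p : ℂ) - 1 ≠ 0 := by
      rw [sub_ne_zero]
      exact_mod_cast hpp.one_lt.ne'
    split_ifs
    · field_simp
      simp
    · field_simp
      ring
  rw [h2, h1]
  have h3 : ∑ d ∈ P.divisors, (moebius d : ℂ) * (pmul
      invTotient (ramanujanFun m)) d =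
      ∑ q ∈ P.divisors, (moebius q : ℂ) / q.totient * ramanujanSum q m := by
    refine sum_congr rfl fun q hq => ?_
    rw [pmul_apply, ramanujanFun_apply m q (pos_of_mem_divisors hq)]
    rw [invTotient_apply]
    ring
  rw [h3]
  refine sum_subset (divisors_subset_of_dvd hK.ne' hPK) fun q hq hq' => ?_
  by_cases hsq : Squarefree q
  · exfalso
    apply hq'
    rw [mem_divisors]
    refine ⟨?_, hPs.ne_zero⟩
    rw [← prod_primeFactors_of_squarefree hsq]
    exact prod_dvd_prod_of_subset _ _ _
      (primeFactors_mono (dvd_of_mem_divisors hq) hK.ne')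
  · rw [moebius_eq_zero_of_not_squarefree hsq]
    simp

lemma coprimeWeight_of_not_coprime {K m : ℕ} (hK : 0 < K) (h : ¬ Coprime m K) :
    coprimeWeight K m = 0 := by
  obtain ⟨p, hp, hpm, hpK⟩ := Prime.not_coprime_iff_dvd.1 h
  exact prod_eq_zero (mem_primeFactors.2 ⟨hp, hpK, hK.ne'⟩) (by simp [hpm])

/-- The ratio `K / φ(K)`. -/
def totientRatio (K : ℕ) : ℝ := ∏ p ∈ K.primeFactors, (p : ℝ) / ((p : ℝ) - 1)

lemma coprimeWeight_of_coprime {K m : ℕ} (h : Coprime m K) :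
    coprimeWeight K m = totientRatio K := by
  rw [coprimeWeight, totientRatio]
  push_cast
  refine prod_congr rfl fun p hp => ?_
  rw [if_neg]
  intro hpm
  have := Nat.dvd_gcd hpm (dvd_of_mem_primeFactors hp)
  rw [h.gcd_eq_one] at this
  exact (prime_of_mem_primeFactors hp).one_lt.ne' (dvd_one.1 this)

lemma prod_div_sub_one_le (S : Finset ℕ) (hS : ∀ p ∈ S, 2 ≤ p) :
    ∏ p ∈ S, (p : ℝ) / ((p : ℝ) - 1) ≤ S.card + 1 := by
  induction S using induction_on_max with
  | empty => simp
  | insert a s hs ih =>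
    have has : a ∉ s := fun h => lt_irrefl _ (hs a h)
    rw [prod_insert has, card_insert_of_notMem has]
    have ha2 : 2 ≤ a := hS a (mem_insert_self _ _)
    have ih' := ih fun p hp => hS p (mem_insert_of_mem hp)
    have hcard : s.card + 2 ≤ a := by
      have : s ⊆ Ico 2 a := fun p hp =>
        mem_Ico.2 ⟨hS p (mem_insert_of_mem hp), hs p hp⟩
      have := card_le_card this
      simp at this
      omega
    have hcard' : (s.card : ℝ) + 2 ≤ a := mod_cast hcard
    have ha1 : (0 : ℝ) < (a : ℝ) - 1 := by
      have : (2 : ℝ) ≤ a := mod_cast ha2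
      linarith
    have hs0 : (0 : ℝ) ≤ s.card := by positivity
    calc (a : ℝ) / ((a : ℝ) - 1) * ∏ p ∈ s, (p : ℝ) / ((p : ℝ) - 1)
        ≤ (a : ℝ) / ((a : ℝ) - 1) * (s.card + 1) := by
          gcongr
      _ ≤ _ := by
          push_cast
          rw [div_mul_eq_mul_div, div_le_iff₀ ha1]
          nlinarith

lemma totientRatio_eq {K : ℕ} (hK : 0 < K) : totientRatio K = (K : ℝ) / K.totient := by
  have h := totient_mul_prod_primeFactors K
  have h' : (K.totient : ℝ) * ∏ p ∈ K.primeFactors, (p : ℝ) =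
      K * ∏ p ∈ K.primeFactors, ((p : ℝ) - 1) := by
    have h2 : ∏ p ∈ K.primeFactors, ((p : ℝ) - 1) =
        ((∏ p ∈ K.primeFactors, (p - 1) : ℕ) : ℝ) := by
      push_cast
      refine prod_congr rfl fun p hp => ?_
      rw [cast_sub (prime_of_mem_primeFactors hp).one_lt.le, cast_one]
    rw [h2]
    have h3 := congrArg (Nat.cast : ℕ → ℝ) h
    rw [cast_mul, cast_mul, cast_prod] at h3
    exact h3
  rw [totientRatio, prod_div_distrib]
  have h3 : ∏ p ∈ K.primeFactors, ((p : ℝ) - 1) ≠ 0 := by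
    rw [prod_ne_zero_iff]
    intro p hp
    rw [sub_ne_zero]
    exact_mod_cast (prime_of_mem_primeFactors hp).one_lt.ne'
  have h4 : (K.totient : ℝ) ≠ 0 := mod_cast (totient_pos.2 hK).ne'
  grind

lemma one_le_totientRatio (K : ℕ) (hK : 0 < K) : 1 ≤ totientRatio K := by
  rw [totientRatio_eq hK, one_le_div (mod_cast totient_pos.2 hK)]
  exact_mod_cast totient_le K

lemma totientRatio_le {K n : ℕ} (hn : 3 ≤ n) (hK : 0 < K) (hKn : K ≤ n) :
    totientRatio K ≤ 3 * log n := by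
  have h1 := prod_div_sub_one_le K.primeFactors
    fun p hp => (prime_of_mem_primeFactors hp).two_le
  have h2 : 2 ^ K.primeFactors.card ≤ K := by
    calc 2 ^ K.primeFactors.card ≤ ∏ p ∈ K.primeFactors, p :=
          pow_card_le_prod _ _ _ fun p hp => (prime_of_mem_primeFactors hp).two_le
      _ ≤ K := le_of_dvd hK (prod_primeFactors_dvd K)
  have h3 : (K.primeFactors.card : ℝ) * log 2 ≤ log n := by
    rw [← log_pow]
    apply log_le_log (by positivity)
    exact_mod_cast h2.trans hKn
  have h4 : (1 : ℝ) ≤ log n := by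
    rw [le_log_iff_exp_le (by positivity)]
    have : (3 : ℝ) ≤ n := mod_cast hn
    linarith [exp_one_lt_d9]
  have h5 := log_two_gt_d9
  have h6 : (0 : ℝ) ≤ K.primeFactors.card := by positivity
  rw [totientRatio]
  nlinarith

lemma inv_totient_le {q n : ℕ} (hn : 3 ≤ n) (hq : 0 < q) (hqn : q ≤ n) :
    1 / (q.totient : ℝ) ≤ 3 * log n / q := by
  have h := totientRatio_le hn hq hqn
  rw [totientRatio_eq hq] at h
  rw [le_div_iff₀ (by positivity)]
  grind

lemma sum_norm_sq_le_of_sq_le {ι : Type*} {I : Finset ι} {S : ι → ℂ} {B : ℝ} (hB : 0 ≤ B)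
    (h : ‖∑ u ∈ I, conj (S u) * S u‖ ^ 2 ≤ (∑ u ∈ I, ‖S u‖ ^ 2) * B) :
    ∑ u ∈ I, ‖S u‖ ^ 2 ≤ B := by
  have h0 : 0 ≤ ∑ u ∈ I, ‖S u‖ ^ 2 := by positivity
  simp only [conj_mul'] at h
  norm_cast at h
  rw [norm_eq_abs, sq_abs] at h
  nlinarith

/-- If the rows of a kernel are almost orthogonal, the associated operator is bounded. -/
lemma sum_norm_row_sq_le {ι κ : Type*} (I : Finset ι) (J : Finset κ) (c : ι → κ → ℂ)
    (y : κ → ℂ) {W : ℝ} (hW0 : 0 ≤ W)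
    (hW : ∀ u ∈ I, ∑ u' ∈ I, ‖∑ v ∈ J, c u v * conj (c u' v)‖ ≤ W) :
    ∑ u ∈ I, ‖∑ v ∈ J, y v * c u v‖ ^ 2 ≤ W * ∑ v ∈ J, ‖y v‖ ^ 2 := by
  refine sum_norm_sq_le_of_sq_le (by positivity) ?_
  have h := norm_bilinear_sq_le I J c (fun u => conj (∑ v ∈ J, y v * c u v)) y hW
  simp only [RCLike.norm_conj, mul_assoc, ← mul_sum] at h
  linarith

/-- The dual form of `sum_norm_row_sq_le`. -/
lemma sum_norm_col_sq_le {ι κ : Type*} (I : Finset ι) (J : Finset κ) (c : ι → κ → ℂ)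
    (x : ι → ℂ) {W : ℝ} (hW0 : 0 ≤ W)
    (hW : ∀ u ∈ I, ∑ u' ∈ I, ‖∑ v ∈ J, c u v * conj (c u' v)‖ ≤ W) :
    ∑ v ∈ J, ‖∑ u ∈ I, x u * c u v‖ ^ 2 ≤ W * ∑ u ∈ I, ‖x u‖ ^ 2 := by
  refine sum_norm_sq_le_of_sq_le (by positivity) ?_
  have h := norm_bilinear_sq_le I J c x (fun v => conj (∑ u ∈ I, x u * c u v)) hW
  rw [sum_comm] at h
  simp only [RCLike.norm_conj, mul_right_comm _ (conj _), ← sum_mul] at h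
  simpa only [mul_comm, mul_left_comm] using h

lemma norm_sum_Icc_e_le {x δ : ℝ} (hδ : 0 < δ) (hx : Far δ x) (T : ℕ) :
    ‖∑ m ∈ Icc 1 T, e (x * m)‖ ≤ 1 / δ := by
  have h := norm_sum_Icc_periodic_mul_e_le (f := fun _ => 1) (K := 1) hδ (by simpa using hx)
    ⟨fun _ => rfl, fun _ => by simp⟩ T
  simpa using h

lemma norm_sum_Icc_periodic_mul_e_le_mul {f : ℕ → ℂ} {x δ B : ℝ} {K : ℕ} (hδ : 0 < δ) (hB : 0 < B)
    (hx : Far δ (x * K)) (hf : ∀ m, f (m + K) = f m) (hf1 : ∀ m, ‖f m‖ ≤ B) (T : ℕ) :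
    ‖∑ m ∈ Icc 1 T, f m * e (x * m)‖ ≤ B * (K / δ) := by
  have h := norm_sum_Icc_periodic_mul_e_le (f := fun m => (B : ℂ)⁻¹ * f m) hδ hx
    ⟨fun m => by rw [hf], fun m => by
      rw [norm_mul, norm_inv, norm_real, norm_eq_abs, abs_of_pos hB,
        inv_mul_le_iff₀ hB, mul_one]
      exact hf1 m⟩ T
  simp_rw [mul_assoc] at h
  rw [← mul_sum, norm_mul, norm_inv, norm_real, norm_eq_abs, abs_of_pos hB,
    inv_mul_le_iff₀ hB] at h
  exact h

/-- Distinct reduced fractions are well spaced modulo one. -/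
lemma far_sub_of_ne {q a q' a' : ℕ} (ha : a ∈ redRes q) (ha' : a' ∈ redRes q')
    (hne : ¬ (q = q' ∧ a = a')) : Far (1 / (q * q')) ((a : ℝ) / q - a' / q') := by
  rw [mem_redRes] at ha ha'
  have hq : 0 < q := by omega
  have hq' : 0 < q' := by omega
  have h1 : (a : ℝ) / q - a' / q' = ((a * q' - a' * q : ℤ) : ℝ) / ((q * q' : ℕ) : ℝ) := by
    push_cast
    field_simp
  rw [h1]
  have h2 := far_div (a := (a * q' - a' * q : ℤ)) (r := q * q') (by positivity) (by
    intro hdvd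
    apply hne
    have e1 : q ∣ q' := by
      have : (q : ℤ) ∣ (a : ℤ) * q' := by
        have h3 : (q : ℤ) ∣ (a * q' - a' * q : ℤ) :=
          (Dvd.intro (q' : ℤ) (by push_cast; ring)).trans hdvd
        have h4 := dvd_add h3 (dvd_mul_left (q : ℤ) a')
        simpa using h4
      have : q ∣ a * q' := mod_cast this
      exact (ha.2.symm).dvd_of_dvd_mul_left this
    have e2 : q' ∣ q := by
      have : (q' : ℤ) ∣ (a' : ℤ) * q := by
        have h3 : (q' : ℤ) ∣ (a * q' - a' * q : ℤ) :=
          (Dvd.intro_left (q : ℤ) (by push_cast; ring)).trans hdvd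
        have h4 := dvd_sub (dvd_mul_left (q' : ℤ) a) h3
        simpa using h4
      have : q' ∣ a' * q := mod_cast this
      exact (ha'.2.symm).dvd_of_dvd_mul_left this
    have e3 : q = q' := Nat.dvd_antisymm e1 e2
    subst e3
    refine ⟨rfl, ?_⟩
    obtain ⟨z, hz⟩ := hdvd
    have hz2 : (a : ℤ) - a' = q * z := by
      have hq0 : (q : ℤ) ≠ 0 := by positivity
      apply mul_right_cancel₀ hq0
      push_cast at hz
      linarith
    have hz0 : z = 0 := by
      by_contra hz0
      have h5 : (q : ℤ) ≤ |(a : ℤ) - a'| := by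
        rw [hz2, abs_mul, abs_cast]
        nlinarith [Int.one_le_abs hz0, (show (0:ℤ) ≤ q by positivity)]
      have h6 : |(a : ℤ) - a'| < q := by
        rw [abs_lt]
        constructor <;> omega
      omega
    grind)
  simpa using h2

lemma card_sigma_redRes_le (X : ℕ) : ((Icc 1 X).sigma redRes).card ≤ X ^ 2 := by
  rw [card_sigma]
  calc ∑ q ∈ Icc 1 X, (redRes q).card ≤ ∑ q ∈ Icc 1 X, X := by
        refine sum_le_sum fun q hq => ?_
        rw [card_redRes]
        exact (totient_le q).trans (mem_Icc.1 hq).2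
    _ = X ^ 2 := by simp [sq]

lemma gram_redRes_le (X n : ℕ) (u : Σ _ : ℕ, ℕ) (hu : u ∈ (Icc 1 X).sigma redRes) :
    ∑ u' ∈ (Icc 1 X).sigma redRes, ‖∑ m ∈ Icc 1 n, e (-((u.2 : ℝ) / u.1 * m)) *
      conj (e (-((u'.2 : ℝ) / u'.1 * m)))‖ ≤ n + (X : ℝ) ^ 4 := by
  have hsum : ∀ u' : Σ _ : ℕ, ℕ, ∑ m ∈ Icc 1 n, e (-((u.2 : ℝ) / u.1 * m)) *
      conj (e (-((u'.2 : ℝ) / u'.1 * m))) =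
      ∑ m ∈ Icc 1 n, e (((u'.2 : ℝ) / u'.1 - (u.2 : ℝ) / u.1) * m) := by
    intro u'
    refine sum_congr rfl fun m _ => ?_
    rw [conj_e, ← e_add]
    congr 1
    ring
  simp_rw [hsum]
  rw [mem_sigma, mem_Icc] at hu
  have hX : 1 ≤ X := hu.1.1.trans hu.1.2
  have hterm : ∀ u' ∈ (Icc 1 X).sigma redRes,
      ‖∑ m ∈ Icc 1 n, e (((u'.2 : ℝ) / u'.1 - (u.2 : ℝ) / u.1) * m)‖ ≤
      (if u' = u then (n : ℝ) else 0) + (X : ℝ) ^ 2 := by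
    intro u' hu'
    rw [mem_sigma, mem_Icc] at hu'
    split_ifs with h
    · refine (norm_sum_le _ _).trans ?_
      simp only [norm_e, sum_const, card_Icc, add_tsub_cancel_right, mul_one, nsmul_eq_mul]
      simp
    · rw [zero_add]
      have hf := far_sub_of_ne hu'.2 hu.2 (fun h' => h (Sigma.ext h'.1 (heq_of_eq h'.2)))
      have hp : (0 : ℝ) < u'.1 * u.1 := by
        have h1 : 0 < u'.1 := hu'.1.1
        have h2 : 0 < u.1 := hu.1.1
        positivity
      refine (norm_sum_Icc_e_le (by positivity) hf n).trans ?_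
      rw [one_div_one_div, sq]
      have h1 : (u'.1 : ℝ) ≤ X := mod_cast hu'.1.2
      have h2 : (u.1 : ℝ) ≤ X := mod_cast hu.1.2
      gcongr
  refine (sum_le_sum hterm).trans ?_
  rw [sum_add_distrib, sum_ite_eq', if_pos (by grind)]
  simp only [sum_const, nsmul_eq_mul]
  have := card_sigma_redRes_le X
  have h3 : (((Icc 1 X).sigma redRes).card : ℝ) ≤ (X : ℝ) ^ 2 := mod_cast this
  nlinarith

/-- A crude additive large sieve. -/
lemma large_sieve (X n : ℕ) (y : ℕ → ℂ) :
    ∑ q ∈ Icc 1 X, ∑ a ∈ redRes q, ‖∑ m ∈ Icc 1 n, y m * e (-((a : ℝ) / q * m))‖ ^ 2 ≤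
      (n + (X : ℝ) ^ 4) * ∑ m ∈ Icc 1 n, ‖y m‖ ^ 2 := by
  rw [sum_sigma']
  exact sum_norm_row_sq_le _ _ (fun (u : Σ _ : ℕ, ℕ) (m : ℕ) => e (-((u.2 : ℝ) / u.1 * m))) y
    (by positivity) (gram_redRes_le X n)

/-- The dual of the crude additive large sieve. -/
lemma dual_large_sieve (X n : ℕ) (x : ℕ → ℕ → ℂ) :
    ∑ m ∈ Icc 1 n, ‖∑ q ∈ Icc 1 X, ∑ a ∈ redRes q, x q a * e (-((a : ℝ) / q * m))‖ ^ 2 ≤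
      (n + (X : ℝ) ^ 4) * ∑ q ∈ Icc 1 X, ∑ a ∈ redRes q, ‖x q a‖ ^ 2 := by
  rw [sum_sigma']
  simp_rw [sum_sigma']
  exact sum_norm_col_sq_le _ _ (fun (u : Σ _ : ℕ, ℕ) (m : ℕ) => e (-((u.2 : ℝ) / u.1 * m)))
    (fun u => x u.1 u.2) (by positivity) (gram_redRes_le X n)

lemma gram_range_eq {M j : ℕ} (hM : 0 < M) (hj : j ∈ range M) :
    ∑ j' ∈ range M, ‖∑ b ∈ range M, e (-((b : ℝ) / M * j)) *
      conj (e (-((b : ℝ) / M * j')))‖ = M := by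
  have h1 : ∀ j' : ℕ, ∑ b ∈ range M, e (-((b : ℝ) / M * j)) *
      conj (e (-((b : ℝ) / M * j'))) =
      if (M : ℤ) ∣ (j' : ℤ) - j then (M : ℂ) else 0 := by
    intro j'
    rw [← sum_range_e M hM]
    refine sum_congr rfl fun b _ => ?_
    rw [conj_e, ← e_add]
    congr 1
    push_cast
    ring
  simp_rw [h1]
  rw [sum_eq_single j]
  · simp
  · intro j' hj' hne
    rw [if_neg, norm_zero]
    rintro ⟨z, hz⟩
    rw [mem_range] at hj hj'
    have : z = 0 := by
      by_contra h0
      have h5 : (M : ℤ) ≤ |(j' : ℤ) - j| := by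
        rw [hz, abs_mul, abs_cast]
        nlinarith [Int.one_le_abs h0, (show (0:ℤ) ≤ M by positivity)]
      have h6 : |(j' : ℤ) - j| < M := by
        rw [abs_lt]
        constructor <;> omega
      omega
    grind
  grind

/-- A sum against a `K`-periodic function is controlled by the Fourier transform at the
reduced fractions with denominators dividing `K`. -/
lemma norm_sum_mul_periodic_sq_le {K : ℕ} (hK : 0 < K) (f : ℕ → ℂ) (hf : UnitPeriodic K f)
    (S : Finset ℕ) (x : ℕ → ℂ) :
    ‖∑ m ∈ S, x m * f m‖ ^ 2 ≤
      ∑ q ∈ K.divisors, ∑ a ∈ redRes q, ‖∑ m ∈ S, x m * e (-((a : ℝ) / q * m))‖ ^ 2 := by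
  rw [← sum_range_div (fun t => ‖∑ m ∈ S, x m * e (-(t * m))‖ ^ 2) hK]
  set X : ℕ → ℂ := fun j => ∑ m ∈ S, x m * e (-((j : ℝ) / K * m)) with hX
  set θ : ℕ → ℂ := fun j => ∑ b ∈ range K, conj (f b) * e (-((b : ℝ) / K * j)) with hφ
  have hK0 : (K : ℂ) ≠ 0 := mod_cast hK.ne'
  have hfm : ∀ m, (K : ℂ) * f m = ∑ j ∈ range K, e (-((j : ℝ) / K * m)) *
      conj (θ j) := by
    intro m
    have h1 : ∀ j : ℕ, e (-((j : ℝ) / K * m)) * conj (θ j) =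
        ∑ b ∈ range K, f b * e ((j : ℝ) / K * (((b : ℤ) - m : ℤ) : ℝ)) := by
      intro j
      rw [hφ]
      simp only
      rw [map_sum, mul_sum]
      refine sum_congr rfl fun b _ => ?_
      rw [map_mul, conj_conj, conj_e, neg_neg, mul_left_comm, ← e_add]
      congr 2
      push_cast
      ring
    simp_rw [h1]
    rw [sum_comm]
    simp_rw [← mul_sum, sum_range_e K hK]
    rw [sum_eq_single (m % K)]
    · rw [if_pos, Function.Periodic.map_mod_nat hf.add m, mul_comm]
      rw [← dvd_neg, neg_sub]
      push_cast
      exact Int.dvd_self_sub_emod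
    · intro b hb hne
      rw [if_neg, mul_zero]
      intro hd
      apply hne
      have : b ≡ m [MOD K] := by
        rw [modEq_iff_dvd, ← dvd_neg, neg_sub]
        exact hd
      rw [← mod_eq_of_lt (mem_range.1 hb)]
      exact this
    · intro h
      exact absurd (mem_range.2 (mod_lt _ hK)) h
  have hmain : (K : ℂ) * ∑ m ∈ S, x m * f m = ∑ j ∈ range K, X j * conj (θ j) := by
    rw [mul_sum]
    simp_rw [mul_left_comm, hfm, mul_sum, hX, sum_mul]
    rw [sum_comm]
    refine sum_congr rfl fun j _ => sum_congr rfl fun m _ => by ring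
  have hφ2 : ∑ j ∈ range K, ‖θ j‖ ^ 2 ≤ (K : ℝ) ^ 2 := by
    have h := sum_norm_row_sq_le (range K) (range K) (fun j b : ℕ => e (-((b : ℝ) / K * j)))
      (fun b => conj (f b)) (W := K) (by positivity) (fun j hj => (gram_range_eq hK hj).le)
    refine h.trans ?_
    have h2 : ∑ b ∈ range K, ‖conj (f b)‖ ^ 2 ≤ K := by
      calc ∑ b ∈ range K, ‖conj (f b)‖ ^ 2 ≤ ∑ b ∈ range K, (1 : ℝ) := by
            refine sum_le_sum fun b _ => ?_
            rw [RCLike.norm_conj]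
            exact pow_le_one₀ (norm_nonneg _) (hf.norm_le b)
        _ = K := by simp
    nlinarith [show (0 : ℝ) ≤ K by positivity]
  have hcs : ‖∑ j ∈ range K, X j * conj (θ j)‖ ^ 2 ≤
      (∑ j ∈ range K, ‖X j‖ ^ 2) * ∑ j ∈ range K, ‖θ j‖ ^ 2 := by
    refine le_trans ?_ (sum_mul_sq_le_sq_mul_sq _ _ _)
    refine pow_le_pow_left₀ (norm_nonneg _) ((norm_sum_le _ _).trans (sum_le_sum fun j _ => ?_)) 2
    rw [norm_mul, RCLike.norm_conj]
  rw [← hmain, norm_mul, mul_pow, Complex.norm_natCast] at hcs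
  have hKr : (0 : ℝ) < (K : ℝ) ^ 2 := by positivity
  have hS0 : 0 ≤ ∑ j ∈ range K, ‖X j‖ ^ 2 := by positivity
  nlinarith

/-- The denominators used in the model for the primes. -/
def modelDenoms (κ Q : ℕ) : Finset ℕ := (Icc 1 Q).filter (fun q => Coprime q κ)

lemma mem_modelDenoms {κ Q q : ℕ} : q ∈ modelDenoms κ Q ↔ (1 ≤ q ∧ q ≤ Q) ∧ Coprime q κ := by
  simp [modelDenoms]

/-- The coefficient `μ(q) / φ(q)`. -/
def ramanujanCoeff (q : ℕ) : ℂ := (moebius q : ℂ) / q.totient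

lemma norm_ramanujanCoeff_le (q : ℕ) : ‖ramanujanCoeff q‖ ≤ 1 / q.totient := by
  rw [ramanujanCoeff, norm_div, Complex.norm_natCast]
  gcongr
  rw [norm_intCast]
  exact_mod_cast abs_moebius_le_one

/-- The partial sum of the Ramanujan expansion of the von Mangoldt function. -/
def modelSum (κ Q m : ℕ) : ℂ := ∑ q ∈ modelDenoms κ Q, ramanujanCoeff q * ramanujanSum q m

/-- A model for the von Mangoldt function, adapted to residue classes modulo `κ`. -/
def model (κ Q m : ℕ) : ℂ := coprimeWeight κ m * modelSum κ Q m

lemma coprimeWeight_add {κ K : ℕ} (h : κ ∣ K) (m : ℕ) :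
    coprimeWeight κ (m + K) = coprimeWeight κ m := by
  rw [coprimeWeight, coprimeWeight]
  refine prod_congr rfl fun p hp => ?_
  have : p ∣ K := (dvd_of_mem_primeFactors hp).trans h
  simp [Nat.dvd_add_left this]

lemma norm_coprimeWeight_le {κ : ℕ} (hκ : 0 < κ) (m : ℕ) :
    ‖coprimeWeight κ m‖ ≤ totientRatio κ := by
  have h1 := one_le_totientRatio κ hκ
  by_cases h : Coprime m κ
  · rw [coprimeWeight_of_coprime h, norm_real, norm_eq_abs, abs_of_nonneg (by linarith)]
  · rw [coprimeWeight_of_not_coprime hκ h, norm_zero]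
    linarith

lemma ramanujanSum_neg (q m : ℕ) :
    ∑ a ∈ redRes q, e (-((a : ℝ) / q * m)) = ramanujanSum q m := by
  have h : conj (ramanujanSum q m) = ramanujanSum q m := by
    rcases Nat.eq_zero_or_pos q with rfl | hq
    · simp [ramanujanSum, redRes]
    · rw [← ramanujanFun_apply m q hq, ramanujanFun, ArithmeticFunction.mul_apply, map_sum]
      refine sum_congr rfl fun x _ => ?_
      rw [dvdWeight_apply]
      split_ifs <;> simp
  rw [← h, ramanujanSum, map_sum]
  exact sum_congr rfl fun a _ => (conj_e _).symm

/-- Exponential sums of partial Ramanujan expansions, twisted by periodic functions. -/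
lemma norm_sum_ramanujan_periodic_le {D : Finset ℕ} {Q K : ℕ} {B δ α : ℝ} {f : ℕ → ℂ}
    (hD : ∀ q ∈ D, 1 ≤ q ∧ q ≤ Q) (hB : 0 < B) (hδ : 0 < δ)
    (hfar : ∀ q ∈ D, Squarefree q → ∀ a ∈ redRes q, Far δ ((α + (a : ℝ) / q) * K))
    (hf : ∀ m, f (m + K) = f m) (hf1 : ∀ m, ‖f m‖ ≤ B) (T : ℕ) :
    ‖∑ m ∈ Icc 1 T, f m * (∑ q ∈ D, ramanujanCoeff q * ramanujanSum q m) * e (α * m)‖ ≤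
      Q * (B * (K / δ)) := by
  have h1 : ∑ m ∈ Icc 1 T, f m * (∑ q ∈ D, ramanujanCoeff q * ramanujanSum q m) * e (α * m) =
      ∑ q ∈ D, ramanujanCoeff q * ∑ a ∈ redRes q, ∑ m ∈ Icc 1 T,
        f m * e ((α + (a : ℝ) / q) * m) := by
    simp_rw [ramanujanSum, mul_sum, sum_mul]
    rw [sum_comm]
    refine sum_congr rfl fun q _ => ?_
    rw [sum_comm]
    refine sum_congr rfl fun a _ => sum_congr rfl fun m _ => ?_
    rw [add_mul, e_add]
    ring
  rw [h1]
  have hterm : ∀ q ∈ D, ‖ramanujanCoeff q * ∑ a ∈ redRes q, ∑ m ∈ Icc 1 T,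
        f m * e ((α + (a : ℝ) / q) * m)‖ ≤ B * (K / δ) := by
    intro q hq
    by_cases hsq : Squarefree q
    · have hq0 : 0 < q := (hD q hq).1
      have hφ : (0 : ℝ) < q.totient := mod_cast totient_pos.2 hq0
      have h2 : ‖∑ a ∈ redRes q, ∑ m ∈ Icc 1 T, f m * e ((α + (a : ℝ) / q) * m)‖ ≤
          q.totient * (B * (K / δ)) := by
        rw [← card_redRes, ← nsmul_eq_mul, ← sum_const]
        exact (norm_sum_le _ _).trans (sum_le_sum fun a ha =>
          norm_sum_Icc_periodic_mul_e_le_mul hδ hB (hfar q hq hsq a ha) hf hf1 T)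
      rw [norm_mul]
      calc _ ≤ 1 / (q.totient : ℝ) * (q.totient * (B * (K / δ))) :=
            mul_le_mul (norm_ramanujanCoeff_le q) h2 (norm_nonneg _) (by positivity)
        _ = _ := by field_simp
    · rw [ramanujanCoeff, moebius_eq_zero_of_not_squarefree hsq]
      simp
      positivity
  refine (norm_sum_le _ _).trans ((sum_le_sum hterm).trans ?_)
  rw [sum_const, nsmul_eq_mul]
  have h3 : D.card ≤ Q := by
    have := card_le_card (fun q hq => mem_Icc.2 (hD q hq) : D ⊆ Icc 1 Q)
    simpa using this
  gcongr

/-- The model has small exponential sums on the minor arcs. -/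
lemma norm_sum_model_minor_le {κ Q r : ℕ} {a : ℤ} {α η : ℝ} (hκ : 0 < κ) (hQ : 1 ≤ Q) (hr : Q < r)
    (ha : IsCoprime a r) (hη : |α * κ - a / r| ≤ η) (hη' : η ≤ 1 / (2 * r * Q))
    {ε : ℕ → ℂ} (hε : UnitPeriodic κ ε) (T : ℕ) :
    ‖∑ m ∈ Icc 1 T, model κ Q m * (ε m * e (α * m))‖ ≤
      Q * (totientRatio κ * (κ * (2 * r * Q))) := by
  have hr0 : (0 : ℝ) < r := mod_cast (by omega : 0 < r)
  have hQ0 : (0 : ℝ) < Q := mod_cast (by omega : 0 < Q)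
  have h1 := one_le_totientRatio κ hκ
  have h := norm_sum_ramanujan_periodic_le (D := modelDenoms κ Q) (Q := Q) (K := κ)
    (B := totientRatio κ) (δ := 1 / (2 * r * Q)) (α := α) (f := fun m => coprimeWeight κ m * ε m)
    (fun q hq => (mem_modelDenoms.1 hq).1) (by linarith) (by positivity) ?_
    (fun m => by rw [hε.add, coprimeWeight_add dvd_rfl]) (fun m => by
      rw [norm_mul]
      exact (mul_le_mul (norm_coprimeWeight_le hκ m) (hε.norm_le m) (norm_nonneg _)
        (by linarith)).trans (by rw [mul_one])) T
  · refine le_trans (le_of_eq ?_) (h.trans (le_of_eq ?_))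
    · congr 1
      refine sum_congr rfl fun m _ => ?_
      rw [model, modelSum]
      ring
    linarith
  · intro q hq _ b hb
    obtain ⟨⟨hq1, hqQ⟩, -⟩ := mem_modelDenoms.1 hq
    have hq0 : (0 : ℝ) < q := mod_cast hq1
    have hnd : ¬ ((r * q : ℕ) : ℤ) ∣ (a * q + κ * b * r) := by
      intro hd
      have h2 : (r : ℤ) ∣ a * q + κ * b * r := (Dvd.intro (q : ℤ) (by push_cast; ring)).trans hd
      have h3 : (r : ℤ) ∣ a * q := (Int.dvd_add_left (dvd_mul_left _ _)).1 h2
      have h4 : (r : ℤ) ∣ q := ha.symm.dvd_of_dvd_mul_left h3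
      have h5 : r ≤ q := le_of_dvd hq1 (mod_cast h4)
      omega
    have h6 := far_div (r := r * q) (by nlinarith) hnd
    have h7 := h6.add hη
    have h8 : ((a * q + κ * b * r : ℤ) : ℝ) / ((r * q : ℕ) : ℝ) + (α * κ - a / r) =
        (α + (b : ℝ) / q) * κ := by
      push_cast
      field_simp
      ring
    rw [h8] at h7
    refine h7.mono ?_
    have h9 : 1 / ((r * q : ℕ) : ℝ) ≥ 1 / (r * Q) := by
      push_cast
      apply one_div_le_one_div_of_le (by positivity)
      have : (q : ℝ) ≤ Q := mod_cast hqQ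
      gcongr
    have h10 : 1 / ((r : ℝ) * Q) = 2 * (1 / (2 * r * Q)) := by
      field_simp
    linarith

lemma coprimeWeight_mul_eq {κ r : ℕ} (hκ : 0 < κ) (hr : 0 < r) (m : ℕ) :
    coprimeWeight (κ * r) m = coprimeWeight κ m *
      coprimeWeight (∏ p ∈ r.primeFactors \ κ.primeFactors, p) m := by
  have h1 : (∏ p ∈ r.primeFactors \ κ.primeFactors, p).primeFactors =
      r.primeFactors \ κ.primeFactors :=
    primeFactors_prod fun p hp => prime_of_mem_primeFactors (mem_sdiff.1 hp).1
  rw [coprimeWeight, coprimeWeight, coprimeWeight, h1, primeFactors_mul hκ.ne' hr.ne',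
    ← prod_union disjoint_sdiff, union_sdiff_self_eq_union]

/-- In residue classes modulo `κ r` the model agrees with the indicator of coprimality. -/
lemma norm_sum_model_sub_coprimeWeight_le {κ Q r : ℕ} (hκ : 0 < κ) (hr : 0 < r) (hrQ : r ≤ Q)
    {f : ℕ → ℂ} (hf : UnitPeriodic (κ * r) f) (T : ℕ) :
    ‖∑ m ∈ Icc 1 T, (model κ Q m - coprimeWeight (κ * r) m) * f m‖ ≤
      Q * (totientRatio κ * ((κ * r : ℕ) * Q)) := by
  set r₂ := ∏ p ∈ r.primeFactors \ κ.primeFactors, p with hr₂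
  have hprime : ∀ p ∈ r.primeFactors \ κ.primeFactors, p.Prime := fun p hp =>
    prime_of_mem_primeFactors (mem_sdiff.1 hp).1
  have hr₂r : r₂ ∣ r := (prod_dvd_prod_of_subset _ _ _ sdiff_subset).trans
    (prod_primeFactors_dvd r)
  have hr₂0 : 0 < r₂ := pos_of_dvd_of_pos hr₂r hr
  have hr₂κ : Coprime r₂ κ := by
    refine Coprime.prod_left fun p hp => ?_
    rw [(hprime p hp).coprime_iff_not_dvd]
    intro hd
    exact (mem_sdiff.1 hp).2 (mem_primeFactors.2 ⟨hprime p hp, hd, hκ.ne'⟩)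
  have hsub : r₂.divisors ⊆ modelDenoms κ Q := by
    intro q hq
    have hqd := dvd_of_mem_divisors hq
    exact mem_modelDenoms.2 ⟨⟨pos_of_mem_divisors hq,
      (le_of_dvd hr (hqd.trans hr₂r)).trans hrQ⟩, hr₂κ.coprime_dvd_left hqd⟩
  have hdiff : ∀ m, model κ Q m - coprimeWeight (κ * r) m = coprimeWeight κ m *
      ∑ q ∈ modelDenoms κ Q \ r₂.divisors, ramanujanCoeff q * ramanujanSum q m := by
    intro m
    rw [coprimeWeight_mul_eq hκ hr, ← hr₂, coprimeWeight_eq hr₂0, model, modelSum,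
      ← sum_sdiff hsub]
    simp only [ramanujanCoeff]
    ring
  have h1 := one_le_totientRatio κ hκ
  have hQ : (0 : ℝ) < Q := mod_cast (by omega : 0 < Q)
  have h := norm_sum_ramanujan_periodic_le (D := modelDenoms κ Q \ r₂.divisors) (Q := Q)
    (K := κ * r) (B := totientRatio κ) (δ := 1 / Q) (α := 0)
    (f := fun m => coprimeWeight κ m * f m)
    (fun q hq => (mem_modelDenoms.1 (mem_sdiff.1 hq).1).1) (by linarith) (by positivity) ?_
    (fun m => by rw [hf.add, coprimeWeight_add (dvd_mul_right _ _)]) (fun m => by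
      rw [norm_mul]
      exact (mul_le_mul (norm_coprimeWeight_le hκ m) (hf.norm_le m) (norm_nonneg _)
        (by linarith)).trans (by rw [mul_one])) T
  · refine le_trans (le_of_eq ?_) (h.trans (le_of_eq ?_))
    · congr 1
      refine sum_congr rfl fun m _ => ?_
      rw [hdiff, zero_mul, e_zero, mul_one]
      ring
    simp
  · intro q hq hsq a ha
    rw [mem_sdiff] at hq
    obtain ⟨⟨hq1, hqQ⟩, hqκ⟩ := mem_modelDenoms.1 hq.1
    rw [mem_redRes] at ha
    have hnd : ¬ (q : ℤ) ∣ (a * (κ * r : ℕ) : ℤ) := by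
      intro hd
      have h2 : q ∣ a * (κ * r) := mod_cast hd
      have h3 : q ∣ κ * r := ha.2.symm.dvd_of_dvd_mul_left h2
      have h4 : q ∣ r := hqκ.dvd_of_dvd_mul_left h3
      apply hq.2
      rw [mem_divisors]
      refine ⟨?_, hr₂0.ne'⟩
      rw [← prod_primeFactors_of_squarefree hsq]
      refine prod_dvd_prod_of_subset _ _ _ fun p hp => mem_sdiff.2
        ⟨primeFactors_mono h4 hr.ne' hp, fun hp' => ?_⟩
      have h5 := Nat.dvd_gcd (dvd_of_mem_primeFactors hp) (dvd_of_mem_primeFactors hp')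
      rw [hqκ.gcd_eq_one] at h5
      exact (prime_of_mem_primeFactors hp).one_lt.ne' (dvd_one.1 h5)
    have h6 := far_div hq1 hnd
    have h8 : ((a * (κ * r : ℕ) : ℤ) : ℝ) / q = (0 + (a : ℝ) / q) * (κ * r : ℕ) := by
      push_cast
      ring
    rw [h8] at h6
    refine h6.mono ?_
    gcongr

lemma sum_inv_totient_le {n Q : ℕ} (hn : 3 ≤ n) (hQ : Q ≤ n) :
    ∑ q ∈ Icc 1 Q, 1 / (q.totient : ℝ) ≤ 6 * log n ^ 2 := by
  have hl := one_le_log_of_three_le hn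
  calc ∑ q ∈ Icc 1 Q, 1 / (q.totient : ℝ) ≤ ∑ q ∈ Icc 1 n, 1 / (q.totient : ℝ) :=
        sum_le_sum_of_subset_of_nonneg (Icc_subset_Icc_right hQ) fun _ _ _ => by positivity
    _ ≤ ∑ q ∈ Icc 1 n, 3 * log n * (1 / q : ℝ) := by
        refine sum_le_sum fun q hq => ?_
        rw [mem_Icc] at hq
        rw [mul_one_div]
        exact inv_totient_le hn hq.1 hq.2
    _ = 3 * log n * ∑ q ∈ Icc 1 n, (1 / q : ℝ) := by rw [mul_sum]
    _ ≤ 3 * log n * (1 + log n) :=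
        mul_le_mul_of_nonneg_left (sum_Icc_inv_le n) (by linarith)
    _ ≤ _ := by nlinarith

/-- The mean square of the model. -/
lemma sum_norm_model_sq_le {n κ Q : ℕ} (hn : 3 ≤ n) (hκ : 0 < κ) (hκn : κ ≤ n) (hQ : Q ≤ n) :
    ∑ m ∈ Icc 1 n, ‖model κ Q m‖ ^ 2 ≤ 54 * log n ^ 4 * (n + (Q : ℝ) ^ 4) := by
  have hl := one_le_log_of_three_le hn
  have h := dual_large_sieve Q n (fun q _ => if Coprime q κ then ramanujanCoeff q else 0)
  have h1 : ∀ m : ℕ, ∑ q ∈ Icc 1 Q, ∑ a ∈ redRes q, (if Coprime q κ then ramanujanCoeff q else 0) *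
      e (-((a : ℝ) / q * m)) = modelSum κ Q m := by
    intro m
    rw [modelSum, modelDenoms, sum_filter]
    refine sum_congr rfl fun q _ => ?_
    rw [← mul_sum, ramanujanSum_neg]
    split_ifs <;> simp
  simp_rw [h1] at h
  have h2 : ∑ q ∈ Icc 1 Q, ∑ a ∈ redRes q,
      ‖(if Coprime q κ then ramanujanCoeff q else 0)‖ ^ 2 ≤ 6 * log n ^ 2 := by
    refine le_trans (sum_le_sum fun q hq => ?_) (sum_inv_totient_le hn hQ)
    rw [sum_const, card_redRes, nsmul_eq_mul]
    have hφ : (0 : ℝ) < q.totient := mod_cast totient_pos.2 (mem_Icc.1 hq).1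
    have h3 : ‖(if Coprime q κ then ramanujanCoeff q else 0)‖ ≤ 1 / q.totient := by
      split_ifs
      · exact norm_ramanujanCoeff_le q
      · simp
    calc _ ≤ (q.totient : ℝ) * (1 / q.totient) ^ 2 := by gcongr
      _ = _ := by field_simp
  have hr := totientRatio_le hn hκ hκn
  have hr1 := one_le_totientRatio κ hκ
  calc ∑ m ∈ Icc 1 n, ‖model κ Q m‖ ^ 2
      ≤ ∑ m ∈ Icc 1 n, (3 * log n) ^ 2 * ‖modelSum κ Q m‖ ^ 2 := by
        refine sum_le_sum fun m _ => ?_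
        rw [model, norm_mul, mul_pow]
        have := (norm_coprimeWeight_le hκ m).trans hr
        gcongr
    _ = (3 * log n) ^ 2 * ∑ m ∈ Icc 1 n, ‖modelSum κ Q m‖ ^ 2 := by rw [mul_sum]
    _ ≤ (3 * log n) ^ 2 * ((n + (Q : ℝ) ^ 4) * (6 * log n ^ 2)) := by
        refine mul_le_mul_of_nonneg_left (h.trans ?_) (by positivity)
        gcongr
    _ = _ := by ring

/-- The Fourier transform of the indicator of coprimality at reduced fractions. -/
lemma norm_sum_coprimeWeight_mul_e_sub_le {K q a : ℕ} (hK : 0 < K) (hq : q ∣ K)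
    (ha : a ∈ redRes q) (y : ℕ) :
    ‖∑ m ∈ Icc 1 y, coprimeWeight K m * e (-((a : ℝ) / q * m)) - y * ramanujanCoeff q‖ ≤
      (K : ℝ) ^ 3 := by
  have hq0 : 0 < q := pos_of_dvd_of_pos hq hK
  have h1 : ∑ m ∈ Icc 1 y, coprimeWeight K m * e (-((a : ℝ) / q * m)) =
      ∑ q' ∈ K.divisors, ∑ a' ∈ redRes q', ramanujanCoeff q' *
        ∑ m ∈ Icc 1 y, e (((a' : ℝ) / q' - a / q) * m) := by
    simp_rw [coprimeWeight_eq hK, ramanujanSum, mul_sum, sum_mul]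
    rw [sum_comm]
    refine sum_congr rfl fun q' _ => ?_
    rw [sum_comm]
    refine sum_congr rfl fun a' _ => sum_congr rfl fun m _ => ?_
    rw [sub_mul, sub_eq_add_neg, e_add, ramanujanCoeff, mul_assoc]
  have h2 : (y : ℂ) * ramanujanCoeff q = ∑ q' ∈ K.divisors, ∑ a' ∈ redRes q',
      if q' = q ∧ a' = a then (y : ℂ) * ramanujanCoeff q else 0 := by
    rw [sum_eq_single q, sum_eq_single a]
    · simp
    · grind
    · grind
    · intro b _ hb
      simp [hb]
    · grind
  rw [h1, h2, ← sum_sub_distrib]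
  simp_rw [← sum_sub_distrib]
  have hterm : ∀ q' ∈ K.divisors, ‖∑ a' ∈ redRes q', (ramanujanCoeff q' *
        ∑ m ∈ Icc 1 y, e (((a' : ℝ) / q' - a / q) * m) -
        if q' = q ∧ a' = a then (y : ℂ) * ramanujanCoeff q else 0)‖ ≤ (K : ℝ) ^ 2 := by
    intro q' hq'
    have hq'0 := pos_of_mem_divisors hq'
    have hφ : (0 : ℝ) < q'.totient := mod_cast totient_pos.2 hq'0
    have : ∀ a' ∈ redRes q', ‖ramanujanCoeff q' *
        ∑ m ∈ Icc 1 y, e (((a' : ℝ) / q' - a / q) * m) -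
        if q' = q ∧ a' = a then (y : ℂ) * ramanujanCoeff q else 0‖ ≤
        1 / q'.totient * (K : ℝ) ^ 2 := by
      intro a' ha'
      split_ifs with h
      · obtain ⟨rfl, rfl⟩ := h
        simp [e_zero, mul_comm]
        positivity
      · rw [sub_zero, norm_mul]
        have hf := far_sub_of_ne ha' ha h
        have hq'r : (0 : ℝ) < q' := mod_cast hq'0
        have hqr : (0 : ℝ) < q := mod_cast hq0
        have h3 := norm_sum_Icc_e_le (by positivity) hf y
        rw [one_div_one_div] at h3
        refine mul_le_mul (norm_ramanujanCoeff_le q') (h3.trans ?_) (norm_nonneg _) (by positivity)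
        rw [sq]
        have e1 : (q' : ℝ) ≤ K := mod_cast le_of_dvd hK (dvd_of_mem_divisors hq')
        have e2 : (q : ℝ) ≤ K := mod_cast le_of_dvd hK hq
        exact mul_le_mul e1 e2 (by positivity) (by positivity)
    refine (norm_sum_le _ _).trans ((sum_le_sum this).trans ?_)
    rw [sum_const, card_redRes, nsmul_eq_mul]
    apply le_of_eq
    field_simp
  refine (norm_sum_le _ _).trans ((sum_le_sum hterm).trans ?_)
  rw [sum_const, nsmul_eq_mul]
  have : (K.divisors.card : ℝ) ≤ K := mod_cast card_divisors_le_self K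
  nlinarith

/-- A bound of the shape `y / log y ^ k` is uniform in `y ≤ n`. -/
lemma exists_uniform_le_div_log_pow (k : ℕ) : ∃ C₀ : ℝ, 1 ≤ C₀ ∧ ∀ C : ℝ, 1 ≤ C → ∀ f : ℕ → ℝ,
    (∀ y : ℕ, 3 ≤ y → f y ≤ C * y / log y ^ k) →
    ∀ n : ℕ, 3 ≤ n → (∀ y ≤ n, f y ≤ 2 * y * log n) →
    ∀ y ≤ n, f y ≤ C * C₀ * n / log n ^ k := by
  obtain ⟨C₁, hC₁1, hC₁⟩ := exists_log_pow_le (k + 1) (δ := 1 / 2) (by norm_num)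
  refine ⟨2 ^ k + 4 * C₁, by have := one_le_pow₀ (n := k) (one_le_two : (1:ℝ) ≤ 2); linarith, ?_⟩
  intro C hC f hf n hn htriv y hy
  have hl := one_le_log_of_three_le hn
  have hn0 : (0 : ℝ) < n := by positivity
  have hs := sqrt_nonneg (n : ℝ)
  have hss := mul_self_sqrt hn0.le
  have h2k : (0 : ℝ) < 2 ^ k := by positivity
  by_cases h : 3 ≤ y ∧ √n ≤ y
  · refine (hf y h.1).trans ?_
    have hlog : log n ≤ 2 * log y := by
      have h1 := log_le_log (sqrt_pos.2 hn0) h.2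
      rw [log_sqrt hn0.le] at h1
      linarith
    have hpow : log n ^ k ≤ 2 ^ k * log y ^ k := by
      rw [← mul_pow]
      gcongr
    have hly := one_le_log_of_three_le h.1
    rw [div_le_div_iff₀ (by positivity) (by positivity)]
    have hyn : (y : ℝ) ≤ n := mod_cast hy
    calc C * y * log n ^ k ≤ C * n * (2 ^ k * log y ^ k) := by gcongr
      _ ≤ _ := by
        have : 0 ≤ C * n * (4 * C₁) * log y ^ k := by positivity
        nlinarith
  · refine (htriv y hy).trans ?_
    have hy2 : (y : ℝ) ≤ 2 * √n := by
      have h1s : 1 ≤ √n := by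
        rw [one_le_sqrt]
        exact_mod_cast (by omega : 1 ≤ n)
      by_cases h3 : 3 ≤ y
      · grind
      · have : (y : ℝ) ≤ 2 := mod_cast (by omega : y ≤ 2)
        linarith
    have h5 := hC₁ n (mod_cast (by omega : 1 ≤ n))
    rw [← sqrt_eq_rpow] at h5
    rw [le_div_iff₀ (by positivity)]
    calc 2 * y * log n * log n ^ k = 2 * y * log n ^ (k + 1) := by ring
      _ ≤ 2 * (2 * √n) * (C₁ * √n) := by gcongr
      _ = 1 * (4 * C₁) * n := by grind
      _ ≤ C * (4 * C₁) * n := by gcongr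
      _ ≤ _ := by
        bound

lemma vonMangoldt_le_log_of_mem {n y m : ℕ} (hy : y ≤ n) (hm : m ∈ Icc 1 y) :
    Λ m ≤ log n := by
  rw [mem_Icc] at hm
  refine vonMangoldt_le_log.trans (log_le_log ?_ ?_)
  · exact_mod_cast hm.1
  · exact_mod_cast hm.2.trans hy

lemma sum_vonMangoldt_le {n y : ℕ} (hy : y ≤ n) :
    ∑ m ∈ Icc 1 y, Λ m ≤ y * log n := by
  calc ∑ m ∈ Icc 1 y, Λ m ≤ ∑ m ∈ Icc 1 y, log n :=
        sum_le_sum fun m hm => vonMangoldt_le_log_of_mem hy hm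
    _ = _ := by simp

/-- Few prime powers share a factor with `q`. -/
lemma sum_vonMangoldt_not_coprime_le {n y q : ℕ} (hn : 3 ≤ n) (hq : 0 < q) (hy : y ≤ n) :
    ∑ m ∈ (Icc 1 y).filter (fun m => ¬ Coprime m q), Λ m
      ≤ 2 * q * log n ^ 2 := by
  have hl := one_le_log_of_three_le hn
  set S := (Icc 1 y).filter (fun m => ¬ Coprime m q) with hS
  rw [← sum_filter_ne_zero]
  have hsub : S.filter (fun m => Λ m ≠ 0) ⊆
      (Icc 1 q ×ˢ Icc 1 (Nat.log 2 n)).image (fun x => x.1 ^ x.2) := by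
    intro m hm
    rw [mem_filter, hS, mem_filter, mem_Icc, vonMangoldt_ne_zero_iff] at hm
    obtain ⟨⟨⟨hm1, hmy⟩, hcop⟩, hpp⟩ := hm
    obtain ⟨p, j, hp, hj, rfl⟩ := (isPrimePow_nat_iff _).1 hpp
    rw [mem_image]
    refine ⟨(p, j), ?_, rfl⟩
    have hpq : p ∣ q := by
      by_contra hd
      exact hcop (((hp.coprime_iff_not_dvd).2 hd).pow_left j)
    simp only [mem_product, mem_Icc]
    refine ⟨⟨hp.one_lt.le, le_of_dvd hq hpq⟩, hj, ?_⟩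
    apply Nat.le_log_of_pow_le one_lt_two
    exact (Nat.pow_le_pow_left hp.two_le j).trans (hmy.trans hy)
  have hcard := (card_le_card hsub).trans card_image_le
  rw [card_product, card_Icc, card_Icc, Nat.add_sub_cancel, Nat.add_sub_cancel] at hcard
  have hlog : (Nat.log 2 n : ℝ) ≤ 2 * log n := by
    have h1 : ((2 : ℝ) ^ Nat.log 2 n) ≤ n := mod_cast pow_log_le_self 2 (by omega)
    have h2 := log_le_log (by positivity) h1
    rw [log_pow] at h2
    have h3 := log_two_gt_d9
    nlinarith [show (0 : ℝ) ≤ Nat.log 2 n by positivity]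
  calc ∑ m ∈ S.filter (fun m => Λ m ≠ 0), Λ m
      ≤ ∑ m ∈ S.filter (fun m => Λ m ≠ 0), log n :=
        sum_le_sum fun m hm => vonMangoldt_le_log_of_mem hy (mem_filter.1 (mem_filter.1 hm).1).1
    _ = ((S.filter (fun m => Λ m ≠ 0)).card : ℝ) * log n := by simp
    _ ≤ (q * (2 * log n)) * log n := by
        have : ((S.filter (fun m => Λ m ≠ 0)).card : ℝ) ≤ (q * Nat.log 2 n : ℕ) := mod_cast hcard
        push_cast at this
        have h4 : (q : ℝ) * Nat.log 2 n ≤ q * (2 * log n) := by gcongr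
        nlinarith
    _ = _ := by ring

/-- The Siegel–Walfisz theorem for characters, uniformly in the length. -/
lemma norm_sum_char_mul_vonMangoldt_sub_le (k : ℕ) : ∃ C : ℝ, 1 ≤ C ∧
    ∀ (q : ℕ) [NeZero q] (χ : DirichletCharacter ℂ q), ∀ n : ℕ, 3 ≤ n → ∀ y ≤ n,
      ‖∑ m ∈ Icc 1 y, χ m * (Λ m : ℂ) - if χ = 1 then (y : ℂ) else 0‖
        ≤ C * q * (n / log n ^ k + log n ^ 2) := by
  obtain ⟨C₁, hC₁1, hC₁⟩ := norm_sum_char_vonMangoldt_le k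
  obtain ⟨C₂, hC₂1, hC₂⟩ := abs_sum_vonMangoldt_sub_le k
  obtain ⟨C₀, hC₀1, hC₀⟩ := exists_uniform_le_div_log_pow k
  refine ⟨C₁ * C₀ + C₂ * C₀ + 2, by nlinarith, ?_⟩
  intro q _ χ n hn y hy
  have hl := one_le_log_of_three_le hn
  have hq1 : (1 : ℝ) ≤ q := mod_cast NeZero.one_le
  have hX : 0 ≤ (n : ℝ) / log n ^ k := by positivity
  split_ifs with hχ
  · have h1 := hC₀ C₂ hC₂1 (fun y => |∑ m ∈ Icc 1 y, Λ m - y|) (fun y hy => hC₂ y hy)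
      n hn (fun y hy => by
        have h2 := sum_vonMangoldt_le hy
        have h3 : 0 ≤ ∑ m ∈ Icc 1 y, Λ m :=
          sum_nonneg fun m _ => vonMangoldt_nonneg
        have h4 : (0 : ℝ) ≤ y := by positivity
        rw [abs_le]
        constructor <;> nlinarith) y hy
    have h5 : ∑ m ∈ Icc 1 y, χ m * (Λ m : ℂ) - (y : ℂ) =
        ((∑ m ∈ Icc 1 y, Λ m - y : ℝ) : ℂ) -
        ((∑ m ∈ (Icc 1 y).filter (fun m => ¬ Coprime m q), Λ m : ℝ) : ℂ) := by
      rw [sum_filter]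
      push_cast
      rw [sub_right_comm, ← sum_sub_distrib]
      congr 1
      refine sum_congr rfl fun m _ => ?_
      rw [hχ]
      by_cases hm : Coprime m q
      · rw [MulChar.one_apply ((ZMod.isUnit_iff_coprime m q).2 hm)]
        simp [hm]
      · rw [MulChar.map_nonunit _ (fun h => hm ((ZMod.isUnit_iff_coprime m q).1 h))]
        simp [hm]
    rw [h5]
    refine (norm_sub_le _ _).trans ?_
    rw [norm_real, norm_real, norm_eq_abs, norm_eq_abs,
      abs_of_nonneg (sum_nonneg fun m _ => vonMangoldt_nonneg)]
    have h6 := sum_vonMangoldt_not_coprime_le hn (NeZero.pos q) hy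
    have h7 : C₂ * C₀ * n / log n ^ k = C₂ * C₀ * (n / log n ^ k) := by ring
    rw [h7] at h1
    have e1 : C₂ * C₀ * (n / log n ^ k) * 1 ≤ C₂ * C₀ * (n / log n ^ k) * q := by
      gcongr
    have e2 : 0 ≤ (C₁ * C₀ + 2) * q * (n / log n ^ k) := by positivity
    have e3 : 0 ≤ (C₁ * C₀ + C₂ * C₀) * q * log n ^ 2 := by positivity
    nlinarith
  · rw [sub_zero]
    have hqh : (1 : ℝ) ≤ (q : ℝ) ^ (1 / 2 : ℝ) := one_le_rpow hq1 (by norm_num)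
    have hqh' : (q : ℝ) ^ (1 / 2 : ℝ) ≤ q :=
      (rpow_le_rpow_of_exponent_le hq1 (by norm_num)).trans (rpow_one _).le
    have h1 := hC₀ (C₁ * (q : ℝ) ^ (1 / 2 : ℝ)) (one_le_mul_of_one_le_of_one_le hC₁1 hqh)
      (fun y => ‖∑ m ∈ Icc 1 y, χ m * (Λ m : ℂ)‖) (fun y hy => hC₁ q χ hχ y hy)
      n hn (fun y hy => by
        have h2 := sum_vonMangoldt_le hy
        have h3 : ‖∑ m ∈ Icc 1 y, χ m * (Λ m : ℂ)‖ ≤ ∑ m ∈ Icc 1 y, Λ m := by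
          refine (norm_sum_le _ _).trans (sum_le_sum fun m _ => ?_)
          rw [norm_mul, norm_real, norm_eq_abs,
            abs_of_nonneg vonMangoldt_nonneg]
          exact mul_le_of_le_one_left vonMangoldt_nonneg (χ.norm_le_one _)
        nlinarith) y hy
    refine h1.trans ?_
    have h7 : C₁ * (q : ℝ) ^ (1 / 2 : ℝ) * C₀ * n / log n ^ k =
      C₁ * C₀ * (q : ℝ) ^ (1 / 2 : ℝ) * (n / log n ^ k) := by ring
    rw [h7]
    have e1 : C₁ * C₀ * (q : ℝ) ^ (1 / 2 : ℝ) * (n / log n ^ k) ≤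
      C₁ * C₀ * q * (n / log n ^ k) := by gcongr
    have e2 : 0 ≤ (C₂ * C₀ + 2) * q * (n / log n ^ k) := by positivity
    have e3 : 0 ≤ (C₁ * C₀ + C₂ * C₀ + 2) * q * log n ^ 2 := by positivity
    nlinarith

/-- The exponential sum over primes at a reduced fraction with small denominator. -/
lemma norm_sum_vonMangoldt_mul_e_sub_le (k : ℕ) : ∃ C : ℝ, 1 ≤ C ∧
    ∀ q a : ℕ, a ∈ redRes q → ∀ n : ℕ, 3 ≤ n → ∀ y ≤ n,
      ‖∑ m ∈ Icc 1 y, (Λ m : ℂ) * e (-((a : ℝ) / q * m)) - y * ramanujanCoeff q‖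
        ≤ C * q ^ 2 * (n / log n ^ k + log n ^ 2) := by
  obtain ⟨C, hC1, hC⟩ := norm_sum_char_mul_vonMangoldt_sub_le k
  refine ⟨C + 2, by linarith, ?_⟩
  intro q a ha n hn y hy
  have hl := one_le_log_of_three_le hn
  rw [mem_redRes] at ha
  have hq : 0 < q := by omega
  have : NeZero q := ⟨hq.ne'⟩
  have hq0 : (0 : ℝ) < q := mod_cast hq
  have hφ : (0 : ℝ) < q.totient := mod_cast totient_pos.2 hq
  set Err := (n : ℝ) / log n ^ k + log n ^ 2 with hErr
  have hErr0 : 0 ≤ Err := by positivity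
  -- the residue classes
  have hclass : ∀ b ∈ redRes q, ‖∑ m ∈ (Icc 1 y).filter (fun m => m % q = b), (Λ m : ℂ) -
      y / q.totient‖ ≤ C * q * Err := by
    intro b hb
    rw [mem_redRes] at hb
    have hbu : IsUnit (b : ZMod q) := (ZMod.isUnit_iff_coprime b q).2 hb.2
    have h1 : (q.totient : ℂ) * ∑ m ∈ (Icc 1 y).filter (fun m => m % q = b), (Λ m : ℂ) =
        ∑ χ : DirichletCharacter ℂ q, χ (b : ZMod q)⁻¹ *
          ∑ m ∈ Icc 1 y, χ m * (Λ m : ℂ) := by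
      simp_rw [mul_sum]
      rw [sum_comm, sum_filter]
      refine sum_congr rfl fun m _ => ?_
      simp_rw [← mul_assoc]
      rw [← sum_mul, sum_char_inv_mul_char_eq ℂ hbu]
      have : (b : ZMod q) = m ↔ m % q = b := by
        rw [ZMod.natCast_eq_natCast_iff', mod_eq_of_lt hb.1, eq_comm]
      simp only [this]
      split_ifs <;> simp
    have h2 : (y : ℂ) = ∑ χ : DirichletCharacter ℂ q, χ (b : ZMod q)⁻¹ *
        (if χ = 1 then (y : ℂ) else 0) := by
      rw [sum_eq_single 1]
      · rw [if_pos rfl, MulChar.one_apply, one_mul]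
        exact IsUnit.of_mul_eq_one _ (ZMod.inv_mul_of_unit _ hbu)
      · grind
      · simp
    have h3 : (q.totient : ℂ) * (∑ m ∈ (Icc 1 y).filter (fun m => m % q = b), (Λ m : ℂ) -
        y / q.totient) = ∑ χ : DirichletCharacter ℂ q, χ (b : ZMod q)⁻¹ *
        (∑ m ∈ Icc 1 y, χ m * (Λ m : ℂ) - if χ = 1 then (y : ℂ) else 0) := by
      simp_rw [mul_sub]
      rw [sum_sub_distrib, ← h1, ← h2]
      have : (q.totient : ℂ) ≠ 0 := mod_cast hφ.ne'
      field_simp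
    have h4 : ‖(q.totient : ℂ) * (∑ m ∈ (Icc 1 y).filter (fun m => m % q = b),
        (Λ m : ℂ) - y / q.totient)‖ ≤ q.totient * (C * q * Err) := by
      rw [h3]
      refine (norm_sum_le _ _).trans ?_
      have hcard : Fintype.card (DirichletCharacter ℂ q) = q.totient := by
        rw [← card_eq_fintype_card]
        exact card_eq_totient_of_hasEnoughRootsOfUnity ℂ q
      calc _ ≤ ∑ χ : DirichletCharacter ℂ q, C * q * Err := by
            refine sum_le_sum fun χ _ => ?_
            rw [norm_mul]
            exact (mul_le_of_le_one_left (norm_nonneg _) (χ.norm_le_one _)).trans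
              (hC q χ n hn y hy)
        _ = _ := by rw [sum_const, card_univ, hcard, nsmul_eq_mul]
    rw [norm_mul, Complex.norm_natCast] at h4
    exact le_of_mul_le_mul_left h4 hφ
  have hper : ∀ m : ℕ, e (-((a : ℝ) / q * m)) = e (-((a : ℝ) / q * (m % q : ℕ))) := by
    intro m
    have h1 : -((a : ℝ) / q * m) = -((a : ℝ) / q * (m % q : ℕ)) + ((-(a * (m / q) : ℕ) : ℤ) : ℝ) := by
      have h2 : (m : ℝ) = (m % q : ℕ) + q * (m / q : ℕ) := mod_cast (mod_add_div m q).symm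
      have h3 : (a : ℝ) / q * q = a := div_mul_cancel₀ _ hq0.ne'
      rw [Int.cast_neg, Int.cast_natCast, cast_mul]
      linear_combination (-((a : ℝ) / q)) * h2 - ((m / q : ℕ) : ℝ) * h3
    rw [h1, e_add_intCast]
  have hsplit : ∑ m ∈ Icc 1 y, (Λ m : ℂ) * e (-((a : ℝ) / q * m)) =
      ∑ b ∈ redRes q, e (-((a : ℝ) / q * b)) *
        ∑ m ∈ (Icc 1 y).filter (fun m => m % q = b), (Λ m : ℂ) +
      ∑ m ∈ (Icc 1 y).filter (fun m => ¬ Coprime m q),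
        (Λ m : ℂ) * e (-((a : ℝ) / q * m)) := by
    rw [← sum_filter_add_sum_filter_not (Icc 1 y) (fun m => Coprime m q)]
    congr 1
    rw [← sum_fiberwise_of_maps_to (t := redRes q) (g := fun m => m % q)]
    · refine sum_congr rfl fun b hb => ?_
      rw [mul_sum, filter_filter]
      rw [mem_redRes] at hb
      refine sum_congr ?_ fun m hm => ?_
      · refine filter_congr fun m _ => ?_
        constructor
        · exact fun h => h.2
        · rintro rfl
          refine ⟨?_, rfl⟩
          have := hb.2
          rw [Coprime, ← gcd_rec] at this
          grind
      grind
    · intro m hm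
      rw [mem_filter] at hm
      rw [mem_redRes]
      refine ⟨mod_lt _ hq, ?_⟩
      have := hm.2.symm
      rwa [Coprime, gcd_rec] at this
  have hmain : (y : ℂ) * ramanujanCoeff q =
      ∑ b ∈ redRes q, e (-((a : ℝ) / q * b)) * ((y : ℂ) / q.totient) := by
    rw [← sum_mul]
    have h1 : ∑ b ∈ redRes q, e (-((a : ℝ) / q * b)) = ramanujanSum q a := by
      rw [← ramanujanSum_neg]
      refine sum_congr rfl fun b _ => ?_
      congr 1
      ring
    rw [h1, ramanujanSum_of_coprime hq ha.2, ramanujanCoeff]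
    ring
  rw [hsplit, hmain, add_sub_right_comm, ← sum_sub_distrib]
  refine (norm_add_le _ _).trans ?_
  have hA : ‖∑ b ∈ redRes q, (e (-((a : ℝ) / q * b)) *
        ∑ m ∈ (Icc 1 y).filter (fun m => m % q = b), (Λ m : ℂ) -
        e (-((a : ℝ) / q * b)) * ((y : ℂ) / q.totient))‖ ≤ q * (C * q * Err) := by
    refine (norm_sum_le _ _).trans ?_
    calc _ ≤ ∑ b ∈ redRes q, C * q * Err := by
          refine sum_le_sum fun b hb => ?_
          rw [← mul_sub, norm_mul, norm_e, one_mul]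
          exact hclass b hb
      _ = q.totient * (C * q * Err) := by rw [sum_const, card_redRes, nsmul_eq_mul]
      _ ≤ _ := by
          have : (q.totient : ℝ) ≤ q := mod_cast totient_le q
          gcongr
  have hB : ‖∑ m ∈ (Icc 1 y).filter (fun m => ¬ Coprime m q),
        (Λ m : ℂ) * e (-((a : ℝ) / q * m))‖ ≤ 2 * q * log n ^ 2 := by
    refine le_trans ((norm_sum_le _ _).trans (le_of_eq ?_)) (sum_vonMangoldt_not_coprime_le hn hq hy)
    refine sum_congr rfl fun m _ => ?_
    rw [norm_mul, norm_e, mul_one, norm_real, norm_eq_abs,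
      abs_of_nonneg vonMangoldt_nonneg]
  have hq1 : (1 : ℝ) ≤ q := mod_cast hq
  have e1 : log n ^ 2 ≤ Err := by
    rw [hErr]
    have : 0 ≤ (n : ℝ) / log n ^ k := by positivity
    linarith
  have e2 : 2 * q * log n ^ 2 ≤ 2 * q ^ 2 * Err := by
    have : (q : ℝ) ≤ q ^ 2 := by nlinarith
    gcongr
  linarith

/-- The part of the mean square of the prime exponential sum over the fractions with denominator
dividing `K` which comes from the denominators exceeding `Q`, together with its expected size. -/
def fourierTail (K Q y : ℕ) : ℝ := ∑ q ∈ K.divisors.filter (fun q => Q < q), ∑ a ∈ redRes q,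
  (‖∑ m ∈ Icc 1 y, (Λ m : ℂ) * e (-((a : ℝ) / q * m))‖ ^ 2 + ((y : ℝ) / q.totient) ^ 2)

lemma fourierTail_nonneg (K Q y : ℕ) : 0 ≤ fourierTail K Q y :=
  sum_nonneg fun _ _ => sum_nonneg fun _ _ => by positivity

lemma fourierTail_eq_zero {K Q : ℕ} (h : K ≤ Q) (y : ℕ) : fourierTail K Q y = 0 := by
  rw [fourierTail, filter_eq_empty_iff.2, sum_empty]
  intro q hq
  have := divisor_le hq
  omega

lemma norm_sum_vonMangoldt_sub_coprimeWeight_sq_le {K Q y : ℕ} {D : ℝ} (hK : 0 < K)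
    (hD : ∀ q ≤ Q, ∀ a ∈ redRes q, ‖∑ m ∈ Icc 1 y, (Λ m : ℂ) * e (-((a : ℝ) / q * m)) -
      y * ramanujanCoeff q‖ ≤ D)
    {f : ℕ → ℂ} (hf : UnitPeriodic K f) :
    ‖∑ m ∈ Icc 1 y, ((Λ m : ℂ) - coprimeWeight K m) * f m‖ ^ 2 ≤
      2 * Q ^ 2 * D ^ 2 + 3 * K ^ 7 + 3 * fourierTail K Q y := by
  refine (norm_sum_mul_periodic_sq_le hK f hf _ _).trans ?_
  have hsplit : ∀ q a : ℕ, ∑ m ∈ Icc 1 y, ((Λ m : ℂ) - coprimeWeight K m) *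
      e (-((a : ℝ) / q * m)) = (∑ m ∈ Icc 1 y, (Λ m : ℂ) * e (-((a : ℝ) / q * m)) -
      y * ramanujanCoeff q) - (∑ m ∈ Icc 1 y, coprimeWeight K m * e (-((a : ℝ) / q * m)) -
      y * ramanujanCoeff q) := by
    intro q a
    simp_rw [sub_mul]
    rw [sum_sub_distrib]
    ring
  have hsmall : ∀ q ∈ K.divisors.filter (fun q => ¬ Q < q), ∀ a ∈ redRes q,
      ‖∑ m ∈ Icc 1 y, ((Λ m : ℂ) - coprimeWeight K m) * e (-((a : ℝ) / q * m))‖ ^ 2 ≤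
      2 * D ^ 2 + 3 * (K : ℝ) ^ 6 := by
    intro q hq a ha
    rw [mem_filter, mem_divisors, not_lt] at hq
    have h1 := hD q hq.2 a ha
    have h2 := norm_sum_coprimeWeight_mul_e_sub_le hK hq.1.1 ha y
    rw [hsplit]
    have h3 := (norm_sub_le (∑ m ∈ Icc 1 y, (Λ m : ℂ) * e (-((a : ℝ) / q * m)) -
      y * ramanujanCoeff q) (∑ m ∈ Icc 1 y, coprimeWeight K m * e (-((a : ℝ) / q * m)) -
      y * ramanujanCoeff q)).trans (add_le_add h1 h2)
    refine (pow_le_pow_left₀ (norm_nonneg _) h3 2).trans ?_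
    nlinarith [sq_nonneg (D - (K : ℝ) ^ 3), sq_nonneg ((K : ℝ) ^ 3)]
  have hlarge : ∀ q ∈ K.divisors.filter (fun q => Q < q), ∀ a ∈ redRes q,
      ‖∑ m ∈ Icc 1 y, ((Λ m : ℂ) - coprimeWeight K m) * e (-((a : ℝ) / q * m))‖ ^ 2 ≤
      3 * (‖∑ m ∈ Icc 1 y, (Λ m : ℂ) * e (-((a : ℝ) / q * m))‖ ^ 2 +
        ((y : ℝ) / q.totient) ^ 2) + 3 * (K : ℝ) ^ 6 := by
    intro q hq a ha
    rw [mem_filter, mem_divisors] at hq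
    have h2 := norm_sum_coprimeWeight_mul_e_sub_le hK hq.1.1 ha y
    rw [hsplit]
    set S := ∑ m ∈ Icc 1 y, (Λ m : ℂ) * e (-((a : ℝ) / q * m))
    have h4 : ‖(y : ℂ) * ramanujanCoeff q‖ ≤ y / q.totient := by
      rw [norm_mul, Complex.norm_natCast, div_eq_mul_one_div]
      exact mul_le_mul_of_nonneg_left (norm_ramanujanCoeff_le q) (cast_nonneg _)
    have h3 := (norm_sub_le (S - y * ramanujanCoeff q) (∑ m ∈ Icc 1 y, coprimeWeight K m *
      e (-((a : ℝ) / q * m)) - y * ramanujanCoeff q)).trans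
      (add_le_add ((norm_sub_le _ _).trans (add_le_add_right h4 _)) h2)
    refine (pow_le_pow_left₀ (norm_nonneg _) h3 2).trans ?_
    nlinarith [sq_nonneg (‖S‖ - (y : ℝ) / q.totient), sq_nonneg (‖S‖ - (K : ℝ) ^ 3),
      sq_nonneg ((y : ℝ) / q.totient - (K : ℝ) ^ 3)]
  have hsum : ∑ q ∈ K.divisors, ∑ a ∈ redRes q, 3 * (K : ℝ) ^ 6 = 3 * (K : ℝ) ^ 7 := by
    simp_rw [sum_const, card_redRes, nsmul_eq_mul]
    rw [← sum_mul, ← cast_sum, sum_totient]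
    ring
  have hsum2 : ∑ q ∈ K.divisors.filter (fun q => ¬ Q < q), ∑ a ∈ redRes q, 2 * D ^ 2 ≤
      2 * Q ^ 2 * D ^ 2 := by
    simp_rw [sum_const, card_redRes, nsmul_eq_mul]
    calc _ ≤ ∑ q ∈ Icc 1 Q, (Q : ℝ) * (2 * D ^ 2) := by
          refine (sum_le_sum fun q hq => ?_).trans
            (sum_le_sum_of_subset_of_nonneg (f := fun _ => (Q : ℝ) * (2 * D ^ 2)) ?_
              fun _ _ _ => by positivity)
          · rw [mem_filter, not_lt] at hq
            have : (q.totient : ℝ) ≤ Q := mod_cast (totient_le q).trans hq.2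
            gcongr
          · intro q hq
            rw [mem_filter, not_lt] at hq
            rw [mem_Icc]
            exact ⟨pos_of_mem_divisors hq.1, hq.2⟩
      _ = _ := by
          rw [sum_const, card_Icc, nsmul_eq_mul, Nat.add_sub_cancel]
          ring
  rw [← sum_filter_add_sum_filter_not K.divisors (fun q => Q < q)] at hsum ⊢
  calc _ ≤ ∑ q ∈ K.divisors.filter (fun q => Q < q), ∑ a ∈ redRes q,
        (3 * (‖∑ m ∈ Icc 1 y, (Λ m : ℂ) * e (-((a : ℝ) / q * m))‖ ^ 2 +
        ((y : ℝ) / q.totient) ^ 2) + 3 * (K : ℝ) ^ 6) +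
        ∑ q ∈ K.divisors.filter (fun q => ¬ Q < q), ∑ a ∈ redRes q,
        (2 * D ^ 2 + 3 * (K : ℝ) ^ 6) :=
        add_le_add (sum_le_sum fun q hq => sum_le_sum fun a ha => hlarge q hq a ha)
          (sum_le_sum fun q hq => sum_le_sum fun a ha => hsmall q hq a ha)
    _ = 3 * fourierTail K Q y + ∑ q ∈ K.divisors.filter (fun q => ¬ Q < q),
        ∑ a ∈ redRes q, 2 * D ^ 2 + 3 * K ^ 7 := by
        rw [← hsum, fourierTail]
        simp only [mul_add, mul_sum, sum_add_distrib]
        ring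
    _ ≤ _ := by linarith

lemma norm_one_sub_e_le (β : ℝ) : ‖1 - e β‖ ≤ 7 * |β| := by
  have h := norm_exp_I_mul_ofReal_sub_one_le (x := 2 * π * β)
  have h1 : e β = Complex.exp (I * ((2 * π * β : ℝ) : ℂ)) := by
    rw [e]
    congr 1
    push_cast
    ring
  rw [norm_sub_rev, h1]
  refine h.trans ?_
  rw [norm_eq_abs, abs_mul, abs_of_pos two_pi_pos]
  have := pi_lt_d2
  have := abs_nonneg β
  nlinarith

/-- Partial summation for a slowly oscillating exponential. -/
lemma norm_sum_mul_e_le (b : ℕ → ℂ) (β : ℝ) (n : ℕ) :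
    ‖∑ m ∈ Icc 1 n, b m * e (β * m)‖ ≤
      ‖∑ m ∈ Icc 1 n, b m‖ + 7 * |β| * ∑ y ∈ range n, ‖∑ m ∈ Icc 1 y, b m‖ := by
  have key : ‖∑ m ∈ Icc 1 n, b m * e (β * m) - e (β * n) * ∑ m ∈ Icc 1 n, b m‖ ≤
      7 * |β| * ∑ y ∈ range n, ‖∑ m ∈ Icc 1 y, b m‖ := by
    induction n with
    | zero => simp
    | succ n ih =>
      rw [sum_Icc_succ_top (by omega), sum_Icc_succ_top (by omega), sum_range_succ]
      have h1 : e (β * (n + 1 : ℕ)) = e (β * n) * e β := by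
        rw [← e_add]
        congr 1
        push_cast
        ring
      have h2 : ∑ m ∈ Icc 1 n, b m * e (β * m) + b (n + 1) * e (β * (n + 1 : ℕ)) -
          e (β * (n + 1 : ℕ)) * (∑ m ∈ Icc 1 n, b m + b (n + 1)) =
          (∑ m ∈ Icc 1 n, b m * e (β * m) - e (β * n) * ∑ m ∈ Icc 1 n, b m) +
          e (β * n) * (1 - e β) * ∑ m ∈ Icc 1 n, b m := by
        rw [h1]
        ring
      rw [h2, mul_add]
      refine (norm_add_le _ _).trans (add_le_add ih ?_)
      rw [norm_mul, norm_mul, norm_e, one_mul]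
      exact mul_le_mul_of_nonneg_right (norm_one_sub_e_le β) (norm_nonneg _)
  have h := norm_le_norm_add_norm_sub' (∑ m ∈ Icc 1 n, b m * e (β * m))
    (e (β * n) * ∑ m ∈ Icc 1 n, b m)
  rw [norm_mul, norm_e, one_mul] at h
  linarith

lemma card_dvd_mul_le {q r M : ℕ} (hq : 0 < q) (hr : 0 < r) :
    (#{κ ∈ Icc 1 M | q ∣ κ * r} : ℝ) ≤ M * r / q := by
  set g := q.gcd r with hg
  have hg0 : 0 < g := gcd_pos_of_pos_left _ hq
  have h1 : ∀ κ, q ∣ κ * r ↔ q / g ∣ κ := by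
    intro κ
    constructor
    · intro h
      exact (Coprime.dvd_of_dvd_mul_right (coprime_div_gcd_div_gcd hg0)
        (by rw [← Nat.mul_div_assoc _ (Nat.gcd_dvd_right q r)]
            exact div_dvd_div (Nat.gcd_dvd_left q r) h))
    · rintro ⟨t, rfl⟩
      obtain ⟨r', hr'⟩ := Nat.gcd_dvd_right q r
      rw [← hg] at hr'
      refine ⟨t * r', ?_⟩
      conv_lhs => rw [hr']
      conv_rhs => rw [← Nat.div_mul_cancel (Nat.gcd_dvd_left q r)]
      rw [← hg]
      ring
  have h2 : #{κ ∈ Icc 1 M | q ∣ κ * r} = M / (q / g) := by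
    simp_rw [h1]
    exact Ioc_filter_dvd_card_eq_div M (q / g)
  rw [h2]
  refine cast_div_le.trans ?_
  rw [cast_div (Nat.gcd_dvd_left q r) (mod_cast hg0.ne'), div_div_eq_mul_div]
  have : (g : ℝ) ≤ r := mod_cast gcd_le_right _ hr
  gcongr

/-- The tails are small on average. -/
lemma sum_fourierTail_le {n y r M Q : ℕ} (hn : 3 ≤ n) (hy : y ≤ n) (hr : 0 < r) (hQ : 0 < Q)
    (hM : (M * r) ^ 4 ≤ n) :
    ∑ κ ∈ Icc 1 M, fourierTail (κ * r) Q y ≤ 8 * (M * r / Q) * n ^ 2 * log n ^ 2 := by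
  have hl := one_le_log_of_three_le hn
  have hQ0 : (0 : ℝ) < Q := mod_cast hQ
  set G : ℕ → ℝ := fun q => ∑ a ∈ redRes q,
    (‖∑ m ∈ Icc 1 y, (Λ m : ℂ) * e (-((a : ℝ) / q * m))‖ ^ 2 + ((y : ℝ) / q.totient) ^ 2)
    with hG
  have hG0 : ∀ q, 0 ≤ G q := fun q => sum_nonneg fun _ _ => by positivity
  have hyn : (y : ℝ) ≤ n := mod_cast hy
  have h1 : ∀ κ ∈ Icc 1 M, fourierTail (κ * r) Q y ≤
      ∑ q ∈ (Icc 1 (M * r)).filter (fun q => Q < q), if q ∣ κ * r then G q else 0 := by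
    intro κ hκ
    rw [mem_Icc] at hκ
    rw [← sum_filter, fourierTail]
    refine sum_le_sum_of_subset_of_nonneg ?_ fun _ _ _ => hG0 _
    intro q hq
    rw [mem_filter, mem_divisors] at hq
    rw [mem_filter, mem_filter, mem_Icc]
    have h3 : q ≤ κ * r := le_of_dvd (by have := hκ.1; positivity) hq.1.1
    exact ⟨⟨⟨by omega, h3.trans (Nat.mul_le_mul_right r hκ.2)⟩, hq.2⟩, hq.1.1⟩
  calc _ ≤ ∑ κ ∈ Icc 1 M, ∑ q ∈ (Icc 1 (M * r)).filter (fun q => Q < q),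
        (if q ∣ κ * r then G q else 0) := sum_le_sum h1
    _ = ∑ q ∈ (Icc 1 (M * r)).filter (fun q => Q < q), (#{κ ∈ Icc 1 M | q ∣ κ * r} : ℝ) * G q := by
        rw [sum_comm]
        refine sum_congr rfl fun q _ => ?_
        rw [← sum_filter, sum_const, nsmul_eq_mul]
    _ ≤ ∑ q ∈ (Icc 1 (M * r)).filter (fun q => Q < q), (M * r / Q : ℝ) * G q := by
        refine sum_le_sum fun q hq => mul_le_mul_of_nonneg_right ?_ (hG0 q)
        rw [mem_filter] at hq
        refine (card_dvd_mul_le (by omega) hr).trans ?_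
        have : (Q : ℝ) ≤ q := mod_cast hq.2.le
        gcongr
    _ ≤ ∑ q ∈ Icc 1 (M * r), (M * r / Q : ℝ) * G q :=
        sum_le_sum_of_subset_of_nonneg (filter_subset _ _) fun q _ _ =>
          mul_nonneg (by positivity) (hG0 q)
    _ = (M * r / Q : ℝ) * (∑ q ∈ Icc 1 (M * r), ∑ a ∈ redRes q,
        ‖∑ m ∈ Icc 1 y, (Λ m : ℂ) * e (-((a : ℝ) / q * m))‖ ^ 2 +
        ∑ q ∈ Icc 1 (M * r), (y : ℝ) ^ 2 * (1 / q.totient)) := by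
        rw [← mul_sum, ← sum_add_distrib]
        congr 1
        refine sum_congr rfl fun q hq => ?_
        rw [mem_Icc] at hq
        have hφ : (q.totient : ℝ) ≠ 0 := mod_cast (totient_pos.2 hq.1).ne'
        simp only [hG]
        rw [sum_add_distrib, sum_const, card_redRes, nsmul_eq_mul]
        congr 1
        field_simp
    _ ≤ (M * r / Q : ℝ) * ((n + n) * (n * log n ^ 2) + n ^ 2 * (6 * log n ^ 2)) := by
        have e1 := large_sieve (M * r) y (fun m => (Λ m : ℂ))
        have e2 : ∑ m ∈ Icc 1 y, ‖(Λ m : ℂ)‖ ^ 2 ≤ n * log n ^ 2 := by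
          calc _ ≤ ∑ m ∈ Icc 1 y, log n ^ 2 := by
                refine sum_le_sum fun m hm => ?_
                rw [norm_real, norm_eq_abs, sq_abs]
                exact pow_le_pow_left₀ vonMangoldt_nonneg
                  (vonMangoldt_le_log_of_mem hy hm) 2
            _ = y * log n ^ 2 := by
                rw [sum_const, card_Icc, nsmul_eq_mul, Nat.add_sub_cancel]
            _ ≤ _ := by gcongr
        have e3 : (((M * r : ℕ) : ℝ)) ^ 4 ≤ n := mod_cast hM
        have e4 : M * r ≤ n := (Nat.le_self_pow (by norm_num) _).trans hM
        have e5 := sum_inv_totient_le hn e4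
        have e6 : ∑ q ∈ Icc 1 (M * r), (y : ℝ) ^ 2 * (1 / q.totient) ≤
            n ^ 2 * (6 * log n ^ 2) := by
          rw [← mul_sum]
          gcongr
        have e7 : ((y : ℝ) + ((M * r : ℕ) : ℝ) ^ 4) * ∑ m ∈ Icc 1 y, ‖(Λ m : ℂ)‖ ^ 2 ≤
          (n + n) * (n * log n ^ 2) := by gcongr
        gcongr
        exact e1.trans e7
    _ = _ := by ring

/-- Measures how badly primes are distributed in progressions to the multiples of `κ`. -/
def primeDefect (n V κ : ℕ) : ℝ := ∑ r ∈ Icc 1 (V ^ 8), (fourierTail (κ * r) (V ^ 92) n +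
  14 * (V : ℝ) ^ 24 / n * ∑ y ∈ range n, fourierTail (κ * r) (V ^ 92) y)

def SiegelWalfisz (n V : ℕ) : Prop := ∀ q ≤ V ^ 92, ∀ a ∈ redRes q, ∀ y ≤ n,
  ‖∑ m ∈ Icc 1 y, (Λ m : ℂ) * e (-((a : ℝ) / q * m)) - y * ramanujanCoeff q‖ ≤ n / (V : ℝ) ^ 120

section
variable {n V κ : ℕ}

lemma le_primeDefect {r : ℕ} (hr : 0 < r) (hrV : r ≤ V ^ 8) :
    fourierTail (κ * r) (V ^ 92) n + 14 * (V : ℝ) ^ 24 / n *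
      ∑ y ∈ range n, fourierTail (κ * r) (V ^ 92) y ≤ primeDefect n V κ := by
  unfold primeDefect
  generalize V ^ 92 = Q
  generalize V ^ 8 = P at *
  exact single_le_sum (f := fun r => fourierTail (κ * r) Q n + 14 * (V : ℝ) ^ 24 / n *
      ∑ y ∈ range n, fourierTail (κ * r) Q y)
      (fun r _ => add_nonneg (fourierTail_nonneg _ _ _) (mul_nonneg (by positivity)
        (sum_nonneg fun y _ => fourierTail_nonneg _ _ _))) (mem_Icc.2 ⟨hr, hrV⟩)

/-- The size conditions on the length `n`, the precision `V` and the modulus `κ`. -/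
structure Small (n V κ : ℕ) : Prop where
  three_le : 3 ≤ n
  two_le : 2 ≤ V
  log_le : log n ^ 5 ≤ V
  pos : 0 < κ
  pow_le : κ ^ 4 * V ^ 100 ≤ n

lemma Small.mul_le (H : Small n V κ) (i j : ℕ) (hi : i ≤ 4 := by simp) (hj : j ≤ 100 := by simp) :
    (κ : ℝ) ^ i * (V : ℝ) ^ j ≤ n := by
  have := (Nat.mul_le_mul (Nat.pow_le_pow_right H.pos hi)
    (Nat.pow_le_pow_right (by linarith [H.two_le]) hj)).trans H.pow_le
  exact_mod_cast this

lemma Small.le (H : Small n V κ) : κ ≤ n := by simpa using H.mul_le 1 0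

lemma norm_sum_vonMangoldt_sub_model_partial_le (H : Small n V κ) (hSW : SiegelWalfisz n V)
    {r : ℕ} (hr : 0 < r) (hrV : r ≤ V ^ 8) {f : ℕ → ℂ} (hf : UnitPeriodic (κ * r) f)
    {y : ℕ} (hy : y ≤ n) :
    ‖∑ m ∈ Icc 1 y, ((Λ m : ℂ) - model κ (V ^ 8) m) * f m‖ ≤
      4 * (n / (V : ℝ) ^ 25) + 3 / (n / (V : ℝ) ^ 25) * fourierTail (κ * r) (V ^ 92) y := by
  have ⟨hn, hV, hlog, hκ0, _⟩ := H
  have hl := one_le_log_of_three_le hn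
  have hv : (2 : ℝ) ≤ V := mod_cast hV
  have hn0 : (0 : ℝ) < n := mod_cast (by omega : 0 < n)
  set v : ℝ := (V : ℝ) with hvdef
  set w : ℝ := n / v ^ 25 with hw
  have hw0 : 0 < w := by positivity
  set τ := fourierTail (κ * r) (V ^ 92) y with hτ
  have hτ0 : 0 ≤ τ := fourierTail_nonneg _ _ _
  have hlv : log n ≤ v := by
    refine le_trans ?_ hlog
    exact le_self_pow₀ hl (by norm_num)
  have hr' : (r : ℝ) ≤ v ^ 8 := by rw [hvdef]; exact_mod_cast hrV
  have hκ1 : (1 : ℝ) ≤ κ := mod_cast hκ0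
  have hr1 : (1 : ℝ) ≤ r := mod_cast hr
  have h1 := norm_sum_vonMangoldt_sub_coprimeWeight_sq_le (K := κ * r) (Q := V ^ 92) (y := y)
    (D := n / v ^ 120) (by positivity) (fun q hq a ha => hSW q hq a ha y hy) hf
  have h2 := norm_sum_model_sub_coprimeWeight_le hκ0 hr hrV hf y
  set A := ‖∑ m ∈ Icc 1 y, ((Λ m : ℂ) - coprimeWeight (κ * r) m) * f m‖ with hA
  have hA0 : 0 ≤ A := norm_nonneg _
  have e1 : 2 * ((V ^ 92 : ℕ) : ℝ) ^ 2 * (n / v ^ 120) ^ 2 ≤ w ^ 2 := by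
    have : 2 * ((V ^ 92 : ℕ) : ℝ) ^ 2 * (n / v ^ 120) ^ 2 = w ^ 2 * (2 / v ^ 6) := by
      rw [hw]
      push_cast
      rw [← hvdef]
      field_simp
    rw [this]
    refine mul_le_of_le_one_right (by positivity) ?_
    rw [div_le_one (by positivity)]
    calc (2 : ℝ) ≤ 2 ^ 6 := by norm_num
      _ ≤ v ^ 6 := by gcongr
  have e2 : 3 * ((κ * r : ℕ) : ℝ) ^ 7 ≤ w ^ 2 := by
    rw [hw, div_pow, le_div_iff₀ (by positivity)]
    push_cast
    calc 3 * ((κ : ℝ) * r) ^ 7 * (v ^ 25) ^ 2 ≤ v ^ 2 * (κ * v ^ 8) ^ 7 * (v ^ 25) ^ 2 := by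
          gcongr
          nlinarith
      _ = κ ^ 7 * v ^ 108 := by ring
      _ ≤ κ ^ 8 * v ^ 200 := by
          gcongr <;> first | assumption | linarith
      _ = ((κ : ℝ) ^ 4 * v ^ 100) ^ 2 := by ring
      _ ≤ n ^ 2 := by
          gcongr
          exact H.mul_le 4 100
  have e3 : A ≤ 3 * w + 3 / w * τ := by
    have h5 : A ^ 2 ≤ 2 * w ^ 2 + 3 * τ := by linarith
    have h6 : A * w ≤ 3 * w ^ 2 + 3 * τ := by nlinarith [sq_nonneg (A - w)]
    have h7 : 3 * w + 3 / w * τ = (3 * w ^ 2 + 3 * τ) / w := by field_simp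
    rw [h7, le_div_iff₀ hw0]
    exact h6
  have e4 : ((V ^ 8 : ℕ) : ℝ) * (totientRatio κ * ((κ * r : ℕ) * (V ^ 8 : ℕ))) ≤ w := by
    have h4 := totientRatio_le hn hκ0 H.le
    rw [hw, le_div_iff₀ (by positivity)]
    push_cast
    rw [← hvdef]
    calc v ^ 8 * (totientRatio κ * (κ * r * v ^ 8)) * v ^ 25
        ≤ v ^ 8 * (v ^ 2 * v * (κ * v ^ 8 * v ^ 8)) * v ^ 25 := by
          have : totientRatio κ ≤ v ^ 2 * v := h4.trans (by nlinarith [sq_nonneg v])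
          gcongr
      _ = κ ^ 1 * v ^ 52 := by ring
      _ ≤ _ := H.mul_le 1 52
  have h3 : ∑ m ∈ Icc 1 y, ((Λ m : ℂ) - model κ (V ^ 8) m) * f m =
      ∑ m ∈ Icc 1 y, ((Λ m : ℂ) - coprimeWeight (κ * r) m) * f m -
      ∑ m ∈ Icc 1 y, (model κ (V ^ 8) m - coprimeWeight (κ * r) m) * f m := by
    rw [← sum_sub_distrib]
    refine sum_congr rfl fun m _ => ?_
    ring
  rw [h3]
  refine (norm_sub_le _ _).trans ?_
  linarith

/-- The major arc estimate. -/
lemma norm_sum_vonMangoldt_sub_model_major_le (H : Small n V κ) (hSW : SiegelWalfisz n V)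
    (hgood : primeDefect n V κ ≤ (n / (V : ℝ) ^ 25) ^ 2)
    {r : ℕ} (hr : 0 < r) (hrV : r ≤ V ^ 8) {a : ℤ} {α : ℝ}
    (hα : |α - a / ((κ * r : ℕ) : ℝ)| ≤ 2 * (V : ℝ) ^ 24 / n)
    {ε : ℕ → ℂ} (hε : UnitPeriodic κ ε) :
    ‖∑ m ∈ Icc 1 n, ((Λ m : ℂ) - model κ (V ^ 8) m) * (ε m * e (α * m))‖ ≤
      500 * (n / V) := by
  have ⟨hn, hV, _, hκ0, _⟩ := H
  have hn0 : (0 : ℝ) < n := mod_cast (by omega : 0 < n)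
  have hv : (2 : ℝ) ≤ V := mod_cast hV
  set v : ℝ := (V : ℝ) with hvdef
  set w : ℝ := n / v ^ 25 with hw
  have hw0 : 0 < w := by positivity
  set K := κ * r with hK
  have hK0 : (0 : ℝ) < (K : ℕ) := mod_cast Nat.mul_pos hκ0 hr
  set β := α - a / (K : ℝ) with hβ
  set f : ℕ → ℂ := fun m => ε m * e ((a : ℝ) / K * m) with hf
  have hf1 : UnitPeriodic (κ * r) f := by
    refine ⟨fun m => ?_, fun m => by simpa only [hf, norm_mul, norm_e, mul_one] using hε.norm_le m⟩
    simp only [hf]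
    rw [mul_comm κ, hε.add_mul, mul_comm r]
    congr 1
    have h2 : (a : ℝ) / K * ((m + κ * r : ℕ) : ℝ) = (a : ℝ) / K * m + (a : ℤ) := by
      rw [← hK]
      push_cast
      field_simp
    rw [h2, e_add_intCast]
  set b : ℕ → ℂ := fun m => ((Λ m : ℂ) - model κ (V ^ 8) m) * f m with hb
  set τ : ℕ → ℝ := fun y => fourierTail K (V ^ 92) y with hτ
  have hB : ∀ y ≤ n, ‖∑ m ∈ Icc 1 y, b m‖ ≤ 4 * w + 3 / w * τ y := fun y hy =>
    norm_sum_vonMangoldt_sub_model_partial_le H hSW hr hrV hf1 hy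
  have h1 : ∑ m ∈ Icc 1 n, ((Λ m : ℂ) - model κ (V ^ 8) m) * (ε m * e (α * m)) =
      ∑ m ∈ Icc 1 n, b m * e (β * m) := by
    refine sum_congr rfl fun m _ => ?_
    simp only [hb, hf]
    have : α * m = (a : ℝ) / K * m + β * m := by rw [hβ]; ring
    rw [this, e_add]
    ring
  rw [h1]
  refine (norm_sum_mul_e_le b β n).trans ?_
  have h2 : ∑ y ∈ range n, ‖∑ m ∈ Icc 1 y, b m‖ ≤ 4 * w * n + 3 / w * ∑ y ∈ range n, τ y := by
    calc _ ≤ ∑ y ∈ range n, (4 * w + 3 / w * τ y) :=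
          sum_le_sum fun y hy => hB y (mem_range.1 hy).le
      _ = _ := by
          rw [sum_add_distrib, sum_const, card_range, nsmul_eq_mul, ← mul_sum]
          ring
  have h3 : τ n + 14 * v ^ 24 / n * ∑ y ∈ range n, τ y ≤ w ^ 2 := by
    refine le_trans ?_ hgood
    exact le_primeDefect hr hrV
  have hτ0 : 0 ≤ ∑ y ∈ range n, τ y := sum_nonneg fun y _ => fourierTail_nonneg _ _ _
  have h4 : 7 * |β| * ∑ y ∈ range n, ‖∑ m ∈ Icc 1 y, b m‖ ≤
      14 * v ^ 24 / n * (4 * w * n + 3 / w * ∑ y ∈ range n, τ y) := by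
    have : 7 * |β| ≤ 14 * v ^ 24 / n := by
      calc 7 * |β| ≤ 7 * (2 * v ^ 24 / n) := by gcongr
        _ = _ := by ring
    gcongr
  have h5 : 14 * v ^ 24 / n * (4 * w * n + 3 / w * ∑ y ∈ range n, τ y) =
      56 * (n / v) + 3 / w * (14 * v ^ 24 / n * ∑ y ∈ range n, τ y) := by
    rw [hw]
    field_simp
    ring
  have h6 : 3 / w * (τ n + 14 * v ^ 24 / n * ∑ y ∈ range n, τ y) ≤ 3 * w := by
    calc _ ≤ 3 / w * w ^ 2 := by gcongr
      _ = 3 * w := by field_simp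
  have h7 : w ≤ n / v := by
    rw [hw]
    exact div_le_div_of_nonneg_left hn0.le (by positivity) (le_self_pow₀ (by linarith) (by norm_num))
  grind

/-- The minor arc estimate. -/
lemma norm_sum_vonMangoldt_sub_model_minor_le (H : Small n V κ)
    {r : ℕ} (hrV : V ^ 8 < r) (hrn : r * (κ * V ^ 24) ≤ n) {a : ℤ} (ha : IsCoprime a r) {α : ℝ}
    (hα : |α * κ - a / r| ≤ 1 / (4 * r * n.sqrt))
    {ε : ℕ → ℂ} (hε : UnitPeriodic κ ε) :
    ‖∑ m ∈ Icc 1 n, ((Λ m : ℂ) - model κ (V ^ 8) m) * (ε m * e (α * m))‖ ≤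
      500 * (n / V) := by
  have ⟨hn, hV, hlog, hκ0, _⟩ := H
  have hl := one_le_log_of_three_le hn
  have hn0 : (0 : ℝ) < n := mod_cast (by omega : 0 < n)
  have hv : (2 : ℝ) ≤ V := mod_cast hV
  set s := n.sqrt with hs
  have hκs : κ * V ^ 24 ≤ s := by
    rw [hs, Nat.le_sqrt']
    calc _ = κ ^ 2 * V ^ 48 := by ring
      _ ≤ n := mod_cast H.mul_le 2 48
  have hV8 : V ^ 8 ≤ s := by
    refine le_trans ?_ hκs
    calc V ^ 8 ≤ V ^ 24 := Nat.pow_le_pow_right (by omega) (by norm_num)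
      _ ≤ _ := Nat.le_mul_of_pos_left _ hκ0
  have hr0 : 0 < r := by omega
  have : NeZero r := ⟨hr0.ne'⟩
  have hrn' : r ≤ n := le_trans (Nat.le_mul_of_pos_right _ (by positivity)) hrn
  have haU : IsUnit (a : ZMod r) := by
    rw [ZMod.coe_int_isUnit_iff_isCoprime]
    exact ha.symm
  have h1 := norm_sum_vonMangoldt_minor_le (U := V ^ 4) hn haU hα (one_le_pow _ _ (by omega))
    (by linarith) (by linarith) hrn' hε
  have hs0 : (0 : ℝ) < s := mod_cast (by positivity : 0 < V ^ 8).trans_le hV8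
  have hrR : (0 : ℝ) < r := mod_cast hr0
  have h2 := norm_sum_model_minor_le (Q := V ^ 8) hκ0 (one_le_pow _ _ (by omega)) hrV ha hα (by
    have : ((V ^ 8 : ℕ) : ℝ) ≤ s := mod_cast hV8
    bound) hε n
  set v : ℝ := (V : ℝ) with hvdef
  have hκ1 : (1 : ℝ) ≤ κ := mod_cast hκ0
  have hlv : log n ≤ v := (le_self_pow₀ hl (by norm_num)).trans hlog
  have hrκ : (r : ℝ) * κ ≤ n / v ^ 24 := by
    rw [le_div_iff₀ (by positivity), mul_assoc, hvdef]
    exact_mod_cast hrn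
  have hv8r : v ^ 8 ≤ r := by rw [hvdef]; exact_mod_cast hrV.le
  have hsn : (s : ℝ) * s ≤ n := mod_cast sqrt_le n
  have hκs' : (κ : ℝ) * v ^ 24 ≤ s := by rw [hvdef]; exact_mod_cast hκs
  have hdiv : ∀ i j : ℕ, i ≤ j → (n : ℝ) / v ^ j ≤ n / v ^ i := fun i j hij =>
    div_le_div_of_nonneg_left hn0.le (by positivity) (pow_le_pow_right₀ (by linarith) hij)
  have hroot : √(n * (n / r + n / (V ^ 4 : ℕ) + κ * (s + r))) ≤ 2 * (n / v ^ 2) := by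
    rw [sqrt_le_left (by positivity)]
    have e1 : (n : ℝ) / r ≤ n / v ^ 4 :=
      (div_le_div_of_nonneg_left hn0.le (by positivity) hv8r).trans (hdiv 4 8 (by norm_num))
    have e2 : (κ : ℝ) * s ≤ n / v ^ 4 := by
      rw [le_div_iff₀ (by positivity)]
      calc (κ : ℝ) * s * v ^ 4 = (κ * v ^ 4) * s := by ring
        _ ≤ (κ * v ^ 24) * s := by
            bound
        _ ≤ s * s := by gcongr
        _ ≤ n := hsn
    have e3 : (κ : ℝ) * r ≤ n / v ^ 4 := by
      rw [mul_comm]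
      exact hrκ.trans (hdiv 4 24 (by norm_num))
    push_cast
    rw [← hvdef]
    calc (n : ℝ) * (n / r + n / v ^ 4 + κ * (s + r)) =
          n * (n / r + n / v ^ 4 + (κ * s + κ * r)) := by ring
      _ ≤ n * (n / v ^ 4 + n / v ^ 4 + (n / v ^ 4 + n / v ^ 4)) := by gcongr
      _ = _ := by ring
  have f1 : 200 * log n ^ 5 * √(n * (n / r + n / (V ^ 4 : ℕ) + κ * (s + r))) ≤
      400 * (n / v) := by
    calc _ ≤ 200 * v * (2 * (n / v ^ 2)) := by gcongr
      _ = 400 * (n / v) := by field_simp; ring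
  have f2 : 16 * ((V ^ 4 : ℕ) : ℝ) ^ 2 * r * κ * log n ≤ 16 * (n / v) := by
    push_cast
    rw [← hvdef]
    calc 16 * (v ^ 4) ^ 2 * r * κ * log n = 16 * (v ^ 8 * (r * κ) * log n) := by ring
      _ ≤ 16 * (v ^ 8 * (n / v ^ 24) * v) := by gcongr
      _ = 16 * (n / v ^ 15) := by field_simp
      _ ≤ 16 * (n / v) := by
          bound
  have f3 : ((V ^ 4 : ℕ) : ℝ) ^ 2 ≤ n / v := by
    rw [le_div_iff₀ (by positivity)]
    push_cast
    rw [← hvdef]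
    calc (v ^ 4) ^ 2 * v = κ ^ 0 * v ^ 9 := by ring
      _ ≤ (n : ℝ) := H.mul_le 0 9
  have f4 : ((V ^ 8 : ℕ) : ℝ) * (totientRatio κ * (κ * (2 * r * (V ^ 8 : ℕ)))) ≤ 6 * (n / v) := by
    have h4 := totientRatio_le hn hκ0 H.le
    push_cast
    rw [← hvdef]
    calc v ^ 8 * (totientRatio κ * (κ * (2 * r * v ^ 8))) =
          2 * (v ^ 16 * totientRatio κ * (r * κ)) := by ring
      _ ≤ 2 * (v ^ 16 * (3 * v) * (n / v ^ 24)) := by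
          bound
      _ = 6 * (n / v ^ 7) := by field_simp; ring
      _ ≤ 6 * (n / v) := by
          bound
  have h3 : ∑ m ∈ Icc 1 n, ((Λ m : ℂ) - model κ (V ^ 8) m) * (ε m * e (α * m)) =
      ∑ m ∈ Icc 1 n, (Λ m : ℂ) * (ε m * e (α * m)) -
      ∑ m ∈ Icc 1 n, model κ (V ^ 8) m * (ε m * e (α * m)) := by
    rw [← sum_sub_distrib]
    refine sum_congr rfl fun m _ => ?_
    ring
  rw [h3]
  refine (norm_sub_le _ _).trans ?_
  have h9 : 0 < (n : ℝ) / v := by positivity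
  linarith

/-- The exponential sums of the primes in residue classes modulo `κ` are close to those of the
model. -/
theorem norm_sum_vonMangoldt_sub_model_le (H : Small n V κ) (hSW : SiegelWalfisz n V)
    (hgood : primeDefect n V κ ≤ (n / (V : ℝ) ^ 25) ^ 2) (α : ℝ)
    {ε : ℕ → ℂ} (hε : UnitPeriodic κ ε) :
    ‖∑ m ∈ Icc 1 n, ((Λ m : ℂ) - model κ (V ^ 8) m) * (ε m * e (α * m))‖ ≤
      500 * (n / V) := by
  have ⟨hn, hV, _, hκ0, _⟩ := H
  have hv : (2 : ℝ) ≤ V := mod_cast hV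
  have hn0 : (0 : ℝ) < n := mod_cast (by omega : 0 < n)
  have hκR : (0 : ℝ) < κ := mod_cast hκ0
  set s := n.sqrt with hs
  have hs1 : 1 ≤ s := Nat.le_sqrt.2 (by omega)
  have hκs : 4 * (κ * V ^ 24) ≤ s := by
    rw [hs, Nat.le_sqrt']
    calc (4 * (κ * V ^ 24)) ^ 2 = 2 ^ 4 * (κ ^ 2 * V ^ 48) := by ring
      _ ≤ V ^ 4 * (κ ^ 2 * V ^ 48) := by gcongr
      _ = κ ^ 2 * V ^ 52 := by ring
      _ ≤ n := mod_cast H.mul_le 2 52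
  set T := n / (κ * V ^ 24) with hT
  have hpos : 0 < κ * V ^ 24 := by positivity
  have hTs : 4 * s ≤ T := by
    rw [hT, Nat.le_div_iff_mul_le hpos]
    calc 4 * s * (κ * V ^ 24) = s * (4 * (κ * V ^ 24)) := by ring
      _ ≤ s * s := Nat.mul_le_mul_left _ hκs
      _ ≤ n := sqrt_le n
  obtain ⟨x, hx, hxT⟩ := exists_rat_abs_sub_le_and_den_le (α * κ) (n := T) (by omega)
  have hr : 0 < x.den := x.den_pos
  have hrR : (0 : ℝ) < x.den := mod_cast hr
  have hxr : (x : ℝ) = (x.num : ℝ) / x.den := mod_cast (Rat.num_div_den x).symm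
  rw [hxr] at hx
  have hcop : IsCoprime x.num (x.den : ℤ) := by
    rw [Int.isCoprime_iff_gcd_eq_one]
    exact x.reduced
  have hsR : (0 : ℝ) < s := mod_cast hs1
  by_cases hrV : x.den ≤ V ^ 8
  · refine norm_sum_vonMangoldt_sub_model_major_le H hSW hgood hr hrV
      (a := x.num) ?_ hε
    have h1 : α - x.num / ((κ * x.den : ℕ) : ℝ) = (α * κ - x.num / x.den) / κ := by
      push_cast
      field_simp
    rw [h1, abs_div, abs_of_pos hκR, div_le_iff₀ hκR]
    refine hx.trans ?_
    have h2 : (n : ℝ) ≤ (T + 1) * (κ * V ^ 24) := by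
      have : n < (T + 1) * (κ * V ^ 24) := by
        rw [hT, mul_comm]
        exact lt_mul_div_succ n hpos
      exact_mod_cast this.le
    have h3 : (1 : ℝ) ≤ x.den := mod_cast hr
    rw [div_le_iff₀ (by positivity), div_mul_eq_mul_div, div_mul_eq_mul_div, le_div_iff₀ hn0,
      one_mul]
    nlinarith
  · refine norm_sum_vonMangoldt_sub_model_minor_le H (not_le.1 hrV) ?_ hcop ?_ hε
    · exact (Nat.mul_le_mul_right _ hxT).trans (div_mul_le_self _ _)
    · refine hx.trans (one_div_le_one_div_of_le (by positivity) ?_)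
      have : 4 * (s : ℝ) ≤ T := mod_cast hTs
      nlinarith
end

lemma primeDefect_eq_zero {n V κ : ℕ} (h : κ * V ^ 8 ≤ V ^ 92) : primeDefect n V κ = 0 := by
  rw [primeDefect]
  refine sum_eq_zero fun r hr => ?_
  have h1 : κ * r ≤ V ^ 92 := (Nat.mul_le_mul_left κ (mem_Icc.1 hr).2).trans h
  simp_rw [fourierTail_eq_zero h1]
  simp

lemma sum_primeDefect_le {n V M : ℕ} (hn : 3 ≤ n) (hV : 2 ≤ V)
    (hlog : log n ^ 5 ≤ V) (hM : (M * V ^ 8) ^ 4 ≤ n) :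
    ∑ κ ∈ Icc 1 M, primeDefect n V κ ≤ 120 * M * n ^ 2 / (V : ℝ) ^ 51 := by
  have hl := one_le_log_of_three_le hn
  have hv : (2 : ℝ) ≤ V := mod_cast hV
  have hn0 : (0 : ℝ) < n := mod_cast (by omega : 0 < n)
  have hl2 : log n ^ 2 ≤ V := (pow_le_pow_right₀ hl (by norm_num)).trans hlog
  set B : ℝ := 8 * (M * (V : ℝ) ^ 8 / (V : ℝ) ^ 92) * n ^ 2 * V with hB
  have hB0 : 0 ≤ B := by positivity
  have h1 : ∀ r ∈ Icc 1 (V ^ 8), ∀ y ≤ n,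
      ∑ κ ∈ Icc 1 M, fourierTail (κ * r) (V ^ 92) y ≤ B := by
    intro r hr y hy
    rw [mem_Icc] at hr
    refine (sum_fourierTail_le hn hy hr.1 (by positivity)
      ((Nat.pow_le_pow_left (Nat.mul_le_mul_left M hr.2) 4).trans hM)).trans ?_
    have : (r : ℝ) ≤ (V : ℝ) ^ 8 := mod_cast hr.2
    rw [hB]
    push_cast
    gcongr
  have h2 : ∑ κ ∈ Icc 1 M, primeDefect n V κ = ∑ r ∈ Icc 1 (V ^ 8),
      (∑ κ ∈ Icc 1 M, fourierTail (κ * r) (V ^ 92) n + 14 * (V : ℝ) ^ 24 / n *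
      ∑ y ∈ range n, ∑ κ ∈ Icc 1 M, fourierTail (κ * r) (V ^ 92) y) := by
    simp only [primeDefect]
    generalize V ^ 92 = Q
    generalize V ^ 8 = P
    rw [sum_comm]
    refine sum_congr rfl fun r _ => ?_
    rw [sum_add_distrib, ← mul_sum, sum_comm (s := Icc 1 M)]
  rw [h2]
  calc _ ≤ ∑ r ∈ Icc 1 (V ^ 8), 15 * (V : ℝ) ^ 24 * B := by
        refine sum_le_sum fun r hr => ?_
        have h3 : ∑ y ∈ range n, ∑ κ ∈ Icc 1 M, fourierTail (κ * r) (V ^ 92) y ≤ n * B := by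
          calc _ ≤ ∑ y ∈ range n, B := sum_le_sum fun y hy => h1 r hr y (mem_range.1 hy).le
            _ = n * B := by rw [sum_const, card_range, nsmul_eq_mul]
        have h4 : 14 * (V : ℝ) ^ 24 / n * ∑ y ∈ range n, ∑ κ ∈ Icc 1 M,
            fourierTail (κ * r) (V ^ 92) y ≤ 14 * (V : ℝ) ^ 24 / n * (n * B) :=
          mul_le_mul_of_nonneg_left h3 (by positivity)
        have h5 : 14 * (V : ℝ) ^ 24 / n * (n * B) = 14 * (V : ℝ) ^ 24 * B := by field_simp
        have h6 : B ≤ (V : ℝ) ^ 24 * B :=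
          le_mul_of_one_le_left hB0 (one_le_pow₀ (by linarith))
        have h7 := h1 r hr n le_rfl
        linarith
    _ = _ := by
        rw [sum_const, card_Icc, nsmul_eq_mul, Nat.add_sub_cancel, hB]
        push_cast
        field_simp
        ring

lemma card_primeDefect_gt_le {n V M : ℕ} (hn : 3 ≤ n) (hV : 2 ≤ V)
    (hlog : log n ^ 5 ≤ V) (hM : (M * V ^ 8) ^ 4 ≤ n) :
    (#{κ ∈ Icc 1 M | ¬ primeDefect n V κ ≤ (n / (V : ℝ) ^ 25) ^ 2} : ℝ) ≤ 120 * M / V := by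
  have hv : (2 : ℝ) ≤ V := mod_cast hV
  have hn0 : (0 : ℝ) < n := mod_cast (by omega : 0 < n)
  have hpos : 0 < (n / (V : ℝ) ^ 25) ^ 2 := by positivity
  have hnonneg : ∀ κ, 0 ≤ primeDefect n V κ := fun κ =>
    sum_nonneg fun r _ => add_nonneg (fourierTail_nonneg _ _ _) (mul_nonneg (by positivity)
        (sum_nonneg fun y _ => fourierTail_nonneg _ _ _))
  refine le_of_mul_le_mul_right ?_ hpos
  calc _ = ∑ κ ∈ (Icc 1 M).filter (fun κ => ¬ primeDefect n V κ ≤ (n / (V : ℝ) ^ 25) ^ 2),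
        (n / (V : ℝ) ^ 25) ^ 2 := by rw [sum_const, nsmul_eq_mul]
    _ ≤ ∑ κ ∈ (Icc 1 M).filter (fun κ => ¬ primeDefect n V κ ≤ (n / (V : ℝ) ^ 25) ^ 2),
        primeDefect n V κ := sum_le_sum fun κ hκ => (not_le.1 (mem_filter.1 hκ).2).le
    _ ≤ ∑ κ ∈ Icc 1 M, primeDefect n V κ :=
        sum_le_sum_of_subset_of_nonneg (filter_subset _ _) fun κ _ _ => hnonneg κ
    _ ≤ _ := sum_primeDefect_le hn hV hlog hM
    _ = _ := by
        field_simp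

lemma sum_residues {κ : ℕ} (hκ : 0 < κ) (I : Finset ℕ) (θ f : ℕ → ℂ) :
    ∑ m ∈ I, f m * θ (m % κ) = ∑ b ∈ range κ, (∑ m ∈ I.filter (fun m => m % κ = b), f m) * θ b := by
  rw [← sum_fiberwise_of_maps_to (t := range κ) (g := fun m => m % κ)
    (fun m _ => mem_range.2 (mod_lt _ hκ))]
  refine sum_congr rfl fun b _ => ?_
  rw [sum_mul]
  refine sum_congr rfl fun m hm => ?_
  rw [(mem_filter.1 hm).2]

/-- The complex number of modulus at most `1` with `x * phase x = ‖x‖`. -/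
def phase (x : ℂ) : ℂ := conj x / ‖x‖

lemma norm_phase_le (x : ℂ) : ‖phase x‖ ≤ 1 := by
  rw [phase, norm_div, RCLike.norm_conj, norm_real, norm_norm]
  exact div_self_le_one _

lemma mul_phase (x : ℂ) : x * phase x = ‖x‖ := by
  by_cases h : x = 0
  · simp [h]
  · have h1 : (‖x‖ : ℂ) ≠ 0 := mod_cast norm_ne_zero_iff.2 h
    rw [phase, mul_div_assoc', mul_conj', sq, mul_div_assoc, div_self h1, mul_one]

/-- Sums over residue classes are controlled by sums twisted by periodic functions. -/
lemma sum_norm_residues_le {κ : ℕ} (hκ : 0 < κ) (I : Finset ℕ) (f : ℕ → ℂ) {S : ℝ}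
    (hS : ∀ ε : ℕ → ℂ, UnitPeriodic κ ε → ‖∑ m ∈ I, f m * ε m‖ ≤ S) :
    ∑ b ∈ range κ, ‖∑ m ∈ I.filter (fun m => m % κ = b), f m‖ ≤ S := by
  set X : ℕ → ℂ := fun b => ∑ m ∈ I.filter (fun m => m % κ = b), f m with hX
  set θ : ℕ → ℂ := fun b => phase (X b) with hφ
  have h1 := hS (fun m => θ (m % κ)) ⟨fun m => by simp, fun m => norm_phase_le _⟩
  rw [sum_residues hκ I θ f] at h1
  have h2 : ∑ b ∈ range κ, (∑ m ∈ I.filter (fun m => m % κ = b), f m) * θ b =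
      ((∑ b ∈ range κ, ‖X b‖ : ℝ) : ℂ) := by
    push_cast
    exact sum_congr rfl fun b _ => mul_phase (X b)
  rw [h2, norm_real] at h1
  exact (le_abs_self _).trans h1

/-- A discrete Parseval inequality. -/
lemma sum_norm_sq_range_le {M : ℕ} (hM : 0 < M) (I : Finset ℕ) (hI : ∀ m ∈ I, m < M) (g : ℕ → ℂ) :
    ∑ j ∈ range M, ‖∑ m ∈ I, g m * e ((j : ℝ) / M * m)‖ ^ 2 = M * ∑ m ∈ I, ‖g m‖ ^ 2 := by
  have h1 : ∀ j : ℕ, ((‖∑ m ∈ I, g m * e ((j : ℝ) / M * m)‖ ^ 2 : ℝ) : ℂ) =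
      ∑ m ∈ I, ∑ m' ∈ I, g m * conj (g m') * e ((j : ℝ) / M * ((m - m' : ℤ) : ℝ)) := by
    intro j
    push_cast
    rw [← mul_conj', map_sum, sum_mul_sum]
    refine sum_congr rfl fun m _ => sum_congr rfl fun m' _ => ?_
    rw [map_mul, conj_e]
    have : (j : ℝ) / M * ((m : ℝ) - m') = j / M * m + -(j / M * m') := by ring
    rw [this, e_add]
    ring
  have h2 : ((∑ j ∈ range M, ‖∑ m ∈ I, g m * e ((j : ℝ) / M * m)‖ ^ 2 : ℝ) : ℂ) =
      ((M * ∑ m ∈ I, ‖g m‖ ^ 2 : ℝ) : ℂ) := by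
    rw [ofReal_sum]
    simp_rw [h1]
    rw [sum_comm]
    rw [ofReal_mul, ofReal_sum, mul_sum, ofReal_natCast]
    refine sum_congr rfl fun m hm => ?_
    rw [sum_comm]
    simp_rw [← mul_sum]
    rw [sum_eq_single_of_mem m hm]
    · rw [sum_range_e M hM, if_pos (by simp), mul_conj', mul_comm, ofReal_pow]
    · intro m' hm' hne
      rw [sum_range_e M hM, if_neg, mul_zero]
      intro h
      have a1 := hI m hm
      have a2 := hI m' hm'
      have := Int.eq_zero_of_abs_lt_dvd h (by rw [abs_lt]; omega)
      omega
  exact_mod_cast h2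

lemma sum_filter_residues_norm_sq {κ : ℕ} (hκ : 0 < κ) (I : Finset ℕ) (g : ℕ → ℂ) :
    ∑ b ∈ range κ, ∑ m ∈ I.filter (fun m => m % κ = b), ‖g m‖ ^ 2 = ∑ m ∈ I, ‖g m‖ ^ 2 :=
  sum_fiberwise_of_maps_to (fun _ _ => mem_range.2 (mod_lt _ hκ)) _

lemma sum_ite_mod_le {κ n b : ℕ} {x : ℝ} (hx : 0 ≤ x) :
    ∑ c ∈ range κ, (if (b + c) % κ = n % κ then x else 0) ≤ x := by
  rw [← sum_filter, sum_const, nsmul_eq_mul]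
  refine mul_le_of_le_one_left hx ?_
  have : #((range κ).filter (fun c => (b + c) % κ = n % κ)) ≤ 1 := by
    rw [card_le_one]
    intro c hc c' hc'
    rw [mem_filter, mem_range] at hc hc'
    have h1 : b + c ≡ b + c' [MOD κ] := hc.2.trans hc'.2.symm
    exact ModEq.eq_of_lt_of_lt (Nat.ModEq.add_left_cancel' b h1) hc.1 hc'.1
  exact_mod_cast this

/-- The trilinear sums in the ternary problem, with weights depending on residue classes. -/
lemma norm_sum_triple_le {κ n : ℕ} (hκ : 0 < κ) {S : ℝ} {F G H : ℕ → ℂ} {c : ℕ → ℕ → ℕ → ℂ}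
    (hc : ∀ x y z, ‖c x y z‖ ≤ 1)
    (hF : ∀ α : ℝ, ∀ ε : ℕ → ℂ, UnitPeriodic κ ε →
      ‖∑ m ∈ Icc 1 n, F m * (ε m * e (α * m))‖ ≤ S) :
    ‖∑ m₁ ∈ Icc 1 n, ∑ m₂ ∈ Icc 1 n, ∑ m₃ ∈ Icc 1 n, if m₁ + m₂ + m₃ = n then
      F m₁ * (G m₂ * (H m₃ * c (m₁ % κ) (m₂ % κ) (m₃ % κ))) else 0‖ ≤
      S * ((∑ m ∈ Icc 1 n, ‖G m‖ ^ 2 + ∑ m ∈ Icc 1 n, ‖H m‖ ^ 2) / 2) := by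
  set I := Icc 1 n with hI
  set M := 3 * n + 1 with hM
  have hM0 : 0 < M := by omega
  have hMR : (0 : ℝ) < M := mod_cast hM0
  have hS0 : 0 ≤ S := (norm_nonneg _).trans (hF 0 0 ⟨by simp, by simp⟩)
  have hIM : ∀ m ∈ I, m < M := fun m hm => by
    grind
  set c' : ℕ → ℕ → ℕ → ℂ := fun x y z => if (x + y + z) % κ = n % κ then c x y z else 0 with hc'
  set T : ℕ → ℂ := fun j => ∑ m₁ ∈ I, ∑ m₂ ∈ I, ∑ m₃ ∈ I,
    F m₁ * e ((j : ℝ) / M * m₁) * (G m₂ * e ((j : ℝ) / M * m₂) * (H m₃ * e ((j : ℝ) / M * m₃) *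
      c' (m₁ % κ) (m₂ % κ) (m₃ % κ))) with hT
  have horth : (M : ℂ) * (∑ m₁ ∈ I, ∑ m₂ ∈ I, ∑ m₃ ∈ I, if m₁ + m₂ + m₃ = n then
      F m₁ * (G m₂ * (H m₃ * c (m₁ % κ) (m₂ % κ) (m₃ % κ))) else 0) =
      ∑ j ∈ range M, e (-((j : ℝ) / M * n)) * T j := by
    simp only [hT, mul_sum]
    rw [sum_comm (s := range M)]
    refine sum_congr rfl fun m₁ h₁ => ?_
    rw [sum_comm (s := range M)]
    refine sum_congr rfl fun m₂ h₂ => ?_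
    rw [sum_comm (s := range M)]
    refine sum_congr rfl fun m₃ h₃ => ?_
    have h1 : ∀ j : ℕ, e (-((j : ℝ) / M * n)) * (F m₁ * e ((j : ℝ) / M * m₁) *
        (G m₂ * e ((j : ℝ) / M * m₂) * (H m₃ * e ((j : ℝ) / M * m₃) *
        c' (m₁ % κ) (m₂ % κ) (m₃ % κ)))) = (F m₁ * (G m₂ * (H m₃ * c' (m₁ % κ) (m₂ % κ) (m₃ % κ)))) *
        e ((j : ℝ) / M * ((m₁ + m₂ + m₃ - n : ℤ) : ℝ)) := by
      intro j
      have : (j : ℝ) / M * ((m₁ + m₂ + m₃ - n : ℤ) : ℝ) =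
        -((j : ℝ) / M * n) + ((j : ℝ) / M * m₁ + ((j : ℝ) / M * m₂ + (j : ℝ) / M * m₃)) := by
        push_cast
        ring
      rw [this, e_add, e_add, e_add]
      ring
    simp_rw [h1]
    rw [← mul_sum, sum_range_e M hM0]
    rw [hI, mem_Icc] at h₁ h₂ h₃
    by_cases h : m₁ + m₂ + m₃ = n
    · have h2 : (m₁ % κ + m₂ % κ + m₃ % κ) % κ = n % κ := by
        rw [← h]
        simp [add_mod]
      rw [if_pos h, if_pos (by
        bound)]
      grind
    · rw [if_neg h, if_neg, mul_zero, mul_zero]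
      intro h2
      have := Int.eq_zero_of_abs_lt_dvd h2 (by rw [abs_lt]; omega)
      omega
  set f : ℕ → ℕ → ℂ := fun j b => ∑ m ∈ I.filter (fun m => m % κ = b), F m * e ((j : ℝ) / M * m)
    with hf
  set g : ℕ → ℕ → ℂ := fun j b => ∑ m ∈ I.filter (fun m => m % κ = b), G m * e ((j : ℝ) / M * m)
    with hg
  set h : ℕ → ℕ → ℂ := fun j b => ∑ m ∈ I.filter (fun m => m % κ = b), H m * e ((j : ℝ) / M * m)
    with hh
  have hTj : ∀ j, T j = ∑ x ∈ range κ, f j x * ∑ y ∈ range κ, g j y * ∑ z ∈ range κ,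
      h j z * c' x y z := by
    intro j
    have e1 : T j = ∑ m₁ ∈ I, F m₁ * e ((j : ℝ) / M * m₁) * ∑ m₂ ∈ I, G m₂ * e ((j : ℝ) / M * m₂) *
        ∑ m₃ ∈ I, H m₃ * e ((j : ℝ) / M * m₃) * c' (m₁ % κ) (m₂ % κ) (m₃ % κ) := by
      simp only [hT, mul_sum]
    have e2 : ∀ x y, ∑ m₃ ∈ I, H m₃ * e ((j : ℝ) / M * m₃) * c' x y (m₃ % κ) =
        ∑ z ∈ range κ, h j z * c' x y z := fun x y =>
      sum_residues hκ I (c' x y) (fun m => H m * e ((j : ℝ) / M * m))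
    have e3 : ∀ x, ∑ m₂ ∈ I, G m₂ * e ((j : ℝ) / M * m₂) * ∑ z ∈ range κ, h j z * c' x (m₂ % κ) z =
        ∑ y ∈ range κ, g j y * ∑ z ∈ range κ, h j z * c' x y z := fun x =>
      sum_residues hκ I (fun y => ∑ z ∈ range κ, h j z * c' x y z)
        (fun m => G m * e ((j : ℝ) / M * m))
    rw [e1]
    simp_rw [e2, e3]
    exact sum_residues hκ I (fun x => ∑ y ∈ range κ, g j y * ∑ z ∈ range κ, h j z * c' x y z)
      (fun m => F m * e ((j : ℝ) / M * m))
  have hfS : ∀ j, ∑ x ∈ range κ, ‖f j x‖ ≤ S := by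
    intro j
    refine sum_norm_residues_le hκ I _ fun ε hε => ?_
    refine le_of_eq_of_le ?_ (hF ((j : ℝ) / M) ε hε)
    congr 1
    refine sum_congr rfl fun m _ => ?_
    ring
  have hinner : ∀ j x, ‖∑ y ∈ range κ, g j y * ∑ z ∈ range κ, h j z * c' x y z‖ ≤
      (∑ y ∈ range κ, ‖g j y‖ ^ 2 + ∑ z ∈ range κ, ‖h j z‖ ^ 2) / 2 := by
    intro j x
    calc _ ≤ ∑ y ∈ range κ, ∑ z ∈ range κ, ((if (x + y + z) % κ = n % κ then ‖g j y‖ ^ 2 / 2 else 0) +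
          if (x + y + z) % κ = n % κ then ‖h j z‖ ^ 2 / 2 else 0) := by
          refine (norm_sum_le _ _).trans (sum_le_sum fun y _ => ?_)
          rw [mul_sum]
          refine (norm_sum_le _ _).trans (sum_le_sum fun z _ => ?_)
          simp only [hc']
          split_ifs with h1
          · rw [norm_mul, norm_mul]
            have a1 : ‖h j z‖ * ‖c x y z‖ ≤ ‖h j z‖ :=
              mul_le_of_le_one_right (norm_nonneg _) (hc _ _ _)
            have a2 := mul_le_mul_of_nonneg_left a1 (norm_nonneg (g j y))
            nlinarith [sq_nonneg (‖g j y‖ - ‖h j z‖)]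
          · simp
      _ = ∑ y ∈ range κ, ∑ z ∈ range κ, (if (x + y + z) % κ = n % κ then ‖g j y‖ ^ 2 / 2 else 0) +
          ∑ z ∈ range κ, ∑ y ∈ range κ, if (x + z + y) % κ = n % κ then ‖h j z‖ ^ 2 / 2 else 0 := by
          simp_rw [sum_add_distrib]
          congr 1
          rw [sum_comm]
          grind
      _ ≤ ∑ y ∈ range κ, ‖g j y‖ ^ 2 / 2 + ∑ z ∈ range κ, ‖h j z‖ ^ 2 / 2 :=
          add_le_add (sum_le_sum fun y _ => sum_ite_mod_le (by positivity))
            (sum_le_sum fun z _ => sum_ite_mod_le (by positivity))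
      _ = _ := by
          rw [← sum_div, ← sum_div, add_div]
  have hTle : ∀ j, ‖T j‖ ≤ S * ((∑ y ∈ range κ, ‖g j y‖ ^ 2 + ∑ z ∈ range κ, ‖h j z‖ ^ 2) / 2) := by
    intro j
    rw [hTj]
    refine (norm_sum_le _ _).trans ?_
    calc _ ≤ ∑ x ∈ range κ, ‖f j x‖ *
          ((∑ y ∈ range κ, ‖g j y‖ ^ 2 + ∑ z ∈ range κ, ‖h j z‖ ^ 2) / 2) := by
          refine sum_le_sum fun x _ => ?_
          rw [norm_mul]
          exact mul_le_mul_of_nonneg_left (hinner j x) (norm_nonneg _)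
      _ ≤ _ := by
          rw [← sum_mul]
          exact mul_le_mul_of_nonneg_right (hfS j) (by positivity)
  have hpars : ∀ G : ℕ → ℂ, ∑ j ∈ range M, ∑ b ∈ range κ,
      ‖∑ m ∈ I.filter (fun m => m % κ = b), G m * e ((j : ℝ) / M * m)‖ ^ 2 =
      M * ∑ m ∈ I, ‖G m‖ ^ 2 := by
    intro G
    rw [sum_comm, ← sum_filter_residues_norm_sq hκ I G, mul_sum]
    exact sum_congr rfl fun b _ =>
      sum_norm_sq_range_le hM0 _ (fun m hm => hIM m (mem_filter.1 hm).1) G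
  refine le_of_mul_le_mul_left ?_ hMR
  calc (M : ℝ) * ‖_‖ = ‖∑ j ∈ range M, e (-((j : ℝ) / M * n)) * T j‖ := by
        rw [← horth, norm_mul, Complex.norm_natCast]
    _ ≤ ∑ j ∈ range M, S * ((∑ y ∈ range κ, ‖g j y‖ ^ 2 + ∑ z ∈ range κ, ‖h j z‖ ^ 2) / 2) := by
        refine (norm_sum_le _ _).trans (sum_le_sum fun j _ => ?_)
        rw [norm_mul, norm_e, one_mul]
        exact hTle j
    _ = S * ((M * ∑ m ∈ I, ‖G m‖ ^ 2 + M * ∑ m ∈ I, ‖H m‖ ^ 2) / 2) := by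
        rw [← mul_sum, ← sum_div, sum_add_distrib, hpars, hpars]
    _ = _ := by ring

lemma prod_one_add_inv_sq_le (J : ℕ) :
    ∏ j ∈ range J, (1 + 1 / (2 * ((j : ℝ) + 1)) ^ 2) ≤ 7 / 4 - 3 / (4 * ((J : ℝ) + 1)) := by
  induction J with
  | zero => norm_num
  | succ J ih =>
    rw [prod_range_succ]
    have hJ : (0 : ℝ) ≤ J := J.cast_nonneg
    calc _ ≤ (7 / 4 - 3 / (4 * ((J : ℝ) + 1))) * (1 + 1 / (2 * ((J : ℝ) + 1)) ^ 2) := by gcongr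
      _ ≤ _ := by
        push_cast
        rw [← sub_nonneg]
        have : 7 / 4 - 3 / (4 * ((J : ℝ) + 1 + 1)) -
            (7 / 4 - 3 / (4 * ((J : ℝ) + 1))) * (1 + 1 / (2 * ((J : ℝ) + 1)) ^ 2) =
            (5 * (J : ℝ) ^ 2 + 6 * J + 4) / (16 * ((J : ℝ) + 1) ^ 3 * (J + 2)) := by
          field_simp
          ring
        rw [this]
        positivity

lemma inv_totient_sq_eq {q : ℕ} (hq : Squarefree q) :
    1 / (q.totient : ℝ) ^ 2 = ∏ p ∈ q.primeFactors, 1 / ((p : ℝ) - 1) ^ 2 := by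
  have h := totient_mul_prod_primeFactors q
  rw [prod_primeFactors_of_squarefree hq, mul_comm] at h
  rw [Nat.eq_of_mul_eq_mul_left hq.ne_zero.bot_lt h, prod_div_distrib, prod_const_one, prod_pow]
  congr 2
  rw [cast_prod]
  exact prod_congr rfl fun p hp => cast_pred (prime_of_mem_primeFactors hp).pos

lemma sum_inv_totient_sq_le {D : Finset ℕ} (hD : ∀ q ∈ D, Odd q ∧ Squarefree q) :
    ∑ q ∈ D, 1 / (q.totient : ℝ) ^ 2 ≤ 7 / 4 := by
  set J := D.sup id
  set S := (range J).image (fun j => 2 * j + 3) with hS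
  have hinj : Set.InjOn primeFactors D := fun q hq q' hq' h => by
    rw [← prod_primeFactors_of_squarefree (hD q hq).2, h,
      prod_primeFactors_of_squarefree (hD q' hq').2]
  calc ∑ q ∈ D, 1 / (q.totient : ℝ) ^ 2
      = ∑ q ∈ D, ∏ p ∈ q.primeFactors, 1 / ((p : ℝ) - 1) ^ 2 :=
        sum_congr rfl fun q hq => inv_totient_sq_eq (hD q hq).2
    _ = ∑ t ∈ D.image primeFactors, ∏ p ∈ t, 1 / ((p : ℝ) - 1) ^ 2 := by
        rw [sum_image hinj]
    _ ≤ ∑ t ∈ S.powerset, ∏ p ∈ t, 1 / ((p : ℝ) - 1) ^ 2 := by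
        refine sum_le_sum_of_subset_of_nonneg (fun t ht => ?_) fun t _ _ =>
          prod_nonneg fun p _ => by positivity
        obtain ⟨q, hq, rfl⟩ := mem_image.1 ht
        rw [mem_powerset]
        intro p hp
        have hpp := prime_of_mem_primeFactors hp
        have hpd := dvd_of_mem_primeFactors hp
        have h1 : q ≤ J := le_sup (f := id) hq
        have h2 := le_of_dvd (hD q hq).1.pos hpd
        obtain ⟨i, hi⟩ := Odd.of_dvd_nat (hD q hq).1 hpd
        have := hpp.two_le
        exact mem_image.2 ⟨i - 1, mem_range.2 (by omega), by omega⟩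
    _ = ∏ p ∈ S, (1 + 1 / ((p : ℝ) - 1) ^ 2) := (prod_one_add _).symm
    _ = ∏ j ∈ range J, (1 + 1 / (2 * ((j : ℝ) + 1)) ^ 2) := by
        rw [hS, prod_image fun a _ b _ h => by simpa using h]
        grind
    _ ≤ _ := (prod_one_add_inv_sq_le J).trans (by
        have : (0 : ℝ) ≤ 3 / (4 * ((J : ℝ) + 1)) := by positivity
        linarith)

/-- The terms of the singular series. -/
def singularTerm (n q : ℕ) : ℂ := ramanujanCoeff q ^ 3 * ramanujanSum q n

lemma norm_singularTerm_le (n : ℕ) {q : ℕ} (hq : 0 < q) :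
    ‖singularTerm n q‖ ≤ 1 / (q.totient : ℝ) ^ 2 := by
  have h0 : (0 : ℝ) < q.totient := mod_cast totient_pos.2 hq
  rw [singularTerm, norm_mul, norm_pow]
  calc _ ≤ (1 / (q.totient : ℝ)) ^ 3 * q.totient := by
        gcongr
        · exact norm_ramanujanCoeff_le q
        · exact norm_ramanujanSum_le q n
    _ = _ := by field_simp

lemma singularTerm_of_not_squarefree (n : ℕ) {q : ℕ} (hq : ¬ Squarefree q) :
    singularTerm n q = 0 := by
  simp [singularTerm, ramanujanCoeff, moebius_eq_zero_of_not_squarefree hq]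

lemma singularTerm_one (n : ℕ) : singularTerm n 1 = 1 := by
  rw [singularTerm, ← ramanujanFun_apply n 1 one_pos, (isMultiplicative_ramanujanFun n).map_one]
  simp [ramanujanCoeff]

lemma singularTerm_two_mul {n q : ℕ} (hn : Odd n) (hq : Odd q) :
    singularTerm n (2 * q) = singularTerm n q := by
  have hc : Coprime 2 q := (coprime_two_left).2 hq
  have h2 : ¬ 2 ∣ n := hn.not_two_dvd_nat
  rw [singularTerm, singularTerm, ramanujanCoeff, ramanujanCoeff, totient_mul hc,
    isMultiplicative_moebius.map_mul_of_coprime hc, totient_two,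
    ← ramanujanFun_apply n q hq.pos, ← ramanujanFun_apply n (2 * q) (by have := hq.pos; omega),
    (isMultiplicative_ramanujanFun n).map_mul_of_coprime hc, ramanujanFun_prime prime_two,
    if_neg h2, moebius_apply_prime prime_two]
  push_cast
  ring

lemma re_sum_singularTerm_ge (n : ℕ) {D : Finset ℕ} (hD : ∀ q ∈ D, Odd q) (h1 : 1 ∈ D) :
    1 / 4 ≤ (∑ q ∈ D, singularTerm n q).re := by
  set E := D.filter Squarefree with hE
  have h1E : 1 ∈ E := by simp [hE, h1]
  have he : ∑ q ∈ D, singularTerm n q = ∑ q ∈ E, singularTerm n q := by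
    rw [hE, sum_filter_of_ne]
    intro q _ h
    by_contra h'
    exact h (singularTerm_of_not_squarefree n h')
  have h2 := sum_inv_totient_sq_le (D := E) fun q hq => by
    grind
  rw [← add_sum_erase _ _ h1E] at h2
  rw [he, ← add_sum_erase _ _ h1E, singularTerm_one, add_re, one_re]
  have h3 : ‖∑ q ∈ E.erase 1, singularTerm n q‖ ≤ ∑ q ∈ E.erase 1, 1 / (q.totient : ℝ) ^ 2 :=
    (norm_sum_le _ _).trans (sum_le_sum fun q hq => norm_singularTerm_le n
      (hD q (mem_filter.1 (mem_of_mem_erase hq)).1).pos)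
  have h4 := (abs_le.1 (abs_re_le_norm (∑ q ∈ E.erase 1, singularTerm n q))).1
  rw [totient_one, cast_one] at h2
  linarith

/-- The truncated singular series is bounded away from zero for odd `n`. -/
lemma norm_sum_singularTerm_ge {n κ Q : ℕ} (hn : Odd n) (hQ : 1 ≤ Q) :
    1 / 4 ≤ ‖∑ q ∈ modelDenoms κ Q, singularTerm n q‖ := by
  refine le_trans ?_ (re_le_norm _)
  set D := modelDenoms κ Q
  set E := (range (Q + 1)).filter (fun q => Odd q ∧ 2 * q ∈ D) with hE
  have hsplit : ∑ q ∈ D, singularTerm n q =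
      ∑ q ∈ D.filter Odd, singularTerm n q + ∑ q ∈ E, singularTerm n q := by
    rw [← sum_filter_add_sum_filter_not D Odd]
    congr 1
    have : ∑ q ∈ E, singularTerm n q = ∑ q ∈ E.image (fun q => 2 * q), singularTerm n q := by
      rw [sum_image fun a _ b _ h => by simpa using h]
      refine sum_congr rfl fun q hq => (singularTerm_two_mul hn ?_).symm
      exact (mem_filter.1 hq).2.1
    rw [this]
    symm
    refine sum_subset (fun q hq => ?_) fun q hq hq' => ?_
    · grind
    · apply singularTerm_of_not_squarefree
      intro hs
      obtain ⟨h1, h2⟩ := mem_filter.1 hq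
      obtain ⟨r, hr⟩ := (not_odd_iff_even.1 h2).two_dvd
      have h3 := (mem_modelDenoms.1 h1).1.2
      refine hq' (mem_image.2 ⟨r, mem_filter.2 ⟨mem_range.2 (by omega), ?_, hr ▸ h1⟩, hr.symm⟩)
      by_contra h4
      obtain ⟨s, hs'⟩ := (not_odd_iff_even.1 h4).two_dvd
      have h5 := hs 2 ⟨s, by rw [hr, hs', mul_assoc]⟩
      exact absurd (Nat.isUnit_iff.1 h5) (by norm_num)
  have h1 : 1 / 4 ≤ (∑ q ∈ D.filter Odd, singularTerm n q).re :=
    re_sum_singularTerm_ge n (fun q hq => (mem_filter.1 hq).2)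
      (mem_filter.2 ⟨mem_modelDenoms.2 ⟨⟨le_rfl, hQ⟩, by simp⟩, odd_one⟩)
  have h2 : 0 ≤ (∑ q ∈ E, singularTerm n q).re := by
    rcases E.eq_empty_or_nonempty with h | ⟨q, hq⟩
    · simp [h]
    · refine le_trans (by norm_num) (re_sum_singularTerm_ge n (D := E)
        (fun q hq => (mem_filter.1 hq).2.1) ?_)
      rw [hE, mem_filter] at hq ⊢
      have h3 := mem_modelDenoms.1 hq.2.2
      have h4 := hq.2.1.pos
      exact ⟨mem_range.2 (by omega), odd_one, mem_modelDenoms.2 ⟨⟨by omega, by omega⟩,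
        Coprime.coprime_mul_right h3.2⟩⟩
  rw [hsplit, add_re]
  linarith

/-- The frequencies in the Ramanujan expansion of the model. -/
def modelFreqs (κ Q : ℕ) : Finset (Σ _ : ℕ, ℕ) := (modelDenoms κ Q).sigma redRes

lemma modelSum_eq (κ Q m : ℕ) :
    modelSum κ Q m = ∑ x ∈ modelFreqs κ Q, ramanujanCoeff x.1 * e ((x.2 : ℝ) / x.1 * m) := by
  simp only [modelSum, modelFreqs, sum_sigma, ramanujanSum, mul_sum]

lemma sum_norm_modelFreqs_le (κ Q : ℕ) :
    ∑ x ∈ modelFreqs κ Q, ‖ramanujanCoeff x.1‖ ≤ Q := by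
  rw [modelFreqs, sum_sigma]
  calc _ ≤ ∑ q ∈ modelDenoms κ Q, (1 : ℝ) := by
        refine sum_le_sum fun q hq => ?_
        have h0 : (0 : ℝ) < q.totient := mod_cast totient_pos.2 (mem_modelDenoms.1 hq).1.1
        simp only [sum_const, card_redRes, nsmul_eq_mul]
        have := mul_le_mul_of_nonneg_left (norm_ramanujanCoeff_le q) h0.le
        rwa [mul_one_div_cancel h0.ne'] at this
    _ ≤ Q := by
        rw [sum_const, nsmul_eq_mul, mul_one]
        exact_mod_cast (card_filter_le _ _).trans (by simp)

lemma far_mul_sub_of_ne {κ Q : ℕ} {x y : Σ _ : ℕ, ℕ} (hx : x ∈ modelFreqs κ Q)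
    (hy : y ∈ modelFreqs κ Q) (hne : x ≠ y) :
    Far (1 / (Q : ℝ) ^ 2) (((x.2 : ℝ) / x.1 - y.2 / y.1) * κ) := by
  obtain ⟨q, a⟩ := x
  obtain ⟨q', a'⟩ := y
  rw [modelFreqs, mem_sigma, mem_modelDenoms] at hx hy
  obtain ⟨⟨⟨hq, hqQ⟩, hc⟩, ha⟩ := hx
  obtain ⟨⟨⟨hq', hqQ'⟩, hc'⟩, ha'⟩ := hy
  dsimp only at *
  have hf := far_sub_of_ne ha ha' (fun h => hne (by rw [h.1, h.2]))
  have h1 : (0 : ℝ) < q := mod_cast hq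
  have h2 : (0 : ℝ) < q' := mod_cast hq'
  intro z
  have key : ((a : ℝ) / q - a' / q') * κ - z =
      ((((a : ℤ) * q' - a' * q) * κ - z * (q * q') : ℤ) : ℝ) / (q * q') := by
    push_cast
    field_simp
  have hz : ((a : ℤ) * q' - a' * q) * κ - z * (q * q') ≠ 0 := by
    intro h
    have hd : ((q * q' : ℕ) : ℤ) ∣ ((a : ℤ) * q' - a' * q) * κ := ⟨z, by push_cast; linarith⟩
    obtain ⟨w, hw⟩ := ((Coprime.mul_left hc hc').isCoprime).dvd_of_dvd_mul_right hd
    have h3 := hf w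
    have h4 : (a : ℝ) / q - a' / q' - w = 0 := by
      have : ((a : ℝ) * q' - a' * q) = q * q' * w := mod_cast hw
      rw [div_sub_div _ _ h1.ne' h2.ne', sub_eq_zero, div_eq_iff (by positivity)]
      linarith
    rw [h4, abs_zero] at h3
    exact absurd h3 (not_le.2 (by positivity))
  rw [key, abs_div, abs_of_pos (mul_pos h1 h2)]
  have h5 : (1 : ℝ) ≤ |((((a : ℤ) * q' - a' * q) * κ - z * (q * q') : ℤ) : ℝ)| := by exact_mod_cast Int.one_le_abs hz
  have h6 : (q : ℝ) ≤ Q := mod_cast hqQ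
  have h7 : (q' : ℝ) ≤ Q := mod_cast hqQ'
  rw [sq]
  gcongr

/-- The pairs in given residue classes whose sum is less than `n`. -/
def residuePairs (n κ b₁ b₂ : ℕ) : Finset (ℕ × ℕ) :=
  (Icc 1 n ×ˢ Icc 1 n).filter (fun m => m.1 % κ = b₁ ∧ m.2 % κ = b₂ ∧ m.1 + m.2 < n)

lemma norm_sum_residuePairs_left_le {n κ b₁ b₂ : ℕ} {θ₁ θ₂ δ : ℝ} (hδ : 0 < δ)
    (h : Far δ (θ₁ * κ)) :
    ‖∑ m ∈ residuePairs n κ b₁ b₂, e (θ₁ * m.1) * e (θ₂ * m.2)‖ ≤ n * (κ / δ) := by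
  rw [residuePairs, sum_filter, sum_product, sum_comm]
  calc _ ≤ ∑ m₂ ∈ Icc 1 n, (κ / δ : ℝ) := by
        refine (norm_sum_le _ _).trans (sum_le_sum fun m₂ h₂ => ?_)
        by_cases hb : m₂ % κ = b₂
        · have h1 : ∑ m₁ ∈ Icc 1 n, (if m₁ % κ = b₁ ∧ m₂ % κ = b₂ ∧ m₁ + m₂ < n then
              e (θ₁ * m₁) * e (θ₂ * m₂) else 0) =
              (∑ m₁ ∈ Icc 1 (n - m₂ - 1), (if m₁ % κ = b₁ then 1 else 0) * e (θ₁ * m₁)) *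
                e (θ₂ * m₂) := by
            rw [sum_mul]
            symm
            refine sum_subset_zero_on_sdiff (Icc_subset_Icc_right (by omega)) (fun m hm => ?_)
              fun m hm => ?_
            · grind
            · grind
          dsimp only
          rw [h1, norm_mul, norm_e, mul_one, ← one_mul (κ / δ : ℝ)]
          refine norm_sum_Icc_periodic_mul_e_le_mul hδ one_pos h (fun m => by simp) (fun m => ?_) _
          split_ifs <;> simp
        · rw [sum_eq_zero fun m _ => if_neg (fun h => hb h.2.1), norm_zero]
          positivity
    _ = _ := by simp

lemma norm_sum_residuePairs_le {n κ b₁ b₂ : ℕ} {θ₁ θ₂ δ : ℝ} (hδ : 0 < δ)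
    (h : Far δ (θ₁ * κ) ∨ Far δ (θ₂ * κ)) :
    ‖∑ m ∈ residuePairs n κ b₁ b₂, e (θ₁ * m.1) * e (θ₂ * m.2)‖ ≤ n * (κ / δ) := by
  rcases h with h | h
  · exact norm_sum_residuePairs_left_le hδ h
  · refine le_of_eq_of_le ?_ (norm_sum_residuePairs_left_le (θ₂ := θ₁) (b₁ := b₂) (b₂ := b₁) hδ h)
    congr 1
    refine sum_nbij' Prod.swap Prod.swap ?_ ?_ (by simp) (by simp) fun m _ => mul_comm _ _ <;>
    · intro m hm
      simp only [residuePairs, mem_filter, mem_product, Prod.fst_swap, Prod.snd_swap] at hm ⊢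
      grind

lemma card_residuePairs_ge {n κ b₁ b₂ : ℕ} (h₁ : b₁ < κ) (h₂ : b₂ < κ)
    (hκ : 8 * κ ≤ n) : (n / (8 * κ) : ℝ) ^ 2 ≤ #(residuePairs n κ b₁ b₂) := by
  set T := n / (4 * κ) with hT
  have h3 : 4 * κ * T ≤ n := mul_div_le n (4 * κ)
  have h4 : n < 4 * κ * (T + 1) := lt_mul_div_succ n (by omega)
  have hT1 : (n / (8 * κ) : ℝ) ≤ T := by
    have h5 : n ≤ 8 * κ * T := by
      by_contra h
      have : 1 ≤ T := (Nat.one_le_div_iff (by omega)).2 (by omega)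
      nlinarith
    have h0 : (0 : ℝ) < κ := mod_cast (by omega : 0 < κ)
    rw [div_le_iff₀ (by positivity)]
    have : (n : ℝ) ≤ 8 * κ * T := mod_cast h5
    linarith
  have hcard : #(range T ×ˢ range T) ≤ #(residuePairs n κ b₁ b₂) := by
    refine card_le_card_of_injOn (fun t => (b₁ + κ * (t.1 + 1), b₂ + κ * (t.2 + 1))) ?_ ?_
    · intro t ht
      rw [mem_coe, mem_product, mem_range, mem_range] at ht
      have h5 : κ * (t.1 + 1) ≤ κ * T := Nat.mul_le_mul_left _ ht.1
      have h6 : κ * (t.2 + 1) ≤ κ * T := Nat.mul_le_mul_left _ ht.2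
      have h7 : 4 * (κ * T) ≤ n := by linarith
      have h8 : κ ≤ κ * (t.1 + 1) := Nat.le_mul_of_pos_right _ (by omega)
      have h9 : κ ≤ κ * (t.2 + 1) := Nat.le_mul_of_pos_right _ (by omega)
      simp only [residuePairs, mem_coe, mem_filter, mem_product, mem_Icc, add_mul_mod_self_left,
        mod_eq_of_lt h₁, mod_eq_of_lt h₂, true_and]
      omega
    · intro t _ t' _ h
      have h0 : κ ≠ 0 := by omega
      simpa [h0, Prod.ext_iff] using h
  rw [card_product, card_range, ← sq] at hcard
  calc (n / (8 * κ) : ℝ) ^ 2 ≤ (T : ℝ) ^ 2 := by gcongr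
    _ ≤ _ := mod_cast hcard

lemma sub_mod_eq {n κ b₁ b₂ b₃ m₁ m₂ : ℕ} (h₃ : b₃ < κ) (hb : n % κ = (b₁ + b₂ + b₃) % κ)
    (h₁ : m₁ % κ = b₁) (h₂ : m₂ % κ = b₂) (h : m₁ + m₂ ≤ n) : (n - m₁ - m₂) % κ = b₃ := by
  have h4 : m₁ + m₂ + (n - m₁ - m₂) ≡ b₁ + b₂ + b₃ [MOD κ] := by
    rw [show m₁ + m₂ + (n - m₁ - m₂) = n by omega]
    exact hb
  have h5 : m₁ + m₂ ≡ b₁ + b₂ [MOD κ] := by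
    rw [← h₁, ← h₂]
    exact ((mod_modEq _ _).add (mod_modEq _ _)).symm
  have := Nat.ModEq.add_left_cancel h5 h4
  rwa [ModEq, mod_eq_of_lt h₃] at this

/-- The sums of a function over representations of `n` in given residue classes. -/
def residueSum (n κ : ℕ) (f : ℕ → ℂ) (b : ℕ × ℕ × ℕ) : ℂ :=
  ∑ m₁ ∈ Icc 1 n, ∑ m₂ ∈ Icc 1 n, ∑ m₃ ∈ Icc 1 n, if m₁ + m₂ + m₃ = n then
    f m₁ * (f m₂ * (f m₃ * if (m₁ % κ, m₂ % κ, m₃ % κ) = b then 1 else 0)) else 0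

lemma residueSum_eq {n κ b₁ b₂ b₃ : ℕ} (h₃ : b₃ < κ)
    (hb : n % κ = (b₁ + b₂ + b₃) % κ) (f : ℕ → ℂ) :
    residueSum n κ f (b₁, b₂, b₃) =
      ∑ m ∈ residuePairs n κ b₁ b₂, f m.1 * (f m.2 * f (n - m.1 - m.2)) := by
  rw [residuePairs, sum_filter, sum_product, residueSum]
  refine sum_congr rfl fun m₁ h1 => sum_congr rfl fun m₂ h2 => ?_
  rw [mem_Icc] at h1 h2
  dsimp only
  by_cases hlt : m₁ + m₂ < n
  · rw [sum_eq_single_of_mem (n - m₁ - m₂) (mem_Icc.2 (by omega)) fun m₃ _ h =>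
      if_neg (by omega), if_pos (by omega)]
    by_cases h12 : m₁ % κ = b₁ ∧ m₂ % κ = b₂
    · have h4 : m₁ + m₂ + (n - m₁ - m₂) ≡ b₁ + b₂ + b₃ [MOD κ] := by
        rw [show m₁ + m₂ + (n - m₁ - m₂) = n by omega]
        exact hb
      have h5 : m₁ + m₂ ≡ b₁ + b₂ [MOD κ] := by
        rw [← h12.1, ← h12.2]
        exact ((mod_modEq _ _).add (mod_modEq _ _)).symm
      have h6 : (n - m₁ - m₂) % κ = b₃ := by
        have := Nat.ModEq.add_left_cancel h5 h4
        rwa [ModEq, mod_eq_of_lt h₃] at this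
      grind
    grind
  · rw [if_neg (fun h => hlt h.2.2), sum_eq_zero fun m₃ h3 => if_neg (by
      grind)]

lemma norm_sum_modelFreqs_sub_le (n κ Q b₁ b₂ : ℕ) :
    ‖∑ m ∈ residuePairs n κ b₁ b₂,
        modelSum κ Q m.1 * (modelSum κ Q m.2 * modelSum κ Q (n - m.1 - m.2)) -
      #(residuePairs n κ b₁ b₂) * ∑ q ∈ modelDenoms κ Q, singularTerm n q‖ ≤
      (Q : ℝ) ^ 5 * κ * n := by
  rcases Nat.eq_zero_or_pos Q with rfl | hQ
  · simp [modelSum, modelDenoms]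
  have hQR : (0 : ℝ) < Q := mod_cast hQ
  set P := residuePairs n κ b₁ b₂
  set Φ := modelFreqs κ Q with hΦ
  set ξ : (Σ _ : ℕ, ℕ) → ℝ := fun x => (x.2 : ℝ) / x.1 with hξ
  set w : (Σ _ : ℕ, ℕ) → ℂ := fun x => ramanujanCoeff x.1 with hw
  set W : (Σ _ : ℕ, ℕ) → (Σ _ : ℕ, ℕ) → (Σ _ : ℕ, ℕ) → ℂ := fun x y z =>
    e (ξ z * n) * ∑ m ∈ P, e ((ξ x - ξ z) * m.1) * e ((ξ y - ξ z) * m.2) with hW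
  set D : (Σ _ : ℕ, ℕ) → (Σ _ : ℕ, ℕ) → (Σ _ : ℕ, ℕ) → ℂ := fun x y z =>
    if y = x then if z = x then #P * e (ξ x * n) else 0 else 0 with hD
  have h1 : ∑ m ∈ P, modelSum κ Q m.1 * (modelSum κ Q m.2 * modelSum κ Q (n - m.1 - m.2)) =
      ∑ x ∈ Φ, ∑ y ∈ Φ, ∑ z ∈ Φ, w x * (w y * w z) * W x y z := by
    have h2 : ∀ m ∈ P, modelSum κ Q m.1 * (modelSum κ Q m.2 * modelSum κ Q (n - m.1 - m.2)) =
        ∑ x ∈ Φ, ∑ y ∈ Φ, ∑ z ∈ Φ, w x * (w y * w z) *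
          (e (ξ z * n) * (e ((ξ x - ξ z) * m.1) * e ((ξ y - ξ z) * m.2))) := by
      intro m hm
      have hlt := (mem_filter.1 hm).2.2.2
      simp only [modelSum_eq]
      rw [sum_mul_sum, sum_mul_sum]
      refine sum_congr rfl fun x _ => ?_
      simp_rw [mul_sum]
      refine sum_congr rfl fun y _ => sum_congr rfl fun z _ => ?_
      have h3 : ξ z * (n - m.1 - m.2 : ℕ) = ξ z * n + (-(ξ z * m.1) + -(ξ z * m.2)) := by
        rw [cast_sub (by omega), cast_sub (by omega)]
        ring
      have h4 : ∀ t : ℝ, ∀ k : ℕ, (t - ξ z) * k = t * k + -(ξ z * k) := fun t k => by ring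
      change w x * e (ξ x * m.1) * (w y * e (ξ y * m.2) *
        (w z * e (ξ z * (n - m.1 - m.2 : ℕ)))) = _
      rw [h3, h4, h4, e_add, e_add, e_add, e_add]
      ring
    rw [sum_congr rfl h2, sum_comm]
    refine sum_congr rfl fun x _ => ?_
    rw [sum_comm]
    refine sum_congr rfl fun y _ => ?_
    rw [sum_comm]
    refine sum_congr rfl fun z _ => ?_
    simp only [hW]
    rw [mul_sum, mul_sum]
  have h2 : #P * ∑ q ∈ modelDenoms κ Q, singularTerm n q =
      ∑ x ∈ Φ, ∑ y ∈ Φ, ∑ z ∈ Φ, w x * (w y * w z) * D x y z := by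
    have h3 : ∀ x ∈ Φ, ∑ y ∈ Φ, ∑ z ∈ Φ, w x * (w y * w z) * D x y z =
        #P * (w x ^ 3 * e (ξ x * n)) := by
      intro x hx
      rw [sum_eq_single_of_mem x hx fun y _ hy => sum_eq_zero fun z _ => by
          grind,
        sum_eq_single_of_mem x hx fun z _ hz => by grind]
      simp only [hD, if_true]
      ring
    rw [sum_congr rfl h3, ← mul_sum, hΦ, modelFreqs, sum_sigma]
    simp only [singularTerm, ramanujanSum, mul_sum, hw, hξ]
  have h3 : ∀ x ∈ Φ, ∀ y ∈ Φ, ∀ z ∈ Φ, ‖W x y z - D x y z‖ ≤ (Q : ℝ) ^ 2 * κ * n := by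
    intro x hx y hy z hz
    by_cases h : y = x ∧ z = x
    · obtain ⟨rfl, rfl⟩ := h
      simp only [hW, hD, if_true, sub_self, zero_mul, e_zero, mul_one, sum_const, nsmul_eq_mul]
      rw [mul_comm, sub_self, norm_zero]
      positivity
    · have h4 : D x y z = 0 := by
        simp only [hD]
        split_ifs <;> tauto
      have h5 : Far (1 / (Q : ℝ) ^ 2) ((ξ x - ξ z) * κ) ∨ Far (1 / (Q : ℝ) ^ 2) ((ξ y - ξ z) * κ) := by
        by_cases hxz : x = z
        · exact Or.inr (far_mul_sub_of_ne hy hz fun hyz => h ⟨hyz.trans hxz.symm, hxz.symm⟩)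
        · exact Or.inl (far_mul_sub_of_ne hx hz hxz)
      have h6 := norm_sum_residuePairs_le (n := n) (b₁ := b₁) (b₂ := b₂) (by positivity) h5
      rw [h4, sub_zero]
      simp only [hW]
      rw [norm_mul, norm_e, one_mul]
      linarith
  rw [h1, h2, ← sum_sub_distrib]
  simp_rw [← sum_sub_distrib, ← mul_sub]
  calc _ ≤ ∑ x ∈ Φ, ∑ y ∈ Φ, ∑ z ∈ Φ, ‖w x‖ * (‖w y‖ * ‖w z‖) * ((Q : ℝ) ^ 2 * κ * n) := by
        refine (norm_sum_le _ _).trans (sum_le_sum fun x hx => (norm_sum_le _ _).trans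
          (sum_le_sum fun y hy => (norm_sum_le _ _).trans (sum_le_sum fun z hz => ?_)))
        rw [norm_mul, norm_mul, norm_mul]
        bound
    _ = (∑ x ∈ Φ, ‖w x‖) ^ 3 * ((Q : ℝ) ^ 2 * κ * n) := by
        simp_rw [← sum_mul, ← mul_sum, ← sum_mul]
        ring
    _ ≤ (Q : ℝ) ^ 3 * ((Q : ℝ) ^ 2 * κ * n) := by
        gcongr
        exact sum_norm_modelFreqs_le κ Q
    _ = _ := by ring

/-- The model has the expected number of representations in admissible residue classes. -/
lemma norm_residueSum_model_ge {n κ Q b₁ b₂ b₃ : ℕ} (hn : Odd n) (hQ : 1 ≤ Q)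
    (hκ : 512 * (Q ^ 5 * κ ^ 3) ≤ n) (h₁ : b₁ < κ) (h₂ : b₂ < κ) (h₃ : b₃ < κ)
    (hc₁ : Coprime b₁ κ) (hc₂ : Coprime b₂ κ) (hc₃ : Coprime b₃ κ)
    (hb : n % κ = (b₁ + b₂ + b₃) % κ) :
    (n / κ : ℝ) ^ 2 / 512 ≤ ‖residueSum n κ (model κ Q) (b₁, b₂, b₃)‖ := by
  have hκ0 : 0 < κ := by omega
  have hκR : (0 : ℝ) < κ := mod_cast hκ0
  have hn0 : (0 : ℝ) < n := mod_cast hn.pos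
  have h8 : 8 * κ ≤ n := by
    have h1 : 1 ≤ Q ^ 5 := one_le_pow _ _ hQ
    have h2 : κ ≤ κ ^ 3 := Nat.le_self_pow (by norm_num) κ
    nlinarith
  rw [residueSum_eq h₃ hb]
  set P := residuePairs n κ b₁ b₂ with hP
  have hmodel : ∀ m b : ℕ, m % κ = b → Coprime b κ →
      model κ Q m = totientRatio κ * modelSum κ Q m := fun m b h hcb => by
    rw [model, coprimeWeight_of_coprime]
    rwa [← h, coprime_iff_gcd_eq_one, ← gcd_rec, Nat.gcd_comm] at hcb
  have h1 : ∑ m ∈ P, model κ Q m.1 * (model κ Q m.2 * model κ Q (n - m.1 - m.2)) =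
      (totientRatio κ : ℂ) ^ 3 *
        ∑ m ∈ P, modelSum κ Q m.1 * (modelSum κ Q m.2 * modelSum κ Q (n - m.1 - m.2)) := by
    rw [mul_sum]
    refine sum_congr rfl fun m hm => ?_
    obtain ⟨_, hm1, hm2, hlt⟩ := mem_filter.1 hm
    rw [hmodel _ _ hm1 hc₁, hmodel _ _ hm2 hc₂, hmodel _ _ (sub_mod_eq h₃ hb hm1 hm2 hlt.le) hc₃]
    ring
  have h2 := norm_sum_modelFreqs_sub_le n κ Q b₁ b₂
  have h3 : (n / (8 * κ) : ℝ) ^ 2 * (1 / 4) ≤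
      ‖(#P : ℂ) * ∑ q ∈ modelDenoms κ Q, singularTerm n q‖ := by
    rw [norm_mul, Complex.norm_natCast]
    exact mul_le_mul (card_residuePairs_ge h₁ h₂ h8) (norm_sum_singularTerm_ge hn hQ)
      (by norm_num) (by positivity)
  have h4 : (Q : ℝ) ^ 5 * κ * n ≤ (n / κ : ℝ) ^ 2 / 512 := by
    rw [div_pow, div_div, le_div_iff₀ (by positivity)]
    have : 512 * ((Q : ℝ) ^ 5 * κ ^ 3) ≤ n := mod_cast hκ
    have := mul_le_mul_of_nonneg_right this hn0.le
    linarith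
  have h5 : (n / (8 * κ) : ℝ) ^ 2 * (1 / 4) = (n / κ : ℝ) ^ 2 / 512 + (n / κ : ℝ) ^ 2 / 512 := by
    field_simp
    norm_num
  have h6 : (1 : ℝ) ≤ totientRatio κ ^ 3 := one_le_pow₀ (one_le_totientRatio κ hκ0)
  rw [h1, norm_mul, norm_pow, norm_real, norm_eq_abs, pow_abs,
    abs_of_nonneg (zero_le_one.trans h6)]
  refine le_trans ?_ (le_mul_of_one_le_left (norm_nonneg _) h6)
  have h7 := norm_sub_norm_le ((#P : ℂ) * ∑ q ∈ modelDenoms κ Q, singularTerm n q)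
    (∑ m ∈ P, modelSum κ Q m.1 * (modelSum κ Q m.2 * modelSum κ Q (n - m.1 - m.2)))
  rw [norm_sub_rev] at h7
  linarith

/-- Sums over representations of `n`, weighted by a function of the residue classes. -/
def tripleSum (n κ : ℕ) (F G H : ℕ → ℂ) (c : ℕ → ℕ → ℕ → ℂ) : ℂ :=
  ∑ m₁ ∈ Icc 1 n, ∑ m₂ ∈ Icc 1 n, ∑ m₃ ∈ Icc 1 n, if m₁ + m₂ + m₃ = n then
    F m₁ * (G m₂ * (H m₃ * c (m₁ % κ) (m₂ % κ) (m₃ % κ))) else 0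

lemma tripleSum_swap (n κ : ℕ) (F G H : ℕ → ℂ) (c : ℕ → ℕ → ℕ → ℂ) :
    tripleSum n κ F G H c = tripleSum n κ G F H (fun x y z => c y x z) := by
  rw [tripleSum, sum_comm]
  refine sum_congr rfl fun x _ => sum_congr rfl fun y _ => sum_congr rfl fun z _ => ?_
  ring

lemma tripleSum_rotate (n κ : ℕ) (F G H : ℕ → ℂ) (c : ℕ → ℕ → ℕ → ℂ) :
    tripleSum n κ F G H c = tripleSum n κ H F G (fun x y z => c y z x) := by
  rw [tripleSum]
  simp_rw [sum_comm (s := Icc 1 n) (t := Icc 1 n) (f := fun m₂ m₃ => ite (_ + m₂ + m₃ = n) _ _)]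
  rw [sum_comm]
  refine sum_congr rfl fun x _ => sum_congr rfl fun y _ => sum_congr rfl fun z _ => ?_
  ring

lemma tripleSum_sub (n κ : ℕ) (f g : ℕ → ℂ) (c : ℕ → ℕ → ℕ → ℂ) :
    tripleSum n κ f f f c - tripleSum n κ g g g c =
      tripleSum n κ (fun m => f m - g m) f f c + tripleSum n κ g (fun m => f m - g m) f c +
        tripleSum n κ g g (fun m => f m - g m) c := by
  simp only [tripleSum, ← sum_sub_distrib, ← sum_add_distrib]
  refine sum_congr rfl fun x _ => sum_congr rfl fun y _ => sum_congr rfl fun z _ => ?_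
  grind

lemma sum_residueSum_mul {n κ : ℕ} (hκ : 0 < κ) (f : ℕ → ℂ) (θ : ℕ × ℕ × ℕ → ℂ) :
    ∑ b ∈ range κ ×ˢ range κ ×ˢ range κ, residueSum n κ f b * θ b =
      tripleSum n κ f f f (fun x y z => θ (x, y, z)) := by
  simp only [residueSum, tripleSum, sum_mul]
  rw [sum_comm]
  refine sum_congr rfl fun x _ => ?_
  rw [sum_comm]
  refine sum_congr rfl fun y _ => ?_
  rw [sum_comm]
  refine sum_congr rfl fun z _ => ?_
  rw [sum_eq_single_of_mem (x % κ, y % κ, z % κ)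
    (by simp [mod_lt _ hκ]) fun b _ hb => by simp [hb.symm]]
  grind

/-- Functions close to each other in the sense of exponential sums have nearly the same numbers of
representations, on average over residue classes. -/
lemma sum_norm_residueSum_sub_le {n κ : ℕ} (hκ : 0 < κ) {S B : ℝ} {f g : ℕ → ℂ}
    (hS : ∀ α : ℝ, ∀ ε : ℕ → ℂ, UnitPeriodic κ ε →
      ‖∑ m ∈ Icc 1 n, (f m - g m) * (ε m * e (α * m))‖ ≤ S)
    (hf : ∑ m ∈ Icc 1 n, ‖f m‖ ^ 2 ≤ B) (hg : ∑ m ∈ Icc 1 n, ‖g m‖ ^ 2 ≤ B) :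
    ∑ b ∈ range κ ×ˢ range κ ×ˢ range κ, ‖residueSum n κ f b - residueSum n κ g b‖ ≤
      3 * (S * B) := by
  have hS0 : 0 ≤ S := (norm_nonneg _).trans (hS 0 0 ⟨by simp, by simp⟩)
  set θ : ℕ × ℕ × ℕ → ℂ := fun b => phase (residueSum n κ f b - residueSum n κ g b) with hφ
  set c : ℕ → ℕ → ℕ → ℂ := fun x y z => θ (x, y, z) with hc
  have hφ1 : ∀ b, ‖θ b‖ ≤ 1 := fun b => norm_phase_le _
  have key : ∀ G H : ℕ → ℂ, ∑ m ∈ Icc 1 n, ‖G m‖ ^ 2 ≤ B → ∑ m ∈ Icc 1 n, ‖H m‖ ^ 2 ≤ B →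
      ∀ c' : ℕ → ℕ → ℕ → ℂ, (∀ x y z, ‖c' x y z‖ ≤ 1) →
      ‖tripleSum n κ (fun m => f m - g m) G H c'‖ ≤ S * B := fun G H hG hH c' hc' =>
    (norm_sum_triple_le hκ hc' hS).trans (mul_le_mul_of_nonneg_left (by linarith) hS0)
  have h1 : ((∑ b ∈ range κ ×ˢ range κ ×ˢ range κ,
      ‖residueSum n κ f b - residueSum n κ g b‖ : ℝ) : ℂ) =
      tripleSum n κ f f f c - tripleSum n κ g g g c := by
    rw [← sum_residueSum_mul hκ f θ, ← sum_residueSum_mul hκ g θ, ← sum_sub_distrib,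
      ofReal_sum]
    refine sum_congr rfl fun b _ => ?_
    rw [← sub_mul, mul_phase]
  have h2 := congrArg norm h1
  rw [norm_real, norm_of_nonneg (sum_nonneg fun _ _ => norm_nonneg _)] at h2
  rw [h2, tripleSum_sub, tripleSum_swap n κ g, tripleSum_rotate n κ g g]
  refine (norm_add₃_le).trans ?_
  grind

section
variable {n V k κ : ℕ}

/-- The logarithmic weight on the primes not dividing `k`. -/
def primeWeight (k m : ℕ) : ℂ := if m.Prime ∧ Coprime m k then (log m : ℂ) else 0

lemma primeWeight_ne_zero {m : ℕ} (h : primeWeight k m ≠ 0) : m.Prime ∧ Coprime m k := by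
  by_contra h'
  exact h (if_neg h')

lemma norm_primeWeight_le {m : ℕ} (hm : m ∈ Icc 1 n) : ‖primeWeight k m‖ ≤ log n := by
  rw [mem_Icc] at hm
  have h1 : log m ≤ log n :=
    log_le_log (mod_cast hm.1) (mod_cast hm.2)
  have h0 : 0 ≤ log m := log_natCast_nonneg m
  rw [primeWeight]
  split_ifs
  · rwa [norm_real, norm_of_nonneg h0]
  · rw [norm_zero]
    exact h0.trans h1

lemma norm_primeWeight_sub_vonMangoldt_le (k m : ℕ) :
    ‖primeWeight k m - (Λ m : ℂ)‖ ≤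
      (if ¬ m.Prime then Λ m else 0) + if ¬ Coprime m k then Λ m else 0 := by
  have h0 := vonMangoldt_nonneg (n := m)
  have h1 : ‖(0 : ℂ) - (Λ m : ℂ)‖ = Λ m := by
    rw [zero_sub, norm_neg, norm_real, norm_of_nonneg h0]
  rw [primeWeight]
  by_cases hp : m.Prime
  · by_cases hc : Coprime m k
    · rw [if_pos ⟨hp, hc⟩, vonMangoldt_apply_prime hp, sub_self]
      simp [hp, hc]
    grind
  grind

lemma sum_norm_primeWeight_sub_vonMangoldt_le (hn : 3 ≤ n) (hk : 0 < k) :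
    ∑ m ∈ Icc 1 n, ‖primeWeight k m - (Λ m : ℂ)‖ ≤
      2 * √n * log n + 2 * k * log n ^ 2 := by
  refine (sum_le_sum fun m _ => norm_primeWeight_sub_vonMangoldt_le k m).trans ?_
  rw [sum_add_distrib, ← sum_filter, ← sum_filter]
  have h1 := Chebyshev.psi_sub_theta_le (x := n) (mod_cast (by omega : 1 ≤ n))
  rw [Chebyshev.psi_sub_theta_eq_sum_not_prime, floor_natCast] at h1
  exact add_le_add h1 (sum_vonMangoldt_not_coprime_le hn hk le_rfl)

lemma norm_sum_primeWeight_sub_model_le (h : Small n V k) (H : Small n V κ)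
    (hSW : SiegelWalfisz n V)
    (hgood : primeDefect n V κ ≤ (n / (V : ℝ) ^ 25) ^ 2) (α : ℝ)
    {ε : ℕ → ℂ} (hε : UnitPeriodic κ ε) :
    ‖∑ m ∈ Icc 1 n, (primeWeight k m - model κ (V ^ 8) m) * (ε m * e (α * m))‖ ≤
      502 * (n / V) := by
  have ⟨hn, hV, hlog, hk0, _⟩ := h
  have h1 := norm_sum_vonMangoldt_sub_model_le H hSW hgood α hε
  have hL := one_le_log_of_three_le hn
  have hv : (2 : ℝ) ≤ V := mod_cast hV
  have hn0 : (0 : ℝ) ≤ n := n.cast_nonneg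
  have hLV : log n ≤ V := (le_self_pow₀ hL (by norm_num)).trans hlog
  have h2 : ‖∑ m ∈ Icc 1 n, (primeWeight k m - (Λ m : ℂ)) * (ε m * e (α * m))‖ ≤
      2 * √n * log n + 2 * k * log n ^ 2 := by
    refine (norm_sum_le _ _).trans (le_trans (sum_le_sum fun m _ => ?_)
      (sum_norm_primeWeight_sub_vonMangoldt_le hn hk0))
    rw [norm_mul, norm_mul, norm_e, mul_one]
    exact mul_le_of_le_one_right (norm_nonneg _) (hε.norm_le m)
  have h3 : (V : ℝ) ^ 6 ≤ n := by simpa using h.mul_le 0 6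
  have h4 : (k : ℝ) * V ^ 6 ≤ n := by simpa using h.mul_le 1 6
  have h5 : 2 * √n * log n ≤ n / V := by
    rw [le_div_iff₀ (by positivity)]
    have : (V : ℝ) ^ 3 ≤ √n := le_sqrt_of_sq_le (by linarith)
    calc 2 * √n * log n * V ≤ V * √n * V * V := by gcongr
      _ = V ^ 3 * √n := by ring
      _ ≤ √n * √n := by gcongr
      _ = n := mul_self_sqrt hn0
  have h6 : 2 * k * log n ^ 2 ≤ n / V := by
    rw [le_div_iff₀ (by positivity)]
    calc 2 * k * log n ^ 2 * V ≤ V * k * V ^ 2 * (V : ℝ) := by gcongr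
      _ = (k * V ^ 4 : ℝ) * 1 := by ring
      _ ≤ (k * V ^ 4 : ℝ) * V ^ 2 := by
        bound
      _ = (k : ℝ) * V ^ 6 := by ring
      _ ≤ (n : ℝ) := h4
  have h7 : ∑ m ∈ Icc 1 n, (primeWeight k m - model κ (V ^ 8) m) * (ε m * e (α * m)) =
      ∑ m ∈ Icc 1 n, (primeWeight k m - (Λ m : ℂ)) * (ε m * e (α * m)) +
        ∑ m ∈ Icc 1 n, ((Λ m : ℂ) - model κ (V ^ 8) m) * (ε m * e (α * m)) := by
    rw [← sum_add_distrib]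
    exact sum_congr rfl fun m _ => by ring
  rw [h7]
  refine (norm_add_le _ _).trans ?_
  linarith

/-- The number of representations by primes in residue classes is close to the one for the model,
on average over the classes. -/
lemma sum_norm_residueSum_primeWeight_sub_le (h : Small n V k) (H : Small n V κ)
    (hSW : SiegelWalfisz n V)
    (hgood : primeDefect n V κ ≤ (n / (V : ℝ) ^ 25) ^ 2) :
    ∑ b ∈ range κ ×ˢ range κ ×ˢ range κ,
      ‖residueSum n κ (primeWeight k) b - residueSum n κ (model κ (V ^ 8)) b‖ ≤
      200000 * ((n : ℝ) ^ 2 * log n ^ 4 / V) := by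
  have ⟨hn, hV, _, hκ0, _⟩ := H
  have hL := one_le_log_of_three_le hn
  have h32 : (V : ℝ) ^ 32 ≤ n := by simpa using H.mul_le 0 32
  have h8 : (V : ℝ) ^ 8 ≤ n := by simpa using H.mul_le 0 8
  have hB1 : ∑ m ∈ Icc 1 n, ‖primeWeight k m‖ ^ 2 ≤ 108 * n * log n ^ 4 := by
    calc _ ≤ ∑ m ∈ Icc 1 n, log n ^ 4 := by
          refine sum_le_sum fun m hm => ?_
          calc _ ≤ log n ^ 2 := by
                gcongr
                exact norm_primeWeight_le hm
            _ ≤ _ := pow_le_pow_right₀ hL (by norm_num)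
      _ = n * log n ^ 4 := by simp
      _ ≤ _ := by
        bound
  have hB2 : ∑ m ∈ Icc 1 n, ‖model κ (V ^ 8) m‖ ^ 2 ≤ 108 * n * log n ^ 4 := by
    refine (sum_norm_model_sq_le hn hκ0 H.le (mod_cast h8)).trans ?_
    have h9 : (((V ^ 8 : ℕ) : ℝ)) ^ 4 ≤ n := by
      push_cast
      rw [← pow_mul]
      exact h32
    have : 0 ≤ 54 * log n ^ 4 := by positivity
    calc _ ≤ 54 * log n ^ 4 * ((n : ℝ) + n) := by gcongr
      _ = _ := by ring
  refine (sum_norm_residueSum_sub_le hκ0 (fun α ε hε => norm_sum_primeWeight_sub_model_le h H hSW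
    hgood α hε) hB1 hB2).trans ?_
  have : 0 ≤ (n : ℝ) ^ 2 * log n ^ 4 / V := by positivity
  grind

end

section
variable {n V k : ℕ}

lemma residueSum_primeWeight_eq_zero {b : ℕ × ℕ × ℕ} (hb : b ∈ badTriplets n k) :
    residueSum n k (primeWeight k) b = 0 := by
  classical
  rw [badTriplets, mem_filter, admTriplets, mem_filter] at hb
  obtain ⟨⟨hb1, -⟩, hb⟩ := hb
  simp only [mem_product, mem_range] at hb1
  unfold residueSum
  refine sum_eq_zero fun m₁ _ => sum_eq_zero fun m₂ _ => sum_eq_zero fun m₃ _ => ?_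
  by_contra h
  simp only [ite_eq_right_iff, not_forall, mul_eq_zero, not_or, exists_prop] at h
  obtain ⟨hs, h₁, h₂, h₃, h4⟩ := h
  refine hb ⟨m₁, m₂, m₃, (primeWeight_ne_zero h₁).1, (primeWeight_ne_zero h₂).1,
    (primeWeight_ne_zero h₃).1, hs, ?_⟩
  simp [← h4.1]

lemma card_filter_mod_eq_le (n k b : ℕ) :
    #{m ∈ Icc 1 n | m % k = b} ≤ n / k + 1 := by
  calc _ ≤ #(range (n / k + 1)) := by
        refine card_le_card_of_injOn (· / k) (fun m hm => ?_) fun m hm m' hm' h => ?_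
        · rw [mem_coe, mem_filter, mem_Icc] at hm
          exact mem_coe.2 (mem_range.2 (lt_succ_of_le (Nat.div_le_div_right hm.1.2)))
        · rw [mem_coe, mem_filter] at hm hm'
          rw [← div_add_mod m k, ← div_add_mod m' k, hm.2, hm'.2]
          grind
    _ = _ := card_range _

lemma card_residuePairs_coprime_le (hk : 0 < k) :
    #{m ∈ residuePairs n 1 0 0 | m.1.Coprime k ∧ m.2.Coprime k ∧ (n - m.1 - m.2).Coprime k} ≤
      (n / k + 1) ^ 2 * #(admTriplets n k) := by
  classical
  have hco : ∀ {m : ℕ}, m.Coprime k → (m % k).Coprime k := fun h => by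
    rwa [Coprime, ← gcd_rec, Nat.gcd_comm]
  refine card_le_mul_card_image_of_maps_to
    (f := fun m : ℕ × ℕ => (m.1 % k, m.2 % k, (n - m.1 - m.2) % k)) (fun m hm => ?_) _
    fun b _ => ?_
  · rw [mem_filter, residuePairs, mem_filter] at hm
    obtain ⟨⟨-, -, -, hlt⟩, h₁, h₂, h₃⟩ := hm
    simp only [admTriplets, mem_filter, mem_product, mem_range]
    refine ⟨⟨mod_lt _ hk, mod_lt _ hk, mod_lt _ hk⟩, hco h₁, hco h₂, hco h₃, ?_⟩
    have h : n = m.1 + m.2 + (n - m.1 - m.2) := by omega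
    conv_lhs => rw [h]
    simp only [add_mod, mod_mod]
  · calc _ ≤ #({m ∈ Icc 1 n | m % k = b.1} ×ˢ {m ∈ Icc 1 n | m % k = b.2.1}) := by
          refine card_le_card fun m hm => ?_
          rw [mem_filter, mem_filter, residuePairs, mem_filter, mem_product] at hm
          grind
      _ ≤ _ := by
          rw [card_product, sq]
          exact Nat.mul_le_mul (card_filter_mod_eq_le n k _) (card_filter_mod_eq_le n k _)

lemma norm_residueSum_one_le (hk : 0 < k) :
    ‖residueSum n 1 (primeWeight k) (0, 0, 0)‖ ≤
      ((n / k + 1 : ℕ) ^ 2 * #(admTriplets n k) : ℝ) * log n ^ 3 := by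
  classical
  rw [residueSum_eq one_pos (by simp [mod_one])]
  have hL : 0 ≤ log n := log_natCast_nonneg n
  calc _ ≤ ∑ m ∈ residuePairs n 1 0 0,
        if m.1.Coprime k ∧ m.2.Coprime k ∧ (n - m.1 - m.2).Coprime k
          then log n ^ 3 else 0 := by
        refine norm_sum_le_of_le _ fun m hm => ?_
        rw [residuePairs, mem_filter, mem_product] at hm
        obtain ⟨⟨hm₁, hm₂⟩, -, -, hlt⟩ := hm
        have hm₃ : n - m.1 - m.2 ∈ Icc 1 n := mem_Icc.2 ⟨by omega, by omega⟩
        split_ifs with h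
        · rw [norm_mul, norm_mul]
          calc _ ≤ log n * (log n * log n) := by
                gcongr <;> exact norm_primeWeight_le ‹_›
            _ = _ := by ring
        · by_contra h'
          have h0 : primeWeight k m.1 * (primeWeight k m.2 * primeWeight k (n - m.1 - m.2)) ≠ 0 :=
            fun h0 => h' (by rw [h0, norm_zero])
          rw [mul_ne_zero_iff, mul_ne_zero_iff] at h0
          exact h ⟨(primeWeight_ne_zero h0.1).2, (primeWeight_ne_zero h0.2.1).2,
            (primeWeight_ne_zero h0.2.2).2⟩
    _ ≤ _ := by
        rw [← sum_filter, sum_const, nsmul_eq_mul]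
        gcongr
        exact_mod_cast card_residuePairs_coprime_le hk

lemma card_badTriplets_le (hn : 3 ≤ n) (hodd : Odd n) (hV : 2 ^ 28 * log n ^ 5 ≤ V)
    (hk0 : 0 < k) (hk : k ^ 4 * V ^ 100 ≤ n)
    (hSW : SiegelWalfisz n V)
    (hgood : primeDefect n V k ≤ (n / (V : ℝ) ^ 25) ^ 2) :
    (#(badTriplets n k) : ℝ) ≤ 10 ^ 12 * #(admTriplets n k) * (log n ^ 7 / V) := by
  classical
  have hL := one_le_log_of_three_le hn
  set L := log n with hLd
  have hL5 : 1 ≤ L ^ 5 := one_le_pow₀ hL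
  have hV2 : 2 ≤ V := by
    have : (2 : ℝ) ≤ V := by linarith
    exact_mod_cast this
  have hlog : L ^ 5 ≤ V := by linarith
  have hVr : (2 : ℝ) ≤ V := mod_cast hV2
  have hV0 : (0 : ℝ) < V := by linarith
  have hn0 : (0 : ℝ) < n := by positivity
  have hkr : (0 : ℝ) < k := mod_cast hk0
  have H : Small n V k := ⟨hn, hV2, hlog, hk0, hk⟩
  have H1 : Small n V 1 := ⟨hn, hV2, hlog, one_pos,
    (Nat.mul_le_mul_right _ (Nat.pow_le_pow_left hk0 4)).trans hk⟩
  have hsize : ∀ κ : ℕ, Small n V κ → 512 * ((V ^ 8) ^ 5 * κ ^ 3) ≤ n := by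
    intro κ h
    refine le_trans ?_ (mod_cast h.mul_le 3 49 : κ ^ 3 * V ^ 49 ≤ n)
    calc 512 * ((V ^ 8) ^ 5 * κ ^ 3) = κ ^ 3 * (2 ^ 9 * V ^ 40) := by ring
      _ ≤ κ ^ 3 * (V ^ 9 * V ^ 40) := by gcongr
      _ = _ := by ring
  have hbad : (#(badTriplets n k) : ℝ) * ((n / k : ℝ) ^ 2 / 512) ≤
      200000 * ((n : ℝ) ^ 2 * L ^ 4 / V) := by
    refine le_trans ?_ (sum_norm_residueSum_primeWeight_sub_le H H hSW hgood)
    rw [← nsmul_eq_mul, ← sum_const]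
    have hsub : badTriplets n k ⊆ range k ×ˢ range k ×ˢ range k :=
      (filter_subset _ _).trans (filter_subset _ _)
    refine le_trans (sum_le_sum fun b hb => ?_)
      (sum_le_sum_of_subset_of_nonneg hsub fun _ _ _ => norm_nonneg _)
    rw [residueSum_primeWeight_eq_zero hb, zero_sub, norm_neg]
    have hb' := (mem_filter.1 hb).1
    rw [admTriplets, mem_filter, mem_product, mem_product] at hb'
    obtain ⟨⟨h₁, h₂, h₃⟩, hc₁, hc₂, hc₃, hmod⟩ := hb'
    exact norm_residueSum_model_ge hodd (one_le_pow _ _ (by omega)) (hsize k H)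
      (mem_range.1 h₁) (mem_range.1 h₂) (mem_range.1 h₃) hc₁ hc₂ hc₃ hmod
  have hone : (n : ℝ) ^ 2 / 1024 ≤ ‖residueSum n 1 (primeWeight k) (0, 0, 0)‖ := by
    have h1 := sum_norm_residueSum_primeWeight_sub_le H H1 hSW (by
      rw [primeDefect_eq_zero (by rw [one_mul]; bound)]
      positivity)
    have h2 := norm_residueSum_model_ge (b₁ := 0) (b₂ := 0) (b₃ := 0) hodd
      (one_le_pow _ _ (by omega)) (hsize 1 H1) one_pos one_pos one_pos (by simp)
      (by simp) (by simp) (by simp [mod_one])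
    simp only [range_one, singleton_product_singleton, sum_singleton] at h1
    have h3 := norm_sub_norm_le (residueSum n 1 (model 1 (V ^ 8)) (0, 0, 0))
      (residueSum n 1 (primeWeight k) (0, 0, 0))
    rw [norm_sub_rev] at h3
    have h4 : 200000 * ((n : ℝ) ^ 2 * L ^ 4 / V) ≤ (n : ℝ) ^ 2 / 1024 := by
      rw [← mul_div_assoc, div_le_div_iff₀ hV0 (by norm_num)]
      have h5 : L ^ 4 ≤ L ^ 5 := pow_le_pow_right₀ hL (by simp)
      nlinarith [sq_nonneg (n : ℝ)]
    rw [cast_one, div_one] at h2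
    linarith
  have hA : (k : ℝ) ^ 2 ≤ 4096 * (#(admTriplets n k) * L ^ 3) := by
    have h1 := hone.trans (norm_residueSum_one_le hk0)
    rw [← hLd] at h1
    have hkn : (1 : ℝ) ≤ n / k := by
      rw [one_le_div hkr]
      exact_mod_cast H.le
    have h2 : ((n / k + 1 : ℕ) : ℝ) ≤ 2 * (n / k) := by
      push_cast
      linarith [cast_div_le (α := ℝ) (m := n) (n := k)]
    have h3 : (n : ℝ) ^ 2 / 1024 ≤ ((2 * (n / k : ℝ)) ^ 2 * #(admTriplets n k)) * L ^ 3 := by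
      refine h1.trans ?_
      gcongr
    have h4 : ((2 * (n / k : ℝ)) ^ 2 * #(admTriplets n k)) * L ^ 3 =
        (n : ℝ) ^ 2 * (4 * (#(admTriplets n k) * L ^ 3) / (k : ℝ) ^ 2) := by
      field_simp
      ring
    rw [h4, div_eq_mul_one_div, mul_le_mul_iff_right₀ (by positivity),
      div_le_div_iff₀ (by norm_num) (by positivity)] at h3
    linarith
  have h1 : (#(badTriplets n k) : ℝ) * ((n / k : ℝ) ^ 2 / 512) =
      (n : ℝ) ^ 2 * (#(badTriplets n k) / (512 * (k : ℝ) ^ 2)) := by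
    field_simp
  have h2 : 200000 * ((n : ℝ) ^ 2 * L ^ 4 / V) = (n : ℝ) ^ 2 * (200000 * (L ^ 4 / V)) := by ring
  rw [h1, h2, mul_le_mul_iff_right₀ (by positivity), div_le_iff₀ (by positivity)] at hbad
  have h0 : 0 ≤ L ^ 4 / V := by positivity
  calc _ ≤ _ := hbad
    _ ≤ 200000 * (L ^ 4 / V) * (512 * (4096 * (#(admTriplets n k) * L ^ 3))) := by gcongr
    _ = (200000 * 512 * 4096) * (#(admTriplets n k) * (L ^ 7 / V)) := by ring
    _ ≤ 10 ^ 12 * (#(admTriplets n k) * (L ^ 7 / V)) := by gcongr; norm_num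
    _ = _ := by ring

end

lemma siegelWalfisz_of_log_le {C L V : ℝ} {n v : ℕ} (hC : 1 ≤ C) (hv : 0 < v) (hCL : 2 * C ≤ L)
    (hn : L ^ (1000 * v) ≤ n) (hV0 : 0 < V) (hV : V ≤ L ^ (2 * v)) :
    C * (V ^ 92) ^ 2 * (n / L ^ (608 * v + 1) + L ^ 2) ≤ n / V ^ 120 := by
  have hL : 2 ≤ L := by linarith
  have hV' : V ^ 304 ≤ L ^ (608 * v) := by
    calc _ ≤ (L ^ (2 * v)) ^ 304 := by gcongr
      _ = _ := by ring
  have hn0 : (0 : ℝ) ≤ n := n.cast_nonneg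
  rw [le_div_iff₀ (by positivity)]
  have h1 : C * (L ^ (608 * v) * (n / L ^ (608 * v + 1))) ≤ n / 2 := by
    have : C * (L ^ (608 * v) * (n / L ^ (608 * v + 1))) = n * (C / L) := by
      rw [pow_succ]
      field_simp
    rw [this, div_eq_mul_one_div (n : ℝ)]
    refine mul_le_mul_of_nonneg_left ?_ hn0
    rw [div_le_div_iff₀ (by linarith) (by norm_num)]
    linarith
  have h2 : C * (L ^ (608 * v) * L ^ 2) ≤ n / 2 := by
    have h3 : L * (L ^ (608 * v) * L ^ 2) ≤ L ^ (1000 * v) := by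
      rw [← pow_add, ← pow_succ']
      exact pow_le_pow_right₀ (by linarith) (by omega)
    have h4 : (2 * C) * (L ^ (608 * v) * L ^ 2) ≤ L * (L ^ (608 * v) * L ^ 2) := by gcongr
    linarith
  calc _ = C * (V ^ 304 * (n / L ^ (608 * v + 1))) + C * (V ^ 304 * L ^ 2) := by ring
    _ ≤ C * (L ^ (608 * v) * (n / L ^ (608 * v + 1))) + C * (L ^ (608 * v) * L ^ 2) := by
        gcongr
    _ ≤ n := by linarith

lemma pow_four_mul_le {κ W n : ℕ} (hκ : κ ^ 5 ≤ n) (hW : W ^ 5 ≤ n) : κ ^ 4 * W ≤ n := by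
  refine le_of_pow_le_pow_left₀ (n := 5) (by simp) (Nat.zero_le _) ?_
  calc _ = (κ ^ 5) ^ 4 * W ^ 5 := by ring
    _ ≤ n ^ 4 * n := by gcongr
    _ = _ := by ring

lemma exceptional_of_log_le {A ε C : ℝ} {v n : ℕ} (hε : 0 < ε) (hA : 0 < A)
    (hC : 1 ≤ C) (hv : A + 12 ≤ v)
    (hSW : ∀ q a : ℕ, a ∈ redRes q → ∀ n : ℕ, 3 ≤ n → ∀ y ≤ n,
      ‖∑ m ∈ Icc 1 y, (Λ m : ℂ) * e (-((a : ℝ) / q * m)) - y * ramanujanCoeff q‖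
        ≤ C * q ^ 2 * (n / log n ^ (608 * v + 1) + log n ^ 2))
    (hn3 : 3 ≤ n) (hL : 2 ^ 28 ≤ log n) (hCL : 2 * C ≤ log n)
    (hn : log n ^ (1000 * v) ≤ n) (hodd : Odd n) :
    (#{k ∈ Icc 1 ⌊(n : ℝ) ^ ((1 : ℝ) / 5 - ε)⌋₊ | ¬ ((badTriplets n k).card ≤
        (10 ^ 12 : ℝ) * (admTriplets n k).card * log n ^ (-A))} : ℝ) ≤
      10 ^ 12 * (n : ℝ) ^ ((1 : ℝ) / 5 - ε) * log n ^ (-A) := by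
  set L := log n with hLd
  set M := ⌊(n : ℝ) ^ ((1 : ℝ) / 5 - ε)⌋₊ with hM
  set V := ⌈L⌉₊ ^ v with hVd
  have hL0 : 0 < L := by linarith
  have hL1 : 1 ≤ L := by linarith
  have hn1 : (1 : ℝ) ≤ n := mod_cast (by omega : 1 ≤ n)
  have hv12 : 12 ≤ v := by
    have : (12 : ℝ) ≤ v := by linarith
    exact_mod_cast this
  have hVle : (V : ℝ) ≤ L ^ (2 * v) := by
    rw [hVd, cast_pow, pow_mul]
    gcongr
    have := (ceil_lt_add_one hL0.le).le
    nlinarith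
  have hVge : L ^ v ≤ V := by
    rw [hVd, cast_pow]
    gcongr
    exact le_ceil L
  have hVA : L ^ 7 / V ≤ L ^ (-A) := by
    have hVpos : 0 < L ^ v := by positivity
    calc _ ≤ L ^ 7 / L ^ v := by gcongr
      _ = L ^ ((7 : ℝ) - v) := by
          rw [rpow_sub hL0, rpow_natCast]
          norm_cast
      _ ≤ _ := rpow_le_rpow_of_exponent_le hL1 (by linarith)
  have hV28 : 2 ^ 28 * L ^ 5 ≤ V := by
    calc _ ≤ L * L ^ 5 := by gcongr
      _ = L ^ 6 := by ring
      _ ≤ L ^ v := pow_le_pow_right₀ hL1 (by omega)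
      _ ≤ _ := hVge
  have hL5 : 1 ≤ L ^ 5 := one_le_pow₀ hL1
  have hV2 : (2 : ℝ) ≤ V := by linarith
  have hV2' : 2 ≤ V := mod_cast hV2
  have hV5 : (V ^ 100) ^ 5 ≤ n := by
    have : ((V : ℝ) ^ 100) ^ 5 ≤ n := by
      calc _ ≤ ((L ^ (2 * v)) ^ 100) ^ 5 := by gcongr
        _ = L ^ (1000 * v) := by ring
        _ ≤ _ := hn
    exact_mod_cast this
  have hMr : (M : ℝ) ≤ (n : ℝ) ^ ((1 : ℝ) / 5 - ε) := floor_le (by positivity)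
  have hM5 : M ^ 5 ≤ n := by
    have h : (M : ℝ) ≤ (n : ℝ) ^ ((1 : ℝ) / 5) :=
      hMr.trans (rpow_le_rpow_of_exponent_le hn1 (by linarith))
    have h' : (M : ℝ) ^ 5 ≤ n := by
      calc _ ≤ ((n : ℝ) ^ ((1 : ℝ) / 5)) ^ 5 := by gcongr
        _ = n := by
            rw [← rpow_natCast, ← rpow_mul (by linarith)]
            norm_num
    exact_mod_cast h'
  have hsize : ∀ κ ≤ M, κ ^ 4 * V ^ 100 ≤ n := fun κ hκ =>
    pow_four_mul_le ((Nat.pow_le_pow_left hκ 5).trans hM5) hV5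
  have hSW' : SiegelWalfisz n V := by
    intro q hq a ha y hy
    refine (hSW q a ha n hn3 y hy).trans (le_trans ?_
      (siegelWalfisz_of_log_le hC (by omega) hCL hn (by linarith) hVle))
    have hq' : (q : ℝ) ≤ (V : ℝ) ^ 92 := mod_cast hq
    gcongr
  have hexc := card_primeDefect_gt_le hn3 hV2' (by linarith) (M := M) (by
    calc _ = M ^ 4 * V ^ 32 := by linarith
      _ ≤ M ^ 4 * V ^ 100 := by
          gcongr 2
          · omega
          · simp
      _ ≤ n := hsize M le_rfl)
  refine le_trans (cast_le.2 (card_le_card ?_)) (hexc.trans ?_)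
  · refine fun k hk => mem_filter.2 ⟨(mem_filter.1 hk).1, fun hgood => (mem_filter.1 hk).2 ?_⟩
    have hkM := mem_Icc.1 (mem_filter.1 hk).1
    refine (card_badTriplets_le hn3 hodd hV28 hkM.1 (hsize k hkM.2) hSW' hgood).trans ?_
    gcongr
  · have h7 : 1 ≤ L ^ 7 := one_le_pow₀ hL1
    calc 120 * (M : ℝ) / V = 120 * M * (1 / V) := by ring
      _ ≤ 10 ^ 12 * (n : ℝ) ^ ((1 : ℝ) / 5 - ε) * (L ^ 7 / V) := by
          bound
      _ ≤ _ := by gcongr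

end TernaryGoldbach

theorem stmt1 (A ε : ℝ) (hA : 0 < A) (hε : 0 < ε) :
    ∃ C > (0:ℝ), ∃ N : ℕ, ∀ n : ℕ, N ≤ n → Odd n →
      (((Finset.Icc 1 ⌊(n : ℝ) ^ ((1:ℝ)/5 - ε)⌋₊).filter (fun k =>
          ¬ ((badTriplets n k).card ≤ C * (admTriplets n k).card * Real.log n ^ (-A)))).card : ℝ)
        ≤ C * (n : ℝ) ^ ((1:ℝ)/5 - ε) * Real.log n ^ (-A) := by
  obtain ⟨v, hv⟩ := exists_nat_ge (A + 12)
  obtain ⟨C, hC, hSW⟩ := TernaryGoldbach.norm_sum_vonMangoldt_mul_e_sub_le (608 * v + 1)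
  have hlog : Filter.Tendsto (fun n : ℕ => Real.log n) Filter.atTop Filter.atTop :=
    Real.tendsto_log_atTop.comp tendsto_natCast_atTop_atTop
  have hpow : ∀ᶠ n : ℕ in Filter.atTop, Real.log n ^ (1000 * v) ≤ n := by
    have h := (Real.isLittleO_pow_log_id_atTop (n := 1000 * v)).comp_tendsto
      (tendsto_natCast_atTop_atTop (R := ℝ))
    filter_upwards [h.bound one_pos] with n hn
    simpa using (le_abs_self _).trans hn
  obtain ⟨N, hN⟩ := Filter.eventually_atTop.1 (((Filter.eventually_ge_atTop 3).and
    (hlog.eventually_ge_atTop (2 ^ 28))).and ((hlog.eventually_ge_atTop (2 * C)).and hpow))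
  refine ⟨10 ^ 12, by norm_num, N, fun n hn hodd => ?_⟩
  obtain ⟨⟨h3, hL⟩, hCL, hn⟩ := hN n hn
  exact TernaryGoldbach.exceptional_of_log_le hε hA hC hv hSW h3 hL hCL hn hodd

end
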